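/- Let φ ∈ Out(F_n) be a fully irreducible atoroidal outer automorphism, Q₁ = ⟨φ^m⟩ a cyclic subgroup (for suitable m) of a purely atoroidal subgroup of Out(F_n) with hyperbolic extension, and G₁ = F_n ⋊ Q₁ the corresponding hyperbolic extension of F_n by Q₁. Let H < G₁ be an infinite quasiconvex subgroup of infinite index such that H is not virtually cyclic. Then there exists a finite index subgroup G₁' < G₁ such that: (1) G₁' = F_m ⋊ ℤ, where the semi-direct product is given by a positive power φ₁ of a lift of φ to a finite index subgroup F_m of F_n; (2) there is a purely atoroidal automorphism ψ of F_m such that Q = ⟨ψ, φ₁⟩ < Out(F_m) is free and G = F_m ⋊ Q is hyperbolic; and (3) G₁' ∩ H is of finite index in H and is not quasiconvex in G. -/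

import Mathlib

/-! ### Core coarse-geometric definitions
Gromov products, hyperbolicity, Gromov boundaries, Cannon–Thurston maps,
word metrics, quasi-isometric embeddings, laminations. -/

/-- The Gromov product of `x` and `y` with respect to the basepoint `o`,
for a distance function `d`. -/
noncomputable def gprod {X : Type*} (d : X → X → ℝ) (o x y : X) : ℝ :=
  (d x o + d y o - d x y) / 2

/-- A distance function is (Gromov) hyperbolic: the four point condition. -/
def IsHypD {X : Type*} (d : X → X → ℝ) : Prop :=
  ∃ δ : ℝ, 0 ≤ δ ∧ ∀ o x y z : X,
    min (gprod d o x y) (gprod d o y z) ≤ gprod d o x z + δ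

/-- A sequence tends to infinity if its Gromov products tend to infinity. -/
def SeqToInf {X : Type*} (d : X → X → ℝ) (s : ℕ → X) : Prop :=
  ∀ (o : X) (M : ℝ), ∃ N : ℕ, ∀ m n : ℕ, N ≤ m → N ≤ n → M ≤ gprod d o (s m) (s n)

/-- Two sequences tending to infinity determine the same boundary point. -/
def SeqFellow {X : Type*} (d : X → X → ℝ) (s t : ℕ → X) : Prop :=
  ∀ (o : X) (M : ℝ), ∃ N : ℕ, ∀ m n : ℕ, N ≤ m → N ≤ n → M ≤ gprod d o (s m) (t n)

/-- Sequences in `X` tending to infinity. -/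
def BdryPre {X : Type*} (d : X → X → ℝ) : Type _ := { s : ℕ → X // SeqToInf d s }

/-- The (sequential model of the) Gromov boundary of `(X, d)`. -/
def Bdry {X : Type*} (d : X → X → ℝ) : Type _ :=
  Quot fun s t : BdryPre d => SeqFellow d s.1 t.1

/-- The boundary point represented by a sequence tending to infinity. -/
def Bdry.mk {X : Type*} {d : X → X → ℝ} (s : BdryPre d) : Bdry d := Quot.mk _ s

/-- A sequence in `X` converges to the boundary point `ξ`. -/
def ConvTo {X : Type*} (d : X → X → ℝ) (s : ℕ → X) (ξ : Bdry d) : Prop :=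
  ∃ h : SeqToInf d s, Bdry.mk ⟨s, h⟩ = ξ

/-- The visual topology on the Gromov boundary. -/
noncomputable instance bdryTopology {X : Type*} (d : X → X → ℝ) :
    TopologicalSpace (Bdry d) :=
  TopologicalSpace.generateFrom
    { U | ∃ (o : X) (M : ℝ) (s : BdryPre d),
        U = { η | ∃ t : BdryPre d, Bdry.mk t = η ∧
          ∀ m n : ℕ, M ≤ gprod d o (s.1 m) (t.1 n) } }

/-- `g` is a Cannon–Thurston map for `f : (Y,dY) → (X,dX)`: it is continuous and,
whenever a sequence in `Y` converges to a boundary point `ξ`, the image sequence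
converges to `g ξ`. -/
def IsCTMapD {Y X : Type*} (dY : Y → Y → ℝ) (dX : X → X → ℝ)
    (f : Y → X) (g : Bdry dY → Bdry dX) : Prop :=
  Continuous g ∧
    ∀ (s : ℕ → Y) (ξ : Bdry dY), ConvTo dY s ξ → ConvTo dX (fun n => f (s n)) (g ξ)

/-- `f : (Y,dY) → (X,dX)` admits a Cannon–Thurston map. -/
def AdmitsCT {Y X : Type*} (dY : Y → Y → ℝ) (dX : X → X → ℝ) (f : Y → X) : Prop :=
  ∃ g, IsCTMapD dY dX f g

/-- The limit set of `A ⊆ X` in the Gromov boundary of `(X,d)`. -/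
def limitSetD {X : Type*} (d : X → X → ℝ) (A : Set X) : Set (Bdry d) :=
  { ξ | ∃ s : ℕ → X, (∀ n, s n ∈ A) ∧ ConvTo d s ξ }

/-- Quasi-isometric embedding with multiplicative/additive constant `k`. -/
def IsQIEmbWith {Y X : Type*} (dY : Y → Y → ℝ) (dX : X → X → ℝ) (k : ℝ) (f : Y → X) : Prop :=
  ∀ y y' : Y, dY y y' / k - k ≤ dX (f y) (f y') ∧ dX (f y) (f y') ≤ k * dY y y' + k

/-- Quasi-isometric embedding. -/
def IsQIEmbD {Y X : Type*} (dY : Y → Y → ℝ) (dX : X → X → ℝ) (f : Y → X) : Prop :=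
  ∃ k : ℝ, 1 ≤ k ∧ IsQIEmbWith dY dX k f

/-- `A` is contained in a finite (`d`-)neighborhood of `B`. -/
def InFiniteNbhd {X : Type*} (d : X → X → ℝ) (A B : Set X) : Prop :=
  ∃ D : ℝ, ∀ a ∈ A, ∃ b ∈ B, d a b ≤ D

/-- The word length of `g` with respect to `S` (inverses of generators allowed). -/
noncomputable def wordLength {G : Type*} [Group G] (S : Set G) (g : G) : ℕ :=
  sInf { n : ℕ | ∃ l : List G, (∀ x ∈ l, x ∈ S ∨ x⁻¹ ∈ S) ∧ l.length = n ∧ l.prod = g }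

/-- The word metric on `G` with respect to `S`. -/
noncomputable def wordDist {G : Type*} [Group G] (S : Set G) (g h : G) : ℝ :=
  wordLength S (g⁻¹ * h)

/-- `S` is a finite generating set of `G`. -/
def GenSet {G : Type*} [Group G] (S : Set G) : Prop :=
  S.Finite ∧ Subgroup.closure S = ⊤

/-- A finitely generated group is hyperbolic if some (equivalently, any) of its
word metrics with respect to a finite generating set is Gromov hyperbolic. -/
def IsHypGroup (G : Type*) [Group G] : Prop :=
  ∃ S : Set G, GenSet S ∧ IsHypD (wordDist S)

/-- The standard distance on `ℤ` (to parametrize (quasi)geodesic lines). -/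
noncomputable def zdist : ℤ → ℤ → ℝ := fun m n => |(m : ℝ) - (n : ℝ)|

/-- A quasigeodesic line in `(Y,dY)`. -/
def IsQGLine {Y : Type*} (dY : Y → Y → ℝ) (α : ℤ → Y) : Prop :=
  IsQIEmbD zdist dY α

/-- `α` is a leaf of the Cannon–Thurston lamination of `f`, whose CT map is `g`:
a quasigeodesic line whose two distinct endpoints at infinity are identified by `g`. -/
def IsLeafD {Y X : Type*} (dY : Y → Y → ℝ) (dX : X → X → ℝ)
    (f : Y → X) (g : Bdry dY → Bdry dX) (α : ℤ → Y) : Prop :=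
  IsQGLine dY α ∧
  ∃ ξp ξm : Bdry dY,
    ConvTo dY (fun n : ℕ => α (n : ℤ)) ξp ∧ ConvTo dY (fun n : ℕ => α (-(n : ℤ))) ξm ∧
    ξp ≠ ξm ∧ g ξp = g ξm

/-- A finitely generated subgroup `H ≤ G` is qi embedded (= quasiconvex when `G` is
hyperbolic, = undistorted): the inclusion is a quasi-isometric embedding for word
metrics coming from finite generating sets (this does not depend on the choices). -/
def QIEmbSubgroup {G : Type*} [Group G] (H : Subgroup G) : Prop :=
  ∃ (S : Set G) (T : Set ↥H), GenSet S ∧ GenSet T ∧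
    IsQIEmbD (wordDist T) (wordDist S) (Subtype.val : ↥H → G)

/-- A group is virtually cyclic (elementary). -/
def VirtCyclic (G : Type*) [Group G] : Prop :=
  ∃ H : Subgroup G, (∃ g : G, H = Subgroup.zpowers g) ∧ H.index ≠ 0

/-- A geodesic metric space. -/
def IsGeodesicMS (X : Type*) [MetricSpace X] : Prop :=
  ∀ x y : X, ∃ γ : ℝ → X, γ 0 = x ∧ γ (dist x y) = y ∧
    ∀ s ∈ Set.Icc (0:ℝ) (dist x y), ∀ t ∈ Set.Icc (0:ℝ) (dist x y),
      dist (γ s) (γ t) = |s - t|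

/-- An automorphism `a` of `K` is hyperbolic (atoroidal): the mapping torus
`K ⋊_a ℤ` is a hyperbolic group. -/
def AtoroidalAut {K : Type*} [Group K] (a : MulAut K) : Prop :=
  IsHypGroup (K ⋊[zpowersHom (MulAut K) a] Multiplicative ℤ)

/-- `A` is a free factor of `K`: there is `B ≤ K` with `K = A ∗ B` (internally). -/
def IsFreeFactor {K : Type*} [Group K] (A : Subgroup K) : Prop :=
  ∃ B : Subgroup K, Function.Bijective (Monoid.Coprod.lift A.subtype B.subtype)

/-- `a` is fully irreducible: no positive power of `a` preserves the conjugacy class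
of a proper (nontrivial) free factor of `K`. -/
def FullyIrreducibleAut {K : Type*} [Group K] (a : MulAut K) : Prop :=
  ∀ p : ℕ, 0 < p → ∀ A : Subgroup K, IsFreeFactor A → A ≠ ⊥ → A ≠ ⊤ →
    ∀ k : K, A.map ((a ^ p : MulAut K) : K ≃* K).toMonoidHom ≠
      A.map (MulAut.conj k).toMonoidHom

namespace FT
open FreeGroup

section tree
variable {α : Type*} [DecidableEq α]

theorem toWord_red {x y : FreeGroup α} (h : (x * y).norm = x.norm + y.norm) :
    (x * y).toWord = x.toWord ++ y.toWord := by
  have h1 := (FreeGroup.reduce.red (L := x.toWord ++ y.toWord)).sublist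
  rw [← toWord_mul] at h1
  refine h1.eq_of_length ?_
  simpa [FreeGroup.norm] using h

theorem norm_mk_of_red {L : List (α × Bool)} (h : IsReduced L) : (mk L).norm = L.length := by
  rw [FreeGroup.norm, toWord_mk, isReduced_iff_reduce_eq.1 h]

theorem split (w : FreeGroup α) (k : ℕ) (hk : k ≤ w.norm) :
    ∃ u v : FreeGroup α, w = u * v ∧ u.norm = k ∧ v.norm = w.norm - k := by
  refine ⟨mk (w.toWord.take k), mk (w.toWord.drop k), ?_, ?_, ?_⟩
  · rw [FreeGroup.mul_mk]; simp [mk_toWord]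
  · rw [norm_mk_of_red]
    · simpa [FreeGroup.norm] using hk
    · exact List.IsChain.take (isReduced_toWord (x := w)) _
  · rw [norm_mk_of_red]
    · simp [FreeGroup.norm]
    · exact List.IsChain.drop (isReduced_toWord (x := w)) _

theorem cancel (g h : FreeGroup α) : ∃ g' c h' : FreeGroup α, g = g' * c ∧ h = c⁻¹ * h' ∧
    g.norm = g'.norm + c.norm ∧ h.norm = c.norm + h'.norm ∧ (g * h).norm = g'.norm + h'.norm := by
  induction hn : g.norm generalizing g h with
  | zero =>
    have : g = 1 := norm_eq_zero.1 hn
    exact ⟨1, 1, h, by simp [this], by simp, by simp, by simp, by simp [this]⟩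
  | succ n ih =>
    by_cases hred : IsReduced (g.toWord ++ h.toWord)
    · refine ⟨g, 1, h, by simp, by simp, by simp [hn], by simp, ?_⟩
      rw [FreeGroup.norm, toWord_mul, isReduced_iff_reduce_eq.1 hred]; simp [FreeGroup.norm]
    · have hg : IsReduced g.toWord := isReduced_toWord
      have hh : IsReduced h.toWord := isReduced_toWord
      rw [FreeGroup.IsReduced, List.isChain_append] at hred
      simp only [FreeGroup.IsReduced] at hg hh
      simp only [hg, hh, true_and] at hred
      push Not at hred
      obtain ⟨a, ha, b, hb, hab, hab'⟩ := hred
      obtain ⟨g1, ag, hgg, hg1, hag⟩ := split g n (by omega)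
      obtain ⟨bh, h1, hhh, hbh, hh1⟩ := split h 1 (by
        by_contra hc
        have : h = 1 := norm_eq_zero.1 (by omega)
        simp [this] at hb)
      have e1 : ag.norm = 1 := by omega
      have w1 := toWord_red (x := g1) (y := ag) (by rw [← hgg]; omega)
      have hpos : 1 ≤ h.norm := by
        by_contra hc
        have : h = 1 := norm_eq_zero.1 (by omega)
        simp [this] at hb
      have w2 := toWord_red (x := bh) (y := h1) (by rw [← hhh]; omega)
      rw [← hgg] at w1
      rw [← hhh] at w2
      obtain ⟨a', ha'⟩ := List.length_eq_one_iff.1 e1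
      obtain ⟨b', hb'⟩ := List.length_eq_one_iff.1 hbh
      rw [w1, ha'] at ha
      rw [w2, hb'] at hb
      simp at ha hb
      subst ha; subst hb
      have hbag : bh = ag⁻¹ := by
        apply toWord_injective
        rw [toWord_inv, ha', hb']
        simp only [invRev, List.map_cons, List.map_nil, List.reverse_singleton, List.cons.injEq,
          and_true]
        ext
        · exact hab.symm
        · revert hab'; cases a'.2 <;> cases b'.2 <;> simp
      obtain ⟨g', c, h', k1, k2, k3, k4, k5⟩ := ih g1 h1 (by omega)
      refine ⟨g', c * ag, h', by rw [hgg, k1]; group, by rw [hhh, k2, hbag]; group, ?_, ?_, ?_⟩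
      · have t1 := norm_mul_le g' (c * ag)
        have t2 := norm_mul_le c ag
        have : g' * (c * ag) = g := by rw [hgg, k1]; group
        rw [this] at t1
        omega
      · have t1 := norm_mul_le g' (c * ag)
        have t2 := norm_mul_le c ag
        have : g' * (c * ag) = g := by rw [hgg, k1]; group
        rw [this] at t1
        omega
      · rw [← k5]; congr 1; rw [hgg, hhh, hbag]; group

theorem initial_part_of {c y' d y'' : FreeGroup α} (h : c * y' = d * y'')
    (h1 : (c * y').norm = c.norm + y'.norm) (h2 : (d * y'').norm = d.norm + y''.norm)
    (hcd : c.norm ≤ d.norm) : ∃ e, d = c * e ∧ d.norm = c.norm + e.norm := by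
  have w1 := toWord_red h1
  have w2 := toWord_red h2
  have hp : c.toWord <+: d.toWord := by
    apply List.prefix_of_prefix_length_le (l₃ := (c * y').toWord)
    · rw [w1]; exact List.prefix_append _ _
    · rw [h, w2]; exact List.prefix_append _ _
    · exact hcd
  obtain ⟨t, ht⟩ := hp
  refine ⟨mk t, ?_, ?_⟩
  · rw [← mk_toWord (x := d), ← ht, ← FreeGroup.mul_mk, mk_toWord]
  · rw [norm_mk_of_red]
    · simp [FreeGroup.norm, ← ht]
    · have hd := isReduced_toWord (x := d)
      rw [← ht] at hd
      exact List.IsChain.right_of_append hd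

/-- distance in the tree -/
def fd (x y : FreeGroup α) : ℕ := (x⁻¹ * y).norm

theorem fd_self (x : FreeGroup α) : fd x x = 0 := by simp [fd]
theorem fd_comm (x y : FreeGroup α) : fd x y = fd y x := by
  rw [fd, fd, ← norm_inv_eq]; simp
theorem fd_tri (x y z : FreeGroup α) : fd x z ≤ fd x y + fd y z := by
  unfold fd; have := norm_mul_le (x⁻¹ * y) (y⁻¹ * z); simpa [mul_assoc] using this
theorem fd_left (g x y : FreeGroup α) : fd (g * x) (g * y) = fd x y := by
  simp [fd, mul_assoc]
theorem fd_zero {x y : FreeGroup α} : fd x y = 0 ↔ x = y := by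
  rw [fd, FreeGroup.norm_eq_zero, inv_mul_eq_one]
theorem fd_one (x : FreeGroup α) : fd 1 x = x.norm := by simp [fd]

theorem fd_four1 (x y z : FreeGroup α) :
    fd 1 y + fd x z ≤ max (fd 1 x + fd y z) (fd 1 z + fd x y) := by
  obtain ⟨x', c, y', hx, hy, hx1, hy1, hxy⟩ := cancel x⁻¹ y
  obtain ⟨z', d, y'', hz, hy2, hz1, hy21, hzy⟩ := cancel z⁻¹ y
  simp only [norm_inv_eq] at hx1 hz1
  have key : ∀ (x z x' y' c d y'' z' : FreeGroup α), x⁻¹ = x' * c → y = c⁻¹ * y' →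
      x.norm = x'.norm + c.norm → y.norm = c.norm + y'.norm → z⁻¹ = z' * d → y = d⁻¹ * y'' →
      z.norm = z'.norm + d.norm → y.norm = d.norm + y''.norm → c.norm ≤ d.norm →
      fd x z + c.norm + c.norm ≤ x.norm + z.norm := by
    intro x z x' y' c d y'' z' hx hy hx1 hy1 hz hy2 hz1 hy21 hcd
    obtain ⟨e, he, hde⟩ := initial_part_of (c := c⁻¹) (d := d⁻¹) (y' := y') (y'' := y'')
      (by rw [← hy, ← hy2]) (by rw [← hy]; simpa using hy1) (by rw [← hy2]; simpa using hy21)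
      (by simpa using hcd)
    simp only [norm_inv_eq] at hde
    have : x⁻¹ * z = x' * e * z'⁻¹ := by
      rw [hx]
      have : z = d⁻¹ * z'⁻¹ := by rw [← mul_inv_rev, ← hz, inv_inv]
      rw [this, he]; group
    rw [fd, this]
    have t1 := norm_mul_le (x' * e) z'⁻¹
    have t2 := norm_mul_le x' e
    rw [norm_inv_eq] at t1
    omega
  have hyz : fd y z = z'.norm + y''.norm := by rw [fd_comm]; exact hzy
  have hxy' : fd x y = x'.norm + y'.norm := hxy
  simp only [fd_one, hyz, hxy']
  rcases le_total c.norm d.norm with h | h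
  · have := key x z x' y' c d y'' z' hx hy hx1 hy1 hz hy2 hz1 hy21 h
    omega
  · have := key z x z' y'' d c y' x' hz hy2 hz1 hy21 hx hy hx1 hy1 h
    rw [fd_comm] at this
    omega

theorem fd_four (o x y z : FreeGroup α) :
    fd o y + fd x z ≤ max (fd o x + fd y z) (fd o z + fd x y) := by
  have := fd_four1 (o⁻¹ * x) (o⁻¹ * y) (o⁻¹ * z)
  simp only [fd_left] at this
  simpa [fd, mul_assoc] using this

/-- medians -/
theorem median (a b v : FreeGroup α) : ∃ m, fd a m + fd m b = fd a b ∧ fd a m + fd m v = fd a v ∧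
    fd b m + fd m v = fd b v := by
  obtain ⟨g', c, h', h1, h2, h3, h4, h5⟩ := cancel (a⁻¹ * b) (b⁻¹ * v)
  refine ⟨a * g', ?_, ?_, ?_⟩
  · have e1 : fd a (a * g') = g'.norm := by simp [fd]
    have e2 : fd (a * g') b = c.norm := by
      have : (a * g')⁻¹ * b = c := by rw [mul_inv_rev, mul_assoc, h1]; group
      rw [fd, this]
    rw [e1, e2, fd, h3]
  · have e1 : fd a (a * g') = g'.norm := by simp [fd]
    have e2 : fd (a * g') v = h'.norm := by
      have : (a * g')⁻¹ * v = h' := by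
        have : v = b * (c⁻¹ * h') := by rw [← h2]; group
        rw [this, mul_inv_rev, mul_assoc, ← mul_assoc a⁻¹ b, h1]; group
      rw [fd, this]
    have : fd a v = (a⁻¹ * b * (b⁻¹ * v)).norm := by rw [fd]; congr 1; group
    rw [e1, e2, this, h5]
  · have e1 : fd b (a * g') = c.norm := by
      have : (a * g')⁻¹ * b = c := by rw [mul_inv_rev, mul_assoc, h1]; group
      rw [fd_comm, fd, this]
    have e2 : fd (a * g') v = h'.norm := by
      have : (a * g')⁻¹ * v = h' := by
        have : v = b * (c⁻¹ * h') := by rw [← h2]; group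
        rw [this, mul_inv_rev, mul_assoc, ← mul_assoc a⁻¹ b, h1]; group
      rw [fd, this]
    rw [e1, e2, fd, h4]

/-- points on a geodesic at prescribed distance -/
theorem point_at (a b : FreeGroup α) (k : ℕ) (hk : k ≤ fd a b) :
    ∃ p, fd a p = k ∧ fd a p + fd p b = fd a b := by
  obtain ⟨u, v, h, hu, hv⟩ := split (a⁻¹ * b) k hk
  have e2 : (a * u)⁻¹ * b = v := by rw [mul_inv_rev, mul_assoc, h]; group
  refine ⟨a * u, by simpa [fd] using hu, ?_⟩
  have e1 : fd a (a * u) = k := by simpa [fd] using hu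
  rw [e1, fd, e2, hv, fd]
  unfold fd at hk; omega

/-- concatenation of overlapping geodesics -/
theorem fd_concat {x a m v : FreeGroup α} (h1 : fd x a + fd a m = fd x m)
    (h2 : fd a m + fd m v = fd a v) (h : a ≠ m) : fd x v = fd x a + fd a m + fd m v := by
  have h0 : fd a m ≠ 0 := fun h' => h (fd_zero.1 h')
  have f := fd_four x a m v
  have t := fd_tri x m v
  omega

/-- uniqueness of points on geodesics -/
theorem point_unique {a b p q : FreeGroup α} (hp : fd a p + fd p b = fd a b)
    (hq : fd a q + fd q b = fd a b) (h : fd a p = fd a q) : p = q := by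
  have f := fd_four a p b q
  rw [← fd_zero]
  have := fd_comm p b; have := fd_comm q b; have := fd_comm b q
  omega

end tree
end FT

namespace FT
open FreeGroup (of mk mk_toWord norm_one norm_mul_le norm_inv_eq norm_of)

section lip
variable {α β : Type*} [DecidableEq α] [DecidableEq β]

theorem norm_one_form {u : FreeGroup α} (h : u.norm = 1) :
    ∃ a, u = of a ∨ u = (of a)⁻¹ := by
  obtain ⟨⟨a, b⟩, ha⟩ := List.length_eq_one_iff.1 h
  refine ⟨a, ?_⟩
  rw [← mk_toWord (x := u), ha]
  cases b
  · right; simp [FreeGroup.of, FreeGroup.inv_mk, FreeGroup.invRev]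
  · left; rfl

/-- induction on the length, splitting the first letter off -/
theorem ind_letter {p : FreeGroup α → Prop} (h1 : p 1)
    (hs : ∀ u v : FreeGroup α, u.norm = 1 → (u * v).norm = 1 + v.norm → p v → p (u * v))
    (w : FreeGroup α) : p w := by
  induction hn : w.norm generalizing w with
  | zero => rw [FreeGroup.norm_eq_zero.1 hn]; exact h1
  | succ n ih =>
    obtain ⟨u, v, h, hu, hv⟩ := split w 1 (by omega)
    rw [h]; refine hs u v hu (by rw [← h]; omega) (ih v (by omega))

theorem lip_of_letters (f : FreeGroup α →* FreeGroup β) (L : ℕ)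
    (hL : ∀ a, (f (of a)).norm ≤ L) (w : FreeGroup α) : (f w).norm ≤ L * w.norm := by
  induction w using ind_letter with
  | h1 => simp
  | hs u v hu huv ih =>
    have : (f u).norm ≤ L := by
      obtain ⟨a, rfl | rfl⟩ := norm_one_form hu
      · exact hL a
      · rw [map_inv, FreeGroup.norm_inv_eq]; exact hL a
    rw [map_mul, huv]
    have := FreeGroup.norm_mul_le (f u) (f v)
    rw [mul_add]; omega

theorem exists_lip [Finite α] (f : FreeGroup α →* FreeGroup β) :
    ∃ L : ℕ, 1 ≤ L ∧ ∀ w, (f w).norm ≤ L * w.norm := by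
  obtain ⟨M, hM⟩ := (Set.finite_range fun a => (f (of a)).norm).bddAbove
  refine ⟨M + 1, by omega, lip_of_letters f (M + 1) fun a => ?_⟩
  have := hM ⟨a, rfl⟩; simp only at this; omega

theorem lip_fd {f : FreeGroup α →* FreeGroup β} {L : ℕ} (hL : ∀ w, (f w).norm ≤ L * w.norm)
    (x y : FreeGroup α) : fd (f x) (f y) ≤ L * fd x y := by
  unfold fd; rw [← map_inv, ← map_mul]; exact hL _

theorem btw_or {A B p : FreeGroup α} (C : FreeGroup α) (h : fd A p + fd p B = fd A B) :
    fd A p + fd p C = fd A C ∨ fd C p + fd p B = fd C B := by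
  have := fd_four A p B C
  have := fd_tri A p C; have := fd_tri C p B
  have := fd_comm p C; have := fd_comm B C; have := fd_comm p B
  omega

theorem near_point (f : FreeGroup α → FreeGroup β) (L : ℕ)
    (hf : ∀ x y, fd x y ≤ 1 → fd (f x) (f y) ≤ L) (a b : FreeGroup α) (p : FreeGroup β)
    (hp : fd (f a) p + fd p (f b) = fd (f a) (f b)) :
    ∃ c, fd a c + fd c b = fd a b ∧ fd (f c) p ≤ L := by
  induction hn : fd a b generalizing a with
  | zero =>
    have := fd_zero.1 hn
    subst this
    refine ⟨a, by simp [fd_self], ?_⟩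
    rw [fd_self] at hp; omega
  | succ n ih =>
    obtain ⟨a', h1, h2⟩ := point_at a b 1 (by omega)
    rcases btw_or (f a') hp with h | h
    · refine ⟨a, by rw [fd_self]; omega, ?_⟩
      have := hf a a' (by omega)
      omega
    · obtain ⟨c, hc, hc'⟩ := ih a' h (by omega)
      refine ⟨c, ?_, hc'⟩
      have := fd_tri a a' c; have := fd_tri a c b
      omega

/-- bounded cancellation -/
theorem bcc [Finite α] [Finite β] (e : FreeGroup α ≃* FreeGroup β) : ∃ B : ℕ, ∀ x y : FreeGroup α,
    (x * y).norm = x.norm + y.norm → (e x).norm + (e y).norm ≤ (e (x * y)).norm + B := by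
  obtain ⟨L, hL1, hL⟩ := exists_lip e.toMonoidHom
  obtain ⟨L', hL'1, hL'⟩ := exists_lip e.symm.toMonoidHom
  have dl := lip_fd hL
  have dl' := lip_fd hL'
  simp only [MulEquiv.toMonoidHom_eq_coe, MonoidHom.coe_coe] at dl dl'
  refine ⟨2 * (L + 2 * L * (L * L')), fun x y hxy => ?_⟩
  have near := near_point (fun z => e z) L (fun x y h => by
    have := dl x y; have : L * fd x y ≤ L * 1 := Nat.mul_le_mul_left _ h; omega)
  obtain ⟨p, h1, h2, h3⟩ := median (e 1) (e x) (e (x * y))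
  obtain ⟨x1, hx1, hx1'⟩ := near 1 x p h1
  obtain ⟨y1, hy1, hy1'⟩ := near x (x * y) p h3
  have e1 : fd (1 : FreeGroup α) (x * y) = (x * y).norm := fd_one _
  have e2 : fd (1 : FreeGroup α) x = x.norm := fd_one _
  have e3 : fd x (x * y) = y.norm := by simp [fd]
  have f1 : fd x1 x ≤ fd x1 y1 := by
    have := fd_tri 1 x1 y1; have := fd_tri 1 y1 (x * y)
    omega
  have f2 : fd (e x1) (e y1) ≤ 2 * L := by
    have := fd_tri (e x1) p (e y1); have := fd_comm p (e y1); omega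
  have f3 : fd x1 y1 ≤ L' * (2 * L) := by
    have := dl' (e x1) (e y1)
    simp only [MulEquiv.symm_apply_apply] at this
    exact this.trans (Nat.mul_le_mul_left _ f2)
  have f4 : fd (e x1) (e x) ≤ L * (L' * (2 * L)) :=
    (dl x1 x).trans (Nat.mul_le_mul_left _ (f1.trans f3))
  have f5 : fd (e x) p ≤ L + L * (L' * (2 * L)) := by
    have := fd_tri (e x) (e x1) p; have := fd_comm (e x) (e x1); omega
  have g1 : (e x).norm = fd (e 1) (e x) := by rw [map_one, fd_one]
  have g2 : (e (x * y)).norm = fd (e 1) (e (x * y)) := by rw [map_one, fd_one]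
  have g3 : (e y).norm = fd (e x) (e (x * y)) := by rw [fd, map_mul]; simp
  rw [g1, g2, g3]
  have := fd_comm p (e x)
  have : L * (L' * (2 * L)) = 2 * L * (L * L') := by ring
  omega

end lip
end FT

namespace FT
open FreeGroup (of mk mk_toWord norm_one norm_mul_le norm_inv_eq norm_of)

section stack
variable {α : Type*} [DecidableEq α]

/-- `u, a, b, w` lie in this order on a geodesic -/
def Ord4 (u a b w : FreeGroup α) : Prop := fd u a + fd a b + fd b w = fd u w

inductive Stk (u : ℕ → FreeGroup α) (D : ℕ → FreeGroup α → ℤ) (c : ℕ → ℤ) (k : ℕ) :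
    FreeGroup α → ℤ → ℕ → Prop
  | nil : Stk u D c k (u 0) 0 0
  | snoc (a b : FreeGroup α) (v : ℤ) (r i : ℕ) (h : Stk u D c k a v r) (hi : i < k)
      (ho : Ord4 (u i) a b (u (i + 1))) (hg : fd (u 0) b = fd (u 0) a + fd a b) :
      Stk u D c k b (v + (D i (a⁻¹ * b) - c i * fd a b)) (r + 1)

theorem Stk.mono {u : ℕ → FreeGroup α} {D : ℕ → FreeGroup α → ℤ} {c : ℕ → ℤ} {k k' : ℕ}
    (hk : k ≤ k') {p : FreeGroup α} {v : ℤ} {r : ℕ} (h : Stk u D c k p v r) :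
    Stk u D c k' p v r := by
  induction h with
  | nil => exact Stk.nil
  | snoc a b v r i h hi ho hg ih => exact Stk.snoc a b v r i ih (by omega) ho hg

theorem Stk.push {u : ℕ → FreeGroup α} {D : ℕ → FreeGroup α → ℤ} {c : ℕ → ℤ} {k : ℕ} {B C : ℤ}
    (hB : 0 ≤ B) (hC : 0 ≤ C)
    (hD : ∀ i x y, (x * y).norm = x.norm + y.norm → D i x + D i y ≤ D i (x * y) + B)
    (hDinv : ∀ i x, D i x⁻¹ = D i x)
    (hpair : ∀ i < k, ∀ a b, Ord4 (u i) a b (u (i + 1)) → Ord4 (u k) b a (u (k + 1)) →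
      (c i + c k) * fd a b ≤ D i (a⁻¹ * b) + D k (a⁻¹ * b) + C)
    {p : FreeGroup α} {v : ℤ} {r : ℕ} (h : Stk u D c k p v r) (q : FreeGroup α)
    (hq : Ord4 (u k) p q (u (k + 1))) :
    ∃ v' : ℤ, ∃ r' : ℕ, Stk u D c (k + 1) q v' r' ∧
      v' - (2 * B + C) * (2 + r - r') ≤ v + (D k (p⁻¹ * q) - c k * fd p q) := by
  have hD' : ∀ i (x m y : FreeGroup α), fd x m + fd m y = fd x y →
      D i (x⁻¹ * m) + D i (m⁻¹ * y) ≤ D i (x⁻¹ * y) + B := by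
    intro i x m y h
    have := hD i (x⁻¹ * m) (m⁻¹ * y) (by
      have : x⁻¹ * m * (m⁻¹ * y) = x⁻¹ * y := by group
      rw [this]; exact h.symm)
    have e : x⁻¹ * m * (m⁻¹ * y) = x⁻¹ * y := by group
    rwa [e] at this
  induction h with
  | nil =>
    refine ⟨_, _, Stk.snoc (u 0) q 0 0 k Stk.nil (by omega) hq (by rw [fd_self]; simp), ?_⟩
    push_cast
    nlinarith
  | snoc a b v r i h hi ho hg ih =>
    obtain ⟨m, h1, h2, h3⟩ := median a b q
    have o1 : Ord4 (u i) a m (u (i + 1)) := by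
      unfold Ord4 at ho ⊢
      have := fd_tri (u i) a m; have := fd_tri (u i) m (u (i + 1)); have := fd_tri m b (u (i+1))
      omega
    have o2 : Ord4 (u i) m b (u (i + 1)) := by
      unfold Ord4 at ho ⊢
      have := fd_tri (u i) a m; have := fd_tri (u i) m (u (i + 1)); have := fd_tri m b (u (i+1))
      omega
    have o3 : Ord4 (u k) b m (u (k + 1)) := by
      unfold Ord4 at hq ⊢
      have := fd_tri (u k) b m; have := fd_tri (u k) m (u (k + 1)); have := fd_tri m q (u (k+1))
      omega
    have o4 : Ord4 (u k) m q (u (k + 1)) := by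
      unfold Ord4 at hq ⊢
      have := fd_tri (u k) b m; have := fd_tri (u k) m (u (k + 1)); have := fd_tri m q (u (k+1))
      omega
    have hp := hpair i hi m b o2 o3
    have d1 := hD' i a m b h1
    have d2 := hD' k b m q h3
    have d3 : D k (b⁻¹ * m) = D k (m⁻¹ * b) := by rw [← hDinv]; simp
    have e1 : (fd a b : ℤ) = fd a m + fd m b := by omega
    have e2 : (fd b q : ℤ) = fd m b + fd m q := by have := fd_comm b m; omega
    have e1' : c i * (fd a b : ℤ) = c i * fd a m + c i * fd m b := by rw [e1]; ring
    have e2' : c k * (fd b q : ℤ) = c k * fd m b + c k * fd m q := by rw [e2]; ring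
    have hp' : c i * (fd m b : ℤ) + c k * fd m b ≤ D i (m⁻¹ * b) + D k (m⁻¹ * b) + C := by
      linarith [add_mul (c i) (c k) (fd m b : ℤ)]
    by_cases hma : a = m
    · subst hma
      obtain ⟨v', r', hs, hv⟩ := ih o4
      refine ⟨v', r', hs, ?_⟩
      push_cast
      rw [fd_self] at e1'
      linarith
    · refine ⟨_, _, Stk.snoc m q _ _ k (Stk.snoc a m v r i (h.mono (by omega)) (by omega) o1 ?_)
        (by omega) o4 ?_, ?_⟩
      · have := fd_tri (u 0) a m; have := fd_tri (u 0) m b; omega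
      · have g : fd (u 0) a + fd a m = fd (u 0) m := by
          have := fd_tri (u 0) a m; have := fd_tri (u 0) m b; omega
        rw [fd_concat g h2 hma]; omega
      · push_cast
        linarith

theorem Stk.nonneg {u : ℕ → FreeGroup α} {D : ℕ → FreeGroup α → ℤ} {c : ℕ → ℤ} {k : ℕ}
    (hD0 : ∀ i x, 0 ≤ D i x) {p : FreeGroup α} {v : ℤ} {r : ℕ} (h : Stk u D c k p v r)
    (hp : p = u 0) : 0 ≤ v := by
  induction h with
  | nil => simp
  | snoc a b v r i h hi ho hg ih =>
    subst hp
    rw [fd_self] at hg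
    have h0 : fd a (u 0) = 0 := by omega
    have := ih (fd_zero.1 h0)
    rw [h0]
    have := hD0 i (a⁻¹ * u 0)
    push_cast; linarith

/-- the stack lemma -/
theorem stack (u : ℕ → FreeGroup α) (D : ℕ → FreeGroup α → ℤ) (c : ℕ → ℤ) (k : ℕ) (B C : ℤ)
    (hB : 0 ≤ B) (hC : 0 ≤ C) (hD0 : ∀ i x, 0 ≤ D i x)
    (hD : ∀ i x y, (x * y).norm = x.norm + y.norm → D i x + D i y ≤ D i (x * y) + B)
    (hDinv : ∀ i x, D i x⁻¹ = D i x)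
    (hpair : ∀ j < k, ∀ i < j, ∀ a b, Ord4 (u i) a b (u (i + 1)) → Ord4 (u j) b a (u (j + 1)) →
      (c i + c j) * fd a b ≤ D i (a⁻¹ * b) + D j (a⁻¹ * b) + C)
    (hclosed : u k = u 0) :
    ∑ i ∈ Finset.range k, c i * fd (u i) (u (i + 1)) ≤
      ∑ i ∈ Finset.range k, D i ((u i)⁻¹ * u (i + 1)) + (2 * B + C) * (2 * k) := by
  have main : ∀ j ≤ k, ∃ v : ℤ, ∃ r : ℕ, Stk u D c j (u j) v r ∧
      v - (2 * B + C) * (2 * j - r) ≤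
        ∑ i ∈ Finset.range j, (D i ((u i)⁻¹ * u (i + 1)) - c i * fd (u i) (u (i + 1))) := by
    intro j
    induction j with
    | zero => intro _; exact ⟨0, 0, Stk.nil, by simp⟩
    | succ j ih =>
      intro hj
      obtain ⟨v, r, hs, hv⟩ := ih (by omega)
      obtain ⟨v', r', hs', hv'⟩ := hs.push hB hC hD hDinv (hpair j (by omega)) (u (j + 1))
        (by simp [Ord4, fd_self])
      refine ⟨v', r', hs', ?_⟩
      rw [Finset.sum_range_succ]
      push_cast
      linarith
  obtain ⟨v, r, hs, hv⟩ := main k le_rfl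
  have := hs.nonneg hD0 hclosed
  rw [Finset.sum_sub_distrib] at hv
  have : 0 ≤ (2 * B + C) * (r : ℤ) := by positivity
  linarith

end stack
end FT

namespace FT
open FreeGroup (of mk mk_toWord norm_one norm_mul_le norm_inv_eq norm_of)

section mach
variable {α σ ι : Type*} [DecidableEq α] [DecidableEq σ]

/-- the generator belonging to a direction -/
def ltr (s : σ × Bool) : FreeGroup σ := mk [s]
/-- the opposite direction -/
def opp (s : σ × Bool) : σ × Bool := (s.1, !s.2)

theorem opp_opp (s : σ × Bool) : opp (opp s) = s := by simp [opp]
theorem opp_ne (s : σ × Bool) : opp s ≠ s := by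
  intro h; have := congrArg Prod.snd h; simp [opp] at this
theorem ltr_opp (s : σ × Bool) : ltr (opp s) = (ltr s)⁻¹ := by
  simp [ltr, opp, FreeGroup.inv_mk, FreeGroup.invRev]
theorem toWord_ltr (s : σ × Bool) : (ltr s).toWord = [s] := by
  simp [ltr, FreeGroup.toWord_mk]
theorem norm_ltr (s : σ × Bool) : (ltr s).norm = 1 := by
  simp [FreeGroup.norm, toWord_ltr]
theorem ltr_inj {s t : σ × Bool} (h : ltr s = ltr t) : s = t := by
  have := toWord_ltr s; rw [h, toWord_ltr] at this; simpa using this.symm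

/-- step of the first letter indicator -/
theorem head_step (y : FreeGroup σ) (s : σ × Bool) :
    (y = 1) ∨ (y * ltr s = 1) ∨ (y * ltr s).toWord.head? = y.toWord.head? := by
  by_cases h1 : y = 1
  · exact Or.inl h1
  by_cases h2 : y * ltr s = 1
  · exact Or.inr (Or.inl h2)
  refine Or.inr (Or.inr ?_)
  obtain ⟨g', c, h', e1, e2, e3, e4, e5⟩ := cancel y (ltr s)
  rw [norm_ltr] at e4
  by_cases hc : c.norm = 0
  · have hc1 := FreeGroup.norm_eq_zero.1 hc
    have := toWord_red (x := y) (y := ltr s) (by rw [norm_ltr]; omega)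
    rw [this, List.head?_append_of_ne_nil]
    simpa [FreeGroup.toWord_eq_nil_iff] using h1
  · have hy : y = (y * ltr s) * (ltr s)⁻¹ := by group
    have := toWord_red (x := y * ltr s) (y := (ltr s)⁻¹) (by
      rw [← hy, norm_inv_eq, norm_ltr]; omega)
    rw [← hy] at this
    rw [this, List.head?_append_of_ne_nil]
    simpa [FreeGroup.toWord_eq_nil_iff] using h2

/-- indicator of first letter -/
def hInd (s : σ × Bool) (y : FreeGroup σ) : ℤ := if y.toWord.head? = some s then 1 else 0

theorem hInd_step (s t : σ × Bool) (y : FreeGroup σ) :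
    hInd s (y * ltr t) - hInd s y =
      (if y = 1 ∧ t = s then 1 else 0) - (if y = ltr s ∧ t = opp s then 1 else 0) := by
  rcases head_step y t with h | h | h
  · subst h
    have : (1 : FreeGroup σ) ≠ ltr s := by
      intro h; have := congrArg FreeGroup.norm h; rw [norm_ltr] at this; simp at this
    simp [hInd, toWord_ltr, this]
  · have hy : y = ltr (opp t) := by rw [ltr_opp]; exact eq_inv_of_mul_eq_one_left h
    have h1 : ltr (opp t) ≠ 1 := by
      intro h; have := congrArg FreeGroup.norm h; rw [norm_ltr] at this; simp at this
    have h3 : (opp t = s) ↔ (t = opp s) := by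
      constructor
      · rintro rfl; rw [opp_opp]
      · rintro rfl; rw [opp_opp]
    have h2 : (ltr (opp t) = ltr s ∧ t = opp s) ↔ t = opp s := by
      constructor
      · exact fun h => h.2
      · intro h; exact ⟨by rw [h3.2 h], h⟩
    rw [h, hy]
    simp only [hInd, h1, h2, toWord_ltr]
    simp [h3]
  · have h1 : ¬ (y = 1 ∧ t = s) := by
      rintro ⟨rfl, rfl⟩
      simp [toWord_ltr] at h
    have h2 : ¬ (y = ltr s ∧ t = opp s) := by
      rintro ⟨rfl, rfl⟩
      simp [toWord_ltr, ltr_opp] at h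
    simp [hInd, h, h1, h2]

variable (α σ ι) in
/-- a system of closed loops in `F ⋊ Q` -/
structure LoopSys where
  nxt : Equiv.Perm ι
  q : ι → FreeGroup σ
  n : ι → FreeGroup α
  kind : ι → Option (σ × Bool)
  hq : ∀ i s, kind i = some s → q (nxt i) = q i * ltr s
  hn : ∀ i s, kind i = some s → n (nxt i) = n i
  hnone : ∀ i, kind i = none → q (nxt i) = q i

namespace LoopSys
variable (L : LoopSys α σ ι)

structure IsMatch (m : Equiv.Perm ι) : Prop where
  inv : ∀ i, m (m i) = i
  none : ∀ i, L.kind i = none → m i = i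
  kind : ∀ i s, L.kind i = some s → L.kind (m i) = some (opp s)
  q : ∀ i s, L.kind i = some s → L.q (m i) = L.q i * ltr s

open Classical in
theorem card_eq [Fintype ι] (a : σ) (p : FreeGroup σ) :
    (Finset.univ.filter fun i => L.kind i = some (a, true) ∧ L.q i = p).card =
    (Finset.univ.filter fun i => L.kind i = some (a, false) ∧ L.q (L.nxt i) = p).card := by
  have key : ∀ i, hInd (a, true) (p⁻¹ * L.q (L.nxt i)) - hInd (a, true) (p⁻¹ * L.q i) =
      (if L.kind i = some (a, true) ∧ L.q i = p then 1 else 0) -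
      (if L.kind i = some (a, false) ∧ L.q (L.nxt i) = p then 1 else 0) := by
    intro i
    cases hk : L.kind i with
    | none => simp [L.hnone i hk]
    | some s =>
      rw [L.hq i s hk, ← mul_assoc, hInd_step]
      have e1 : (p⁻¹ * L.q i = 1 ∧ s = (a, true)) ↔ (some s = some (a, true) ∧ L.q i = p) := by
        rw [inv_mul_eq_one, Option.some_inj]; tauto
      have e2 : (p⁻¹ * L.q i = ltr (a, true) ∧ s = opp (a, true)) ↔
          (some s = some (a, false) ∧ L.q i * ltr s = p) := by
        rw [Option.some_inj]
        constructor
        · rintro ⟨h1, h2⟩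
          refine ⟨h2, ?_⟩
          rw [h2, ltr_opp, ← h1]; group
        · rintro ⟨h1, h2⟩
          refine ⟨?_, h1⟩
          have : ltr s = (ltr (a, true))⁻¹ := by rw [← ltr_opp, h1]; rfl
          rw [← h2, this]; group
      simp only [e1, e2]
  have hs : ∑ i, (hInd (a, true) (p⁻¹ * L.q (L.nxt i)) - hInd (a, true) (p⁻¹ * L.q i)) = 0 := by
    rw [Finset.sum_sub_distrib, Equiv.sum_comp L.nxt (fun i => hInd (a, true) (p⁻¹ * L.q i)),
      sub_self]
  simp only [key] at hs
  rw [Finset.sum_sub_distrib, Finset.sum_boole, Finset.sum_boole] at hs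
  have := sub_eq_zero.1 hs
  exact_mod_cast this

open Classical in
theorem exists_match [Fintype ι] : ∃ m, L.IsMatch m := by
  let A := {i : ι // ∃ a, L.kind i = some (a, true)}
  let N := {i : ι // ∃ a, L.kind i = some (a, false)}
  let kA : A → FreeGroup σ × Option σ := fun i => (L.q i.1, (L.kind i.1).map Prod.fst)
  let kN : N → FreeGroup σ × Option σ := fun i => (L.q (L.nxt i.1), (L.kind i.1).map Prod.fst)
  have hE : ∀ k, Nonempty ({x : A // kA x = k} ≃ {x : N // kN x = k}) := by
    rintro ⟨p, o⟩
    refine ⟨Fintype.equivOfCardEq ?_⟩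
    cases o with
    | none =>
      have h1 : IsEmpty {x : A // kA x = (p, none)} := by
        refine ⟨?_⟩
        rintro ⟨⟨i, a, ha⟩, h⟩
        simp [kA, ha] at h
      have h2 : IsEmpty {x : N // kN x = (p, none)} := by
        refine ⟨?_⟩
        rintro ⟨⟨i, a, ha⟩, h⟩
        simp [kN, ha] at h
      simp
    | some a =>
      have := L.card_eq a p
      rw [← Fintype.card_subtype, ← Fintype.card_subtype] at this
      refine Eq.trans (Fintype.card_congr ?_) (this.trans (Fintype.card_congr ?_))
      · refine ⟨fun x => ⟨x.1.1, ?_⟩, fun x => ⟨⟨x.1, a, x.2.1⟩, ?_⟩, fun x => rfl, fun x => rfl⟩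
        · obtain ⟨⟨i, b, hb⟩, h⟩ := x
          simp only [kA, hb, Prod.mk.injEq, Option.map_some, Option.some_inj] at h
          exact ⟨by rw [hb, h.2], h.1⟩
        · simp [kA, x.2.1, x.2.2]
      · refine ⟨fun x => ⟨⟨x.1, a, x.2.1⟩, ?_⟩, fun x => ⟨x.1.1, ?_⟩, fun x => rfl, fun x => rfl⟩
        · simp [kN, x.2.1, x.2.2]
        · obtain ⟨⟨i, b, hb⟩, h⟩ := x
          simp only [kN, hb, Prod.mk.injEq, Option.map_some, Option.some_inj] at h
          exact ⟨by rw [hb, h.2], h.1⟩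
  let e : A ≃ N := (Equiv.sigmaFiberEquiv kA).symm.trans
    ((Equiv.sigmaCongrRight fun k => (hE k).some).trans (Equiv.sigmaFiberEquiv kN))
  have he : ∀ x, kN (e x) = kA x := fun x => ((hE (kA x)).some ⟨x, rfl⟩).2
  have he1 : ∀ (i : ι) (a : σ) (h : L.kind i = some (a, true)),
      L.kind (e ⟨i, a, h⟩).1 = some (a, false) ∧ L.q (e ⟨i, a, h⟩).1 = L.q i * ltr (a, true) := by
    intro i a h
    have h1 := he ⟨i, a, h⟩
    obtain ⟨b, hb⟩ := (e ⟨i, a, h⟩).2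
    simp only [kN, kA, hb, h, Option.map_some, Prod.mk.injEq, Option.some_inj] at h1
    rw [hb, h1.2]
    refine ⟨rfl, ?_⟩
    have h2 := L.hq _ _ hb
    have h3 : ltr (b, false) = (ltr (a, true))⁻¹ := by rw [← ltr_opp, h1.2]; rfl
    rw [← h1.1, h2, h3]; group
  have he2 : ∀ (i : ι) (a : σ) (h : L.kind i = some (a, false)),
      L.kind (e.symm ⟨i, a, h⟩).1 = some (a, true) ∧
      L.q (e.symm ⟨i, a, h⟩).1 = L.q i * ltr (a, false) := by
    intro i a h
    have h1 := he (e.symm ⟨i, a, h⟩)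
    rw [e.apply_symm_apply] at h1
    obtain ⟨b, hb⟩ := (e.symm ⟨i, a, h⟩).2
    simp only [kN, kA, hb, h, Option.map_some, Prod.mk.injEq, Option.some_inj] at h1
    refine ⟨by rw [hb, ← h1.2], ?_⟩
    rw [← h1.1, L.hq _ _ h]
  let f : ι → ι := fun i => if h : ∃ a, L.kind i = some (a, true) then (e ⟨i, h⟩).1 else
    if h : ∃ a, L.kind i = some (a, false) then (e.symm ⟨i, h⟩).1 else i
  have f1 : ∀ i (h : ∃ a, L.kind i = some (a, true)), f i = (e ⟨i, h⟩).1 := fun i h => by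
    simp only [f, h, dif_pos]
  have f2 : ∀ i (h : ∃ a, L.kind i = some (a, false)), f i = (e.symm ⟨i, h⟩).1 := fun i h => by
    have h' : ¬ ∃ a, L.kind i = some (a, true) := by
      rintro ⟨a, ha⟩; obtain ⟨b, hb⟩ := h; rw [ha] at hb; simp at hb
    simp only [f, h, h', dif_pos, dif_neg, not_false_eq_true]
  have f3 : ∀ i, L.kind i = none → f i = i := fun i h => by simp [f, h]
  have hinv : Function.Involutive f := by
    intro i
    cases hk : L.kind i with
    | none => rw [f3 i hk, f3 i hk]
    | some s =>
      obtain ⟨a, b⟩ := s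
      cases b
      · rw [f2 i ⟨a, hk⟩, f1 _ ⟨a, (he2 i a hk).1⟩]
        simp
      · rw [f1 i ⟨a, hk⟩, f2 _ ⟨a, (he1 i a hk).1⟩]
        simp
  refine ⟨hinv.toPerm, ⟨hinv, f3, ?_, ?_⟩⟩
  · rintro i ⟨a, b⟩ hk
    change L.kind (f i) = _
    cases b
    · rw [f2 i ⟨a, hk⟩, (he2 i a hk).1]; rfl
    · rw [f1 i ⟨a, hk⟩, (he1 i a hk).1]; rfl
  · rintro i ⟨a, b⟩ hk
    change L.q (f i) = _
    cases b
    · rw [f2 i ⟨a, hk⟩, (he2 i a hk).2]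
    · rw [f1 i ⟨a, hk⟩, (he1 i a hk).2]

end LoopSys
end mach
end FT

namespace FT
open FreeGroup (of mk mk_toWord norm_one norm_mul_le norm_inv_eq norm_of)

section mach2
variable {α σ ι : Type*} [DecidableEq α] [DecidableEq σ] [Fintype ι]
namespace LoopSys
variable (ρ : FreeGroup σ →* MulAut (FreeGroup α)) (L : LoopSys α σ ι)

/-- cost of the matching `m` at `i` -/
def cost (m : Equiv.Perm ι) (i : ι) : ℕ := ((ρ (L.q i))⁻¹ ((L.n i)⁻¹ * L.n (m i))).norm

theorem exists_min : ∃ m, L.IsMatch m ∧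
    ∀ m', L.IsMatch m' → ∑ i, L.cost ρ m i ≤ ∑ i, L.cost ρ m' i := by
  classical
  obtain ⟨m0, h0⟩ := L.exists_match
  have hex : ∃ k, ∃ m, L.IsMatch m ∧ ∑ i, L.cost ρ m i = k := ⟨_, m0, h0, rfl⟩
  obtain ⟨m, hm, hk⟩ := Nat.find_spec hex
  refine ⟨m, hm, fun m' hm' => ?_⟩
  rw [hk]
  exact Nat.find_min' hex ⟨m', hm', rfl⟩

theorem rho_step (p : FreeGroup σ) (s : σ × Bool) (x : FreeGroup α) :
    (ρ (p * ltr s))⁻¹ x = (ρ (ltr s))⁻¹ ((ρ p)⁻¹ x) := by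
  rw [map_mul, mul_inv_rev]; rfl

variable {L ρ}

theorem IsMatch.swap [DecidableEq ι] {m : Equiv.Perm ι} (hm : L.IsMatch m) {i k : ι}
    (hk : L.kind i = L.kind k) (hq : L.q i = L.q k) :
    L.IsMatch (Equiv.swap i k * m * Equiv.swap i k) := by
  have h1 : ∀ j, L.kind (Equiv.swap i k j) = L.kind j := by
    intro j
    rcases eq_or_ne j i with rfl | h
    · rw [Equiv.swap_apply_left, hk]
    rcases eq_or_ne j k with rfl | h'
    · rw [Equiv.swap_apply_right, hk]
    · rw [Equiv.swap_apply_of_ne_of_ne h h']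
  have h2 : ∀ j, L.q (Equiv.swap i k j) = L.q j := by
    intro j
    rcases eq_or_ne j i with rfl | h
    · rw [Equiv.swap_apply_left, hq]
    rcases eq_or_ne j k with rfl | h'
    · rw [Equiv.swap_apply_right, hq]
    · rw [Equiv.swap_apply_of_ne_of_ne h h']
  refine ⟨?_, ?_, ?_, ?_⟩
  · intro j; simp [hm.inv]
  · intro j hj
    simp only [Equiv.Perm.mul_apply]
    rw [hm.none _ ((h1 j).trans hj), Equiv.swap_apply_self]
  · intro j s hj
    simp only [Equiv.Perm.mul_apply]
    rw [h1, hm.kind _ s ((h1 j).trans hj)]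
  · intro j s hj
    simp only [Equiv.Perm.mul_apply]
    rw [h2, hm.q _ s ((h1 j).trans hj), h2]

theorem min_overlap {B : ℕ} {m : Equiv.Perm ι} (hm : L.IsMatch m)
    (hmin : ∀ m', L.IsMatch m' → ∑ i, L.cost ρ m i ≤ ∑ i, L.cost ρ m' i)
    (hB : ∀ (s : σ × Bool) (x y : FreeGroup α), (x * y).norm = x.norm + y.norm →
      ((ρ (ltr s))⁻¹ x).norm + ((ρ (ltr s))⁻¹ y).norm ≤ ((ρ (ltr s))⁻¹ (x * y)).norm + B)
    {i k : ι} {s : σ × Bool} (hik : i ≠ k) (hi : L.kind i = some s) (hk : L.kind k = some s)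
    (hq : L.q i = L.q k) {a b : FreeGroup α}
    (o1 : Ord4 ((ρ (L.q i))⁻¹ (L.n i)) a b ((ρ (L.q i))⁻¹ (L.n (m i))))
    (o2 : Ord4 ((ρ (L.q i))⁻¹ (L.n k)) b a ((ρ (L.q i))⁻¹ (L.n (m k)))) :
    fd a b ≤ 2 * B := by
  classical
  set m' := Equiv.swap i k * m * Equiv.swap i k with hm'def
  have hm' : L.IsMatch m' := hm.swap (hi.trans hk.symm) hq
  have k1 : L.kind (m i) = some (opp s) := hm.kind i s hi
  have k2 : L.kind (m k) = some (opp s) := hm.kind k s hk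
  have kne : ∀ j j', L.kind j = some (opp s) → L.kind j' = some s → j ≠ j' := by
    rintro j j' h h' rfl
    rw [h] at h'
    exact opp_ne s (Option.some_inj.1 h')
  have mik : m i ≠ m k := fun h => hik (m.injective h)
  have v1 : m' i = m k := by
    simp only [hm'def, Equiv.Perm.mul_apply, Equiv.swap_apply_left]
    exact Equiv.swap_apply_of_ne_of_ne (kne _ _ k2 hi) (kne _ _ k2 hk)
  have v2 : m' k = m i := by
    simp only [hm'def, Equiv.Perm.mul_apply, Equiv.swap_apply_right]
    exact Equiv.swap_apply_of_ne_of_ne (kne _ _ k1 hi) (kne _ _ k1 hk)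
  have v3 : m' (m k) = i := by rw [← v1, hm'.inv]
  have v4 : m' (m i) = k := by rw [← v2, hm'.inv]
  have v5 : ∀ j, j ∉ ({i, k, m i, m k} : Finset ι) → m' j = m j := by
    intro j hj
    simp only [Finset.mem_insert, Finset.mem_singleton, not_or] at hj
    simp only [hm'def, Equiv.Perm.mul_apply]
    rw [Equiv.swap_apply_of_ne_of_ne hj.1 hj.2.1, Equiv.swap_apply_of_ne_of_ne]
    · intro h; exact hj.2.2.1 (by rw [← h, hm.inv])
    · intro h; exact hj.2.2.2 (by rw [← h, hm.inv])
  have hle := hmin m' hm'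
  have hsum : ∑ j, ((L.cost ρ m' j : ℤ) - L.cost ρ m j) =
      ∑ j ∈ ({i, k, m i, m k} : Finset ι), ((L.cost ρ m' j : ℤ) - L.cost ρ m j) := by
    symm
    apply Finset.sum_subset (Finset.subset_univ _)
    intro j _ hj
    simp [cost, v5 j hj]
  rw [Finset.sum_sub_distrib, Finset.sum_insert (by simp [hik, (kne _ _ k1 hi).symm,
    (kne _ _ k2 hi).symm]), Finset.sum_insert (by simp [(kne _ _ k1 hk).symm,
    (kne _ _ k2 hk).symm]), Finset.sum_insert (by simp [mik]), Finset.sum_singleton] at hsum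
  have hle' : (∑ j, (L.cost ρ m j : ℤ)) ≤ ∑ j, (L.cost ρ m' j : ℤ) := by exact_mod_cast hle
  -- compute all costs
  set P := (ρ (L.q i))⁻¹ with hP
  set E := (ρ (ltr s))⁻¹ with hE
  have qmi : L.q (m i) = L.q i * ltr s := hm.q i s hi
  have qmk : L.q (m k) = L.q i * ltr s := by rw [hm.q k s hk, hq]
  have c1 : ∀ x y, (P (x⁻¹ * y)).norm = fd (P x) (P y) := by
    intro x y; rw [fd, map_mul, map_inv]
  have c2 : ∀ x y, (E (P (x⁻¹ * y))).norm = fd (E (P x)) (E (P y)) := by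
    intro x y; rw [fd, map_mul, map_inv, map_mul, map_inv]
  have A1 : L.cost ρ m i = fd (P (L.n i)) (P (L.n (m i))) := by rw [cost, ← hP, c1]
  have A2 : L.cost ρ m k = fd (P (L.n k)) (P (L.n (m k))) := by rw [cost, ← hq, ← hP, c1]
  have A3 : L.cost ρ m (m i) = fd (E (P (L.n i))) (E (P (L.n (m i)))) := by
    rw [cost, qmi, rho_step, ← hP, ← hE, c2, hm.inv, fd_comm]
  have A4 : L.cost ρ m (m k) = fd (E (P (L.n k))) (E (P (L.n (m k)))) := by
    rw [cost, qmk, rho_step, ← hP, ← hE, c2, hm.inv, fd_comm]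
  have B1 : L.cost ρ m' i = fd (P (L.n i)) (P (L.n (m k))) := by rw [cost, ← hP, c1, v1]
  have B2 : L.cost ρ m' k = fd (P (L.n k)) (P (L.n (m i))) := by rw [cost, ← hq, ← hP, c1, v2]
  have B3 : L.cost ρ m' (m i) = fd (E (P (L.n k))) (E (P (L.n (m i)))) := by
    rw [cost, qmi, rho_step, ← hP, ← hE, c2, v4, fd_comm]
  have B4 : L.cost ρ m' (m k) = fd (E (P (L.n i))) (E (P (L.n (m k)))) := by
    rw [cost, qmk, rho_step, ← hP, ← hE, c2, v3, fd_comm]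
  have hB' : ∀ x y z, fd x y + fd y z = fd x z →
      fd (E x) (E y) + fd (E y) (E z) ≤ fd (E x) (E z) + B := by
    intro x y z h
    have e : x⁻¹ * y * (y⁻¹ * z) = x⁻¹ * z := by group
    have := hB s (x⁻¹ * y) (y⁻¹ * z) (by rw [e]; exact h.symm)
    rw [e, ← hE] at this
    simpa [fd, map_mul, map_inv] using this
  generalize P (L.n i) = ni at *
  generalize P (L.n k) = nk at *
  generalize P (L.n (m i)) = mi at *
  generalize P (L.n (m k)) = mk at *
  unfold Ord4 at o1 o2
  have t1 := fd_tri ni a mk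
  have t2 := fd_tri nk b mi
  have t3 := fd_tri (E ni) (E a) (E mk)
  have t4 := fd_tri (E nk) (E b) (E mi)
  have x1 := fd_tri ni a mi
  have x2 := fd_tri a b mi
  have x3 := fd_tri nk b mk
  have x4 := fd_tri b a mk
  have y1 := hB' ni a mi (by omega)
  have y2 := hB' a b mi (by omega)
  have y3 := hB' nk b mk (by omega)
  have y4 := hB' b a mk (by omega)
  have := fd_comm a b
  omega

end LoopSys
end mach2
end FT

namespace FT
open FreeGroup (of mk mk_toWord norm_one norm_mul_le norm_inv_eq norm_of)

section mach3
variable {α σ ι : Type*} [DecidableEq α] [DecidableEq σ] [Fintype ι]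
namespace LoopSys
variable (ρ : FreeGroup σ →* MulAut (FreeGroup α)) (L : LoopSys α σ ι)

/-- the weight function -/
def Dw (i : ι) (x : FreeGroup α) : ℤ :=
  (L.kind i).elim 0 fun s => (((ρ (ltr s))⁻¹ x).norm : ℤ)
/-- the coefficient -/
def cw (i : ι) : ℤ := (L.kind i).elim 1 fun _ => 2

theorem perm_sum (f : Equiv.Perm ι) (g : ι → ℤ) (k : ℕ) :
    ∑ i, ∑ t ∈ Finset.range k, g ((f ^ t) i) = k * ∑ i, g i := by
  rw [Finset.sum_comm]
  have : ∀ t ∈ Finset.range k, ∑ i, g ((f ^ t) i) = ∑ i, g i := fun t _ =>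
    Equiv.sum_comp (f ^ t) g
  rw [Finset.sum_congr rfl this]
  simp

/-- length of the vertical side -/
def vlen (i : ι) : ℕ := (L.kind i).elim (fd ((ρ (L.q i))⁻¹ (L.n i)) ((ρ (L.q i))⁻¹ (L.n (L.nxt i))))
  fun _ => 0

theorem iso {C0 B Cg : ℕ}
    (hFL : ∀ s s' : σ × Bool, s ≠ s' → ∀ w : FreeGroup α,
      10 * w.norm ≤ ((ρ (ltr s))⁻¹ w).norm + ((ρ (ltr s'))⁻¹ w).norm + C0)
    (hB : ∀ (s : σ × Bool) (x y : FreeGroup α), (x * y).norm = x.norm + y.norm →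
      ((ρ (ltr s))⁻¹ x).norm + ((ρ (ltr s))⁻¹ y).norm ≤ ((ρ (ltr s))⁻¹ (x * y)).norm + B)
    (hgood : ∀ i, L.kind i = none → ∀ a b,
      Ord4 ((ρ (L.q i))⁻¹ (L.n i)) a b ((ρ (L.q i))⁻¹ (L.n (L.nxt i))) → ∀ s : σ × Bool,
      10 * fd a b ≤ ((ρ (ltr s))⁻¹ (a⁻¹ * b)).norm + Cg)
    (hshort : ∀ i j, i ≠ j → L.kind i = none → L.kind j = none →
      L.vlen ρ i ≤ 1 ∨ L.vlen ρ j ≤ 1) :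
    ∃ m, L.IsMatch m ∧ ∑ i, L.cost ρ m i + ∑ i, L.vlen ρ i ≤
      2 * (2 * B + (C0 + 8 * B + Cg + 2)) * Fintype.card ι := by
  obtain ⟨m, hm, hmin⟩ := L.exists_min ρ
  refine ⟨m, hm, ?_⟩
  set C : ℕ := C0 + 8 * B + Cg + 2 with hC
  set f : Equiv.Perm ι := L.nxt * m with hf
  have fnone : ∀ i, L.kind i = none → f i = L.nxt i := fun i h => by
    simp [hf, hm.none i h]
  have fq : ∀ i, L.q (f i) = L.q i := by
    intro i
    cases hk : L.kind i with
    | none => rw [fnone i hk, L.hnone i hk]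
    | some s =>
      simp only [hf, Equiv.Perm.mul_apply]
      rw [L.hq _ _ (hm.kind i s hk), hm.q i s hk, ltr_opp]; group
  have fn : ∀ i s, L.kind i = some s → L.n (f i) = L.n (m i) := by
    intro i s hk
    simp only [hf, Equiv.Perm.mul_apply]
    exact L.hn _ _ (hm.kind i s hk)
  have cpos : ∀ a b : FreeGroup α, (0:ℤ) ≤ fd a b := fun a b => by positivity
  have pair : ∀ i j, L.q i = L.q j → ∀ a b,
      Ord4 ((ρ (L.q i))⁻¹ (L.n i)) a b ((ρ (L.q i))⁻¹ (L.n (f i))) →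
      Ord4 ((ρ (L.q i))⁻¹ (L.n j)) b a ((ρ (L.q i))⁻¹ (L.n (f j))) →
      (L.cw i + L.cw j) * fd a b ≤ L.Dw ρ i (a⁻¹ * b) + L.Dw ρ j (a⁻¹ * b) + C := by
    intro i j hqij a b o1 o2
    have hab := fd_comm a b
    rcases eq_or_ne i j with rfl | hij
    · have h0 : fd a b = 0 := by
        unfold Ord4 at o1 o2
        have := fd_tri ((ρ (L.q i))⁻¹ (L.n i)) b ((ρ (L.q i))⁻¹ (L.n (f i)))
        have := fd_tri ((ρ (L.q i))⁻¹ (L.n i)) a ((ρ (L.q i))⁻¹ (L.n (f i)))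
        have := fd_tri ((ρ (L.q i))⁻¹ (L.n i)) a b
        have := fd_tri a b ((ρ (L.q i))⁻¹ (L.n (f i)))
        have := fd_tri ((ρ (L.q i))⁻¹ (L.n i)) b a
        have := fd_tri b a ((ρ (L.q i))⁻¹ (L.n (f i)))
        omega
      have : ∀ x, 0 ≤ L.Dw ρ i x := by
        intro x; unfold Dw; cases L.kind i <;> simp
      have := this (a⁻¹ * b)
      rw [h0]; push_cast; linarith
    cases hi : L.kind i with
    | none =>
      cases hj : L.kind j with
      | none =>
        have h1 : fd a b ≤ 1 := by
          have e1 : L.vlen ρ i = fd ((ρ (L.q i))⁻¹ (L.n i)) ((ρ (L.q i))⁻¹ (L.n (L.nxt i))) := by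
            simp [vlen, hi]
          have e2 : L.vlen ρ j = fd ((ρ (L.q i))⁻¹ (L.n j)) ((ρ (L.q i))⁻¹ (L.n (L.nxt j))) := by
            simp [vlen, hj, hqij]
          rw [fnone i hi] at o1
          rw [fnone j hj] at o2
          unfold Ord4 at o1 o2
          rcases hshort i j hij hi hj with h | h <;> omega
        simp only [cw, Dw, hi, hj, Option.elim_none]
        have : (fd a b : ℤ) ≤ 1 := by exact_mod_cast h1
        rw [hC]; push_cast; linarith
      | some s =>
        rw [fnone i hi] at o1
        have := hgood i hi a b o1 s
        simp only [cw, Dw, hi, hj, Option.elim_none, Option.elim_some]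
        rw [hC]; push_cast; omega
    | some s =>
      cases hj : L.kind j with
      | none =>
        rw [fnone j hj, hqij] at o2
        have := hgood j hj b a o2 s
        have e : ((ρ (ltr s))⁻¹ (b⁻¹ * a)).norm = ((ρ (ltr s))⁻¹ (a⁻¹ * b)).norm := by
          rw [← norm_inv_eq, ← map_inv]; simp
        simp only [cw, Dw, hi, hj, Option.elim_none, Option.elim_some]
        rw [hC]; push_cast; omega
      | some s' =>
        simp only [cw, Dw, hi, hj, Option.elim_some]
        rcases eq_or_ne s s' with rfl | hss
        · rw [fn i s hi] at o1
          rw [fn j s hj] at o2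
          have := min_overlap hm hmin hB hij hi hj hqij o1 o2
          rw [hC]; push_cast; omega
        · have := hFL s s' hss (a⁻¹ * b)
          change 10 * fd a b ≤ _ at this
          rw [hC]; push_cast; omega
  have qpow : ∀ (i : ι) (t : ℕ), L.q ((f ^ t) i) = L.q i := by
    intro i t
    induction t with
    | zero => simp
    | succ t ih => rw [pow_succ', Equiv.Perm.mul_apply, fq, ih]
  set k := orderOf f with hk
  have kpos : 0 < k := orderOf_pos f
  have hstack : ∀ i, ∑ t ∈ Finset.range k, L.cw ((f ^ t) i) *
        fd ((ρ (L.q ((f ^ t) i)))⁻¹ (L.n ((f ^ t) i))) ((ρ (L.q ((f ^ t) i)))⁻¹ (L.n (f ((f ^ t) i)))) ≤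
      ∑ t ∈ Finset.range k, L.Dw ρ ((f ^ t) i) (((ρ (L.q ((f ^ t) i)))⁻¹ (L.n ((f ^ t) i)))⁻¹ *
         ((ρ (L.q ((f ^ t) i)))⁻¹ (L.n (f ((f ^ t) i))))) + (2 * B + C) * (2 * k) := by
    intro i
    have := stack (fun t => (ρ (L.q i))⁻¹ (L.n ((f ^ t) i))) (fun t => L.Dw ρ ((f ^ t) i))
      (fun t => L.cw ((f ^ t) i)) k B C (by positivity) (by positivity)
      (by intro t x; unfold Dw; cases L.kind ((f ^ t) i) <;> simp)
      (by
        intro t x y hxy; unfold Dw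
        cases L.kind ((f ^ t) i) with
        | none => simp
        | some s => simp only [Option.elim_some]; exact_mod_cast hB s x y hxy)
      (by
        intro t x; unfold Dw
        cases L.kind ((f ^ t) i) with
        | none => simp
        | some s => simp only [Option.elim_some]; rw [map_inv, norm_inv_eq])
      (by
        intro t2 h2 t1 h1 a b o1 o2
        simp only [pow_succ', Equiv.Perm.mul_apply] at o1 o2
        apply pair _ _ (by rw [qpow, qpow]) a b
        · rw [qpow]; exact o1
        · rw [qpow]; exact o2)
      (by simp [hk, pow_orderOf_eq_one])
    simp only [qpow]
    simpa only [pow_succ', Equiv.Perm.mul_apply] using this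
  have hsum := Finset.sum_le_sum fun i (_ : i ∈ Finset.univ) => hstack i
  rw [Finset.sum_add_distrib, perm_sum f (fun i => L.cw i *
        fd ((ρ (L.q i))⁻¹ (L.n i)) ((ρ (L.q i))⁻¹ (L.n (f i)))), perm_sum f (fun i =>
        L.Dw ρ i (((ρ (L.q i))⁻¹ (L.n i))⁻¹ * ((ρ (L.q i))⁻¹ (L.n (f i)))))] at hsum
  have s1 : ∀ i, L.cw i * fd ((ρ (L.q i))⁻¹ (L.n i)) ((ρ (L.q i))⁻¹ (L.n (f i))) =
      2 * L.cost ρ m i + L.vlen ρ i := by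
    intro i
    cases hi : L.kind i with
    | none => simp [cw, vlen, cost, hi, hm.none i hi, fnone i hi]
    | some s =>
      simp [cw, vlen, cost, hi, fn i s hi, fd]
  have s2 : ∀ i, L.Dw ρ i (((ρ (L.q i))⁻¹ (L.n i))⁻¹ * ((ρ (L.q i))⁻¹ (L.n (f i)))) =
      L.cost ρ m (m i) := by
    intro i
    cases hi : L.kind i with
    | none => simp [Dw, cost, hi, hm.none i hi]
    | some s =>
      simp only [Dw, hi, Option.elim_some, cost, hm.inv, hm.q i s hi, fn i s hi]
      rw [rho_step, ← norm_inv_eq, ← map_inv]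
      simp
  simp only [s1, s2] at hsum
  rw [Equiv.sum_comp m (fun i => (L.cost ρ m i : ℤ)), Finset.sum_add_distrib,
    ← Finset.mul_sum] at hsum
  simp only [Finset.sum_const, Finset.card_univ, smul_eq_mul, nsmul_eq_mul] at hsum
  have hkz : (0:ℤ) < k := by exact_mod_cast kpos
  have fin : (2 * ∑ i, (L.cost ρ m i : ℤ) + ∑ i, (L.vlen ρ i : ℤ)) ≤
      ∑ i, (L.cost ρ m i : ℤ) + (2 * (2 * B + C)) * Fintype.card ι := by
    refine le_of_mul_le_mul_left ?_ hkz
    refine hsum.trans (le_of_eq ?_)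
    ring
  zify
  linarith

end LoopSys
end mach3
end FT

namespace FT
open FreeGroup (of mk mk_toWord norm_one norm_mul_le norm_inv_eq norm_of)
open SemidirectProduct (inl inr)

section area
variable {α σ : Type*} [DecidableEq α] [DecidableEq σ]
variable (ρ : FreeGroup σ →* MulAut (FreeGroup α))

/-- the flaring condition -/
def FL : Prop := ∃ C : ℕ, ∀ s s' : σ × Bool, s ≠ s' → ∀ w : FreeGroup α,
      10 * w.norm ≤ ((ρ (ltr s))⁻¹ w).norm + ((ρ (ltr s'))⁻¹ w).norm + C

/-- adjacency in the Cayley graph -/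
def Adj (g g' : FreeGroup α ⋊[ρ] FreeGroup σ) : Prop :=
  (∃ x : FreeGroup α, x.norm ≤ 1 ∧ g' = g * inl x) ∨ ∃ s : σ × Bool, g' = g * inr (ltr s)

theorem tree_pot (A : FreeGroup α → FreeGroup α → ℝ) (hA : ∀ x y, A x y = - A y x) :
    ∃ P : FreeGroup α → ℝ, ∀ y x, x.norm = 1 → P (y * x) - P y = A y (y * x) := by
  let P : FreeGroup α → ℝ := fun y => ∑ j ∈ Finset.range y.norm,
    A (mk (y.toWord.take j)) (mk (y.toWord.take (j + 1)))
  have key : ∀ y x : FreeGroup α, x.norm = 1 → (y * x).norm = y.norm + 1 →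
      P (y * x) - P y = A y (y * x) := by
    intro y x hx h
    have hw := toWord_red (x := y) (y := x) (by omega)
    simp only [P]
    rw [h, Finset.sum_range_succ]
    have e1 : ∀ j ∈ Finset.range y.norm, A (mk ((y * x).toWord.take j)) (mk ((y * x).toWord.take (j + 1)))
        = A (mk (y.toWord.take j)) (mk (y.toWord.take (j + 1))) := by
      intro j hj
      have hj' : j < y.toWord.length := Finset.mem_range.1 hj
      rw [hw, List.take_append_of_le_length (by omega), List.take_append_of_le_length (by omega)]
    rw [Finset.sum_congr rfl e1]
    have e2 : mk ((y * x).toWord.take y.norm) = y := by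
      rw [hw, FreeGroup.norm, List.take_left, mk_toWord]
    have e3 : mk ((y * x).toWord.take (y.norm + 1)) = y * x := by
      rw [List.take_of_length_le, mk_toWord]
      change (y * x).norm ≤ _
      omega
    rw [e2, e3]; ring
  refine ⟨P, fun y x hx => ?_⟩
  obtain ⟨g', c, h', e1, e2, e3, e4, e5⟩ := cancel y x
  by_cases hc : c.norm = 0
  · exact key y x hx (by omega)
  · have := key (y * x) x⁻¹ (by simpa using hx) (by
      have : y * x * x⁻¹ = y := by group
      rw [this]; omega)
    have e : y * x * x⁻¹ = y := by group
    rw [e] at this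
    rw [hA]; linarith

theorem inl_inr (g : FreeGroup α ⋊[ρ] FreeGroup σ) :
    g = inr g.right * inl ((ρ g.right)⁻¹ g.left) := by
  ext <;> simp

theorem inl_inr_comm (s : FreeGroup σ) (x : FreeGroup α) :
    (inl x * inr s : FreeGroup α ⋊[ρ] FreeGroup σ) = inr s * inl ((ρ s)⁻¹ x) := by
  ext <;> simp

theorem exists_BL [Finite α] [Finite σ] : ∃ B L : ℕ,
    (∀ (s : σ × Bool) (x y : FreeGroup α), (x * y).norm = x.norm + y.norm →
      ((ρ (ltr s))⁻¹ x).norm + ((ρ (ltr s))⁻¹ y).norm ≤ ((ρ (ltr s))⁻¹ (x * y)).norm + B) ∧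
    (∀ (s : σ × Bool) (x : FreeGroup α), ((ρ (ltr s))⁻¹ x).norm ≤ L * x.norm) := by
  choose B hB using fun s : σ × Bool => bcc (α := α) (β := α) (ρ (ltr s))⁻¹
  choose L hL1 hL using fun s : σ × Bool => exists_lip (α := α) (β := α)
    ((ρ (ltr s))⁻¹ : MulAut (FreeGroup α)).toMonoidHom
  obtain ⟨MB, hMB⟩ := (Set.finite_range B).bddAbove
  obtain ⟨ML, hML⟩ := (Set.finite_range L).bddAbove
  refine ⟨MB, ML, fun s x y h => ?_, fun s x => ?_⟩
  · have := hB s x y h; have := hMB ⟨s, rfl⟩; omega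
  · exact (hL s x).trans (Nat.mul_le_mul_right _ (hML ⟨s, rfl⟩))

theorem area [Finite α] [Finite σ] (hFL : FL ρ) : ∃ K : ℝ, 0 ≤ K ∧
    ∀ (h κ : FreeGroup α ⋊[ρ] FreeGroup σ → ℝ) (ε : ℝ), 0 ≤ ε →
      (∀ g g', Adj ρ g g' → |h g' - h g| ≤ ε) → (∀ g g', Adj ρ g g' → |κ g' - κ g| ≤ 1) →
      ∀ (ℓ : ℕ) (z : ℕ → FreeGroup α ⋊[ρ] FreeGroup σ), z ℓ = z 0 →
        (∀ i < ℓ, Adj ρ (z i) (z (i + 1))) →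
        |∑ i ∈ Finset.range ℓ, (h (z i) + h (z (i + 1))) / 2 * (κ (z (i + 1)) - κ (z i))|
          ≤ ε * K * ℓ := by
  obtain ⟨C0, hFL⟩ := hFL
  obtain ⟨B, Lp, hB, hLp⟩ := exists_BL ρ
  refine ⟨(4 + Lp * (1 + Lp)) * (2 * (2 * B + (C0 + 8 * B + 10 + 2)) : ℕ), by positivity, ?_⟩
  intro h κ ε hε hh hκ ℓ z hz hadj
  rcases Nat.eq_zero_or_pos ℓ with rfl | hℓ
  · simp
  set a : FreeGroup α ⋊[ρ] FreeGroup σ → FreeGroup α ⋊[ρ] FreeGroup σ → ℝ :=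
    fun g g' => (h g + h g') / 2 * (κ g' - κ g) with ha
  have aanti : ∀ g g', a g g' = - a g' g := by intro g g'; simp only [ha]; ring
  -- potential
  have hP : ∃ P : FreeGroup α ⋊[ρ] FreeGroup σ → ℝ, ∀ g (x : FreeGroup α), x.norm = 1 →
      P (g * inl x) - P g = a g (g * inl x) := by
    choose P0 hP0 using fun q : FreeGroup σ => tree_pot
      (fun x y : FreeGroup α => a (inr q * inl x) (inr q * inl y)) (fun x y => aanti _ _)
    refine ⟨fun g => P0 g.right ((ρ g.right)⁻¹ g.left), fun g x hx => ?_⟩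
    have := hP0 g.right ((ρ g.right)⁻¹ g.left) x hx
    simp only [SemidirectProduct.mul_left, SemidirectProduct.mul_right,
      SemidirectProduct.left_inl, SemidirectProduct.right_inl, mul_one, map_mul]
    rw [MulAut.inv_apply_self, this, map_mul, ← mul_assoc, ← inl_inr]
  obtain ⟨P, hP⟩ := hP
  have adjv : ∀ g (x : FreeGroup α), x.norm ≤ 1 → Adj ρ g (g * inl x) :=
    fun g x hx => Or.inl ⟨x, hx, rfl⟩
  have adjh : ∀ g (s : σ × Bool), Adj ρ g (g * inr (ltr s)) := fun g s => Or.inr ⟨s, rfl⟩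
  -- approximation along vertical paths
  have approx : ∀ (y : FreeGroup α) (g0 g : FreeGroup α ⋊[ρ] FreeGroup σ) (k : ℝ), 0 ≤ k →
      |h g - h g0| ≤ ε * k →
      |P (g * inl y) - P g - h g0 * (κ (g * inl y) - κ g)| ≤ y.norm * (ε * (k + y.norm)) := by
    intro y g0
    induction y using ind_letter with
    | h1 => intro g k hk _; simp
    | hs u v hu huv ih =>
      intro g k hk hg
      have a1 := hh g (g * inl u) (adjv g u hu.le)
      have a2 := hκ g (g * inl u) (adjv g u hu.le)
      have i1 := ih (g * inl u) (k + 1) (by linarith) (by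
        calc |h (g * inl u) - h g0| ≤ |h (g * inl u) - h g| + |h g - h g0| := abs_sub_le _ _ _
          _ ≤ ε + ε * k := add_le_add a1 hg
          _ = ε * (k + 1) := by ring)
      have p1 := hP g u hu
      rw [huv, map_mul, ← mul_assoc]
      push_cast
      have e : P (g * inl u * inl v) - P g - h g0 * (κ (g * inl u * inl v) - κ g) =
        (P (g * inl u * inl v) - P (g * inl u) - h g0 * (κ (g * inl u * inl v) - κ (g * inl u)))
        + ((h g + h (g * inl u)) / 2 - h g0) * (κ (g * inl u) - κ g) := by
        have : P (g * inl u) - P g = (h g + h (g * inl u)) / 2 * (κ (g * inl u) - κ g) := p1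
        linarith [this]
      rw [e]
      have b1 : |(h g + h (g * inl u)) / 2 - h g0| ≤ ε * (k + 1) := by
        rw [abs_le] at hg a1 ⊢; constructor <;> nlinarith
      have b2 : |((h g + h (g * inl u)) / 2 - h g0) * (κ (g * inl u) - κ g)| ≤ ε * (k + 1) := by
        rw [abs_mul]
        calc _ ≤ ε * (k + 1) * 1 := mul_le_mul b1 a2 (abs_nonneg _) (by positivity)
          _ = _ := by ring
      refine (abs_add_le _ _).trans ((add_le_add i1 b2).trans ?_)
      have : (0:ℝ) ≤ v.norm := by positivity
      nlinarith [mul_nonneg hε this]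
  -- horizontal defect
  set Δ : (σ × Bool) → FreeGroup α ⋊[ρ] FreeGroup σ → ℝ :=
    fun s g => a g (g * inr (ltr s)) + P g - P (g * inr (ltr s)) with hΔ
  have Δopp : ∀ s g, Δ (opp s) g = - Δ s (g * inr (ltr (opp s))) := by
    intro s g
    have e : g * inr (ltr (opp s)) * inr (ltr s) = g := by
      rw [ltr_opp, mul_assoc, ← map_mul]; simp
    simp only [hΔ]
    rw [e, aanti]; ring
  have Δ1 : ∀ s g (x : FreeGroup α), x.norm = 1 →
      |Δ s (g * inl x) - Δ s g| ≤ ε * (4 + Lp * (1 + Lp)) := by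
    intro s g x hx
    set y := (ρ (ltr s))⁻¹ x with hy
    have e : g * inl x * inr (ltr s) = g * inr (ltr s) * inl y := by
      rw [mul_assoc, inl_inr_comm, ← mul_assoc]
    have hyn : (y.norm : ℝ) ≤ Lp := by
      have := hLp s x; rw [hx, mul_one] at this; exact_mod_cast this
    have q1 := approx y g (g * inr (ltr s)) 1 zero_le_one (by
      rw [mul_one]; exact hh _ _ (adjh g s))
    have p1 : P (g * inl x) - P g = a g (g * inl x) := hP g x hx
    have c1 := hh g (g * inl x) (adjv g x hx.le)
    have c2 := hκ g (g * inl x) (adjv g x hx.le)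
    have c3 := hh _ _ (adjh g s)
    have c4 := hκ _ _ (adjh g s)
    have c5 := hh _ _ (adjh (g * inl x) s)
    have c6 := hκ _ _ (adjh (g * inl x) s)
    have expand : Δ s (g * inl x) - Δ s g =
        ((h (g * inl x) + h (g * inl x * inr (ltr s))) / 2 - h g) *
          (κ (g * inl x * inr (ltr s)) - κ (g * inl x))
        - ((h g + h (g * inr (ltr s))) / 2 - h g) * (κ (g * inr (ltr s)) - κ g)
        + ((h g + h (g * inl x)) / 2 - h g) * (κ (g * inl x) - κ g)
        - (P (g * inr (ltr s) * inl y) - P (g * inr (ltr s))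
          - h g * (κ (g * inr (ltr s) * inl y) - κ (g * inr (ltr s)))) := by
      have p1' : P (g * inl x) = P g + (h g + h (g * inl x)) / 2 * (κ (g * inl x) - κ g) := by
        have : P (g * inl x) - P g = (h g + h (g * inl x)) / 2 * (κ (g * inl x) - κ g) := p1
        linarith
      simp only [hΔ, ha]
      rw [← e, p1']; ring
    rw [expand]
    have bd : ∀ u v k : ℝ, |u| ≤ ε * k → |v| ≤ 1 → 0 ≤ k → |u * v| ≤ ε * k := by
      intro u v k hu hv hk
      rw [abs_mul]
      calc _ ≤ ε * k * 1 := mul_le_mul hu hv (abs_nonneg _) (by positivity)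
        _ = _ := by ring
    have d1 := bd _ _ 2 (by
      rw [abs_le] at c1 c5 ⊢; constructor <;> linarith :
        |(h (g * inl x) + h (g * inl x * inr (ltr s))) / 2 - h g| ≤ ε * 2) c6 (by norm_num)
    have d2 := bd _ _ 1 (by
      rw [abs_le] at c3 ⊢; constructor <;> linarith :
        |(h g + h (g * inr (ltr s))) / 2 - h g| ≤ ε * 1) c4 (by norm_num)
    have d3 := bd _ _ 1 (by
      rw [abs_le] at c1 ⊢; constructor <;> linarith :
        |(h g + h (g * inl x)) / 2 - h g| ≤ ε * 1) c2 (by norm_num)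
    have d4 : (y.norm : ℝ) * (ε * (1 + y.norm)) ≤ Lp * (ε * (1 + Lp)) := by
      gcongr
    have q2 := q1.trans d4
    rw [abs_le] at d1 d2 d3 q2 ⊢
    constructor <;> linarith
  have Δv : ∀ s (y : FreeGroup α) g, |Δ s (g * inl y) - Δ s g| ≤ ε * (4 + Lp * (1 + Lp)) * y.norm := by
    intro s y
    induction y using ind_letter with
    | h1 => intro g; simp
    | hs u v hu huv ih =>
      intro g
      rw [huv, map_mul, ← mul_assoc]
      push_cast
      have i1 := ih (g * inl u)
      have i2 := Δ1 s g u hu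
      have := abs_sub_le (Δ s (g * inl u * inl v)) (Δ s (g * inl u)) (Δ s g)
      linarith
  -- the loop system
  obtain ⟨k, rfl⟩ : ∃ k, ℓ = k + 1 := ⟨ℓ - 1, by omega⟩
  classical
  have hnx : ∀ i : Fin (k + 1), z (finRotate (k + 1) i : Fin (k + 1)) = z (i + 1) := by
    intro i
    rw [finRotate_succ_apply, Fin.val_add_one]
    split_ifs with hi
    · rw [hi]; simp [hz]
    · rfl
  set kd : Fin (k + 1) → Option (σ × Bool) := fun i =>
    if hs : ∃ s, z (i + 1) = z i * inr (ltr s) then some hs.choose else none with hkd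
  have kd1 : ∀ i s, kd i = some s → z (i + 1) = z i * inr (ltr s) := by
    intro i s hi
    simp only [hkd] at hi
    split_ifs at hi with hs
    have := hs.choose_spec
    rw [← Option.some_inj.1 hi]; exact this
  have kd2 : ∀ i, kd i = none → ∃ x : FreeGroup α, x.norm ≤ 1 ∧ z (i + 1) = z i * inl x := by
    intro i hi
    simp only [hkd] at hi
    split_ifs at hi with hs
    rcases hadj i i.2 with hh | hh
    · exact hh
    · exact absurd hh hs
  let LS : LoopSys α σ (Fin (k + 1)) :=
    { nxt := finRotate (k + 1)
      q := fun i => (z i).right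
      n := fun i => (z i).left
      kind := kd
      hq := by intro i s hi; simp only [hnx]; rw [kd1 i s hi]; simp
      hn := by intro i s hi; simp only [hnx]; rw [kd1 i s hi]; simp
      hnone := by
        intro i hi; simp only [hnx]
        obtain ⟨x, _, hx⟩ := kd2 i hi
        rw [hx]; simp }
  have hvl : ∀ i, LS.kind i = none → fd ((ρ (LS.q i))⁻¹ (LS.n i)) ((ρ (LS.q i))⁻¹ (LS.n (LS.nxt i))) ≤ 1 := by
    intro i hi
    obtain ⟨x, hx1, hx⟩ := kd2 i hi
    have : LS.n (LS.nxt i) = (z i).left * ρ (z i).right x := by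
      simp only [LS, hnx]; rw [hx]; simp
    rw [this, fd, map_mul]
    simp [LS, hx1]
  obtain ⟨m, hm, hS⟩ := LS.iso ρ (C0 := C0) (B := B) (Cg := 10) hFL hB
    (by
      intro i hi a b o s
      have := hvl i hi
      unfold Ord4 at o
      omega)
    (by
      intro i j _ hi hj
      left
      have := hvl i hi
      simpa [LoopSys.vlen, hi] using this)
  -- the integral
  set A : Fin (k + 1) → ℝ := fun i => (kd i).elim 0 fun s => Δ s (z i) with hA
  have hstep : ∀ i : Fin (k + 1), a (z i) (z (i + 1)) =
      A i + (P (z (finRotate (k + 1) i : Fin (k + 1))) - P (z i)) := by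
    intro i
    rw [hnx]
    cases hi : kd i with
    | none =>
      obtain ⟨x, hx1, hx⟩ := kd2 i hi
      simp only [hA, hi, Option.elim_none]
      rcases Nat.lt_or_ge x.norm 1 with h0 | h0
      · have : x = 1 := FreeGroup.norm_eq_zero.1 (by omega)
        rw [hx, this]; simp [ha]
      · rw [hx, hP _ _ (by omega)]; ring
    | some s =>
      simp only [hA, hi, Option.elim_some, hΔ]
      rw [kd1 i s hi]; ring
  have h_inter : ∑ i ∈ Finset.range (k + 1), a (z i) (z (i + 1)) = ∑ i, A i := by
    rw [Finset.sum_range]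
    rw [Finset.sum_congr rfl fun i _ => hstep i, Finset.sum_add_distrib, Finset.sum_sub_distrib,
      Equiv.sum_comp (finRotate (k + 1)) (fun i : Fin (k + 1) => P (z i)), sub_self, add_zero]
  have hpairA : ∀ i, |A i + A (m i)| ≤ ε * (4 + Lp * (1 + Lp)) * LS.cost ρ m i := by
    intro i
    cases hi : kd i with
    | none =>
      have : m i = i := hm.none i hi
      simp only [this, hA, hi, Option.elim_none]
      simp; positivity
    | some s =>
      have hk2 : kd (m i) = some (opp s) := hm.kind i s hi
      have hq2 : (z (m i)).right = (z i).right * ltr s := hm.q i s hi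
      simp only [hA, hi, hk2, Option.elim_some]
      rw [Δopp]
      have e : z (m i) * inr (ltr (opp s)) =
          z i * inl ((ρ (z i).right)⁻¹ ((z i).left⁻¹ * (z (m i)).left)) := by
        ext
        · simp
        · simp [hq2, ltr_opp]
      rw [e]
      have := Δv s ((ρ (z i).right)⁻¹ ((z i).left⁻¹ * (z (m i)).left)) (z i)
      rw [abs_sub_comm] at this
      exact this
  have hdouble : ∑ i, (A i + A (m i)) = 2 * ∑ i, A i := by
    rw [Finset.sum_add_distrib, Equiv.sum_comp m A]; ring
  change |∑ i ∈ Finset.range (k + 1), a (z i) (z (i + 1))| ≤ _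
  rw [h_inter]
  have hS' : ∑ i, (LS.cost ρ m i : ℝ) ≤
      ((2 * (2 * B + (C0 + 8 * B + 10 + 2)) : ℕ) : ℝ) * ((k + 1 : ℕ) : ℝ) := by
    have h1 : ∑ i, LS.cost ρ m i ≤ 2 * (2 * B + (C0 + 8 * B + 10 + 2)) * (k + 1) := by
      rw [Fintype.card_fin] at hS; omega
    exact_mod_cast h1
  have f1 : |2 * ∑ i, A i| ≤ ε * (4 + Lp * (1 + Lp)) * ∑ i, (LS.cost ρ m i : ℝ) := by
    rw [← hdouble, Finset.mul_sum]
    exact (Finset.abs_sum_le_sum_abs _ _).trans (Finset.sum_le_sum fun i _ => hpairA i)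
  have f2 := mul_le_mul_of_nonneg_left hS' (by positivity : 0 ≤ ε * (4 + (Lp:ℝ) * (1 + Lp)))
  rw [abs_mul, abs_two] at f1
  have := abs_nonneg (∑ i, A i)
  calc |∑ i, A i| ≤ 2 * |∑ i, A i| := by linarith
    _ ≤ _ := f1.trans f2
    _ = _ := by ring

end area
end FT

namespace FT

/-- integer valued geodesic metrics -/
structure GM {X : Type*} (d : X → X → ℕ) : Prop where
  zero : ∀ x y, d x y = 0 ↔ x = y
  comm : ∀ x y, d x y = d y x
  tri : ∀ x y z, d x z ≤ d x y + d y z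
  geod : ∀ x y k, k ≤ d x y → ∃ p, d x p = k ∧ d p y = d x y - k

section
variable {X : Type*} {d : X → X → ℕ}

theorem GM.self (hd : GM d) (x : X) : d x x = 0 := (hd.zero x x).2 rfl

/-- betweenness -/
def Bt (d : X → X → ℕ) (x p y : X) : Prop := d x p + d p y = d x y

/-- a path through points satisfying `S` -/
inductive Pth (d : X → X → ℕ) (S : X → Prop) : ℕ → X → X → Prop
  | nil (x : X) : S x → Pth d S 0 x x
  | cons (n : ℕ) (x y z : X) : S x → d x y ≤ 1 → Pth d S n y z → Pth d S (n + 1) x z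

theorem Pth.trans {S : X → Prop} {n m : ℕ} {x y z : X} (h : Pth d S n x y) (h' : Pth d S m y z) :
    Pth d S (n + m) x z := by
  induction h with
  | nil x hx => simpa using h'
  | cons n x y w hx hxy _ ih =>
    have := Pth.cons _ x y z hx hxy (ih h')
    have e : n + 1 + m = n + m + 1 := by omega
    rw [e]; exact this

theorem Pth.mono {S S' : X → Prop} (hS : ∀ x, S x → S' x) {n : ℕ} {x y : X} (h : Pth d S n x y) :
    Pth d S' n x y := by
  induction h with
  | nil x hx => exact .nil x (hS x hx)
  | cons n x y w hx hxy _ ih => exact .cons n x y w (hS x hx) hxy ih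

theorem Pth.left {S : X → Prop} {n : ℕ} {x y : X} (h : Pth d S n x y) : S x := by
  cases h <;> assumption

theorem Pth.right {S : X → Prop} {n : ℕ} {x y : X} (h : Pth d S n x y) : S y := by
  induction h <;> assumption

theorem Pth.fn {S : X → Prop} {n : ℕ} {x y : X} (h : Pth d S n x y) :
    ∃ z : ℕ → X, z 0 = x ∧ z n = y ∧ (∀ i < n, d (z i) (z (i + 1)) ≤ 1) ∧ ∀ i ≤ n, S (z i) := by
  induction h with
  | nil x hx => exact ⟨fun _ => x, rfl, rfl, by simp, fun _ _ => hx⟩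
  | cons n x y w hx hxy _ ih =>
    obtain ⟨z, h0, h1, h2, h3⟩ := ih
    refine ⟨fun i => Nat.casesOn i x z, rfl, h1, ?_, ?_⟩
    · rintro (_ | i) hi
      · simpa [h0] using hxy
      · exact h2 i (by omega)
    · rintro (_ | i) hi
      · exact hx
      · exact h3 i (by omega)

theorem bt_trans (hd : GM d) {x p y q : X} (h : Bt d x p y) (h' : Bt d x q p) : Bt d x q y := by
  unfold Bt at *
  have := hd.tri q p y
  have := hd.tri x q y
  omega

theorem bt_symm (hd : GM d) {x p y : X} (h : Bt d x p y) : Bt d y p x := by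
  unfold Bt at *
  rw [hd.comm y p, hd.comm p x, hd.comm y x]; omega

theorem bt_left (hd : GM d) (x y : X) : Bt d x x y := by simp [Bt, hd.self]
theorem bt_right (hd : GM d) (x y : X) : Bt d x y y := by simp [Bt, hd.self]

theorem geo_pth (hd : GM d) : ∀ (n : ℕ) (x y : X), d x y = n → Pth d (fun q => Bt d x q y) n x y := by
  intro n
  induction n with
  | zero =>
    intro x y h
    have := (hd.zero x y).1 h
    subst this
    exact .nil x (bt_left hd x x)
  | succ n ih =>
    intro x y h
    obtain ⟨p, h1, h2⟩ := hd.geod x y 1 (by omega)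
    refine .cons n x p y (bt_left hd x y) h1.le ((ih p y (by omega)).mono ?_)
    intro q hq
    have hp : Bt d x p y := by unfold Bt; omega
    exact bt_symm hd (bt_trans hd (bt_symm hd hp) (bt_symm hd hq))

theorem geo_fn (hd : GM d) (x y : X) : ∃ z : ℕ → X, z 0 = x ∧ z (d x y) = y ∧
    (∀ i j, i ≤ j → j ≤ d x y → d (z i) (z j) = j - i) := by
  obtain ⟨z, h0, h1, h2, h3⟩ := (geo_pth hd _ x y rfl).fn
  have key : ∀ i j, i ≤ j → j ≤ d x y → d (z i) (z j) ≤ j - i := by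
    intro i j hij
    induction j, hij using Nat.le_induction with
    | base => intro _; simp [hd.self]
    | succ j hj ih =>
      intro h
      have := hd.tri (z i) (z j) (z (j + 1))
      have := ih (by omega)
      have := h2 j (by omega)
      omega
  refine ⟨z, h0, h1, fun i j hij hj => ?_⟩
  have a := key 0 i (by omega) (by omega)
  have b := key i j hij hj
  have c := key j _ hj le_rfl
  have e := hd.tri (z 0) (z i) (z (d x y))
  have f := hd.tri (z i) (z j) (z (d x y))
  rw [h0, h1] at *
  omega

theorem geo_fn_through (hd : GM d) {x p y : X} (hp : Bt d x p y) : ∃ z : ℕ → X, z 0 = x ∧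
    z (d x y) = y ∧ z (d x p) = p ∧ (∀ i j, i ≤ j → j ≤ d x y → d (z i) (z j) = j - i) := by
  obtain ⟨z, h0, h1, h2⟩ := geo_fn hd x p
  obtain ⟨z', h0', h1', h2'⟩ := geo_fn hd p y
  refine ⟨fun i => if i ≤ d x p then z i else z' (i - d x p), by simp [h0], ?_, by simp [h1], ?_⟩
  · unfold Bt at hp
    by_cases h : d x y ≤ d x p
    · have : d p y = 0 := by omega
      have e := (hd.zero _ _).1 this
      subst e
      simp [h1]
    · simp only [h, if_false]
      rw [← hp, Nat.add_sub_cancel_left, h1']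
  · intro i j hij hj
    unfold Bt at hp
    by_cases hi : i ≤ d x p
    · by_cases hj' : j ≤ d x p
      · simp only [hi, hj', if_true]; exact h2 i j hij hj'
      · simp only [hi, hj', if_true, if_false]
        have a := h2 0 i (by omega) hi
        have b := h2 i _ hi le_rfl
        have c := h2' 0 (j - d x p) (by omega) (by omega)
        have e := h2' (j - d x p) _ (by omega) le_rfl
        rw [h0] at a; rw [h1] at b; rw [h0'] at c; rw [h1'] at e
        have f := hd.tri (z i) p (z' (j - d x p))
        have g := hd.tri x (z i) y
        have g' := hd.tri (z i) (z' (j - d x p)) y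
        omega
    · have hj' : ¬ j ≤ d x p := by omega
      simp only [hi, hj', if_false]
      rw [h2' _ _ (by omega) (by omega)]; omega

/-- linear isoperimetry in integrated form -/
def AR (d : X → X → ℕ) (K : ℝ) : Prop := ∀ (h κ : X → ℝ) (ε : ℝ), 0 ≤ ε →
  (∀ g g', d g g' ≤ 1 → |h g' - h g| ≤ ε) → (∀ g g', d g g' ≤ 1 → |κ g' - κ g| ≤ 1) →
  ∀ (l : ℕ) (z : ℕ → X), z l = z 0 → (∀ i < l, d (z i) (z (i + 1)) ≤ 1) →
  |∑ i ∈ Finset.range l, (h (z i) + h (z (i+1))) / 2 * (κ (z (i+1)) - κ (z i))| ≤ ε * K * l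

theorem T' (hd : GM d) {K : ℝ} (hK : AR d K) {a p b : X} (hp : Bt d a p b) (R l : ℕ)
    (hl : Pth d (fun q => R ≤ d p q) l b a) : (R : ℝ) ^ 2 ≤ 2 * K * (d a b + l) := by
  obtain ⟨z, z0, z1, zp, zd⟩ := geo_fn_through hd hp
  obtain ⟨y, y0, y1, y2, y3⟩ := hl.fn
  have hb := hl.left
  have ha := hl.right
  set n := d a b with hn
  let h : X → ℝ := fun x => max 0 ((R : ℝ) - d p x)
  let κ : X → ℝ := fun x => d a x
  let w : ℕ → X := fun i => if i ≤ n then z i else y (i - n)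
  have w1 : ∀ i, i ≤ n → w i = z i := fun i hi => by simp [w, hi]
  have w2 : ∀ i, w (n + i) = y i := fun i => by
    by_cases hi : i = 0
    · subst hi; simp [w, z1, y0]
    · have : ¬ n + i ≤ n := by omega
      simp only [w, this, if_false, Nat.add_sub_cancel_left]
  have lip : ∀ o g g' : X, d g g' ≤ 1 → |(d o g' : ℝ) - d o g| ≤ 1 := by
    intro o g g' hg
    have e1 : (d o g' : ℝ) ≤ d o g + d g g' := by exact_mod_cast hd.tri o g g'
    have e2 : (d o g : ℝ) ≤ d o g' + d g g' := by
      have := hd.tri o g' g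
      rw [hd.comm g' g] at this; exact_mod_cast this
    have e3 : (d g g' : ℝ) ≤ 1 := by exact_mod_cast hg
    rw [abs_le]; constructor <;> linarith
  have hlip : ∀ g g', d g g' ≤ 1 → |h g' - h g| ≤ 1 := by
    intro g g' hg
    have := lip p g g' hg
    simp only [h]
    refine (abs_max_sub_max_le_max _ _ _ _).trans ?_
    simp only [sub_self, abs_zero]
    refine max_le zero_le_one ?_
    have e : (R : ℝ) - d p g' - (R - d p g) = -((d p g' : ℝ) - d p g) := by ring
    rw [e, abs_neg]; exact this
  have main := hK h κ 1 zero_le_one hlip (fun g g' hg => lip a g g' hg) (n + l) w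
    (by rw [w2, w1 0 (by omega), y1, z0]) (by
      intro i hi
      by_cases hin : i < n
      · rw [w1 i hin.le, w1 (i+1) hin, zd i (i+1) (by omega) (by omega)]; omega
      · obtain ⟨j, rfl⟩ := Nat.exists_eq_add_of_le (not_lt.1 hin)
        rw [w2, add_assoc, w2]; exact y2 j (by omega))
  rw [Finset.sum_range_add] at main
  have s2 : ∑ x ∈ Finset.range l, (h (w (n + x)) + h (w (n + x + 1))) / 2 *
      (κ (w (n + x + 1)) - κ (w (n + x))) = 0 := by
    apply Finset.sum_eq_zero
    intro i hi
    have hi := Finset.mem_range.1 hi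
    have f : ∀ i ≤ l, h (w (n + i)) = 0 := by
      intro i hi
      rw [w2]
      have := y3 i hi
      have : (R : ℝ) ≤ d p (y i) := by exact_mod_cast this
      simp only [h]; exact max_eq_left (by linarith)
    rw [add_assoc, f i hi.le, f (i + 1) hi]; simp
  have hk : d a p ≤ n := by unfold Bt at hp; omega
  have hRk : R ≤ d a p := by rw [hd.comm]; exact ha
  have s1 : (R : ℝ) ^ 2 / 2 ≤ ∑ x ∈ Finset.range n, (h (w x) + h (w (x + 1))) / 2 *
      (κ (w (x + 1)) - κ (w x)) := by
    have e : ∀ i ∈ Finset.range n, (h (w i) + h (w (i + 1))) / 2 *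
      (κ (w (i + 1)) - κ (w i)) = (h (z i) + h (z (i + 1))) / 2 := by
      intro i hi
      have hi := Finset.mem_range.1 hi
      rw [w1 i hi.le, w1 (i+1) hi]
      have e1 := zd 0 i (by omega) hi.le
      have e2 := zd 0 (i+1) (by omega) hi
      rw [z0] at e1 e2
      simp only [κ, e1, e2]; push_cast; simp
    rw [Finset.sum_congr rfl e]
    have nn : ∀ x, 0 ≤ h x := fun x => le_max_left _ _
    obtain ⟨c, hc⟩ := Nat.exists_eq_add_of_le hRk
    have e3 : n = c + R + (n - d a p) := by omega
    rw [e3, Finset.sum_range_add, Finset.sum_range_add]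
    have p1 : 0 ≤ ∑ x ∈ Finset.range c, (h (z x) + h (z (x + 1))) / 2 :=
      Finset.sum_nonneg fun i _ => by linarith [nn (z i), nn (z (i + 1))]
    have p3 : 0 ≤ ∑ x ∈ Finset.range (n - d a p), (h (z (c + R + x)) + h (z (c + R + x + 1))) / 2 :=
      Finset.sum_nonneg fun i _ => by linarith [nn (z (c + R + i)), nn (z (c + R + i + 1))]
    have p2 : (R : ℝ) ^ 2 / 2 ≤ ∑ x ∈ Finset.range R, (h (z (c + x)) + h (z (c + x + 1))) / 2 := by
      have lb : ∀ i ≤ R, (i : ℝ) ≤ h (z (c + i)) := by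
        intro i hi
        have := zd (c + i) (d a p) (by omega) hk
        rw [zp, hd.comm] at this
        have e5 : d p (z (c + i)) + i = R := by omega
        have e6 : (d p (z (c + i)) : ℝ) + i = R := by exact_mod_cast e5
        simp only [h]; exact le_max_of_le_right (by linarith)
      have e7 : (R : ℝ) ^ 2 / 2 = ∑ x ∈ Finset.range R, ((x : ℝ) + ((x + 1 : ℕ) : ℝ)) / 2 := by
        clear * -
        induction R with
        | zero => simp
        | succ R ih => rw [Finset.sum_range_succ, ← ih]; push_cast; ring
      rw [e7]
      apply Finset.sum_le_sum
      intro i hi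
      have hi := Finset.mem_range.1 hi
      have a1 := lb i hi.le
      have a2 := lb (i + 1) hi
      rw [← add_assoc] at a2
      linarith
    linarith
  rw [s2, add_zero] at main
  have := (le_abs_self _).trans main
  push_cast at this
  linarith

/-- thinness of triangles with perimeter at most `L` -/
def Th (d : X → X → ℕ) (L D : ℕ) : Prop := ∀ x y z p, Bt d x p y → d x y + d y z + d z x ≤ L →
  ∃ q, (Bt d x q z ∨ Bt d z q y) ∧ d p q ≤ D

theorem Th.mono {L D D' : ℕ} (h : Th d L D) (hD : D ≤ D') : Th d L D' := by
  intro x y z p hp hL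
  obtain ⟨q, hq, hq'⟩ := h x y z p hp hL
  exact ⟨q, hq, hq'.trans hD⟩

theorem lemS (hd : GM d) {L D R : ℕ} (hT : Th d (2 * L) D) (hD : 1 ≤ D) (hR : R ≤ D) {p u v c : X}
    (hu : ∀ q, Bt d u q c → R ≤ d p q) (hv : ∀ q, Bt d v q c → R ≤ d p q)
    (hul : 2 * d u c ≤ L) (hvl : 2 * d v c ≤ L) (huv : d u v ≤ 6 * D) (hpu : d p u ≤ 3 * D) :
    ∃ l, l ≤ 28 * D ∧ Pth d (fun q => R ≤ d p q) l u v := by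
  have pt : ∀ (S : X → Prop) (x y : X), (∀ q, Bt d x q y → S q) → Pth d S (d x y) x y :=
    fun S x y h => (geo_pth hd _ x y rfl).mono h
  have tr := hd.tri
  by_cases h : d u c ≤ 10 * D
  · have h1 := pt (fun q => R ≤ d p q) u c hu
    have h2 := pt (fun q => R ≤ d p q) c v (fun q hq => hv q (bt_symm hd hq))
    refine ⟨_, ?_, h1.trans h2⟩
    have := tr c u v
    rw [hd.comm c u] at this
    omega
  · obtain ⟨w, w1, w2⟩ := hd.geod u c (10 * D) (by omega)
    have hw : Bt d u w c := by unfold Bt; omega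
    obtain ⟨q, hq, hwq⟩ := hT u c v w hw (by
      have := tr u c v
      rw [hd.comm c v] at *; rw [hd.comm v u] at *; omega)
    rcases hq with hq | hq
    · exfalso
      unfold Bt at hq
      have := tr u q w
      rw [hd.comm q w] at this
      omega
    · have h1 := pt (fun q => R ≤ d p q) u w (fun x hx => hu x (bt_trans hd hw hx))
      have h2 := pt (fun q => R ≤ d p q) w q (fun x hx => by
        unfold Bt at hx
        have a1 := tr u p x
        have a2 := tr u x w
        rw [hd.comm u p] at *
        rw [hd.comm x w] at *
        omega)
      have h3 := pt (fun q => R ≤ d p q) q v (fun x hx =>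
        hv x (bt_trans hd hq (bt_symm hd hx)))
      refine ⟨_, ?_, (h1.trans h2).trans h3⟩
      have a1 := tr q w v
      have a2 := tr w u v
      rw [hd.comm q w] at *
      rw [hd.comm w u] at *
      omega

theorem Th_base (hd : GM d) {K : ℝ} (hK : AR d K) {L D : ℕ} (hD : 2 * K * L < (D + 1) ^ 2)
    (hK0 : 0 ≤ K) : Th d L D := by
  intro x y z p hp hL
  by_contra hc
  push Not at hc
  have h1 : Pth d (fun q => D + 1 ≤ d p q) (d y z) y z :=
    (geo_pth hd _ y z rfl).mono fun q hq => hc q (Or.inr (bt_symm hd hq))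
  have h2 : Pth d (fun q => D + 1 ≤ d p q) (d z x) z x :=
    (geo_pth hd _ z x rfl).mono fun q hq => hc q (Or.inl (bt_symm hd hq))
  have := T' hd hK hp (D + 1) _ (h1.trans h2)
  have e : ((d x y : ℝ) + ((d y z + d z x : ℕ) : ℝ)) ≤ L := by
    rw [add_assoc] at hL; exact_mod_cast hL
  have : 2 * K * ((d x y : ℝ) + ((d y z + d z x : ℕ) : ℝ)) ≤ 2 * K * L := by
    apply mul_le_mul_of_nonneg_left e; positivity
  push_cast at *
  linarith

theorem Th_step (hd : GM d) {K : ℝ} (hK : AR d K) (hK0 : 0 ≤ K) {L D D' : ℕ} (hD : 1 ≤ D)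
    (hT : Th d (2 * L) D)
    (hD' : 2 * K * (34 * D) < (D' + 1) ^ 2) : Th d L D' := by
  intro a b c p hp hL
  have tr := hd.tri
  have hTL : ∀ x y z p, Bt d x p y → d x y + d y z + d z x ≤ L →
      ∃ q, (Bt d x q z ∨ Bt d z q y) ∧ d p q ≤ D := fun x y z p h1 h2 => hT x y z p h1 (by omega)
  by_cases hDD : D ≤ D'
  · obtain ⟨q, h1, h2⟩ := hTL a b c p hp hL
    exact ⟨q, h1, h2.trans hDD⟩
  by_contra hc
  push Not at hc
  have side : ∀ q, (Bt d a q c ∨ Bt d c q b) → (∀ x, Bt d q x c → D' + 1 ≤ d p x) ∧ 2 * d q c ≤ L := by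
    rintro q (hq | hq)
    · refine ⟨fun x hx => hc x (Or.inl ?_), ?_⟩
      · exact bt_symm hd (bt_trans hd (bt_symm hd hq) (bt_symm hd hx))
      · unfold Bt at hq
        have := tr a b c
        rw [hd.comm a c] at *
        omega
    · refine ⟨fun x hx => hc x (Or.inr ?_), ?_⟩
      · exact (bt_trans hd hq (bt_symm hd hx))
      · unfold Bt at hq
        have := tr b a c
        rw [hd.comm b a, hd.comm a c, hd.comm b c] at this
        rw [hd.comm b c] at *
        rw [hd.comm q c] at *
        omega
  have R : D' + 1 ≤ D := by omega
  -- the two ends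
  have ends : ∀ e : X, (∃ e', Bt d e p e' ∧ (e = a ∧ e' = b ∨ e = b ∧ e' = a)) → ∃ y y', Bt d e y p ∧
      d y p ≤ 2 * D ∧ d y y' ≤ D ∧ (Bt d a y' c ∨ Bt d c y' b) ∧
      Pth d (fun q => D' + 1 ≤ d p q) (d y y') y y' := by
    rintro e ⟨e', he, hee⟩
    have heside : Bt d a e c ∨ Bt d c e b := by
      rcases hee with ⟨rfl, _⟩ | ⟨rfl, _⟩
      · exact Or.inl (bt_left hd _ _)
      · exact Or.inr (bt_right hd _ _)
    by_cases h : d e p ≤ 2 * D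
    · refine ⟨e, e, bt_left hd _ _, h, by simp [hd.self], heside, ?_⟩
      rw [hd.self]
      exact .nil e ((side e heside).1 e (bt_left hd _ _))
    · obtain ⟨y, y1, y2⟩ := hd.geod e p (d e p - 2 * D) (by omega)
      have hy : Bt d e y p := by unfold Bt; omega
      have hye : Bt d e y e' := bt_trans hd he hy
      have hyab : Bt d a y b := by
        rcases hee with ⟨rfl, rfl⟩ | ⟨rfl, rfl⟩
        · exact hye
        · exact bt_symm hd hye
      obtain ⟨y', q1, q2⟩ := hTL a b c y hyab hL
      refine ⟨y, y', hy, by omega, q2, q1, (geo_pth hd _ y y' rfl).mono ?_⟩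
      intro x hx
      unfold Bt at hx
      have := tr y x p
      rw [hd.comm x p] at this
      omega
  obtain ⟨y, y', hy, hyp, hyy, hys, py⟩ := ends a ⟨b, hp, Or.inl ⟨rfl, rfl⟩⟩
  obtain ⟨z, z', hz, hzp, hzz, hzs, pz⟩ := ends b ⟨a, bt_symm hd hp, Or.inr ⟨rfl, rfl⟩⟩
  have hz2 : Bt d p z b := bt_symm hd hz
  have hypz : Bt d y p z := by
    unfold Bt at *
    have b1 := tr a y z
    have b2 := tr a z b
    have b3 := tr y p z
    omega
  have c1 := tr y' y p
  have c2 := tr z p z'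
  have c3 := tr y p z'
  have c4 := tr y' y z'
  have c6 := tr p z z'
  rw [hd.comm y' y] at *
  rw [hd.comm y' p] at *
  rw [hd.comm z p] at *
  obtain ⟨l, hl, pl⟩ := lemS hd hT hD R (side z' hzs).1 (side y' hys).1 (side z' hzs).2 (side y' hys).2
    (by rw [hd.comm]; omega) (by omega)
  have pback : Pth d (fun q => D' + 1 ≤ d p q) (d y y') y' y := by
    have py2 : Pth d (fun q => D' + 1 ≤ d p q) (d y y') y y' := py
    have rev : ∀ {S : X → Prop} {n : ℕ} {x y : X}, Pth d S n x y → Pth d S n y x := by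
      intro S n x y h
      induction h with
      | nil x hx => exact .nil x hx
      | cons n x y w hx hxy h ih =>
        exact ih.trans (.cons 0 y x x h.left (by rw [hd.comm]; exact hxy) (.nil x hx))
    exact rev py2
  have fin := T' hd hK hypz (D' + 1) _ ((pz.trans pl).trans pback)
  have e : d y z + (d z z' + l + d y y') ≤ 34 * D := by
    unfold Bt at hypz
    have : d p z ≤ 2 * D := hzp
    omega
  have e' : ((d y z : ℝ) + ((d z z' + l + d y y' : ℕ) : ℝ)) ≤ 34 * D := by exact_mod_cast e
  have : 2 * K * ((d y z : ℝ) + ((d z z' + l + d y y' : ℕ) : ℝ)) ≤ 2 * K * (34 * D) := by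
    apply mul_le_mul_of_nonneg_left e'; positivity
  push_cast at *
  linarith

theorem Th_all (hd : GM d) {K : ℝ} (hK : AR d K) (hK0 : 0 ≤ K) : ∃ D, ∀ L, Th d L D := by
  obtain ⟨M, hM⟩ := exists_nat_ge (2 * K * 34 + 1)
  have hM1 : (1 : ℝ) ≤ M := by linarith
  have hM1' : 1 ≤ M := by exact_mod_cast hM1
  have ind : ∀ i L, Th d (2 ^ i * L) (M * 2 ^ 2 ^ i) → Th d L (M * 2) := by
    intro i
    induction i with
    | zero => intro L h; simpa using h
    | succ i ih =>
      intro L h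
      apply ih
      refine Th_step hd hK hK0 (D := M * 2 ^ 2 ^ (i + 1)) ?_ ?_ ?_
      · exact Nat.mul_pos hM1' (by positivity)
      · rw [← mul_assoc, ← pow_succ']; exact h
      · have e : (2 : ℝ) ^ 2 ^ (i + 1) = ((2 : ℝ) ^ 2 ^ i) ^ 2 := by
          rw [← pow_mul, ← pow_succ]
        push_cast
        rw [e]
        set x : ℝ := (2 : ℝ) ^ 2 ^ i
        have hx : 0 < x := by positivity
        have : 2 * K * (34 * (M * x ^ 2)) ≤ M * (M * x ^ 2) := by
          have : 0 ≤ M * x ^ 2 := by positivity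
          nlinarith
        have : 0 < M * x := by positivity
        nlinarith
  refine ⟨M * 2, fun L => ind L L (Th_base hd hK ?_ hK0)⟩
  have h1 : (L : ℝ) ≤ 2 ^ L := by exact_mod_cast Nat.lt_two_pow_self.le
  have h2 : (2 : ℝ) ^ L ≤ 2 ^ 2 ^ L := by
    exact_mod_cast Nat.pow_le_pow_right (by norm_num) Nat.lt_two_pow_self.le
  push_cast
  set y : ℝ := (2 : ℝ) ^ L
  set x : ℝ := (2 : ℝ) ^ 2 ^ L
  have hy : 0 < y := by positivity
  have hx : 0 < x := by positivity
  have h3 : y * L ≤ x * x := by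
    have : (0:ℝ) ≤ L := by positivity
    nlinarith
  have h4 : 2 * K * (y * L) ≤ M * (x * x) := by
    have : 0 ≤ y * L := by positivity
    nlinarith
  have h5 : (M : ℝ) * (x * x) ≤ (M * x) * (M * x) := by
    have : 0 < M * (x * x) := by positivity
    nlinarith
  have : 0 < M * x := by positivity
  nlinarith

theorem Th_hyp (hd : GM d) {D : ℕ} (hT : ∀ L, Th d L D) : IsHypD (fun x y => (d x y : ℝ)) := by
  refine ⟨3 * D + 1, by positivity, fun o x y z => ?_⟩
  have tr := hd.tri
  have la : ∀ x y q, Bt d x q y → d x o + d y o ≤ d x y + 2 * d o q := by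
    intro x y q hq
    unfold Bt at hq
    have := tr x q o
    have := tr y q o
    rw [hd.comm y q, hd.comm q o] at *
    omega
  have lb : ∃ p, Bt d x p z ∧ d x z + 2 * d o p ≤ d x o + d z o + 4 * D + 2 := by
    obtain ⟨w, w0, w1, wd⟩ := geo_fn hd x z
    have hw : ∀ i ≤ d x z, Bt d x (w i) z := by
      intro i hi
      have a := wd 0 i (by omega) hi
      have b := wd i _ hi le_rfl
      rw [w0] at a; rw [w1] at b
      unfold Bt; omega
    have ex : ∃ i, i ≤ d x z ∧ ∃ q, Bt d o q z ∧ d (w i) q ≤ D :=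
      ⟨d x z, le_rfl, z, bt_right hd _ _, by simp [w1, hd.self]⟩
    classical
    obtain ⟨hi, q, hq, hqd⟩ := Nat.find_spec ex
    have hmin := fun j => Nat.find_min ex (m := j)
    set i := Nat.find ex with hidef
    have near1 : ∃ q', Bt d x q' o ∧ d (w i) q' ≤ D + 1 := by
      by_cases h0 : i = 0
      · exact ⟨x, bt_left hd _ _, by rw [h0, w0, hd.self]; omega⟩
      · have hm := hmin (i - 1) (by omega)
        push Not at hm
        obtain ⟨q', h1, h2⟩ := hT _ x z o (w (i - 1)) (hw _ (by omega)) le_rfl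
        rcases h1 with h1 | h1
        · refine ⟨q', h1, ?_⟩
          have := tr (w i) (w (i - 1)) q'
          have := wd (i - 1) i (by omega) hi
          rw [hd.comm] at this
          omega
        · have := hm (by omega) q' h1; omega
    obtain ⟨q', hq', hqd'⟩ := near1
    refine ⟨w i, hw i hi, ?_⟩
    have hb := hw i hi
    unfold Bt at hb hq hq'
    have a1 := tr x q' (w i)
    have a2 := tr o q' (w i)
    have a3 := tr o q (w i)
    have a4 := tr (w i) q z
    rw [hd.comm q' (w i), hd.comm o q'] at *
    rw [hd.comm q (w i), hd.comm z o] at *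
    omega
  obtain ⟨p, hp, hp'⟩ := lb
  obtain ⟨q, hq, hq'⟩ := hT _ x z y p hp le_rfl
  have a0 := tr o p q
  unfold gprod
  have hp'' : (d x z : ℝ) + 2 * d o p ≤ d x o + d z o + 4 * D + 2 := by exact_mod_cast hp'
  have a0' : (d o q : ℝ) ≤ d o p + D := by
    have : d o q ≤ d o p + D := by omega
    exact_mod_cast this
  rcases hq with hq | hq
  · have := la _ _ _ hq
    have : (d x o : ℝ) + d y o ≤ d x y + 2 * d o q := by exact_mod_cast this
    exact (min_le_left _ _).trans (by linarith)
  · have := la _ _ _ hq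
    have : (d y o : ℝ) + d z o ≤ d y z + 2 * d o q := by exact_mod_cast this
    exact (min_le_right _ _).trans (by linarith)

end
end FT

namespace FT
open FreeGroup (of mk mk_toWord norm_one norm_mul_le norm_inv_eq norm_of)
open SemidirectProduct (inl inr)

section wl
variable {G : Type*} [Group G] {S : Set G}

theorem wl_le (l : List G) (h : ∀ x ∈ l, x ∈ S ∨ x⁻¹ ∈ S) : wordLength S l.prod ≤ l.length :=
  Nat.sInf_le ⟨l, h, rfl, rfl⟩

theorem wl_one : wordLength S (1 : G) = 0 := by
  have := wl_le (S := S) [] (by simp)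
  simpa using this

theorem wl_letter {g : G} (h : g ∈ S ∨ g⁻¹ ∈ S) : wordLength S g ≤ 1 := by
  have := wl_le (S := S) [g] (by simpa using h)
  simpa using this

theorem wl_ex (hS : Subgroup.closure S = ⊤) (g : G) :
    ∃ l : List G, (∀ x ∈ l, x ∈ S ∨ x⁻¹ ∈ S) ∧ l.length = wordLength S g ∧ l.prod = g := by
  have hne : { n : ℕ | ∃ l : List G, (∀ x ∈ l, x ∈ S ∨ x⁻¹ ∈ S) ∧ l.length = n ∧ l.prod = g }.Nonempty := by
    have : g ∈ Subgroup.closure S := by rw [hS]; trivial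
    rw [← Subgroup.mem_toSubmonoid, Subgroup.closure_toSubmonoid] at this
    obtain ⟨l, h1, h2⟩ := Submonoid.exists_list_of_mem_closure this
    exact ⟨l.length, l, h1, rfl, h2⟩
  exact Nat.sInf_mem hne

theorem wl_mul (hS : Subgroup.closure S = ⊤) (g h : G) :
    wordLength S (g * h) ≤ wordLength S g + wordLength S h := by
  obtain ⟨l, h1, h2, h3⟩ := wl_ex hS g
  obtain ⟨l', h1', h2', h3'⟩ := wl_ex hS h
  have := wl_le (S := S) (l ++ l') (by
    intro x hx
    rcases List.mem_append.1 hx with hx | hx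
    exacts [h1 x hx, h1' x hx])
  rw [List.prod_append, h3, h3', List.length_append] at this
  omega

theorem wl_inv_le (hS : Subgroup.closure S = ⊤) (g : G) :
    wordLength S g⁻¹ ≤ wordLength S g := by
  obtain ⟨l, h1, h2, h3⟩ := wl_ex hS g
  have := wl_le (S := S) (l.map (·⁻¹)).reverse (by
    intro x hx
    simp only [List.mem_reverse, List.mem_map] at hx
    obtain ⟨y, hy, rfl⟩ := hx
    rw [inv_inv]
    exact (h1 y hy).symm)
  rw [← List.prod_inv_reverse, h3] at this
  simpa [h2] using this

theorem wl_inv (hS : Subgroup.closure S = ⊤) (g : G) : wordLength S g⁻¹ = wordLength S g := by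
  apply le_antisymm (wl_inv_le hS g)
  have := wl_inv_le hS g⁻¹
  rwa [inv_inv] at this

theorem wl_zero (hS : Subgroup.closure S = ⊤) (g : G) : wordLength S g = 0 ↔ g = 1 := by
  constructor
  · intro h
    obtain ⟨l, h1, h2, h3⟩ := wl_ex hS g
    rw [h, List.length_eq_zero_iff] at h2
    rw [← h3, h2]; rfl
  · rintro rfl; exact wl_one

theorem wl_split (hS : Subgroup.closure S = ⊤) (g : G) (k : ℕ) (hk : k ≤ wordLength S g) :
    ∃ a b, g = a * b ∧ wordLength S a = k ∧ wordLength S b = wordLength S g - k := by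
  obtain ⟨l, h1, h2, h3⟩ := wl_ex hS g
  have e : g = (l.take k).prod * (l.drop k).prod := by
    rw [← List.prod_append, List.take_append_drop, h3]
  have a1 := wl_le (S := S) (l.take k) (fun x hx => h1 x (List.mem_of_mem_take hx))
  have a2 := wl_le (S := S) (l.drop k) (fun x hx => h1 x (List.mem_of_mem_drop hx))
  have a3 := wl_mul hS (l.take k).prod (l.drop k).prod
  rw [← e] at a3
  rw [List.length_take] at a1
  rw [List.length_drop] at a2
  exact ⟨_, _, e, by omega, by omega⟩

theorem wl_one_form (hS : Subgroup.closure S = ⊤) {g : G} (h : wordLength S g = 1) :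
    g ∈ S ∨ g⁻¹ ∈ S := by
  obtain ⟨l, h1, h2, h3⟩ := wl_ex hS g
  rw [h, List.length_eq_one_iff] at h2
  obtain ⟨a, rfl⟩ := h2
  simp at h3
  subst h3
  exact h1 a (by simp)

/-- Lipschitz estimates are checked on generators -/
theorem wl_lip (hS : Subgroup.closure S = ⊤) (f : G → ℝ) (L : ℝ) (h1 : f 1 ≤ 0)
    (hm : ∀ g h, f (g * h) ≤ f g + f h) (hl : ∀ s ∈ S, f s ≤ L ∧ f s⁻¹ ≤ L) (g : G) :
    f g ≤ L * wordLength S g := by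
  obtain ⟨l, h1', h2, h3⟩ := wl_ex hS g
  rw [← h2, ← h3]
  clear h2 h3
  induction l with
  | nil => simpa using h1
  | cons a l ih =>
    have h4 := ih (fun x hx => h1' x (List.mem_cons_of_mem _ hx))
    have h5 : f a ≤ L := by
      rcases h1' a (by simp) with h | h
      · exact (hl a h).1
      · have := (hl _ h).2; rwa [inv_inv] at this
    have := hm a l.prod
    rw [List.prod_cons, List.length_cons]
    push_cast
    linarith

/-- word distance as natural number -/
noncomputable def nd (S : Set G) (g h : G) : ℕ := wordLength S (g⁻¹ * h)

theorem nd_cast (S : Set G) : wordDist S = fun g h => (nd S g h : ℝ) := rfl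

theorem nd_left (S : Set G) (a g h : G) : nd S (a * g) (a * h) = nd S g h := by
  unfold nd; congr 1; group

theorem nd_GM (hS : Subgroup.closure S = ⊤) : GM (nd S) where
  zero x y := by
    unfold nd; rw [wl_zero hS]
    rw [inv_mul_eq_one]
  comm x y := by
    unfold nd; rw [← wl_inv hS]; congr 1; group
  tri x y z := by
    have := wl_mul hS (x⁻¹ * y) (y⁻¹ * z)
    have e : x⁻¹ * y * (y⁻¹ * z) = x⁻¹ * z := by group
    rw [e] at this
    exact this
  geod x y k hk := by
    obtain ⟨a, b, h1, h2, h3⟩ := wl_split hS (x⁻¹ * y) k hk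
    refine ⟨x * a, ?_, ?_⟩
    · unfold nd; rw [← h2]; congr 1; group
    · unfold nd; rw [← h3]; congr 1
      have : y = x * (a * b) := by rw [← h1]; group
      rw [this]; group

theorem hom_lip {G' : Type*} [Group G'] {S' : Set G'} (hS : GenSet S)
    (hS' : Subgroup.closure S' = ⊤) (f : G →* G') :
    ∃ L : ℝ, 0 ≤ L ∧ ∀ g, (wordLength S' (f g) : ℝ) ≤ L * wordLength S g := by
  obtain ⟨L, hL⟩ : ∃ L : ℕ, ∀ s ∈ S, wordLength S' (f s) ≤ L := by
    obtain ⟨L, hL⟩ := (hS.1.image fun s => wordLength S' (f s)).bddAbove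
    exact ⟨L, fun s hs => hL ⟨s, hs, rfl⟩⟩
  refine ⟨L, by positivity, wl_lip hS.2 (fun g => (wordLength S' (f g) : ℝ)) L ?_ ?_ ?_⟩
  · simp [wl_one]
  · intro g h
    have := wl_mul hS' (f g) (f h)
    simp only [_root_.map_mul]
    exact_mod_cast this
  · intro s hs
    have := hL s hs
    simp only [_root_.map_inv, wl_inv hS']
    exact ⟨by exact_mod_cast this, by exact_mod_cast this⟩

theorem wl_equiv {G' : Type*} [Group G'] (e : G ≃* G') (hS : Subgroup.closure S = ⊤)
    (hS' : Subgroup.closure (e '' S) = ⊤) (g : G) :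
    wordLength (e '' S) (e g) = wordLength S g := by
  apply le_antisymm
  · obtain ⟨l, h1, h2, h3⟩ := wl_ex hS g
    have := wl_le (S := e '' S) (l.map e) (by
      intro x hx
      obtain ⟨y, hy, rfl⟩ := List.mem_map.1 hx
      rcases h1 y hy with h | h
      · exact Or.inl ⟨y, h, rfl⟩
      · exact Or.inr ⟨_, h, by simp⟩)
    rw [List.length_map, h2, ← map_list_prod, h3] at this
    exact this
  · obtain ⟨l, h1, h2, h3⟩ := wl_ex hS' (e g)
    have := wl_le (S := S) (l.map e.symm) (by
      intro x hx
      obtain ⟨y, hy, rfl⟩ := List.mem_map.1 hx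
      rcases h1 y hy with h | h
      · obtain ⟨z, hz, rfl⟩ := h
        exact Or.inl (by simpa using hz)
      · obtain ⟨z, hz, hz'⟩ := h
        refine Or.inr ?_
        rw [← map_inv, ← hz']; simpa using hz)
    rw [List.length_map, h2, ← map_list_prod, h3] at this
    simpa using this

theorem closure_image {G' : Type*} [Group G'] (e : G ≃* G') (hS : Subgroup.closure S = ⊤) :
    Subgroup.closure (e '' S) = ⊤ := by
  have := (MonoidHom.map_closure e.toMonoidHom S)
  rw [hS, Subgroup.map_top_of_surjective _ e.surjective] at this
  exact this.symm

theorem hyp_iso {G' : Type*} [Group G'] (e : G ≃* G') (h : IsHypGroup G) : IsHypGroup G' := by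
  obtain ⟨S, ⟨hf, hS⟩, δ, hδ, hh⟩ := h
  have hS' := closure_image e hS
  refine ⟨e '' S, ⟨hf.image _, hS'⟩, δ, hδ, ?_⟩
  have key : ∀ g h : G', wordDist (e '' S) g h = wordDist S (e.symm g) (e.symm h) := by
    intro g h
    unfold wordDist
    rw [← wl_equiv e hS hS']
    simp
  intro o x y z
  have := hh (e.symm o) (e.symm x) (e.symm y) (e.symm z)
  simp only [gprod, key] at *
  exact this
end wl

section
variable {α σ : Type*} [DecidableEq α] [DecidableEq σ]
variable (ρ : FreeGroup σ →* MulAut (FreeGroup α))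

/-- standard generators -/
def stdS : Set (FreeGroup α ⋊[ρ] FreeGroup σ) :=
  Set.range (fun a => inl (of a)) ∪ Set.range (fun s => inr (of s))

theorem stdS_closure : Subgroup.closure (stdS ρ) = ⊤ := by
  rw [eq_top_iff]
  intro g _
  have h1 : ∀ x : FreeGroup α, (inl x : FreeGroup α ⋊[ρ] FreeGroup σ) ∈ Subgroup.closure (stdS ρ) := by
    intro x
    have : x ∈ (Subgroup.closure (stdS ρ)).comap inl := by
      have e : Subgroup.closure (Set.range of) ≤ (Subgroup.closure (stdS ρ)).comap (inl : FreeGroup α →* FreeGroup α ⋊[ρ] FreeGroup σ) := by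
        rw [Subgroup.closure_le]
        rintro _ ⟨a, rfl⟩
        exact Subgroup.subset_closure (Or.inl ⟨a, rfl⟩)
      apply e
      rw [FreeGroup.closure_range_of]; trivial
    exact this
  have h2 : ∀ x : FreeGroup σ, (inr x : FreeGroup α ⋊[ρ] FreeGroup σ) ∈ Subgroup.closure (stdS ρ) := by
    intro x
    have : x ∈ (Subgroup.closure (stdS ρ)).comap inr := by
      have e : Subgroup.closure (Set.range of) ≤ (Subgroup.closure (stdS ρ)).comap (inr : FreeGroup σ →* FreeGroup α ⋊[ρ] FreeGroup σ) := by
        rw [Subgroup.closure_le]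
        rintro _ ⟨a, rfl⟩
        exact Subgroup.subset_closure (Or.inr ⟨a, rfl⟩)
      apply e
      rw [FreeGroup.closure_range_of]; trivial
    exact this
  rw [← SemidirectProduct.inl_left_mul_inr_right g]
  exact Subgroup.mul_mem _ (h1 _) (h2 _)

theorem stdS_gen [Finite α] [Finite σ] : GenSet (stdS ρ) :=
  ⟨(Set.finite_range _).union (Set.finite_range _), stdS_closure ρ⟩

theorem adj_of_letter {g x : FreeGroup α ⋊[ρ] FreeGroup σ} (h : x ∈ stdS ρ ∨ x⁻¹ ∈ stdS ρ) :
    Adj ρ g (g * x) := by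
  rcases h with (⟨a, ha⟩ | ⟨a, ha⟩) | (⟨a, ha⟩ | ⟨a, ha⟩)
  · exact Or.inl ⟨of a, by simp, by rw [← ha]⟩
  · refine Or.inr ⟨(a, true), ?_⟩
    rw [← ha]; rfl
  · refine Or.inl ⟨(of a)⁻¹, by simp, ?_⟩
    rw [map_inv]
    simp only at ha
    rw [ha, inv_inv]
  · refine Or.inr ⟨(a, false), ?_⟩
    have e : ltr (a, false) = (of a)⁻¹ := rfl
    rw [e, map_inv]
    simp only at ha
    rw [ha, inv_inv]

theorem adj_of_nd {g g' : FreeGroup α ⋊[ρ] FreeGroup σ} (h : nd (stdS ρ) g g' ≤ 1) : Adj ρ g g' := by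
  have hS := stdS_closure ρ
  by_cases h0 : nd (stdS ρ) g g' = 0
  · have := ((nd_GM hS).zero _ _).1 h0
    subst this
    exact Or.inl ⟨1, by simp, by simp⟩
  · have h1 : wordLength (stdS ρ) (g⁻¹ * g') = 1 := by
      change nd _ _ _ = _; omega
    have := adj_of_letter ρ (g := g) (wl_one_form hS h1)
    rwa [mul_inv_cancel_left] at this

theorem nd_of_adj {g g' : FreeGroup α ⋊[ρ] FreeGroup σ} (h : Adj ρ g g') : nd (stdS ρ) g g' ≤ 1 := by
  unfold nd
  rcases h with ⟨x, hx, rfl⟩ | ⟨s, rfl⟩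
  · rw [inv_mul_cancel_left]
    rcases Nat.lt_or_ge x.norm 1 with h | h
    · have : x = 1 := FreeGroup.norm_eq_zero.1 (by omega)
      subst this
      rw [map_one, wl_one]; omega
    · obtain ⟨a, h | h⟩ := norm_one_form (u := x) (by omega)
      · exact wl_letter (Or.inl (Or.inl ⟨a, by simp [h]⟩))
      · exact wl_letter (Or.inr (Or.inl ⟨a, by simp [h]⟩))
  · rw [inv_mul_cancel_left]
    obtain ⟨a, b⟩ := s
    cases b
    · have e : ltr (a, false) = (of a)⁻¹ := rfl
      exact wl_letter (Or.inr (Or.inr ⟨a, by simp [e]⟩))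
    · exact wl_letter (Or.inl (Or.inr ⟨a, rfl⟩))

theorem hyp_of_FL [Finite α] [Finite σ] (h : FL ρ) : IsHypGroup (FreeGroup α ⋊[ρ] FreeGroup σ) := by
  obtain ⟨K, hK0, hK⟩ := area ρ h
  have hd := nd_GM (stdS_closure ρ)
  have : AR (nd (stdS ρ)) K := by
    intro h κ ε hε hh hκ l z hz hst
    exact hK h κ ε hε (fun g g' hg => hh g g' (nd_of_adj ρ hg)) (fun g g' hg => hκ g g' (nd_of_adj ρ hg))
      l z hz (fun i hi => adj_of_nd ρ (hst i hi))
  obtain ⟨D, hD⟩ := Th_all hd this hK0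
  exact ⟨stdS ρ, stdS_gen ρ, Th_hyp hd hD⟩
end
end FT

namespace FT

section
variable {X : Type*} {d : X → X → ℕ}

/-- real Gromov product of an integer metric -/
noncomputable def gp (d : X → X → ℕ) (o x y : X) : ℝ := gprod (fun x y => (d x y : ℝ)) o x y

theorem gp_def (o x y : X) : gp d o x y = ((d x o : ℝ) + d y o - d x y) / 2 := rfl

/-- four point condition -/
def H4 (d : X → X → ℕ) (δ : ℝ) : Prop :=
  ∀ o x y z : X, min (gp d o x y) (gp d o y z) ≤ gp d o x z + δ

theorem gp_comm (hd : GM d) (o x y : X) : gp d o x y = gp d o y x := by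
  rw [gp_def, gp_def, hd.comm x y]; ring

theorem gp_ge (hd : GM d) (o x y : X) : (d o x : ℝ) - d x y ≤ gp d o x y := by
  rw [gp_def]
  have h1 : (d x o : ℝ) ≤ d x y + d y o := by exact_mod_cast hd.tri x y o
  rw [hd.comm o x]
  linarith

theorem chain {δ : ℝ} (hδ : 0 ≤ δ) (h4 : H4 d δ) (p : X) (r : ℝ) : ∀ (N : ℕ) (x : ℕ → X) (l : ℕ),
    1 ≤ l → l ≤ 2 ^ N → (∀ i < l, r ≤ gp d p (x i) (x (i + 1))) →
    r ≤ gp d p (x 0) (x l) + δ * N := by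
  intro N
  induction N with
  | zero =>
    intro x l h1 h2 h
    have : l = 1 := by simp at h2; omega
    subst this
    simpa using h 0 (by omega)
  | succ N ih =>
    intro x l h1 h2 h
    push_cast
    by_cases hl : l ≤ 2 ^ N
    · have := ih x l h1 hl h
      linarith
    · have hp : 1 ≤ 2 ^ N := Nat.one_le_two_pow
      have a := ih x (2 ^ N) hp le_rfl (fun i hi => h i (by omega))
      have b := ih (fun i => x (2 ^ N + i)) (l - 2 ^ N) (by omega) (by rw [pow_succ] at h2; omega)
        (fun i hi => h (2 ^ N + i) (by omega))
      have e : 2 ^ N + (l - 2 ^ N) = l := by omega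
      simp only [e, add_zero] at b
      have c := h4 p (x 0) (x (2 ^ N)) (x l)
      have : r - δ * N ≤ min (gp d p (x 0) (x (2 ^ N))) (gp d p (x (2 ^ N)) (x l)) :=
        le_min (by linarith) (by linarith)
      linarith

/-- a coarse section over the integers -/
structure Sec (d : X → X → ℕ) (π : X → ℤ) (b M : ℕ) (γ : ℤ → X) : Prop where
  ht : ∀ k, -(M : ℤ) ≤ k → k ≤ M → π (γ k) = k
  st : ∀ k, -(M : ℤ) ≤ k → k < M → d (γ k) (γ (k + 1)) ≤ b

theorem Sec.len (hd : GM d) {π : X → ℤ} {b M : ℕ} {γ : ℤ → X} (h : Sec d π b M γ) (i : ℕ) : ∀ (j : ℤ),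
    -(M : ℤ) ≤ j → j + i ≤ M → d (γ j) (γ (j + i)) ≤ b * i := by
  induction i with
  | zero => intro j _ _; simp [hd.self]
  | succ i ih =>
    intro j h1 h2
    push_cast at h2
    have a := ih j h1 (by omega)
    have c := h.st (j + i) (by omega) (by omega)
    have := hd.tri (γ j) (γ (j + i)) (γ (j + i + 1))
    push_cast
    rw [← add_assoc, mul_add]
    omega

theorem Sec.len' (hd : GM d) {π : X → ℤ} {b M : ℕ} {γ : ℤ → X} (h : Sec d π b M γ) (j k : ℤ) 
    (hj : -(M : ℤ) ≤ j) (hj' : j ≤ M) (hk : -(M : ℤ) ≤ k) (hk' : k ≤ M) :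
    d (γ j) (γ k) ≤ b * (k - j).natAbs := by
  rcases le_total j k with hjk | hjk
  · have := h.len hd (k - j).natAbs j hj (by omega)
    have e : j + ((k - j).natAbs : ℤ) = k := by omega
    rwa [e] at this
  · have := h.len hd (k - j).natAbs k hk (by omega)
    have e : k + ((k - j).natAbs : ℤ) = j := by omega
    rw [e] at this
    rwa [hd.comm]

theorem sq_bound (n : ℕ) : n ^ 2 ≤ 4 * 2 ^ n := by
  induction n with
  | zero => simp
  | succ n ih =>
    rcases Nat.lt_or_ge n 3 with h | h
    · interval_cases n <;> norm_num
    · rw [pow_succ 2 n]; nlinarith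

theorem sec_mid (hd : GM d) {δ : ℝ} (hδ : 0 ≤ δ) (h4 : H4 d δ) {π : X → ℤ} {b M : ℕ} {γ : ℤ → X}
    (h : Sec d π b M γ) (p : X) (D : ℕ)
    (hp : ∀ k, -(M : ℤ) ≤ k → k ≤ M → D ≤ d p (γ k)) (N : ℕ) (j k : ℤ) 
    (hj : -(M : ℤ) ≤ j) (hj' : j ≤ M) (hk : -(M : ℤ) ≤ k) (hk' : k ≤ M)
    (hN : (k - j).natAbs ≤ 2 ^ N) : (D : ℝ) - b ≤ gp d p (γ j) (γ k) + δ * N := by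
  have main : ∀ j k : ℤ, -(M : ℤ) ≤ j → j ≤ k → k ≤ M → (k - j).natAbs ≤ 2 ^ N → 
      (D : ℝ) - b ≤ gp d p (γ j) (γ k) + δ * N := by
    intro j k hj hjk hk hN
    by_cases e : j = k
    · subst e
      have := hp j hj hk
      have a : (D : ℝ) ≤ d p (γ j) := by exact_mod_cast this
      have c := gp_ge hd p (γ j) (γ j)
      rw [hd.self] at c
      have : 0 ≤ δ * N := by positivity
      have : (0 : ℝ) ≤ b := by positivity
      push_cast at c
      linarith
    · have := chain hδ h4 p ((D : ℝ) - b) N (fun i => γ (j + i)) (k - j).natAbs (by omega) hN ?_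
      · have e : j + ((k - j).natAbs : ℤ) = k := by omega
        rw [e] at this
        simpa using this
      · intro i hi
        have a := hp (j + i) (by omega) (by omega)
        have c := h.st (j + i) (by omega) (by omega)
        have a' : (D : ℝ) ≤ d p (γ (j + i)) := by exact_mod_cast a
        have c' : (d (γ (j + i)) (γ (j + i + 1)) : ℝ) ≤ b := by exact_mod_cast c
        have := gp_ge hd p (γ (j + i)) (γ (j + i + 1))
        simp only [Nat.cast_add, Nat.cast_one, ← add_assoc]
        linarith
  rcases le_total j k with hjk | hjk
  · exact main j k hj hjk hk' hN
  · have := main k j hk hjk hj' (by omega)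
    rwa [gp_comm hd]

theorem morse (hd : GM d) {δ : ℝ} (hδ : 0 ≤ δ) (h4 : H4 d δ) {π : X → ℤ} (L b : ℕ)
    (hL : ∀ x y, (π y - π x).natAbs ≤ L * d x y) : ∃ D : ℕ, ∀ (M : ℕ) (γ : ℤ → X), Sec d π b M γ →
    ∀ p, Bt d (γ (-M)) p (γ M) → ∃ k : ℤ, -(M : ℤ) ≤ k ∧ k ≤ M ∧ d p (γ k) ≤ D := by
  set c : ℝ := 12 * L * δ + 6 * L * (b + 4 * δ) + 2 with hc
  have hc0 : 0 ≤ c := by positivity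
  obtain ⟨Ds, hDs⟩ := exists_nat_ge ((b : ℝ) + 2 * δ * (c + 1) + 2 * δ)
  refine ⟨Ds, fun M γ h => ?_⟩
  have ex : ∃ D : ℕ, ∀ p, Bt d (γ (-M)) p (γ M) → ∃ k : ℤ, -(M : ℤ) ≤ k ∧ k ≤ M ∧ d p (γ k) ≤ D := by
    refine ⟨d (γ (-M)) (γ M), fun p hp => ⟨M, by omega, le_rfl, ?_⟩⟩
    unfold Bt at hp; omega
  classical
  have hD := Nat.find_spec ex
  set D := Nat.find ex with hDdef
  suffices hle : D ≤ Ds by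
    intro p hp
    obtain ⟨k, h1, h2, h3⟩ := hD p hp
    exact ⟨k, h1, h2, h3.trans hle⟩
  by_cases hD0 : D = 0
  · omega
  have hmin := Nat.find_min ex (m := D - 1) (by omega)
  push Not at hmin
  obtain ⟨p, hp, hpk⟩ := hmin
  have hpk' : ∀ k, -(M : ℤ) ≤ k → k ≤ M → D ≤ d p (γ k) := fun k h1 h2 => by
    have := hpk k h1 h2; omega
  have tr := hd.tri
  have ends : ∀ e e', Bt d (γ e) p (γ e') → (e = -(M : ℤ) ∧ e' = M ∨ e = M ∧ e' = -(M : ℤ)) →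
      ∃ y, ∃ k : ℤ, Bt d (γ e) y p ∧ -(M : ℤ) ≤ k ∧ k ≤ M ∧ d y (γ k) ≤ D ∧ d y p ≤ 2 * D ∧
        (D : ℝ) ≤ gp d p y (γ k) := by
    intro e e' hep hee
    by_cases hs : d (γ e) p ≤ 2 * D
    · refine ⟨γ e, e, bt_left hd _ _, by omega, by omega, by simp [hd.self], hs, ?_⟩
      have a := hpk' e (by omega) (by omega)
      have a' : (D : ℝ) ≤ d p (γ e) := by exact_mod_cast a
      have := gp_ge hd p (γ e) (γ e)
      rw [hd.self] at this
      push_cast at this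
      linarith
    · obtain ⟨y, y1, y2⟩ := hd.geod (γ e) p (d (γ e) p - 2 * D) (by omega)
      have hy : Bt d (γ e) y p := by unfold Bt; omega
      have hye := bt_trans hd hep hy
      have hy2 : Bt d (γ (-M)) y (γ M) := by
        rcases hee with ⟨rfl, rfl⟩ | ⟨rfl, rfl⟩
        · exact hye
        · exact bt_symm hd hye
      obtain ⟨k, k1, k2, k3⟩ := hD y hy2
      refine ⟨y, k, hy, k1, k2, k3, by omega, ?_⟩
      have a := hpk' k k1 k2
      have a' : (D : ℝ) ≤ d p (γ k) := by exact_mod_cast a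
      have k3' : (d y (γ k) : ℝ) ≤ D := by exact_mod_cast k3
      have y3 : d y p = 2 * D := by omega
      have y3' : (d y p : ℝ) = 2 * D := by exact_mod_cast y3
      rw [gp_def, hd.comm (γ k) p]
      linarith
  obtain ⟨y, j, hy, j1, j2, j3, j4, j5⟩ := ends (-M) M hp (Or.inl ⟨rfl, rfl⟩)
  obtain ⟨z, k, hz, k1, k2, k3, k4, k5⟩ := ends M (-M) (bt_symm hd hp) (Or.inr ⟨rfl, rfl⟩)
  have hz2 : Bt d p z (γ M) := bt_symm hd hz
  have hypz : Bt d y p z := by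
    unfold Bt at *
    have b1 := tr (γ (-M)) y z
    have b2 := tr (γ (-M)) z (γ M)
    have b3 := tr y p z
    omega
  have gyz : gp d p y z = 0 := by
    unfold Bt at hypz
    have : (d y p : ℝ) + d p z = d y z := by exact_mod_cast hypz
    rw [gp_def, hd.comm z p]; linarith
  have hjk : (k - j).natAbs ≤ L * (6 * D) := by
    have a1 := hL (γ j) (γ k)
    rw [h.ht k k1 k2, h.ht j j1 j2] at a1
    refine a1.trans (Nat.mul_le_mul_left _ ?_)
    have b1 := tr (γ j) y (γ k)
    have b2 := tr y p (γ k)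
    have b3 := tr p z (γ k)
    rw [hd.comm (γ j) y, hd.comm p z] at *
    omega
  set s := Nat.sqrt (L * (6 * D)) with hs
  have hs1 : s * s ≤ L * (6 * D) := Nat.sqrt_le _
  have hs2 : L * (6 * D) < (s + 1) * (s + 1) := Nat.lt_succ_sqrt _
  have hN : (k - j).natAbs ≤ 2 ^ (2 * (s + 1)) := by
    have := sq_bound (2 * (s + 1))
    nlinarith
  have m1 := sec_mid hd hδ h4 h p D hpk' _ j k j1 j2 k1 k2 hN
  have q1 := h4 p y (γ j) (γ k)
  have q2 := h4 p y (γ k) z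
  rw [gyz] at q2
  rw [gp_comm hd p (γ k) z] at q2
  have fin : (D : ℝ) ≤ b + δ * (2 * (s + 1)) + 2 * δ := by
    push_cast at m1
    have hb : (0 : ℝ) ≤ b := by positivity
    have hs0 : 0 ≤ δ * (2 * ((s : ℝ) + 1)) := by positivity
    have r1 : (D : ℝ) - b - δ * (2 * (s + 1)) ≤ min (gp d p y (γ j)) (gp d p (γ j) (γ k)) :=
      le_min (by linarith) (by linarith)
    have r2 : (D : ℝ) - b - δ * (2 * (s + 1)) - δ ≤ min (gp d p y (γ k)) (gp d p z (γ k)) :=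
      le_min (by linarith) (by linarith)
    linarith
  have hsc : (s : ℝ) ≤ c := by
    rcases Nat.eq_zero_or_pos s with h0 | h0
    · rw [h0]; exact_mod_cast hc0
    · have e1 : (s : ℝ) * s ≤ L * (6 * D) := by exact_mod_cast hs1
      have hL0 : (0 : ℝ) ≤ L := by positivity
      have e2 : (L : ℝ) * (6 * D) ≤ L * (6 * (b + δ * (2 * (s + 1)) + 2 * δ)) := by gcongr
      have e3 : (1 : ℝ) ≤ s := by exact_mod_cast h0
      have e4 : (s : ℝ) * s ≤ 12 * L * δ * s + (6 * L * (b + 4 * δ)) * s := by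
        have : (0 : ℝ) ≤ 6 * L * (b + 4 * δ) := by positivity
        nlinarith
      have : (s : ℝ) ≤ 12 * L * δ + 6 * L * (b + 4 * δ) := by
        by_contra hcon
        push Not at hcon
        nlinarith
      rw [hc]; linarith
  have : (D : ℝ) ≤ Ds := by
    have : δ * (2 * (s + 1)) ≤ 2 * δ * (c + 1) := by nlinarith
    linarith
  exact_mod_cast this

theorem gp_geo (hd : GM d) {δ : ℝ} (hδ : 0 ≤ δ) (h4 : H4 d δ) (p x y : X) :
    ∃ q, Bt d x q y ∧ (d p q : ℝ) ≤ gp d p x y + 2 * δ + 1 := by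
  have t1 := hd.tri p x y
  have t2 := hd.tri x y p
  have t3 := hd.tri x p y
  rw [hd.comm p x] at t1
  rw [hd.comm y p] at t2
  obtain ⟨q, q1, q2⟩ := hd.geod x y ((d x p + d x y - d p y) / 2) (by omega)
  refine ⟨q, by unfold Bt; omega, ?_⟩
  set s := (d x p + d x y - d p y) / 2 with hs
  have s1 : 2 * s ≤ d x p + d x y - d p y := Nat.mul_div_le _ _
  have s2 : d x p + d x y - d p y ≤ 2 * s + 1 := by omega
  have r1 : (2 : ℝ) * s + d p y ≤ d x p + d x y := by
    have : 2 * s + d p y ≤ d x p + d x y := by omega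
    exact_mod_cast this
  have r2 : (d x p : ℝ) + d x y ≤ 2 * s + 1 + d p y := by
    have : d x p + d x y ≤ 2 * s + 1 + d p y := by omega
    exact_mod_cast this
  have e1 : (d x q : ℝ) = s := by exact_mod_cast q1
  have e2 : (d q y : ℝ) = d x y - s := by
    have : d q y + s = d x y := by omega
    have : (d q y : ℝ) + s = d x y := by exact_mod_cast this
    linarith
  have := h4 p x q y
  rw [gp_def, gp_def, gp_def, hd.comm y p, hd.comm q p, e1, e2] at this
  rw [gp_def, hd.comm y p]
  rcases min_le_iff.1 this with h | h <;> linarith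

theorem core (hd : GM d) {δ : ℝ} (hδ : 0 ≤ δ) (h4 : H4 d δ) {π : X → ℤ} (L b : ℕ) (hL0 : 1 ≤ L)
    (hL : ∀ x y, (π y - π x).natAbs ≤ L * d x y) : ∃ A : ℕ, ∀ E : ℕ, ∃ M0 : ℕ, ∀ M ≥ M0, 
    ∀ (γ γ' : ℤ → X), Sec d π b M γ → Sec d π b M γ' → d (γ M) (γ' M) ≤ E → d (γ (-M)) (γ' (-M)) ≤ E →
    d (γ 0) (γ' 0) ≤ A := by
  obtain ⟨D, hD⟩ := morse hd hδ h4 L b hL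
  have tr := hd.tri
  -- points of the section are close to the geodesic
  have near : ∀ (M : ℕ) (γ : ℤ → X), Sec d π b M γ → ∃ p, Bt d (γ (-M)) p (γ M) ∧
      d (γ 0) p ≤ D + b * (L * (2 * D + 1)) := by
    intro M γ h
    obtain ⟨w, w0, w1, wd⟩ := geo_fn hd (γ (-M)) (γ M)
    have hw : ∀ i ≤ d (γ (-M)) (γ M), Bt d (γ (-M)) (w i) (γ M) := by
      intro i hi
      have a := wd 0 i (by omega) hi
      have c := wd i _ hi le_rfl
      rw [w0] at a; rw [w1] at c
      unfold Bt; omega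
    have ex : ∃ i, i ≤ d (γ (-M)) (γ M) ∧ ∃ k : ℤ, 0 ≤ k ∧ k ≤ M ∧ d (w i) (γ k) ≤ D :=
      ⟨_, le_rfl, M, by omega, le_rfl, by simp [w1, hd.self]⟩
    classical
    obtain ⟨hi, k, hk, hk', hkd⟩ := Nat.find_spec ex
    have hmin := fun j => Nat.find_min ex (m := j)
    set i := Nat.find ex with hidef
    have hk2 : k.natAbs ≤ L * (2 * D + 1) := by
      by_cases h0 : i = 0
      · rw [h0, w0] at hkd
        have := hL (γ (-M)) (γ k)
        rw [h.ht _ (by omega) (by omega), h.ht _ (by omega) (by omega)] at this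
        have := this.trans (Nat.mul_le_mul_left L (hkd.trans (by omega : D ≤ 2 * D + 1)))
        omega
      · obtain ⟨k', k1, k2, k3⟩ := hD M γ h (w (i - 1)) (hw _ (by omega))
        have hm := hmin (i - 1) (by omega)
        push Not at hm
        have hneg : k' < 0 := by
          by_contra hcon
          have := hm (by omega) k' (by omega) k2
          omega
        have e := wd (i - 1) i (by omega) hi
        have a1 := tr (γ k') (w (i - 1)) (γ k)
        have a2 := tr (w (i - 1)) (w i) (γ k)
        rw [hd.comm (γ k') (w (i - 1))] at a1
        have := hL (γ k') (γ k)
        rw [h.ht _ (by omega) (by omega), h.ht _ (by omega) (by omega)] at this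
        have := this.trans (Nat.mul_le_mul_left L (by omega : d (γ k') (γ k) ≤ 2 * D + 1))
        omega
    refine ⟨w i, hw i hi, ?_⟩
    have a1 := tr (γ 0) (γ k) (w i)
    have a2 := h.len' hd 0 k (by omega) (by omega) (by omega) (by omega)
    have a3 : b * (k - 0).natAbs ≤ b * (L * (2 * D + 1)) := Nat.mul_le_mul_left _ (by
      rw [sub_zero]; exact hk2)
    rw [hd.comm (γ k)] at a1
    omega
  obtain ⟨Q, hQ⟩ := exists_nat_ge (4 * δ + 1)
  set D1 := D + b * (L * (2 * D + 1)) with hD1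
  set D2 := D1 + Q + D with hD2
  refine ⟨D2 + b * (L * D2), fun E => ⟨L * (D1 + E + Q), fun M hM γ γ' h h' hE1 hE2 => ?_⟩⟩
  obtain ⟨p, hp, hp'⟩ := near M γ h
  have far : ∀ k : ℤ, k.natAbs = M → -(M : ℤ) ≤ k → k ≤ M → E + Q ≤ d p (γ k) := by
    intro k hk k1 k2
    have := hL (γ 0) (γ k)
    rw [h.ht _ (by omega) (by omega), h.ht _ (by omega) (by omega)] at this
    have a : L * (D1 + E + Q) ≤ L * d (γ 0) (γ k) := by
      rw [sub_zero] at this; omega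
    have := Nat.le_of_mul_le_mul_left a (by omega)
    have := tr (γ 0) p (γ k)
    omega
  have g0 : gp d p (γ (-M)) (γ M) = 0 := by
    unfold Bt at hp
    have : (d (γ (-M)) p : ℝ) + d p (γ M) = d (γ (-M)) (γ M) := by exact_mod_cast hp
    rw [gp_def, hd.comm (γ M) p]; linarith
  have f1 := far M (by omega) (by omega) (by omega)
  have f2 := far (-M) (by omega) (by omega) (by omega)
  have f1' : (E : ℝ) + Q ≤ d p (γ M) := by exact_mod_cast f1
  have f2' : (E : ℝ) + Q ≤ d p (γ (-M)) := by exact_mod_cast f2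
  have hE1' : (d (γ M) (γ' M) : ℝ) ≤ E := by exact_mod_cast hE1
  have hE2' : (d (γ (-M)) (γ' (-M)) : ℝ) ≤ E := by exact_mod_cast hE2
  have g1 := gp_ge hd p (γ M) (γ' M)
  have g2 := gp_ge hd p (γ (-M)) (γ' (-M))
  have k1 := h4 p (γ (-M)) (γ' (-M)) (γ' M)
  have k2 := h4 p (γ (-M)) (γ' M) (γ M)
  rw [g0, gp_comm hd p (γ' M)] at k2
  have g3 : gp d p (γ' (-M)) (γ' M) ≤ 2 * δ := by
    rcases min_le_iff.1 k2 with a | a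
    · rcases min_le_iff.1 k1 with a' | a' <;> linarith
    · linarith
  obtain ⟨q, hq, hq'⟩ := gp_geo hd hδ h4 p (γ' (-M)) (γ' M)
  have hq2 : d p q ≤ Q := by
    have : (d p q : ℝ) ≤ Q := by linarith
    exact_mod_cast this
  obtain ⟨k, c1, c2, c3⟩ := hD M γ' h' q hq
  have e1 := tr (γ 0) p (γ' k)
  have e2 := tr p q (γ' k)
  have e3 : d (γ 0) (γ' k) ≤ D2 := by omega
  have e4 := hL (γ 0) (γ' k)
  rw [h.ht _ (by omega) (by omega), h'.ht _ (by omega) (by omega)] at e4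
  have e5 := h'.len' hd 0 k (by omega) (by omega) c1 c2
  have e6 : b * (k - 0).natAbs ≤ b * (L * D2) :=
    Nat.mul_le_mul_left _ (e4.trans (Nat.mul_le_mul_left _ e3))
  have e7 := tr (γ 0) (γ' k) (γ' 0)
  rw [hd.comm (γ' k)] at e7
  omega
end
end FT

namespace FT
open FreeGroup (of mk mk_toWord norm_one norm_mul_le norm_inv_eq norm_of)
open SemidirectProduct (inl inr)

section
variable {α : Type*} [DecidableEq α]

/-- flaring of an automorphism -/
def Flare (φ : MulAut (FreeGroup α)) : Prop := ∀ Λ : ℕ, ∃ k0 : ℕ, ∀ k ≥ k0, ∃ C : ℕ,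
  ∀ w : FreeGroup α, Λ * w.norm ≤ ((φ ^ k) w).norm + ((φ ^ k)⁻¹ w).norm + C

theorem ball_finite {G : Type*} [Group G] {S : Set G} (hS : GenSet S) (r : ℕ) :
    {g : G | wordLength S g ≤ r}.Finite := by
  induction r with
  | zero =>
    refine (Set.finite_singleton (1 : G)).subset ?_
    intro g hg
    exact (wl_zero hS.2 g).1 (Nat.le_zero.1 hg)
  | succ r ih =>
    have hT : (S ∪ S⁻¹ ∪ {1} : Set G).Finite := (hS.1.union hS.1.inv).union (Set.finite_singleton _)
    refine (hT.mul ih).subset ?_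
    intro g hg
    have hg : wordLength S g ≤ r + 1 := hg
    rcases Nat.eq_zero_or_pos (wordLength S g) with h | h
    · refine Set.mem_mul.2 ⟨1, by simp, g, ?_, by simp⟩
      change wordLength S g ≤ r; omega
    · obtain ⟨a, b, h1, h2, h3⟩ := wl_split hS.2 g 1 h
      refine Set.mem_mul.2 ⟨a, ?_, b, ?_, h1.symm⟩
      · rcases wl_one_form hS.2 h2 with h | h
        · exact Or.inl (Or.inl h)
        · exact Or.inl (Or.inr h)
      · change wordLength S b ≤ r; omega

/-- mapping torus -/
abbrev MT {α : Type*} (φ : MulAut (FreeGroup α)) := FreeGroup α ⋊[zpowersHom (MulAut (FreeGroup α)) φ] Multiplicative ℤ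

theorem coreF [Finite α] (φ : MulAut (FreeGroup α))
    (h : IsHypGroup (FreeGroup α ⋊[zpowersHom (MulAut (FreeGroup α)) φ] Multiplicative ℤ)) (B : ℕ) :
    ∃ A : ℕ, ∀ E : ℕ, ∃ M0 : ℕ, ∀ M ≥ M0, ∀ u u' : ℤ → FreeGroup α,
      (∀ k, -(M : ℤ) ≤ k → k < M → fd (φ (u k)) (u (k + 1)) ≤ B) →
      (∀ k, -(M : ℤ) ≤ k → k < M → fd (φ (u' k)) (u' (k + 1)) ≤ B) →
      fd (u M) (u' M) ≤ E → fd (u (-M)) (u' (-M)) ≤ E → fd (u 0) (u' 0) ≤ A := by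
  obtain ⟨S, hS, δ, hδ, h4⟩ := h
  have hd := nd_GM hS.2
  have h4' : H4 (nd S) δ := h4
  -- Lipschitz constants
  let π : MT φ → ℤ := fun g => - Multiplicative.toAdd g.right
  obtain ⟨L, hL⟩ : ∃ L : ℕ, ∀ s ∈ S, (Multiplicative.toAdd s.right).natAbs ≤ L := by
    obtain ⟨L, hL⟩ := (hS.1.image fun s : MT φ => (Multiplicative.toAdd s.right).natAbs).bddAbove
    exact ⟨L, fun s hs => hL ⟨s, hs, rfl⟩⟩
  have hπ : ∀ x y, (π y - π x).natAbs ≤ (L + 1) * nd S x y := by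
    have key : ∀ g : MT φ, (((Multiplicative.toAdd g.right).natAbs : ℕ) : ℝ) ≤ L * wordLength S g := by
      refine wl_lip hS.2 (fun g : MT φ => (((Multiplicative.toAdd g.right).natAbs : ℕ) : ℝ)) L ?_ ?_ ?_
      · simp
      · intro g h
        have := Int.natAbs_add_le (Multiplicative.toAdd g.right) (Multiplicative.toAdd h.right)
        simp only [SemidirectProduct.mul_right, toAdd_mul]
        exact_mod_cast this
      · intro s hs
        have := hL s hs
        simp only [SemidirectProduct.inv_right, toAdd_inv, Int.natAbs_neg]
        exact ⟨by exact_mod_cast this, by exact_mod_cast this⟩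
    intro x y
    have k := key (x⁻¹ * y)
    have k' : (Multiplicative.toAdd (x⁻¹ * y).right).natAbs ≤ L * nd S x y := by exact_mod_cast k
    simp only [SemidirectProduct.mul_right, SemidirectProduct.inv_right, toAdd_mul, toAdd_inv] at k'
    simp only [π]
    rw [add_mul]
    omega
  obtain ⟨c1, hc1⟩ : ∃ c : ℕ, ∀ x : FreeGroup α, wordLength S (inl x : MT φ) ≤ c * x.norm := by
    cases nonempty_fintype α
    refine ⟨∑ a, wordLength S (inl (of a) : MT φ), fun x => ?_⟩
    induction x using ind_letter with
    | h1 => simp [wl_one]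
    | hs u v hu huv ih =>
      rw [_root_.map_mul, huv, mul_add]
      refine (wl_mul hS.2 _ _).trans (add_le_add ?_ ih)
      obtain ⟨a, ha⟩ := norm_one_form hu
      have e : wordLength S (inl u : MT φ) = wordLength S (inl (of a) : MT φ) := by
        rcases ha with rfl | rfl
        · rfl
        · rw [_root_.map_inv, wl_inv hS.2]
      rw [e, mul_one]
      exact Finset.single_le_sum (f := fun a => wordLength S (inl (of a) : MT φ)) (fun _ _ => Nat.zero_le _) (Finset.mem_univ a)
  let t : MT φ := inr (Multiplicative.ofAdd (-1))
  set b := wordLength S t + c1 * B with hb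
  obtain ⟨A, hA⟩ := core hd hδ h4' (L + 1) b (by omega) hπ
  obtain ⟨A', hA'⟩ : ∃ A' : ℕ, ∀ g : MT φ, wordLength S g ≤ A → g.left.norm ≤ A' := by
    obtain ⟨A', hA'⟩ := ((ball_finite hS A).image fun g : MT φ => g.left.norm).bddAbove
    exact ⟨A', fun g hg => hA' ⟨g, hg, rfl⟩⟩
  refine ⟨A', fun E => ?_⟩
  obtain ⟨M0, hM0⟩ := hA (c1 * E)
  refine ⟨M0, fun M hM u u' hu hu' hE hE' => ?_⟩
  let γ : (ℤ → FreeGroup α) → ℤ → MT φ := fun u k => inr (Multiplicative.ofAdd (-k)) * inl (u k)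
  have sec : ∀ u : ℤ → FreeGroup α, (∀ k, -(M : ℤ) ≤ k → k < M → fd (φ (u k)) (u (k + 1)) ≤ B) →
      Sec (nd S) π b M (γ u) := by
    intro u hu
    refine ⟨fun k _ _ => by simp [π, γ], fun k h1 h2 => ?_⟩
    have e : (γ u k)⁻¹ * γ u (k + 1) = t * inl ((φ (u k))⁻¹ * u (k + 1)) := by
      simp only [γ, t]
      ext
      · simp [zpowersHom_apply]
        rw [← MulAut.mul_apply, ← zpow_add, show k + (-1 + -k) = -1 by ring, zpow_neg_one]
        rfl
      · simp [zpowersHom_apply]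
    unfold nd
    rw [e]
    refine (wl_mul hS.2 _ _).trans (Nat.add_le_add_left ((hc1 _).trans ?_) _)
    exact Nat.mul_le_mul_left _ (hu k h1 h2)
  have diff : ∀ k, (γ u k)⁻¹ * γ u' k = inl ((u k)⁻¹ * u' k) := by
    intro k
    simp only [γ]
    rw [_root_.map_mul, _root_.map_inv]; group
  have fin := hM0 M hM (γ u) (γ u') (sec u hu) (sec u' hu') ?_ ?_
  · unfold nd at fin
    rw [diff] at fin
    exact hA' _ fin
  · unfold nd
    rw [diff]
    exact (hc1 _).trans (Nat.mul_le_mul_left _ hE)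
  · unfold nd
    rw [diff]
    exact (hc1 _).trans (Nat.mul_le_mul_left _ hE')

/-- prefixes -/
def pre (v : FreeGroup α) (x : ℕ) : FreeGroup α := mk (v.toWord.take x)

theorem pre_spec (v : FreeGroup α) (x : ℕ) (hx : x ≤ v.norm) :
    fd 1 (pre v x) = x ∧ fd (pre v x) v = v.norm - x := by
  have hr : FreeGroup.IsReduced v.toWord := FreeGroup.isReduced_toWord
  have h1 : FreeGroup.IsReduced (v.toWord.take x) := List.IsChain.take hr _
  have h2 : FreeGroup.IsReduced (v.toWord.drop x) := List.IsChain.drop hr _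
  have e : v = pre v x * mk (v.toWord.drop x) := by
    unfold pre
    rw [FreeGroup.mul_mk, List.take_append_drop, mk_toWord]
  constructor
  · rw [fd_one]; unfold pre
    rw [norm_mk_of_red h1, List.length_take]
    exact min_eq_left hx
  · have : (pre v x)⁻¹ * v = mk (v.toWord.drop x) := by
      conv_lhs => rw [e]
      have : pre (pre v x * mk (v.toWord.drop x)) x = pre v x := by rw [← e]
      rw [this]; group
    unfold fd
    rw [this, norm_mk_of_red h2, List.length_drop]; rfl

theorem pre_zero (v : FreeGroup α) : pre v 0 = 1 := by
  have := (pre_spec v 0 (by omega)).1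
  exact (fd_zero.1 this).symm

theorem pre_norm (v : FreeGroup α) : pre v v.norm = v := by
  have := (pre_spec v _ le_rfl).2
  rw [Nat.sub_self] at this
  exact fd_zero.1 this

theorem pre_fd (v : FreeGroup α) {x y : ℕ} (hxy : x ≤ y) (hy : y ≤ v.norm) :
    fd (pre v x) (pre v y) = y - x := by
  have e : pre (pre v y) x = pre v x := by
    have hr : FreeGroup.IsReduced v.toWord := FreeGroup.isReduced_toWord
    have h1 : FreeGroup.IsReduced (v.toWord.take y) := List.IsChain.take hr _
    unfold pre
    rw [FreeGroup.toWord_mk, FreeGroup.isReduced_iff_reduce_eq.1 h1, List.take_take, min_eq_left hxy]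
  have hn : (pre v y).norm = y := by rw [← fd_one]; exact (pre_spec v y hy).1
  have := (pre_spec (pre v y) x (by omega)).2
  rw [e, hn] at this
  exact this

theorem posmap (e : MulAut (FreeGroup α)) (B : ℕ) 
    (hB : ∀ x y : FreeGroup α, (x * y).norm = x.norm + y.norm → (e x).norm + (e y).norm ≤ (e (x * y)).norm + B)
    (v : FreeGroup α) : ∃ m : ℕ → ℕ, Monotone m ∧ m 0 = 0 ∧ m v.norm = (e v).norm ∧
      ∀ x ≤ v.norm, fd (e (pre v x)) (pre (e v) (m x)) ≤ 2 * B := by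
  let f : ℕ → ℕ := fun x => min (e (pre v x)).norm (e v).norm
  let m : ℕ → ℕ := fun x => (Finset.range (x + 1)).sup f
  have hle : ∀ x, m x ≤ (e v).norm := fun x => Finset.sup_le fun i _ => min_le_right _ _
  have hge : ∀ x, f x ≤ m x := fun x => Finset.le_sup (f := f) (Finset.mem_range.2 (by omega))
  -- additive splitting
  have add : ∀ x y, x ≤ y → y ≤ v.norm →
      (e (pre v x)).norm + fd (e (pre v x)) (e (pre v y)) ≤ (e (pre v y)).norm + B := by
    intro x y hxy hy
    have := hB (pre v x) ((pre v x)⁻¹ * pre v y) (by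
      rw [mul_inv_cancel_left]
      have a := pre_fd v hxy hy
      have b := (pre_spec v x (by omega)).1
      have c := (pre_spec v y hy).1
      rw [fd_one] at b c
      unfold fd at a
      omega)
    rw [mul_inv_cancel_left] at this
    unfold fd
    rwa [_root_.map_mul, _root_.map_inv] at this
  refine ⟨m, ?_, ?_, ?_, ?_⟩
  · intro x y hxy
    exact Finset.sup_mono (Finset.range_mono (by omega))
  · simp [m, f, pre_zero]
  · apply le_antisymm (hle _)
    have := hge v.norm
    simp only [f, pre_norm, min_self] at this
    exact this
  · intro x hx
    have up : m x ≤ (e (pre v x)).norm + B := by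
      refine Finset.sup_le fun i hi => (min_le_left _ _).trans ?_
      have := add i x (by have := Finset.mem_range.1 hi; omega) hx
      omega
    have lo := hge x
    have ad := add x v.norm hx le_rfl
    rw [pre_norm] at ad
    have ps := pre_spec (e v) (m x) (hle x)
    have four := fd_four (pre (e v) (m x)) 1 (e (pre v x)) (e v)
    -- fd P y + fd x z ≤ max ...
    rw [fd_comm (pre (e v) (m x)) 1, ps.1, ps.2, fd_one, fd_one, fd_comm (e (pre v x))] at four
    have hm := hle x
    simp only [f] at lo
    rw [fd_comm (e (pre v x)) (pre (e v) (m x))]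
    rw [fd_comm (e v)] at four
    omega

theorem seqpos (e : MulAut (FreeGroup α)) (B : ℕ) 
    (hB : ∀ x y : FreeGroup α, (x * y).norm = x.norm + y.norm → (e x).norm + (e y).norm ≤ (e (x * y)).norm + B)
    (w : FreeGroup α) : ∃ P : ℕ → ℕ → ℕ, (∀ x, P 0 x = x) ∧ ∀ k, Monotone (P k) ∧ P k 0 = 0 ∧
      P k w.norm = ((e ^ k) w).norm ∧ ∀ x ≤ w.norm,
        fd (e (pre ((e ^ k) w) (P k x))) (pre ((e ^ (k + 1)) w) (P (k + 1) x)) ≤ 2 * B := by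
  choose m m1 m2 m3 m4 using posmap e B hB
  let P : ℕ → ℕ → ℕ := fun k => Nat.rec (fun x => x) (fun k f x => m ((e ^ k) w) (f x)) k
  have hP : ∀ k x, P (k + 1) x = m ((e ^ k) w) (P k x) := fun k x => rfl
  have es : ∀ k, (e ^ (k + 1)) w = e ((e ^ k) w) := fun k => by rw [pow_succ']; rfl
  have key : ∀ k, Monotone (P k) ∧ P k 0 = 0 ∧ P k w.norm = ((e ^ k) w).norm := by
    intro k
    induction k with
    | zero => exact ⟨fun _ _ h => h, rfl, rfl⟩
    | succ k ih =>
      refine ⟨fun x y h => ?_, ?_, ?_⟩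
      · rw [hP, hP]; exact m1 _ (ih.1 h)
      · rw [hP, ih.2.1, m2]
      · rw [hP, ih.2.2, m3, es]
  refine ⟨P, fun x => rfl, fun k => ⟨(key k).1, (key k).2.1, (key k).2.2, fun x hx => ?_⟩⟩
  rw [hP, es]
  apply m4
  rw [← (key k).2.2]
  exact (key k).1 hx

theorem flare_of_hyp [Finite α] (φ : MulAut (FreeGroup α))
    (h : IsHypGroup (FreeGroup α ⋊[zpowersHom (MulAut (FreeGroup α)) φ] Multiplicative ℤ)) :
    Flare φ := by
  obtain ⟨B1, hB1⟩ := bcc φ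
  obtain ⟨B2, hB2⟩ := bcc φ⁻¹
  obtain ⟨L, hL1, hL⟩ := exists_lip (φ : FreeGroup α ≃* FreeGroup α).toMonoidHom
  obtain ⟨A, hA⟩ := coreF φ h (2 * B1 + L * (2 * B2))
  intro Λ
  obtain ⟨M0, hM0⟩ := hA (Λ * (A + 1))
  refine ⟨M0, fun M hM => ⟨Λ * (A + 1), fun w => ?_⟩⟩
  obtain ⟨P, P0, hP⟩ := seqpos φ B1 hB1 w
  obtain ⟨P', P0', hP'⟩ := seqpos φ⁻¹ B2 hB2 w
  let u : ℕ → ℤ → FreeGroup α := fun x k => if 0 ≤ k then pre ((φ ^ k.natAbs) w) (P k.natAbs x)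
    else pre ((φ⁻¹ ^ k.natAbs) w) (P' k.natAbs x)
  have un : ∀ x (k : ℕ), u x (-k) = pre ((φ⁻¹ ^ k) w) (P' k x) := by
    intro x k
    rcases Nat.eq_zero_or_pos k with rfl | hk
    · simp [u, P0, P0']
    · have : ¬ (0 ≤ -(k : ℤ)) := by omega
      simp [u, this]
      intro h; omega
  have up : ∀ x (k : ℕ), u x k = pre ((φ ^ k) w) (P k x) := by
    intro x k; simp [u]
  have hu : ∀ x ≤ w.norm, ∀ k, -(M : ℤ) ≤ k → k < M →
      fd (φ (u x k)) (u x (k + 1)) ≤ 2 * B1 + L * (2 * B2) := by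
    intro x hx k _ _
    rcases le_or_gt 0 k with hk | hk
    · obtain ⟨j, rfl⟩ := Int.eq_ofNat_of_zero_le hk
      have e : ((j : ℤ) + 1) = ((j + 1 : ℕ) : ℤ) := by push_cast; rfl
      rw [e, up, up]
      have := (hP j).2.2.2 x hx
      omega
    · obtain ⟨j, rfl⟩ : ∃ j : ℕ, k = -((j + 1 : ℕ) : ℤ) := ⟨(-k).natAbs - 1, by omega⟩
      have e : -((j + 1 : ℕ) : ℤ) + 1 = -(j : ℤ) := by push_cast; ring
      rw [e, un, un]
      have a := (hP' j).2.2.2 x hx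
      set p := pre ((φ⁻¹ ^ (j + 1)) w) (P' (j + 1) x)
      set q := pre ((φ⁻¹ ^ j) w) (P' j x)
      have b := lip_fd hL p (φ⁻¹ q)
      have e2 : (φ : FreeGroup α ≃* FreeGroup α).toMonoidHom (φ⁻¹ q) = q := by
        change φ (φ⁻¹ q) = q
        simp
      rw [e2] at b
      have e3 : (φ : FreeGroup α ≃* FreeGroup α).toMonoidHom p = φ p := rfl
      rw [e3, fd_comm p] at b
      have := Nat.mul_le_mul_left L a
      omega
  have chunk : ∀ x, x + (A + 1) ≤ w.norm →
      Λ * (A + 1) + P M x + P' M x ≤ P M (x + (A + 1)) + P' M (x + (A + 1)) := by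
    intro x hx
    have mo := (hP M).1 (by omega : x ≤ x + (A + 1))
    have mo' := (hP' M).1 (by omega : x ≤ x + (A + 1))
    have mt := (hP M).1 hx
    have mt' := (hP' M).1 hx
    rw [(hP M).2.2.1] at mt
    rw [(hP' M).2.2.1] at mt'
    by_contra hcon
    have := hM0 M hM (u x) (u (x + (A + 1))) (hu x (by omega)) (hu _ hx)
      (by rw [up, up, pre_fd _ mo mt]; omega) (by rw [un, un, pre_fd _ mo' mt']; omega)
    have e0 := up x 0
    have e1 := up (x + (A + 1)) 0
    simp only [P0, Nat.cast_zero, pow_zero, MulAut.one_apply] at e0 e1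
    rw [e0, e1, pre_fd _ (by omega) hx] at this
    omega
  have tot : ∀ i, i * (A + 1) ≤ w.norm → i * (Λ * (A + 1)) ≤ P M (i * (A + 1)) + P' M (i * (A + 1)) := by
    intro i
    induction i with
    | zero => intro _; simp
    | succ i ih =>
      intro hi
      rw [Nat.succ_mul] at hi
      have := ih (by omega)
      have := chunk _ hi
      rw [Nat.succ_mul, Nat.succ_mul]
      omega
  have t := tot (w.norm / (A + 1)) (Nat.div_mul_le_self _ _)
  have mt := (hP M).1 (Nat.div_mul_le_self w.norm (A + 1))
  have mt' := (hP' M).1 (Nat.div_mul_le_self w.norm (A + 1))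
  rw [(hP M).2.2.1] at mt
  rw [(hP' M).2.2.1] at mt'
  have e : (φ ^ M)⁻¹ = φ⁻¹ ^ M := by rw [inv_pow]
  rw [e]
  have dm := Nat.div_add_mod w.norm (A + 1)
  have ml := Nat.mod_lt w.norm (by omega : 0 < A + 1)
  set q := w.norm / (A + 1)
  have : Λ * w.norm ≤ q * (Λ * (A + 1)) + Λ * (A + 1) := by
    rw [← dm]
    nlinarith
  omega
end
end FT

namespace FT
open FreeGroup (of mk mk_toWord norm_one norm_mul_le norm_inv_eq norm_of)

/-- a finite permutation graph with a rooted spanning tree -/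
structure TG (α V : Type*) where
  π : α → Equiv.Perm V
  o : V
  par : V → V
  lt : V → α × Bool
  D : V → ℕ
  τ : V → FreeGroup α
  hpar : ∀ v, v ≠ o → FreeGroup.lift π (ltr (lt v)) (par v) = v
  hD : ∀ v, v ≠ o → D (par v) < D v
  τo : τ o = 1
  hτ : ∀ v, v ≠ o → τ v = ltr (lt v) * τ (par v)

namespace TG
variable {α V : Type*} [DecidableEq α] [DecidableEq V] (t : TG α V)

/-- the action -/
def P : FreeGroup α →* Equiv.Perm V := FreeGroup.lift t.π

/-- the tree edge of a vertex -/
def te (v : V) : V × α := if (t.lt v).2 = true then (t.par v, (t.lt v).1) else (v, (t.lt v).1)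

/-- the non-tree edges -/
def E : Type _ := {e : V × α // ¬ ∃ v, v ≠ t.o ∧ t.te v = e}

theorem ltr_true (x : α) : ltr (x, true) = of x := rfl
theorem ltr_false (x : α) : ltr (x, false) = (of x)⁻¹ := by
  rw [← ltr_true, ← ltr_opp]; rfl

theorem P_of (x : α) : t.P (of x) = t.π x := by simp [P]

theorem par_true {v : V} (h : v ≠ t.o) (h2 : (t.lt v).2 = true) : t.π (t.lt v).1 (t.par v) = v := by
  have := t.hpar v h
  rw [show t.lt v = ((t.lt v).1, true) by rw [← h2], ltr_true] at this
  simpa using this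

theorem par_false {v : V} (h : v ≠ t.o) (h2 : (t.lt v).2 = false) : t.π (t.lt v).1 v = t.par v := by
  have := t.hpar v h
  rw [show t.lt v = ((t.lt v).1, false) by rw [← h2], ltr_false] at this
  rw [_root_.map_inv, FreeGroup.lift_apply_of, Equiv.Perm.inv_eq_iff_eq] at this
  exact this.symm

theorem te_inj {v v' : V} (h : v ≠ t.o) (h' : v' ≠ t.o) (e : t.te v = t.te v') : v = v' := by
  have d1 := t.hD v h
  have d2 := t.hD v' h'
  unfold te at e
  rcases hb : (t.lt v).2 <;> rcases hb' : (t.lt v').2 <;> simp [hb, hb'] at e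
  · exact e.1
  · have a1 := t.par_false h hb
    have a2 := t.par_true h' hb'
    rw [← e.1, ← e.2, a1] at a2
    rw [a2] at d1
    rw [← e.1] at d2
    omega
  · have a1 := t.par_true h hb
    have a2 := t.par_false h' hb'
    rw [e.1, e.2, a2] at a1
    rw [a1] at d2
    rw [e.1] at d1
    omega
  · have a1 := t.par_true h hb
    have a2 := t.par_true h' hb'
    rw [← e.1, ← e.2, a1] at a2
    exact a2

open Classical in
/-- label of an edge -/
noncomputable def ε (e : V × α) : FreeGroup t.E :=
  if h : ∃ v, v ≠ t.o ∧ t.te v = e then 1 else of (⟨e, h⟩ : t.E)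

/-- the cocycle action -/
noncomputable def Sg : FreeGroup α →* Equiv.Perm (V × FreeGroup t.E) :=
  FreeGroup.lift fun x =>
    { toFun := fun p => (t.π x p.1, t.ε (p.1, x) * p.2)
      invFun := fun p => ((t.π x).symm p.1, (t.ε ((t.π x).symm p.1, x))⁻¹ * p.2)
      left_inv := fun p => by simp
      right_inv := fun p => by simp }

/-- the cocycle -/
noncomputable def c (g : FreeGroup α) (v : V) : FreeGroup t.E := (t.Sg g (v, 1)).2

theorem Sg_of (x : α) (v : V) (h : FreeGroup t.E) :
    t.Sg (of x) (v, h) = (t.π x v, t.ε (v, x) * h) := by simp [Sg]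

theorem Sg_eq (g : FreeGroup α) : ∀ (v : V) (h : FreeGroup t.E),
    t.Sg g (v, h) = (t.P g v, t.c g v * h) := by
  have key : ∀ g : FreeGroup α, (∃ k : V → FreeGroup t.E, ∀ v h, t.Sg g (v, h) = (t.P g v, k v * h)) := by
    intro g
    induction g using FreeGroup.induction_on with
    | C1 => exact ⟨fun _ => 1, by simp⟩
    | of x => exact ⟨fun v => t.ε (v, x), fun v h => by rw [Sg_of, P_of]⟩
    | inv_of x ih =>
      refine ⟨fun v => (t.ε (t.P (of x)⁻¹ v, x))⁻¹, fun v h => ?_⟩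
      rw [_root_.map_inv, Equiv.Perm.inv_eq_iff_eq, Sg_of]
      simp [P_of]
    | mul g h ig ih =>
      obtain ⟨k, hk⟩ := ig
      obtain ⟨k', hk'⟩ := ih
      exact ⟨fun v => k (t.P h v) * k' v, fun v x => by
        rw [_root_.map_mul, Equiv.Perm.mul_apply, hk', hk]; simp [mul_assoc]⟩
  obtain ⟨k, hk⟩ := key g
  intro v h
  rw [c, hk, hk]; simp

theorem c_mul (g h : FreeGroup α) (v : V) : t.c (g * h) v = t.c g (t.P h v) * t.c h v := by
  have := t.Sg_eq (g * h) v 1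
  rw [_root_.map_mul, Equiv.Perm.mul_apply, Sg_eq, Sg_eq] at this
  simpa using (congrArg Prod.snd this).symm

theorem c_one (v : V) : t.c 1 v = 1 := by simp [c]
theorem c_of (x : α) (v : V) : t.c (of x) v = t.ε (v, x) := by simp [c, Sg_of]
theorem c_inv (g : FreeGroup α) (v : V) : t.c g⁻¹ v = (t.c g (t.P g⁻¹ v))⁻¹ := by
  have := t.c_mul g g⁻¹ v
  rw [mul_inv_cancel, c_one] at this
  exact (inv_eq_of_mul_eq_one_right this.symm).symm

theorem ε_te {v : V} (h : v ≠ t.o) : t.ε (t.te v) = 1 := by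
  unfold ε; rw [dif_pos ⟨v, h, rfl⟩]

theorem c_lt {v : V} (h : v ≠ t.o) : t.c (ltr (t.lt v)) (t.par v) = 1 := by
  have h1 := t.ε_te h
  unfold te at h1
  rcases hb : (t.lt v).2
  · rw [show t.lt v = ((t.lt v).1, false) by rw [← hb], ltr_false, c_inv]
    simp only [hb] at h1
    have := t.par_false h hb
    rw [_root_.map_inv, P_of]
    rw [show (t.π (t.lt v).1)⁻¹ (t.par v) = v by rw [Equiv.Perm.inv_eq_iff_eq]; exact this.symm, c_of]
    simpa using h1
  · rw [show t.lt v = ((t.lt v).1, true) by rw [← hb], ltr_true, c_of]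
    simpa [hb] using h1

theorem P_τ (v : V) : t.P (t.τ v) t.o = v := by
  induction hd : t.D v using Nat.strong_induction_on generalizing v with
  | _ d ih =>
    by_cases h : v = t.o
    · rw [h, t.τo]; simp
    · rw [t.hτ v h, _root_.map_mul, Equiv.Perm.mul_apply, ih _ (hd ▸ t.hD v h) _ rfl]
      exact t.hpar v h

theorem c_τ (v : V) : t.c (t.τ v) t.o = 1 := by
  induction hd : t.D v using Nat.strong_induction_on generalizing v with
  | _ d ih =>
    by_cases h : v = t.o
    · rw [h, t.τo, c_one]
    · rw [t.hτ v h, c_mul, P_τ, ih _ (hd ▸ t.hD v h) _ rfl, t.c_lt h, mul_one]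

instance : DecidableEq t.E := fun a b => decidable_of_iff (a.1 = b.1) Subtype.ext_iff.symm

theorem ε_norm (e : V × α) : (t.ε e).norm ≤ 1 := by
  unfold ε; split_ifs
  · simp
  · exact (norm_of _).le

theorem c_norm (g : FreeGroup α) (v : V) : (t.c g v).norm ≤ g.norm := by
  induction g using ind_letter generalizing v with
  | h1 => simp [c_one]
  | hs u w hu huv ih =>
    rw [c_mul, huv]
    refine (FreeGroup.norm_mul_le _ _).trans (add_le_add ?_ (ih v))
    obtain ⟨x, rfl | rfl⟩ := norm_one_form hu
    · rw [c_of]; exact t.ε_norm _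
    · rw [c_inv, norm_inv_eq, c_of]; exact t.ε_norm _

/-- the inverse map -/
def η : FreeGroup t.E →* FreeGroup α :=
  FreeGroup.lift fun e => (t.τ (t.π e.1.2 e.1.1))⁻¹ * of e.1.2 * t.τ e.1.1

theorem η_c (g : FreeGroup α) (v : V) : t.η (t.c g v) = (t.τ (t.P g v))⁻¹ * g * t.τ v := by
  induction g using FreeGroup.induction_on generalizing v with
  | C1 => simp [c_one]
  | of x =>
    rw [c_of, P_of]
    unfold ε
    split_ifs with h
    · obtain ⟨u, hu, he⟩ := h
      have e1 := t.hτ u hu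
      unfold te at he
      rcases hb : (t.lt u).2 <;> simp [hb, Prod.ext_iff] at he
      · have e2 := t.par_false hu hb
        rw [show t.lt u = ((t.lt u).1, false) by rw [← hb], ltr_false] at e1
        obtain ⟨rfl, rfl⟩ := he
        rw [e2, e1]; simp
      · have e2 := t.par_true hu hb
        rw [show t.lt u = ((t.lt u).1, true) by rw [← hb], ltr_true] at e1
        obtain ⟨rfl, rfl⟩ := he
        rw [e2, e1]; simp
    · unfold η; erw [FreeGroup.lift_apply_of]
  | inv_of x ih =>
    rw [c_inv, _root_.map_inv, ih]
    simp [mul_assoc]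
  | mul g h ig ih =>
    rw [c_mul, _root_.map_mul, ig, ih, _root_.map_mul, Equiv.Perm.mul_apply]
    group

/-- the stabilizer -/
def N : Subgroup (FreeGroup α) := (MulAction.stabilizer (Equiv.Perm V) t.o).comap t.P

theorem mem_N (g : FreeGroup α) : g ∈ t.N ↔ t.P g t.o = t.o := by
  simp [N, MulAction.mem_stabilizer_iff]

theorem c_η (w : FreeGroup t.E) : t.P (t.η w) t.o = t.o ∧ t.c (t.η w) t.o = w := by
  induction w using FreeGroup.induction_on with
  | C1 => simp [c_one]
  | of e =>
    have h1 : t.η (of e) = (t.τ (t.π e.1.2 e.1.1))⁻¹ * (of e.1.2 * t.τ e.1.1) := by simp [η, mul_assoc]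
    have h2 : t.P (of e.1.2 * t.τ e.1.1) t.o = t.π e.1.2 e.1.1 := by
      rw [_root_.map_mul, Equiv.Perm.mul_apply, P_τ, P_of]
    have h3 : t.P (t.τ (t.π e.1.2 e.1.1))⁻¹ (t.π e.1.2 e.1.1) = t.o := by
      rw [_root_.map_inv, Equiv.Perm.inv_eq_iff_eq, P_τ]
    refine ⟨?_, ?_⟩
    · rw [h1, _root_.map_mul, Equiv.Perm.mul_apply, h2, h3]
    · rw [h1, c_mul, h2, c_inv, h3, c_τ, c_mul, c_τ, P_τ, c_of]
      unfold ε
      rw [dif_neg e.2]; simp; rfl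
  | inv_of e ih =>
    have h : t.P (t.η (of e))⁻¹ t.o = t.o := by
      rw [_root_.map_inv, Equiv.Perm.inv_eq_iff_eq, ih.1]
    refine ⟨by rw [_root_.map_inv]; exact h, ?_⟩
    rw [_root_.map_inv, c_inv, h, ih.2]
  | mul g h ig ih =>
    refine ⟨by rw [_root_.map_mul, _root_.map_mul, Equiv.Perm.mul_apply, ih.1, ig.1], ?_⟩
    rw [_root_.map_mul, c_mul, ih.1, ig.2, ih.2]

/-- the stabilizer is free -/
noncomputable def κ : t.N ≃* FreeGroup t.E where
  toFun g := t.c g.1 t.o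
  invFun w := ⟨t.η w, (t.mem_N _).2 (t.c_η w).1⟩
  left_inv g := by
    apply Subtype.ext
    simp only [η_c]
    rw [(t.mem_N _).1 g.2, t.τo]; simp
  right_inv w := (t.c_η w).2
  map_mul' g h := by
    change t.c (g.1 * h.1) t.o = _
    rw [c_mul, (t.mem_N _).1 h.2]

theorem κ_apply (g : t.N) : t.κ g = t.c g.1 t.o := rfl
theorem κ_symm (w : FreeGroup t.E) : ((t.κ.symm w : t.N) : FreeGroup α) = t.η w := rfl

theorem N_index [Finite V] : t.N.index ≠ 0 := by
  unfold N
  rw [Subgroup.index_comap]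
  exact Subgroup.index_ne_zero_of_finite

theorem card_E [Fintype V] [Fintype α] :
    Nat.card t.E + Fintype.card V = Fintype.card V * Fintype.card α + 1 := by
  classical
  have h1 : Nat.card t.E + Nat.card {e : V × α // ∃ v, v ≠ t.o ∧ t.te v = e} = Fintype.card V * Fintype.card α := by
    rw [← Fintype.card_prod, ← Nat.card_eq_fintype_card (α := V × α), add_comm, E, ← Nat.card_sum]
    exact Nat.card_congr (Equiv.sumCompl _)
  have h2 : Nat.card {e : V × α // ∃ v, v ≠ t.o ∧ t.te v = e} = Nat.card {v : V // v ≠ t.o} := by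
    refine (Nat.card_congr (Equiv.ofBijective (fun v : {v : V // v ≠ t.o} => (⟨t.te v.1, v.1, v.2, rfl⟩ : {e : V × α // ∃ v, v ≠ t.o ∧ t.te v = e})) ⟨?_, ?_⟩)).symm
    · intro a b h
      exact Subtype.ext (t.te_inj a.2 b.2 (congrArg Subtype.val h))
    · rintro ⟨e, v, hv, he⟩
      exact ⟨⟨v, hv⟩, Subtype.ext he⟩
  have h3 : Nat.card {v : V // v ≠ t.o} + 1 = Fintype.card V := by
    rw [Nat.card_eq_fintype_card, Fintype.card_subtype_compl, Fintype.card_subtype_eq]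
    have : 0 < Fintype.card V := Fintype.card_pos_iff.2 ⟨t.o⟩
    omega
  omega

end TG
end FT

namespace FT
open FreeGroup (of mk mk_toWord norm_one norm_inv_eq norm_of)

section
variable {α : Type*} [DecidableEq α]

theorem fball_finite [Finite α] (r : ℕ) : {g : FreeGroup α | g.norm ≤ r}.Finite := by
  refine ((List.finite_length_le (α × Bool) r).image mk).subset ?_
  intro g hg
  exact ⟨g.toWord, hg, mk_toWord⟩

theorem parents [hne : Nonempty α] (A : Subgroup (FreeGroup α)) :
    ∃ (D : FreeGroup α ⧸ A → ℕ) (par : FreeGroup α ⧸ A → FreeGroup α ⧸ A)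
      (lt : FreeGroup α ⧸ A → α × Bool) (τ : FreeGroup α ⧸ A → FreeGroup α),
      (∀ g : FreeGroup α, D g ≤ g.norm) ∧ (∀ v, ∃ g : FreeGroup α, (g : FreeGroup α ⧸ A) = v ∧ g.norm = D v) ∧
      (∀ v, v ≠ ((1 : FreeGroup α) : FreeGroup α ⧸ A) → ltr (lt v) • par v = v ∧ D (par v) < D v ∧
        τ v = ltr (lt v) * τ (par v)) ∧
      τ ((1 : FreeGroup α) : FreeGroup α ⧸ A) = 1 := by
  classical
  have hex : ∀ v : FreeGroup α ⧸ A, ∃ k, ∃ g : FreeGroup α, (g : FreeGroup α ⧸ A) = v ∧ g.norm = k := by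
    intro v; obtain ⟨g, rfl⟩ := QuotientGroup.mk_surjective v
    exact ⟨_, g, rfl, rfl⟩
  let D : FreeGroup α ⧸ A → ℕ := fun v => Nat.find (hex v)
  have hD1 : ∀ g : FreeGroup α, D g ≤ g.norm := fun g => Nat.find_min' _ ⟨g, rfl, rfl⟩
  have hD2 : ∀ v, ∃ g : FreeGroup α, (g : FreeGroup α ⧸ A) = v ∧ g.norm = D v := fun v => Nat.find_spec (hex v)
  have key : ∀ v, ∃ p : (FreeGroup α ⧸ A) × (α × Bool), v ≠ ((1 : FreeGroup α) : FreeGroup α ⧸ A) →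
      ltr p.2 • p.1 = v ∧ D p.1 < D v := by
    intro v
    by_cases hv : v = ((1 : FreeGroup α) : FreeGroup α ⧸ A)
    · exact ⟨⟨v, (Classical.choice hne, true)⟩, fun h => (h hv).elim⟩
    obtain ⟨g, hg, hgn⟩ := hD2 v
    have hpos : 1 ≤ g.norm := by
      rcases Nat.eq_zero_or_pos g.norm with h | h
      · exact (hv (by rw [← hg, FreeGroup.norm_eq_zero.1 h])).elim
      · exact h
    obtain ⟨u, w, h1, h2, h3⟩ := split g 1 hpos
    obtain ⟨s, hs⟩ : ∃ s, u = ltr s := by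
      obtain ⟨a, h | h⟩ := norm_one_form h2
      · exact ⟨(a, true), h⟩
      · exact ⟨(a, false), by rw [TG.ltr_false]; exact h⟩
    refine ⟨⟨(w : FreeGroup α ⧸ A), s⟩, fun _ => ⟨?_, ?_⟩⟩
    · rw [← hg, h1, hs]; rfl
    · have := hD1 w
      change D w < D v
      omega
  choose p hp using key
  let step : (v : FreeGroup α ⧸ A) → ((u : FreeGroup α ⧸ A) → D u < D v → FreeGroup α) → FreeGroup α :=
    fun v ih => if h : v = ((1 : FreeGroup α) : FreeGroup α ⧸ A) then 1 else ltr (p v).2 * ih (p v).1 (hp v h).2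
  have wf : WellFounded (fun u v : FreeGroup α ⧸ A => D u < D v) := (measure D).wf
  refine ⟨D, fun v => (p v).1, fun v => (p v).2, wf.fix step, hD1, hD2, fun v hv => ⟨(hp v hv).1, (hp v hv).2, ?_⟩, ?_⟩
  · rw [wf.fix_eq]; simp only [step]; rw [dif_neg hv]
  · rw [wf.fix_eq]; simp [step]


theorem grow {Ω : Type*} [DecidableEq Ω] [Infinite Ω] (o : Ω) (D : Ω → ℕ) (par : Ω → Ω)
    (h : ∀ v, v ≠ o → D (par v) < D v) (V0 : Finset Ω) (ho : o ∈ V0)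
    (hV : ∀ v ∈ V0, v ≠ o → par v ∈ V0) (k : ℕ) :
    ∃ V : Finset Ω, V0 ⊆ V ∧ V.card = V0.card + k ∧ ∀ v ∈ V, v ≠ o → par v ∈ V := by
  induction k with
  | zero => exact ⟨V0, subset_rfl, rfl, hV⟩
  | succ k ih =>
    obtain ⟨V, h1, h2, h3⟩ := ih
    have hne : {v : Ω | v ∉ V}.Nonempty := by
      obtain ⟨v, hv⟩ := Infinite.exists_notMem_finset V
      exact ⟨v, hv⟩
    let v := Function.argminOn D {v : Ω | v ∉ V} hne
    have hv : v ∉ V := Function.argminOn_mem D {v : Ω | v ∉ V} hne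
    have hvo : v ≠ o := fun e => hv (e ▸ h1 ho)
    have hp : par v ∈ V := by
      by_contra hc
      exact absurd (h v hvo) (Function.not_lt_argminOn D {v : Ω | v ∉ V} hc)
    refine ⟨insert v V, h1.trans (Finset.subset_insert _ _), ?_, ?_⟩
    · rw [Finset.card_insert_of_notMem hv]; omega
    · intro u hu huo
      rcases Finset.mem_insert.1 hu with rfl | hu
      · exact Finset.mem_insert_of_mem hp
      · exact Finset.mem_insert_of_mem (h3 u hu huo)

theorem marshall (n : ℕ) (hn : 0 < n) (a : Fin n → FreeGroup (Fin n))
    (hinj : Function.Injective (FreeGroup.lift a)) (A : Subgroup (FreeGroup (Fin n)))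
    (hA : A = (FreeGroup.lift a).range) (hidx : A.index = 0) :
    ∃ N : Subgroup (FreeGroup (Fin n)), N.index ≠ 0 ∧ A ≤ N ∧ ∃ (r : ℕ)
      (e : N ≃* FreeGroup (Option (Fin r) × Fin n)),
      (∀ g : N, (e g).norm ≤ g.1.norm) ∧
      ∀ g : N, g.1 ∈ A ↔ e g ∈ (FreeGroup.map (fun j : Fin n => ((none : Option (Fin r)), j))).range := by
  classical
  have : NeZero n := ⟨hn.ne'⟩
  have hinf : Infinite (FreeGroup (Fin n) ⧸ A) := Subgroup.index_eq_zero_iff_infinite.1 hidx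
  obtain ⟨D, par, lt, τ, hD1, hD2, hp, hτ1⟩ := parents A
  set o : FreeGroup (Fin n) ⧸ A := ((1 : FreeGroup (Fin n)) : FreeGroup (Fin n) ⧸ A) with ho
  obtain ⟨R, hR⟩ : ∃ R, ∀ i, (a i).norm ≤ R :=
    ⟨∑ i, (a i).norm, fun i => Finset.single_le_sum (f := fun i => (a i).norm) (fun _ _ => Nat.zero_le _) (Finset.mem_univ i)⟩
  have hbf : {v : FreeGroup (Fin n) ⧸ A | D v ≤ R}.Finite := by
    refine ((fball_finite (α := Fin n) R).image (fun g : FreeGroup (Fin n) => (g : FreeGroup (Fin n) ⧸ A))).subset ?_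
    intro v hv
    obtain ⟨g, h1, h2⟩ := hD2 v
    exact ⟨g, by rw [Set.mem_ofPred_eq, h2]; exact hv, h1⟩
  have hDo : D o = 0 := by have := hD1 1; rw [FreeGroup.norm_one] at this; exact Nat.le_zero.1 this
  obtain ⟨V, hV0, hVc, hVp⟩ := grow o D par (fun v hv => (hp v hv).2.1) hbf.toFinset (by simp [hDo])
    (fun v hv hvo => by
      have := (hp v hvo).2.1
      simp only [Set.Finite.mem_toFinset, Set.mem_ofPred_eq] at hv ⊢; omega)
    ((n - 1) * hbf.toFinset.card + 1)
  have hball : ∀ g : FreeGroup (Fin n), g.norm ≤ R → (g : FreeGroup (Fin n) ⧸ A) ∈ V := by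
    intro g hg
    apply hV0
    simp only [Set.Finite.mem_toFinset, Set.mem_ofPred_eq]
    exact (hD1 g).trans hg
  have hoV : o ∈ V := hball 1 (by simp)
  -- permutations
  let pe : ∀ x : Fin n, {v : V // of x • v.1 ∈ V} ≃ {v : V // (of x)⁻¹ • v.1 ∈ V} := fun x =>
    { toFun := fun v => ⟨⟨of x • v.1.1, v.2⟩, by simp⟩
      invFun := fun v => ⟨⟨(of x)⁻¹ • v.1.1, v.2⟩, by simp⟩
      left_inv := fun v => by simp
      right_inv := fun v => by simp }
  let π : Fin n → Equiv.Perm V := fun x => (pe x).extendSubtype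
  have hπ : ∀ x (v : V) (h : of x • v.1 ∈ V), π x v = ⟨of x • v.1, h⟩ := by
    intro x v h
    exact (pe x).extendSubtype_apply_of_mem v h
  have hparV : ∀ v : V, v ≠ ⟨o, hoV⟩ → par v.1 ∈ V := fun v hv => hVp v.1 v.2 (fun e => hv (Subtype.ext e))
  let t : TG (Fin n) V :=
    { π := π
      o := ⟨o, hoV⟩
      par := fun v => if h : par v.1 ∈ V then ⟨par v.1, h⟩ else v
      lt := fun v => lt v.1
      D := fun v => D v.1
      τ := fun v => τ v.1
      hpar := by
        intro v hv
        rw [dif_pos (hparV v hv)]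
        have h1 := (hp v.1 (fun e => hv (Subtype.ext e))).1
        rcases hl : lt v.1 with ⟨x, b⟩
        rw [hl] at h1
        cases b
        · rw [TG.ltr_false] at h1 ⊢
          rw [_root_.map_inv, FreeGroup.lift_apply_of, Equiv.Perm.inv_eq_iff_eq]
          have h2 : of x • v.1 = par v.1 := (inv_smul_eq_iff.1 h1).symm
          rw [hπ x v (by rw [h2]; exact hparV v hv)]
          exact Subtype.ext h2.symm
        · rw [TG.ltr_true] at h1 ⊢
          rw [FreeGroup.lift_apply_of, hπ x _ (by rw [h1]; exact v.2)]
          exact Subtype.ext h1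
      hD := by
        intro v hv
        rw [dif_pos (hparV v hv)]
        exact (hp v.1 (fun e => hv (Subtype.ext e))).2.1
      τo := hτ1
      hτ := by
        intro v hv
        rw [dif_pos (hparV v hv)]
        exact (hp v.1 (fun e => hv (Subtype.ext e))).2.2 }
  let TE : t.E → Prop := fun e => of e.1.2 • e.1.1.1 ∈ V
  have hε : ∀ (x : Fin n) (v : V), of x • v.1 ∈ V → t.ε (v, x) ∈ Subgroup.closure (of '' {e | TE e}) := by
    intro x v h
    unfold TG.ε
    split_ifs with h'
    · exact one_mem _
    · exact Subgroup.subset_closure ⟨_, h, rfl⟩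
  have path : ∀ g : FreeGroup (Fin n), g.norm ≤ R → (t.P g t.o).1 = (g : FreeGroup (Fin n) ⧸ A) ∧
      t.c g t.o ∈ Subgroup.closure (of '' {e | TE e}) := by
    intro g
    induction g using ind_letter with
    | h1 => intro _; exact ⟨by simp [t, ho], by rw [TG.c_one]; exact one_mem _⟩
    | hs u w hu huv ih =>
      intro hR'
      obtain ⟨i1, i2⟩ := ih (by omega)
      have hm := hball _ hR'
      have hm' := hball w (by omega)
      have ew : t.P w t.o = ⟨(w : FreeGroup (Fin n) ⧸ A), hm'⟩ := Subtype.ext i1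
      obtain ⟨x, rfl | rfl⟩ := norm_one_form hu
      · have h1 : of x • (w : FreeGroup (Fin n) ⧸ A) ∈ V := hm
        rw [_root_.map_mul, Equiv.Perm.mul_apply, TG.c_mul, ew, TG.P_of, TG.c_of]
        refine ⟨?_, mul_mem (hε _ _ h1) i2⟩
        change (π x _).1 = _
        rw [hπ x _ h1]; rfl
      · have h1 : (of x)⁻¹ • (w : FreeGroup (Fin n) ⧸ A) ∈ V := hm
        have h2 : t.P (of x)⁻¹ ⟨(w : FreeGroup (Fin n) ⧸ A), hm'⟩ = ⟨_, h1⟩ := by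
          rw [_root_.map_inv, Equiv.Perm.inv_eq_iff_eq, TG.P_of]
          change _ = π x _
          rw [hπ x _ (by simpa using hm')]
          apply Subtype.ext; simp
        rw [_root_.map_mul, Equiv.Perm.mul_apply, TG.c_mul, ew, h2, TG.c_inv, h2, TG.c_of]
        refine ⟨rfl, mul_mem (inv_mem (hε _ _ (by simpa using hm'))) i2⟩
  have hAN : ∀ g ∈ A, ∃ h : g ∈ t.N, t.κ ⟨g, h⟩ ∈ Subgroup.closure (of '' {e | TE e}) := by
    have hAc : A ≤ ((Subgroup.closure (of '' {e | TE e})).comap t.κ.toMonoidHom).map t.N.subtype := by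
      refine hA.le.trans (FreeGroup.range_lift_le ?_)
      rintro _ ⟨i, rfl⟩
      obtain ⟨p1, p2⟩ := path (a i) (hR i)
      have hm : a i ∈ t.N := by
        rw [TG.mem_N]
        apply Subtype.ext
        rw [p1]
        refine QuotientGroup.eq.2 ?_
        rw [mul_one, hA]
        exact inv_mem ⟨of i, by simp⟩
      exact ⟨⟨a i, hm⟩, p2, rfl⟩
    intro g hg
    obtain ⟨g', h1, rfl⟩ := hAc hg
    exact ⟨g'.2, h1⟩
  have hτo : ∀ v, ((τ v : FreeGroup (Fin n)) : FreeGroup (Fin n) ⧸ A) = v := by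
    intro v
    induction hd : D v using Nat.strong_induction_on generalizing v with
    | _ d ih =>
      by_cases hv : v = o
      · rw [hv, hτ1]
      · obtain ⟨p1, p2, p3⟩ := hp v hv
        have := ih _ (hd ▸ p2) (par v) rfl
        rw [p3]
        conv_rhs => rw [← p1, ← this]
        rfl
  have hηA : ∀ w ∈ Subgroup.closure (of '' {e | TE e}), t.η w ∈ A := by
    have : Subgroup.closure (of '' {e | TE e}) ≤ A.comap t.η := by
      rw [Subgroup.closure_le]
      rintro _ ⟨e, he, rfl⟩
      change t.η (of e) ∈ A
      have e1 : t.η (of e) = (t.τ (t.π e.1.2 e.1.1))⁻¹ * (of e.1.2 * t.τ e.1.1) := by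
        simp [TG.η, mul_assoc]
      rw [e1]
      refine QuotientGroup.eq.1 ?_
      change ((τ (π e.1.2 e.1.1).1 : FreeGroup (Fin n)) : FreeGroup (Fin n) ⧸ A) =
        of e.1.2 • ((τ e.1.1.1 : FreeGroup (Fin n)) : FreeGroup (Fin n) ⧸ A)
      rw [hτo, hτo, hπ _ _ he]
    exact this
  have hiff : ∀ g : t.N, g.1 ∈ A ↔ t.κ g ∈ Subgroup.closure (of '' {e | TE e}) := by
    intro g
    refine ⟨fun h => (hAN g.1 h).2, fun h => ?_⟩
    have := hηA _ h
    rwa [← TG.κ_symm, MulEquiv.symm_apply_apply] at this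
  -- sizes
  have hinj2 : Function.Injective (t.η.comp (FreeGroup.map (Subtype.val : {e // TE e} → t.E))) := by
    have h1 : Function.Injective t.η := by
      intro x y h
      rw [← (t.c_η x).2, ← (t.c_η y).2, h]
    exact h1.comp (FreeGroup.map_injective Subtype.val_injective)
  have hrange : (FreeGroup.map (Subtype.val : {e // TE e} → t.E)).range = Subgroup.closure (of '' {e | TE e}) := by
    rw [FreeGroup.map_eq_lift, FreeGroup.range_lift_eq_closure, Set.range_comp]
    congr 2
    ext e
    exact ⟨fun ⟨x, hx⟩ => hx ▸ x.2, fun h => ⟨⟨e, h⟩, rfl⟩⟩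
  have hr2 : (t.η.comp (FreeGroup.map (Subtype.val : {e // TE e} → t.E))).range = A := by
    rw [MonoidHom.range_comp, hrange]
    ext g
    refine ⟨?_, fun hg => ?_⟩
    · rintro ⟨w, hw, rfl⟩; exact hηA w hw
    · obtain ⟨h1, h2⟩ := hAN g hg
      refine ⟨_, h2, ?_⟩
      rw [← TG.κ_symm, MulEquiv.symm_apply_apply]
  have eq1 : FreeGroup (Fin n) ≃* FreeGroup {e // TE e} :=
    ((MonoidHom.ofInjective hinj).trans (MulEquiv.subgroupCongr (hA.symm.trans hr2.symm))).trans
      (MonoidHom.ofInjective hinj2).symm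
  have eq2 : Fin n ≃ {e // TE e} := Equiv.ofFreeGroupEquiv eq1
  have hfE : Finite t.E := by unfold TG.E; infer_instance
  have hcard := t.card_E
  rw [Fintype.card_coe, hVc, Fintype.card_fin] at hcard
  have hc2 : Nat.card {e // TE e} + Nat.card {e // ¬ TE e} = Nat.card t.E := by
    rw [← Nat.card_sum]
    exact Nat.card_congr (Equiv.sumCompl _)
  rw [← Nat.card_congr eq2, Nat.card_fin] at hc2
  set b := hbf.toFinset.card
  have hc3 : Nat.card {e // ¬ TE e} = Nat.card (Fin (b * (n - 1)) × Fin n) := by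
    rw [Nat.card_prod, Nat.card_fin, Nat.card_fin]
    obtain ⟨k, rfl⟩ : ∃ k, n = k + 1 := ⟨n - 1, by omega⟩
    simp only [Nat.add_sub_cancel] at *
    nlinarith
  have eq3 : {e // ¬ TE e} ≃ Fin (b * (n - 1)) × Fin n := (Finite.card_eq.1 hc3).some
  let eE : t.E ≃ Option (Fin (b * (n - 1))) × Fin n :=
    ((Equiv.sumCompl TE).symm.trans (Equiv.sumCongr eq2.symm eq3)).trans optionProdEquiv.symm
  refine ⟨t.N, t.N_index, fun g hg => (hAN g hg).1, b * (n - 1),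
    t.κ.trans (FreeGroup.freeGroupCongr eE), fun g => ?_, fun g => ?_⟩
  · change (FreeGroup.map eE (t.c g.1 t.o)).norm ≤ _
    refine le_trans ?_ (t.c_norm g.1 t.o)
    refine (lip_of_letters (FreeGroup.map eE) 1 ?_ _).trans (by simp)
    intro e
    rw [FreeGroup.map.of]; exact (norm_of _).le
  · rw [hiff g, ← hrange]
    have key : (FreeGroup.freeGroupCongr eE).toMonoidHom.comp
        ((FreeGroup.map (Subtype.val : {e // TE e} → t.E)).comp (FreeGroup.map eq2)) =
        FreeGroup.map (fun j : Fin n => ((none : Option (Fin (b * (n - 1)))), j)) := by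
      ext j
      simp [eE, optionProdEquiv]
    rw [← key]
    constructor
    · rintro ⟨w, hw⟩
      refine ⟨FreeGroup.map eq2.symm w, ?_⟩
      change FreeGroup.freeGroupCongr eE (FreeGroup.map Subtype.val (FreeGroup.map eq2 (FreeGroup.map eq2.symm w))) = FreeGroup.freeGroupCongr eE (t.κ g)
      have hh : FreeGroup.map eq2 (FreeGroup.map eq2.symm w) = w := by
        rw [FreeGroup.map.comp]; simp
      rw [← hw, hh]
    · rintro ⟨w, hw⟩
      refine ⟨FreeGroup.map eq2 w, ?_⟩
      exact (FreeGroup.freeGroupCongr eE).injective hw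

end
end FT

namespace FT
open FreeGroup (of mk mk_toWord norm_one norm_inv_eq norm_of)

section
variable {α : Type*} [DecidableEq α]

theorem pow_norm {x : FreeGroup α} (hx : x ≠ 1) : ∃ c τ : ℕ, 1 ≤ τ ∧ ∀ p : ℕ, 1 ≤ p →
    (x ^ p).norm = 2 * c + p * τ := by
  refine ⟨(FreeGroup.reduceCyclically.conjugator x.toWord).length,
    (FreeGroup.reduceCyclically x.toWord).length, ?_, ?_⟩
  · by_contra h
    have h0 : FreeGroup.reduceCyclically x.toWord = [] := by
      apply List.length_eq_zero_iff.1; omega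
    have := FreeGroup.reduceCyclically.conj_conjugator_reduceCyclically x.toWord
    rw [h0] at this
    have h2 := congrArg mk this
    rw [mk_toWord, List.append_nil, ← FreeGroup.mul_mk, ← FreeGroup.inv_mk, mul_inv_cancel] at h2
    exact hx h2.symm
  · intro p hp
    obtain ⟨q, rfl⟩ : ∃ q, p = q + 1 := ⟨p - 1, by omega⟩
    have h1 := FreeGroup.reduceCyclically.reduce_flatten_replicate_succ
      (FreeGroup.isReduced_toWord (x := x)) q
    rw [FreeGroup.norm, FreeGroup.toWord_pow, h1]
    simp [FreeGroup.invRev_length]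
    ring

theorem norm_pow_inv (x : FreeGroup α) (p : ℕ) : (x⁻¹ ^ p).norm = (x ^ p).norm := by
  rw [inv_pow, norm_inv_eq]

/-- key: two powers with the same translation data. -/
theorem FW0 [Finite α] {X Y h : FreeGroup α} {c τ : ℕ} (hτ : 1 ≤ τ)
    (hX : ∀ p : ℕ, 1 ≤ p → (X ^ p).norm = 2 * c + p * τ)
    (hY : ∀ p : ℕ, 1 ≤ p → (Y ^ p).norm = 2 * c + p * τ)
    (hne : ∀ d : ℕ, 1 ≤ d → h * Y ^ d * h⁻¹ ≠ X ^ d) :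
    ∃ D : ℕ, ∀ a b : ℕ, (X ^ a).norm + (Y ^ b).norm ≤ fd (X ^ a) (h * Y ^ b) + D := by
  have hfin := fball_finite (α := α) (2 * c + 3 * h.norm)
  let k := hfin.toFinset.card
  have hX' : ∀ p : ℕ, (X ^ p).norm ≤ 2 * c + p * τ := by
    intro p; rcases Nat.eq_zero_or_pos p with rfl | hp
    · simp
    · exact (hX p hp).le
  have hY' : ∀ p : ℕ, (Y ^ p).norm ≤ 2 * c + p * τ := by
    intro p; rcases Nat.eq_zero_or_pos p with rfl | hp
    · simp
    · exact (hY p hp).le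
  refine ⟨2 * (2 * c + (k + 1) * τ) + 2 * h.norm + 2 * c, fun a b => ?_⟩
  by_contra hcon
  push Not at hcon
  have t1 : (Y ^ b).norm ≤ fd (X ^ a) (h * Y ^ b) + (X ^ a).norm + h.norm := by
    have e1 := fd_tri (1 : FreeGroup α) (X ^ a) (h * Y ^ b)
    have e2 := fd_tri h (1 : FreeGroup α) (h * Y ^ b)
    have e3 : fd h (h * Y ^ b) = (Y ^ b).norm := by simp [fd]
    have e4 : fd h 1 = h.norm := by simp [fd]
    rw [fd_one] at e1 
    rw [fd_one] at e2 e1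
    omega
  have t2 : (X ^ a).norm ≤ fd (X ^ a) (h * Y ^ b) + (Y ^ b).norm + h.norm := by
    have e1 := fd_tri (1 : FreeGroup α) (h * Y ^ b) (X ^ a)
    rw [fd_one, fd_one, fd_comm] at e1
    have := FreeGroup.norm_mul_le h (Y ^ b)
    omega
  have ha : k + 1 < a := by
    by_contra hh
    have : a * τ ≤ (k + 1) * τ := Nat.mul_le_mul_right _ (by omega)
    have := hX' a; omega
  have hb : k + 1 < b := by
    by_contra hh
    have : b * τ ≤ (k + 1) * τ := Nat.mul_le_mul_right _ (by omega)
    have := hY' b; omega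
  have key : ∀ i : ℕ, i ≤ k → (X⁻¹ ^ i * h * Y ^ i).norm ≤ 2 * c + 3 * h.norm := by
    intro i hi
    have hik : i * τ ≤ (k + 1) * τ := Nat.mul_le_mul_right _ (by omega)
    have e : (X⁻¹ ^ i * h * Y ^ i).norm = fd (X ^ i) (h * Y ^ i) := by
      simp [fd, mul_assoc]
    rw [e]
    have f1 : fd (X ^ i) (X ^ a) = 2 * c + (a - i) * τ := by
      rw [← hX (a - i) (by omega), fd, ← pow_sub_mul_pow X (show i ≤ a by omega),
        (Commute.pow_pow_self X (a-i) i).eq]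
      simp
    have f2 : fd (h * Y ^ i) (h * Y ^ b) = 2 * c + (b - i) * τ := by
      rw [← hY (b - i) (by omega), fd_left, fd, ← pow_sub_mul_pow Y (show i ≤ b by omega),
        (Commute.pow_pow_self Y (b-i) i).eq]
      simp
    have ma : (a - i) * τ + i * τ = a * τ := by rw [← add_mul]; congr 1; omega
    have mb : (b - i) * τ + i * τ = b * τ := by rw [← add_mul]; congr 1; omega
    have g1 := fd_four 1 (X ^ i) (X ^ a) (h * Y ^ b)
    have g2 := fd_four 1 (X ^ i) (h * Y ^ b) (h * Y ^ i)
    rw [fd_one, fd_one, fd_one] at g1 g2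
    have n1 := hX' i
    have n2 := hY' i
    have n3 := hX a (by omega)
    have n4 := hY b (by omega)
    have n5 := FreeGroup.norm_mul_le h (Y ^ i)
    have n6 := FreeGroup.norm_mul_le h (Y ^ b)
    have n7 := FreeGroup.norm_mul_le h⁻¹ (h * Y ^ b)
    rw [inv_mul_cancel_left, norm_inv_eq] at n7
    have f3 := fd_comm (h * Y ^ b) (h * Y ^ i)
    rw [f3, f2] at g2
    rw [f1] at g1
    omega
  -- pigeonhole
  have hmaps : ∀ i ∈ Finset.range (k + 1), X⁻¹ ^ i * h * Y ^ i ∈ hfin.toFinset := by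
    intro i hi
    rw [Finset.mem_range] at hi
    rw [Set.Finite.mem_toFinset]
    exact key i (by omega)
  obtain ⟨i, hi, j, hj, hij, heq⟩ := Finset.exists_ne_map_eq_of_card_lt_of_maps_to
    (by simp [k]) hmaps
  have main : ∀ i j : ℕ, i < j → X⁻¹ ^ i * h * Y ^ i = X⁻¹ ^ j * h * Y ^ j → False := by
    intro i j hij heq
    refine hne (j - i) (by omega) ?_
    obtain ⟨d, rfl⟩ : ∃ d, j = i + d := ⟨j - i, by omega⟩
    rw [Nat.add_sub_cancel_left]
    rw [pow_add, pow_add, (Commute.pow_pow_self Y i d).eq] at heq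
    have h2 : h = X⁻¹ ^ d * h * Y ^ d := by
      have : X⁻¹ ^ i * (h) * Y ^ i = X⁻¹ ^ i * (X⁻¹ ^ d * h * Y ^ d) * Y ^ i := by
        rw [heq]; group
      exact mul_left_cancel (mul_right_cancel this)
    rw [inv_pow] at h2
    have h3 : X ^ d * h = h * Y ^ d := by
      conv_lhs => rw [h2]
      group
    rw [← h3]; group
  rcases lt_or_gt_of_ne hij with h1 | h1
  · exact main i j h1 heq
  · exact main j i h1 heq.symm

theorem conj_root {x y : FreeGroup α} {d : ℕ} (hd : 1 ≤ d) {h : FreeGroup α}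
    (e : h * x ^ d * h⁻¹ = y ^ d) : h * x * h⁻¹ = y := by
  have : (h * x * h⁻¹) ^ d = y ^ d := by rw [conj_pow, e]
  exact pow_left_injective (by omega) this

theorem FW [Finite α] {x h : FreeGroup α} (hc : h * x ≠ x * h) :
    ∃ D : ℕ, ∀ a b : ℤ, (x ^ a).norm + (x ^ b).norm ≤ (x ^ a * h * x ^ b).norm + D := by
  have hx : x ≠ 1 := by rintro rfl; simp at hc
  obtain ⟨c, τ, hτ, hp⟩ := pow_norm hx
  have hq : ∀ p : ℕ, 1 ≤ p → (x⁻¹ ^ p).norm = 2 * c + p * τ := by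
    intro p h1; rw [norm_pow_inv]; exact hp p h1
  have n1 : h * x * h⁻¹ ≠ x := by
    intro e; apply hc
    calc h * x = h * x * h⁻¹ * h := by group
      _ = x * h := by rw [e]
  have n2 : h * x * h⁻¹ ≠ x⁻¹ := by
    intro e
    have e2 : (h ^ 2) * x * (h^2)⁻¹ = x := by
      calc (h ^ 2) * x * (h^2)⁻¹ = h * (h * x * h⁻¹) * h⁻¹ := by rw [pow_two]; simp only [mul_assoc, mul_inv_rev]
        _ = h * x⁻¹ * h⁻¹ := by rw [e]
        _ = (h * x * h⁻¹)⁻¹ := by group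
        _ = x := by rw [e, inv_inv]
    have e3 : x * h ^ 2 * x⁻¹ = h ^ 2 := by
      have : h ^ 2 * x = x * h ^ 2 := by
        calc h ^ 2 * x = (h ^ 2) * x * (h^2)⁻¹ * h ^ 2 := by group
          _ = _ := by rw [e2]
      rw [← this]; group
    have e4 := conj_root (by norm_num) e3
    apply hc
    calc h * x = (x * h * x⁻¹) * x := by rw [e4]
      _ = x * h := by group
  have n1' : h * x⁻¹ * h⁻¹ ≠ x⁻¹ := by
    intro e; apply n1; rw [← inv_inj, ← e]; group
  have n2' : h * x⁻¹ * h⁻¹ ≠ x := by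
    intro e; apply n2; rw [← inv_inj, inv_inv]
    calc (h * x * h⁻¹)⁻¹ = h * x⁻¹ * h⁻¹ := by group
      _ = x := e
  obtain ⟨D1, h1⟩ := FW0 hτ hp hp (h := h) (fun d hd e => n1 (conj_root hd e))
  obtain ⟨D2, h2⟩ := FW0 hτ hp hq (h := h) (fun d hd e => n2' (conj_root hd e))
  obtain ⟨D3, h3⟩ := FW0 hτ hq hp (h := h) (fun d hd e => n2 (conj_root hd e))
  obtain ⟨D4, h4⟩ := FW0 hτ hq hq (h := h) (fun d hd e => n1' (conj_root hd e))
  refine ⟨D1 + D2 + D3 + D4, fun a b => ?_⟩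
  have fe : ∀ X Y : FreeGroup α, fd X (h * Y) = (X⁻¹ * h * Y).norm := by
    intro X Y; simp [fd, mul_assoc]
  rcases Int.eq_nat_or_neg a with ⟨p, rfl | rfl⟩ <;> rcases Int.eq_nat_or_neg b with ⟨q, rfl | rfl⟩
  · have := h3 p q; rw [fe] at this; simp only [inv_pow, inv_inv, norm_inv_eq] at this
    simp only [zpow_natCast]; omega
  · have := h4 p q; rw [fe] at this; simp only [inv_pow, inv_inv, norm_inv_eq] at this
    simp only [zpow_natCast, zpow_neg, norm_inv_eq]; omega
  · have := h1 p q; rw [fe] at this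
    simp only [zpow_natCast, zpow_neg, norm_inv_eq]; omega
  · have := h2 p q; rw [fe] at this; simp only [inv_pow, norm_inv_eq] at this
    simp only [zpow_natCast, zpow_neg, norm_inv_eq]; omega

/-- same-sign powers. -/
theorem FWs {x : FreeGroup α} : ∃ D : ℕ, ∀ a b : ℤ, (0 ≤ a ∧ 0 ≤ b ∨ a ≤ 0 ∧ b ≤ 0) →
    (x ^ a).norm + (x ^ b).norm ≤ (x ^ a * x ^ b).norm + D := by
  by_cases hx : x = 1
  · subst hx; exact ⟨0, by simp⟩
  obtain ⟨c, τ, hτ, hp⟩ := pow_norm hx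
  have main : ∀ a b : ℕ, (x ^ a).norm + (x ^ b).norm ≤ (x ^ a * x ^ b).norm + 2 * c := by
    intro a b
    rcases Nat.eq_zero_or_pos a with rfl | ha
    · simp
    rcases Nat.eq_zero_or_pos b with rfl | hb
    · simp
    rw [← pow_add, hp a ha, hp b hb, hp _ (by omega), add_mul]; omega
  refine ⟨2 * c, ?_⟩
  rintro a b (⟨ha, hb⟩ | ⟨ha, hb⟩)
  · lift a to ℕ using ha
    lift b to ℕ using hb
    simpa using main a b
  · obtain ⟨a, rfl⟩ : ∃ a' : ℕ, a = -a' := ⟨a.natAbs, by omega⟩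
    obtain ⟨b, rfl⟩ : ∃ a' : ℕ, b = -a' := ⟨b.natAbs, by omega⟩
    have := main b a
    have e : (x ^ (-(a:ℤ)) * x ^ (-(b:ℤ))) = (x ^ b * x ^ a)⁻¹ := by
      simp [zpow_neg]
    rw [e, norm_inv_eq]; simp [zpow_neg]; omega
end

section
variable {α ι β : Type*} [DecidableEq α] [DecidableEq ι] [DecidableEq β]

theorem norm_one_ltr {u : FreeGroup ι} (h : u.norm = 1) : ∃ s, u = ltr s := by
  obtain ⟨a, rfl | rfl⟩ := norm_one_form h
  · exact ⟨(a, true), (TG.ltr_true a).symm⟩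
  · exact ⟨(a, false), (TG.ltr_false a).symm⟩

theorem ltr_mul_norm {s t : ι × Bool} (h : (ltr s * ltr t).norm = 2) : t ≠ opp s := by
  rintro rfl
  rw [ltr_opp, mul_inv_cancel] at h; simp at h

/-- local to global, one step -/
theorem L2G (f : FreeGroup ι →* FreeGroup α) (D : ℕ)
    (h1 : ∀ s t, t ≠ opp s → (f (ltr s)).norm + (f (ltr t)).norm ≤ (f (ltr s) * f (ltr t)).norm + D)
    (h2 : ∀ s, D < (f (ltr s)).norm) (v : FreeGroup ι) :
    ∀ s, (ltr s * v).norm = 1 + v.norm →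
      (f (ltr s)).norm + (f v).norm ≤ (f (ltr s * v)).norm + D := by
  induction v using ind_letter with
  | h1 => intro s _; simp
  | hs u v hu huv ih =>
    intro s hs
    obtain ⟨t, rfl⟩ := norm_one_ltr hu
    have i1 := ih t huv
    have hst : t ≠ opp s := by
      rintro rfl
      rw [ltr_opp, mul_inv_cancel_left] at hs
      rw [ltr_opp] at huv; omega
    have i2 := h1 s t hst
    have i3 := h2 t
    have g := fd_four 1 (f (ltr s))⁻¹ (f (ltr t * v)) (f (ltr t))
    rw [fd_one, fd_one, fd_one, norm_inv_eq] at g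
    have e1 : fd (f (ltr s))⁻¹ (f (ltr t)) = (f (ltr s) * f (ltr t)).norm := by simp [fd]
    have e2 : fd (f (ltr t * v)) (f (ltr t)) = (f v).norm := by
      rw [fd_comm]; simp [fd]
    have e3 : fd (f (ltr s))⁻¹ (f (ltr t * v)) = (f (ltr s * (ltr t * v))).norm := by simp [fd]
    rw [e1, e2, e3] at g
    omega

theorem L2G_cmp (f : FreeGroup ι →* FreeGroup α) (g : FreeGroup ι →* FreeGroup β) (D Λ : ℕ)
    (h1 : ∀ s t, t ≠ opp s → (f (ltr s)).norm + (f (ltr t)).norm ≤ (f (ltr s) * f (ltr t)).norm + D)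
    (h2 : ∀ s, D < (f (ltr s)).norm) (h3 : ∀ s, Λ * (g (ltr s)).norm + D ≤ (f (ltr s)).norm)
    (w : FreeGroup ι) : Λ * (g w).norm ≤ (f w).norm := by
  induction w using ind_letter with
  | h1 => simp
  | hs u v hu huv ih =>
    obtain ⟨t, rfl⟩ := norm_one_ltr hu
    have := L2G f D h1 h2 v t huv
    have h4 := h3 t
    have h5 := FreeGroup.norm_mul_le (g (ltr t)) (g v)
    rw [_root_.map_mul g]
    have : Λ * (g (ltr t) * g v).norm ≤ Λ * (g (ltr t)).norm + Λ * (g v).norm := by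
      rw [← mul_add]; exact Nat.mul_le_mul_left _ h5
    omega
end

section
variable {α : Type*} [DecidableEq α]

def Good (φ : MulAut (FreeGroup α)) (S : Set (FreeGroup α)) : Prop :=
  ∀ Λ : ℕ, ∃ k0 : ℕ, ∀ k ≥ k0, ∃ C : ℕ, ∀ a ∈ S,
    Λ * a.norm ≤ ((φ ^ k) a).norm + C ∧ Λ * a.norm ≤ ((φ ^ k)⁻¹ a).norm + C

theorem good_half (φ : MulAut (FreeGroup α)) (S : Set (FreeGroup α)) (C0 C : ℕ)
    (h0 : ∀ a ∈ S, 2 * a.norm ≤ (φ a).norm + C0)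
    (hC : ∀ w, 4 * w.norm ≤ (φ w).norm + (φ⁻¹ w).norm + C) (a) (ha : a ∈ S) (j : ℕ) :
    2 ^ j * a.norm ≤ ((φ ^ j) a).norm + 2 ^ j * (C0 + 2 * C) := by
  have step : ∀ j, 2 * ((φ ^ j) a).norm ≤ ((φ ^ (j + 1)) a).norm + (C0 + 2 * C) := by
    intro j
    induction j with
    | zero => have := h0 a ha; simp; omega
    | succ j ih =>
      have h := hC ((φ ^ (j + 1)) a)
      have e1 : φ ((φ ^ (j + 1)) a) = (φ ^ (j + 1 + 1)) a := by
        rw [pow_succ' φ (j + 1)]; rfl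
      have e2 : φ⁻¹ ((φ ^ (j + 1)) a) = (φ ^ j) a := by
        rw [pow_succ' φ j, MulAut.mul_apply, MulAut.inv_apply_self]
      rw [e1, e2] at h
      omega
  have : 2 ^ j * a.norm + (C0 + 2 * C) ≤ ((φ ^ j) a).norm + 2 ^ j * (C0 + 2 * C) := by
    induction j with
    | zero => simp
    | succ j ih => 
      have := step j
      rw [pow_succ, mul_comm (2 ^ j) 2, mul_assoc, mul_assoc]
      omega
  omega

theorem good_of_two (φ : MulAut (FreeGroup α)) (S : Set (FreeGroup α)) (C0 C : ℕ)
    (h0 : ∀ a ∈ S, 2 * a.norm ≤ (φ a).norm + C0 ∧ 2 * a.norm ≤ (φ⁻¹ a).norm + C0)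
    (hC : ∀ w, 4 * w.norm ≤ (φ w).norm + (φ⁻¹ w).norm + C) : Good φ S := by
  intro Λ
  refine ⟨Λ, fun k hk => ⟨2 ^ k * (C0 + 2 * C), fun a ha => ?_⟩⟩
  have hL : Λ * a.norm ≤ 2 ^ k * a.norm :=
    Nat.mul_le_mul_right _ (hk.le.trans (Nat.lt_two_pow_self).le)
  have g1 := good_half φ S C0 C (fun a ha => (h0 a ha).1) hC a ha k
  have g2 := good_half φ⁻¹ S C0 C (fun a ha => (h0 a ha).2) (by
    intro w; have := hC w; rw [inv_inv]; omega) a ha k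
  rw [inv_pow] at g2
  exact ⟨hL.trans g1, hL.trans g2⟩

theorem conv (t : ℤ → ℕ) (h1 : ∀ j, 1 ≤ t j) (h : ∀ j, 4 * t j ≤ t (j - 1) + t (j + 1)) (B : ℕ) :
    ∃ J : ℕ, ∀ j : ℕ, J ≤ j → B ≤ t j := by
  by_cases hex : ∃ i : ℕ, t i ≤ t (i + 1)
  · obtain ⟨i, hi⟩ := hex
    have mono : ∀ d : ℕ, t (i + d) + 1 ≤ t (i + d + 1) + (if d = 0 then 1 else 0) ∧ d ≤ t (i + d) := by
      intro d
      induction d with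
      | zero => simp; omega
      | succ d ih =>
        have h2 := h (i + d + 1)
        have h3 := h1 (i + d)
        have h4 := h1 (i + d + 1)
        rw [show (i + d + 1 - 1 : ℤ) = i + d by ring] at h2
        push_cast
        rw [show (i + (d + 1) : ℤ) = i + d + 1 by ring]
        split_ifs at ih <;> simp <;> (try subst d) <;> (try push_cast at *) <;> omega
    refine ⟨i + B, fun j hj => ?_⟩
    have := (mono (j - i)).2
    rw [show ((i : ℤ) + ((j - i : ℕ) : ℤ)) = j by push_cast [show i ≤ j by omega]; ring] at this
    omega
  · push Not at hex
    exfalso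
    have : ∀ i : ℕ, t i + i ≤ t 0 := by
      intro i
      induction i with
      | zero => simp
      | succ i ih => have := hex i; push_cast; omega
    have h2 := this (t 0 + 1)
    omega
end
end FT

namespace FT
open FreeGroup (of mk mk_toWord norm_one norm_inv_eq norm_of)

section
variable {α : Type*} [DecidableEq α]

theorem zpow_nc {x y : FreeGroup α} (h : y * x ≠ x * y) (d : ℤ) (hd : d ≠ 0) :
    y ^ d * x ≠ x * y ^ d := by
  intro e
  have key : ∀ k : ℕ, 1 ≤ k → y ^ k * x = x * y ^ k → False := by
    intro k hk e
    have e2 : x * y ^ k * x⁻¹ = y ^ k := by rw [← e]; group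
    have e3 := conj_root hk e2
    apply h
    calc y * x = (x * y * x⁻¹) * x := by rw [e3]
      _ = x * y := by group
  rcases Int.eq_nat_or_neg d with ⟨p, rfl | rfl⟩
  · exact key p (by omega) (by simpa using e)
  · refine key p (by omega) ?_
    rw [zpow_neg, zpow_natCast] at e
    calc y ^ p * x = y ^ p * (x * (y ^ p)⁻¹) * y ^ p := by group
      _ = y ^ p * ((y ^ p)⁻¹ * x) * y ^ p := by rw [e]
      _ = x * y ^ p := by group

theorem FWfin [Finite α] {I : Type*} [Finite I] {x : FreeGroup α} (h : I → FreeGroup α)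
    (hc : ∀ i, h i * x ≠ x * h i) :
    ∃ D : ℕ, ∀ i, ∀ a b : ℤ, (x ^ a).norm + (x ^ b).norm ≤ (x ^ a * h i * x ^ b).norm + D := by
  have := Fintype.ofFinite I
  choose D hD using fun i => FW (hc i)
  refine ⟨∑ i, D i, fun i a b => (hD i a b).trans ?_⟩
  have : D i ≤ ∑ i, D i := Finset.single_le_sum (f := D) (fun _ _ => Nat.zero_le _) (Finset.mem_univ i)
  omega

def lad {n : ℕ} (x y : FreeGroup α) (L : ℕ) (i : Fin n) : FreeGroup α :=
  y ^ ((i : ℕ) + 1) * x ^ L * (y ^ ((i : ℕ) + 1))⁻¹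

def sg (b : Bool) : ℤ := if b then 1 else -1

theorem lift_ltr {ι G : Type*} [DecidableEq ι] [Group G] (f : FreeGroup ι →* G) (s : ι × Bool) :
    f (ltr s) = f (of s.1) ^ sg s.2 := by
  obtain ⟨i, b⟩ := s
  cases b
  · rw [TG.ltr_false]; simp [sg]
  · rw [TG.ltr_true]; simp [sg]

theorem norm_zpow_sg (x : FreeGroup α) (L : ℕ) (b : Bool) : (x ^ (sg b * L)).norm = (x ^ L).norm := by
  cases b <;> simp [sg]

theorem lad_ltr {n : ℕ} (x y : FreeGroup α) (L : ℕ) (s : Fin n × Bool) :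
    FreeGroup.lift (lad x y L) (ltr s) =
      y ^ ((s.1 : ℕ) + 1) * x ^ (sg s.2 * (L : ℤ)) * (y ^ ((s.1 : ℕ) + 1))⁻¹ := by
  rw [lift_ltr, FreeGroup.lift_apply_of, lad, conj_zpow, ← zpow_natCast x L, ← zpow_mul, mul_comm]

theorem norm3 (a b c : FreeGroup α) : (a * b * c).norm ≤ a.norm + b.norm + c.norm := by
  have := FreeGroup.norm_mul_le (a * b) c
  have := FreeGroup.norm_mul_le a b
  omega

theorem norm3' (a b c : FreeGroup α) : b.norm ≤ a.norm + (a * b * c).norm + c.norm := by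
  have := norm3 a⁻¹ (a * b * c) c⁻¹
  rw [show a⁻¹ * (a * b * c) * c⁻¹ = b by group, norm_inv_eq, norm_inv_eq] at this
  exact this

theorem ladder [Finite α] (n : ℕ) {x y : FreeGroup α} (hc : y * x ≠ x * y) :
    ∃ D : ℕ, ∀ L : ℕ,
      (∀ s : Fin n × Bool, (FreeGroup.lift (lad x y L) (ltr s)).norm ≤ (x ^ L).norm + D ∧
        (x ^ L).norm ≤ (FreeGroup.lift (lad x y L) (ltr s)).norm + D) ∧
      ∀ s t : Fin n × Bool, t ≠ opp s →
        (FreeGroup.lift (lad x y L) (ltr s)).norm + (FreeGroup.lift (lad x y L) (ltr t)).norm ≤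
        (FreeGroup.lift (lad x y L) (ltr s) * FreeGroup.lift (lad x y L) (ltr t)).norm + D := by
  let I := {p : Fin n × Fin n // p.1 ≠ p.2}
  obtain ⟨D1, h1⟩ := FWfin (I := I) (x := x)
    (fun p => y ^ (((p.1.2 : ℕ) : ℤ) - ((p.1.1 : ℕ) : ℤ))) (fun p => zpow_nc hc _ (by
      have := p.2
      intro e; apply this; ext; omega))
  obtain ⟨D2, h2⟩ := FWs (x := x)
  obtain ⟨M, hM⟩ : ∃ M, ∀ i : Fin n, (y ^ ((i : ℕ) + 1)).norm ≤ M :=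
    ⟨∑ i : Fin n, (y ^ ((i : ℕ) + 1)).norm, fun i =>
      Finset.single_le_sum (f := fun i : Fin n => (y ^ ((i : ℕ) + 1)).norm)
        (fun _ _ => Nat.zero_le _) (Finset.mem_univ i)⟩
  have hup : ∀ L : ℕ, ∀ s : Fin n × Bool,
      (FreeGroup.lift (lad x y L) (ltr s)).norm ≤ (x ^ L).norm + 2 * M ∧
        (x ^ L).norm ≤ (FreeGroup.lift (lad x y L) (ltr s)).norm + 2 * M := by
    intro L s
    rw [lad_ltr]
    have e1 := norm3 (y ^ ((s.1 : ℕ) + 1)) (x ^ (sg s.2 * (L : ℤ))) (y ^ ((s.1 : ℕ) + 1))⁻¹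
    have e2 := norm3' (y ^ ((s.1 : ℕ) + 1)) (x ^ (sg s.2 * (L : ℤ))) (y ^ ((s.1 : ℕ) + 1))⁻¹
    rw [norm_inv_eq, norm_zpow_sg] at e1 e2
    have := hM s.1
    omega
  refine ⟨D1 + D2 + 6 * M, fun L => ⟨fun s => ?_, fun s t hst => ?_⟩⟩
  · have := hup L s; omega
  have us := (hup L s).1
  have ut := (hup L t).1
  have key : (x ^ L).norm + (x ^ L).norm ≤
    (x ^ (sg s.2 * (L : ℤ)) * y ^ (((t.1 : ℕ) : ℤ) - ((s.1 : ℕ) : ℤ)) * x ^ (sg t.2 * (L : ℤ))).norm +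
      (D1 + D2) := by
    by_cases hst1 : s.1 = t.1
    · have hb : s.2 = t.2 := by
        by_contra hb
        apply hst
        ext
        · simp [opp, hst1]
        · revert hb; rcases s with ⟨s, b⟩; rcases t with ⟨t, b'⟩; cases b <;> cases b' <;> simp [opp]
      have := h2 (sg s.2 * (L : ℤ)) (sg t.2 * (L : ℤ)) (by
        rw [hb]; cases t.2 <;> simp [sg])
      rw [norm_zpow_sg, norm_zpow_sg] at this
      rw [hst1, sub_self, zpow_zero, mul_one]; omega
    · have := h1 ⟨(s.1, t.1), hst1⟩ (sg s.2 * (L : ℤ)) (sg t.2 * (L : ℤ))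
      rw [norm_zpow_sg, norm_zpow_sg] at this
      simp only at this
      omega
  have e : FreeGroup.lift (lad x y L) (ltr s) * FreeGroup.lift (lad x y L) (ltr t) =
     y ^ ((s.1 : ℕ) + 1) * (x ^ (sg s.2 * (L : ℤ)) * y ^ (((t.1 : ℕ) : ℤ) - ((s.1 : ℕ) : ℤ)) * x ^ (sg t.2 * (L : ℤ))) * (y ^ ((t.1 : ℕ) + 1))⁻¹ := by
    rw [lad_ltr, lad_ltr]
    have : y ^ (((t.1 : ℕ) : ℤ) - ((s.1 : ℕ) : ℤ)) = (y ^ ((s.1 : ℕ) + 1))⁻¹ * y ^ ((t.1 : ℕ) + 1) := by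
      rw [← zpow_natCast, ← zpow_natCast, ← zpow_neg, ← zpow_add]; congr 1; push_cast; ring
    rw [this]; group
  have k2 := norm3' (y ^ ((s.1 : ℕ) + 1)) (x ^ (sg s.2 * (L : ℤ)) * y ^ (((t.1 : ℕ) : ℤ) - ((s.1 : ℕ) : ℤ)) * x ^ (sg t.2 * (L : ℤ))) (y ^ ((t.1 : ℕ) + 1))⁻¹
  rw [← e, norm_inv_eq] at k2
  have := hM s.1
  have := hM t.1
  omega

theorem map_lad {n : ℕ} (g : FreeGroup α ≃* FreeGroup α) (x y : FreeGroup α) (L : ℕ) :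
    (g : FreeGroup α →* FreeGroup α).comp (FreeGroup.lift (lad (n := n) x y L)) =
      FreeGroup.lift (lad (g x) (g y) L) := by
  apply FreeGroup.ext_hom
  intro i
  simp [lad]

theorem lin_dom {A B C D : ℕ} (h : ∀ p : ℕ, 1 ≤ p → A + p * B ≤ C + p * D) : B ≤ D := by
  by_contra hh
  have := h (C + 1) (by omega)
  have : (C + 1) * (D + 1) ≤ (C + 1) * B := Nat.mul_le_mul_left _ (by omega)
  rw [mul_add] at this
  omega

theorem aut_mul_ne {g : MulAut (FreeGroup α)} {x y : FreeGroup α} (h : y * x ≠ x * y) :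
    g y * g x ≠ g x * g y := by
  intro e; rw [← _root_.map_mul, ← _root_.map_mul] at e; exact h (g.injective e)

theorem base_A {n : ℕ} (hn : 0 < n) (φ : MulAut (FreeGroup (Fin n))) (hfl : Flare φ)
    {w w' : FreeGroup (Fin n)} (hww : w' * w ≠ w * w') :
    ∃ (k1 : ℕ) (a : Fin n → FreeGroup (Fin n)), 0 < k1 ∧ (∀ i, a i ∈ Subgroup.closure {w, w'}) ∧
      Function.Injective (FreeGroup.lift a) ∧ (FreeGroup.lift a).range.index = 0 ∧
      Good (φ ^ k1) (FreeGroup.lift a).range := by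
  obtain ⟨k0, hk0⟩ := hfl 4
  obtain ⟨C, hC⟩ := hk0 (k0 + 1) (by omega)
  set φ' := φ ^ (k0 + 1) with hφ'
  have hw1 : w ≠ 1 := by rintro rfl; simp at hww
  have hne : ∀ j : ℤ, (φ' ^ j) w ≠ 1 := by
    intro j e; exact hw1 ((φ' ^ j).injective (e.trans (map_one (φ' ^ j)).symm))
  choose c τ hτ hpn using fun j => pow_norm (hne j)
  have hconv : ∀ j, 4 * τ j ≤ τ (j - 1) + τ (j + 1) := by
    intro j
    apply lin_dom (A := 4 * (2 * c j)) (C := 2 * c (j - 1) + 2 * c (j + 1) + C)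
    intro p hp
    have h1 := hC (((φ' ^ j) w) ^ p)
    have e1 : φ' (((φ' ^ j) w) ^ p) = ((φ' ^ (j + 1)) w) ^ p := by
      rw [map_pow, ← MulAut.mul_apply, ← zpow_one_add, add_comm]
    have e2 : φ'⁻¹ (((φ' ^ j) w) ^ p) = ((φ' ^ (j - 1)) w) ^ p := by
      rw [map_pow, ← MulAut.mul_apply, zpow_sub_one, (Commute.zpow_self φ' j).inv_right.eq]
    rw [e1, e2, hpn j p hp, hpn _ p hp, hpn _ p hp] at h1
    nlinarith
  obtain ⟨J1, hJ1⟩ := conv τ hτ hconv (4 * τ 0)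
  obtain ⟨J2, hJ2⟩ := conv (fun j => τ (-j)) (fun j => hτ _) (fun j => by
    have := hconv (-j)
    rw [show -(j - 1) = -j + 1 by ring, show -(j + 1) = -j - 1 by ring]; omega) (4 * τ 0)
  let J : ℕ := J1 + J2 + 1
  have hB1 := hJ1 J (by omega)
  have hB2 := hJ2 J (by omega)
  obtain ⟨Ck, hCk⟩ := hk0 ((k0 + 1) * J) (by
    have : (k0 + 1) * 1 ≤ (k0 + 1) * J := Nat.mul_le_mul_left _ (by omega)
    omega)
  set k1 := (k0 + 1) * J with hk1
  have hpow : φ ^ k1 = φ' ^ J := by rw [hφ', ← pow_mul]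
  have ex1 : (φ ^ k1) w = (φ' ^ (J : ℤ)) w := by rw [hpow, zpow_natCast]
  have ex2 : (φ ^ k1)⁻¹ w = (φ' ^ (-(J : ℤ))) w := by rw [hpow, zpow_neg, zpow_natCast]
  have hp0 : ∀ p, 1 ≤ p → (w ^ p).norm = 2 * c 0 + p * τ 0 := by
    intro p hp; have := hpn 0 p hp; simpa using this
  obtain ⟨D0, hD0⟩ := ladder n hww
  obtain ⟨D1, hD1⟩ := ladder n (aut_mul_ne (g := φ ^ k1) hww)
  obtain ⟨D2, hD2⟩ := ladder n (aut_mul_ne (g := (φ ^ k1)⁻¹) hww)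
  let L : ℕ := 4 * c 0 + 2 * D0 + 3 * D1 + 3 * D2 + 1
  have hLτ : L ≤ L * τ 0 := Nat.le_mul_of_pos_right _ (hτ 0)
  have hw0 : (w ^ L).norm = 2 * c 0 + L * τ 0 := hp0 L (by omega)
  have hx1 : 4 * (L * τ 0) ≤ (((φ ^ k1) w) ^ L).norm := by
    rw [ex1, hpn _ L (by omega)]
    have : L * (4 * τ 0) ≤ L * τ J := Nat.mul_le_mul_left _ hB1
    nlinarith
  have hx2 : 4 * (L * τ 0) ≤ (((φ ^ k1)⁻¹ w) ^ L).norm := by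
    rw [ex2, hpn _ L (by omega)]
    have : L * (4 * τ 0) ≤ L * τ (-J) := Nat.mul_le_mul_left _ hB2
    nlinarith
  let a : Fin n → FreeGroup (Fin n) := lad w w' L
  have m1 : ∀ u, (φ ^ k1) (FreeGroup.lift a u) = FreeGroup.lift (lad ((φ ^ k1) w) ((φ ^ k1) w') L) u :=
    fun u => DFunLike.congr_fun (map_lad (φ ^ k1) w w' L) u
  have m2 : ∀ u, (φ ^ k1)⁻¹ (FreeGroup.lift a u) = FreeGroup.lift (lad ((φ ^ k1)⁻¹ w) ((φ ^ k1)⁻¹ w') L) u :=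
    fun u => DFunLike.congr_fun (map_lad (φ ^ k1)⁻¹ w w' L) u
  have d1 : ∀ s, D1 < (FreeGroup.lift (lad (n := n) ((φ ^ k1) w) ((φ ^ k1) w') L) (ltr s)).norm := by
    intro s; have := ((hD1 L).1 s).2; omega
  have d2 : ∀ s, D2 < (FreeGroup.lift (lad (n := n) ((φ ^ k1)⁻¹ w) ((φ ^ k1)⁻¹ w') L) (ltr s)).norm := by
    intro s; have := ((hD2 L).1 s).2; omega
  have g1 : ∀ u, 2 * (FreeGroup.lift a u).norm ≤ ((φ ^ k1) (FreeGroup.lift a u)).norm := by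
    intro u
    rw [m1]
    refine L2G_cmp _ _ D1 2 (hD1 L).2 d1 (fun s => ?_) u
    have := ((hD1 L).1 s).2
    have h9 : (FreeGroup.lift a (ltr s)).norm ≤ (w ^ L).norm + D0 := ((hD0 L).1 s).1
    omega
  have g2 : ∀ u, 2 * (FreeGroup.lift a u).norm ≤ ((φ ^ k1)⁻¹ (FreeGroup.lift a u)).norm := by
    intro u
    rw [m2]
    refine L2G_cmp _ _ D2 2 (hD2 L).2 d2 (fun s => ?_) u
    have := ((hD2 L).1 s).2
    have h9 : (FreeGroup.lift a (ltr s)).norm ≤ (w ^ L).norm + D0 := ((hD0 L).1 s).1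
    omega
  have hgood : ∀ x ∈ (FreeGroup.lift a).range, 2 * x.norm ≤ ((φ ^ k1) x).norm + 0 ∧
      2 * x.norm ≤ ((φ ^ k1)⁻¹ x).norm + 0 := by
    rintro x ⟨u, rfl⟩
    exact ⟨g1 u, g2 u⟩
  refine ⟨k1, a, by positivity, fun i => ?_, ?_, ?_, good_of_two _ _ 0 Ck hgood hCk⟩
  · have hw : w ∈ Subgroup.closure {w, w'} := Subgroup.subset_closure (by simp)
    have hw' : w' ∈ Subgroup.closure {w, w'} := Subgroup.subset_closure (by simp)
    exact mul_mem (mul_mem (pow_mem hw' _) (pow_mem hw _)) (inv_mem (pow_mem hw' _))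
  · rw [injective_iff_map_eq_one]
    intro u hu
    have := L2G_cmp _ (MonoidHom.id _) D1 1 (hD1 L).2 d1 (fun s => by
      have := d1 s; rw [MonoidHom.id_apply, norm_ltr]; omega) u
    rw [← m1, hu, map_one, FreeGroup.norm_one, MonoidHom.id_apply] at this
    exact FreeGroup.norm_eq_zero.1 (by omega)
  · by_contra hidx
    set A := (FreeGroup.lift a).range with hA
    have h2 : (A.comap ((φ ^ k1 : MulAut _) : FreeGroup (Fin n) ≃* FreeGroup (Fin n)).toMonoidHom).index ≠ 0 := by
      rw [Subgroup.index_comap_of_surjective]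
      · exact hidx
      · exact (φ ^ k1).surjective
    have h3 := Subgroup.index_inf_ne_zero hidx h2
    obtain ⟨p, hp, -, hmem⟩ := Subgroup.exists_pow_mem_of_index_ne_zero h3 w
    obtain ⟨hm1, hm2⟩ := hmem
    have hm3 : (φ ^ k1) (w ^ p) ∈ A := hm2
    have q1 := (hgood _ hm1).1
    have q2 := (hgood _ hm3).2
    rw [MulAut.inv_apply_self] at q2
    rw [hp0 p (by omega)] at q1 q2
    have := hτ 0
    have : p ≤ p * τ 0 := Nat.le_mul_of_pos_right _ (hτ 0)
    omega
end
end FT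

namespace FT
open FreeGroup (of mk mk_toWord norm_one norm_inv_eq norm_of)

section
variable {α : Type*} [DecidableEq α]

theorem chain3 {p q r : FreeGroup α} {D : ℕ} (h1 : p.norm + q.norm ≤ (p * q).norm + D)
    (h2 : q.norm + r.norm ≤ (q * r).norm + D) (h3 : D < q.norm) :
    p.norm + (q * r).norm ≤ (p * (q * r)).norm + D := by
  have g := fd_four 1 p⁻¹ (q * r) q
  rw [fd_one, fd_one, fd_one, norm_inv_eq] at g
  have e1 : fd p⁻¹ q = (p * q).norm := by simp [fd]
  have e2 : fd (q * r) q = r.norm := by rw [fd_comm]; simp [fd]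
  have e3 : fd p⁻¹ (q * r) = (p * (q * r)).norm := by simp [fd]
  rw [e1, e2, e3] at g
  omega

/-- the twisted letters -/
def tw {β : Type*} (κ : β × Bool → ℕ) (X Z : FreeGroup α) (B : β × Bool → FreeGroup α) (T : ℕ)
    (s : β × Bool) : FreeGroup α :=
  Z ^ κ s * X ^ (sg s.2 * (T : ℤ)) * (Z ^ κ s)⁻¹ * B s *
    (Z ^ κ (opp s) * X ^ (sg s.2 * (T : ℤ)) * (Z ^ κ (opp s))⁻¹)

theorem exists_bd {I : Type*} [Finite I] (f : I → ℕ) : ∃ M, ∀ i, f i ≤ M := by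
  have := Fintype.ofFinite I
  exact ⟨∑ i, f i, fun i => Finset.single_le_sum (f := f) (fun _ _ => Nat.zero_le _) (Finset.mem_univ i)⟩

theorem twist_D [Finite α] {β : Type*} [Finite β] [DecidableEq β] (κ : β × Bool → ℕ)
    (hκ : Function.Injective κ)
    {X Z : FreeGroup α} (hXZ : Z * X ≠ X * Z) (B : β × Bool → FreeGroup α)
    (hB : ∀ s, ((Z ^ κ s)⁻¹ * B s * Z ^ κ (opp s)) * X ≠ X * ((Z ^ κ s)⁻¹ * B s * Z ^ κ (opp s))) :
    ∃ D : ℕ, ∀ T : ℕ,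
      (∀ s, 2 * (X ^ T).norm ≤ (tw κ X Z B T s).norm + D ∧ (tw κ X Z B T s).norm ≤ 2 * (X ^ T).norm + D) ∧
      (D < (X ^ T).norm → ∀ s t, t ≠ opp s →
        (tw κ X Z B T s).norm + (tw κ X Z B T t).norm ≤ (tw κ X Z B T s * tw κ X Z B T t).norm + D) := by
  obtain ⟨D1, h1⟩ := FWfin _ hB
  let I := {p : (β × Bool) × (β × Bool) // p.2 ≠ opp p.1}
  obtain ⟨D2, h2⟩ := FWfin (I := I) (x := X)
    (fun p => Z ^ ((κ p.1.2 : ℤ) - (κ (opp p.1.1) : ℤ))) (fun p => zpow_nc hXZ _ (by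
      have := p.2
      intro e; apply this; apply hκ; omega))
  obtain ⟨M1, hM1⟩ := exists_bd (fun s => (Z ^ κ s).norm)
  obtain ⟨M2, hM2⟩ := exists_bd (fun s => ((Z ^ κ s)⁻¹ * B s * Z ^ κ (opp s)).norm)
  set M := M1 + M2 with hM
  obtain ⟨h, hh⟩ : ∃ h : β × Bool → FreeGroup α, ∀ s, h s = (Z ^ κ s)⁻¹ * B s * Z ^ κ (opp s) :=
    ⟨_, fun _ => rfl⟩
  have es : ∀ T s, tw κ X Z B T s = Z ^ κ s * (X ^ (sg s.2 * (T : ℤ)) *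
      h s * X ^ (sg s.2 * (T : ℤ))) * (Z ^ κ (opp s))⁻¹ := by
    intro T s; rw [hh]; simp only [tw, mul_assoc]
  simp only [← hh] at h1 hM2
  have hhM : ∀ s, (h s).norm ≤ M := fun s => (hM2 s).trans (by omega)
  have hZM : ∀ s, (Z ^ κ s).norm ≤ M := fun s => (hM1 s).trans (by omega)
  have mid : ∀ (T : ℕ) s, 2 * (X ^ T).norm ≤ (X ^ (sg s.2 * (T : ℤ)) * h s * X ^ (sg s.2 * (T : ℤ))).norm + D1 ∧
     (X ^ (sg s.2 * (T : ℤ)) * h s * X ^ (sg s.2 * (T : ℤ))).norm ≤ 2 * (X ^ T).norm + M ∧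
     (tw κ X Z B T s).norm ≤ (X ^ (sg s.2 * (T : ℤ)) * h s * X ^ (sg s.2 * (T : ℤ))).norm + 2 * M ∧
     (X ^ (sg s.2 * (T : ℤ)) * h s * X ^ (sg s.2 * (T : ℤ))).norm ≤ (tw κ X Z B T s).norm + 2 * M := by
    intro T s
    have a1 := h1 s (sg s.2 * (T : ℤ)) (sg s.2 * (T : ℤ))
    have a2 := norm3 (X ^ (sg s.2 * (T : ℤ))) (h s) (X ^ (sg s.2 * (T : ℤ)))
    have a3 := norm3 (Z ^ κ s) (X ^ (sg s.2 * (T : ℤ)) * h s * X ^ (sg s.2 * (T : ℤ))) (Z ^ κ (opp s))⁻¹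
    have a4 := norm3' (Z ^ κ s) (X ^ (sg s.2 * (T : ℤ)) * h s * X ^ (sg s.2 * (T : ℤ))) (Z ^ κ (opp s))⁻¹
    rw [← es] at a3 a4
    rw [norm_inv_eq] at a3 a4
    rw [norm_zpow_sg] at a1 a2
    have := hhM s
    have := hZM s
    have := hZM (opp s)
    refine ⟨?_, ?_, ?_, ?_⟩
    · exact le_trans (by omega) a1
    all_goals omega
  refine ⟨3 * (D1 + D2 + 10 * M) + 20 * M, fun T => ⟨fun s => ?_, fun hT s t hst => ?_⟩⟩
  · have := mid T s; omega
  obtain ⟨s1, s2, s3, s4⟩ := mid T s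
  obtain ⟨t1, t2, t3, t4⟩ := mid T t
  set e := sg s.2 * (T : ℤ) with he
  set e' := sg t.2 * (T : ℤ) with he'
  set z := Z ^ ((κ t : ℤ) - (κ (opp s) : ℤ)) with hz
  have hz' : z = (Z ^ κ (opp s))⁻¹ * Z ^ κ t := by
    rw [hz, ← zpow_natCast, ← zpow_natCast, ← zpow_neg, ← zpow_add]; congr 1; ring
  have hzM : z.norm ≤ 2 * M := by
    rw [hz']
    have := FreeGroup.norm_mul_le (Z ^ κ (opp s))⁻¹ (Z ^ κ t)
    rw [norm_inv_eq] at this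
    have := hZM (opp s)
    have := hZM t
    omega
  have w2 := h2 ⟨(s, t), hst⟩ e e'
  simp only at w2
  rw [← hz] at w2
  have nE : (X ^ e).norm = (X ^ T).norm := norm_zpow_sg _ _ _
  have nE' : (X ^ e').norm = (X ^ T).norm := norm_zpow_sg _ _ _
  rw [nE, nE'] at w2
  have hs := hhM s
  have ht := hhM t
  have bd : ∀ a b : FreeGroup α, (a * b).norm ≤ a.norm + b.norm := FreeGroup.norm_mul_le
  have bd' : ∀ a b : FreeGroup α, a.norm ≤ (a * b).norm + b.norm := by
    intro a b
    have := FreeGroup.norm_mul_le (a * b) b⁻¹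
    rw [norm_inv_eq, mul_inv_cancel_right] at this; exact this
  -- pieces
  have p1 := bd (X ^ e) (h s)
  have p2 := bd (X ^ e) z
  have p2' := bd' (X ^ e) z
  have p3 := bd (X ^ e') (h t)
  have p3' := bd' (X ^ e') (h t)
  have q1 : (X ^ e * h s * X ^ e).norm ≤ (X ^ e * h s * (X ^ e * z)).norm + z.norm := by
    rw [← mul_assoc (_ * _) (X ^ _) _]; exact bd' _ _
  have q2 : (X ^ e * z * X ^ e').norm ≤ (X ^ e * z * (X ^ e' * h t)).norm + (h t).norm := by
    rw [← mul_assoc (_ * _) (X ^ _) _]; exact bd' _ _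
  have c1 : (X ^ e' * h t).norm + (X ^ e').norm ≤ (X ^ e' * h t * X ^ e').norm + (D1 + D2 + 10 * M) := by omega
  have c2 := chain3 (p := X ^ e * z) (q := X ^ e' * h t) (r := X ^ e') (D := D1 + D2 + 10 * M)
    (by omega) c1 (by omega)
  have c3 := chain3 (p := X ^ e * h s) (q := X ^ e * z) (r := X ^ e' * h t * X ^ e') (D := D1 + D2 + 10 * M)
    (by omega) c2 (by omega)
  have q3 := bd (X ^ e * h s) (X ^ e)
  have fin : tw κ X Z B T s * tw κ X Z B T t = Z ^ κ s *
      (X ^ e * h s * (X ^ e * z * (X ^ e' * h t * X ^ e'))) * (Z ^ κ (opp t))⁻¹ := by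
    rw [es, es, hz']; simp only [mul_assoc, ← he, ← he']
  have q4 := norm3' (Z ^ κ s) (X ^ e * h s * (X ^ e * z * (X ^ e' * h t * X ^ e'))) (Z ^ κ (opp t))⁻¹
  rw [← fin, norm_inv_eq] at q4
  have := hZM s
  have := hZM (opp t)
  omega

/-! ### transfer -/
theorem Flare.pow {φ : MulAut (FreeGroup α)} (h : Flare φ) {l : ℕ} (hl : 0 < l) : Flare (φ ^ l) := by
  intro Λ
  obtain ⟨k0, hk⟩ := h Λ
  refine ⟨k0, fun k hkk => ?_⟩
  obtain ⟨C, hC⟩ := hk (l * k) (by nlinarith)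
  exact ⟨C, by simpa only [pow_mul] using hC⟩

theorem Good.pow {φ : MulAut (FreeGroup α)} {S} (h : Good φ S) {l : ℕ} (hl : 0 < l) : Good (φ ^ l) S := by
  intro Λ
  obtain ⟨k0, hk⟩ := h Λ
  refine ⟨k0, fun k hkk => ?_⟩
  obtain ⟨C, hC⟩ := hk (l * k) (by nlinarith)
  exact ⟨C, by simpa only [pow_mul] using hC⟩

theorem Good.mono {φ : MulAut (FreeGroup α)} {S S' : Set (FreeGroup α)} (h : Good φ S) (hS : S' ⊆ S) :
    Good φ S' := by
  intro Λ
  obtain ⟨k0, hk⟩ := h Λ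
  refine ⟨k0, fun k hkk => ?_⟩
  obtain ⟨C, hC⟩ := hk k hkk
  exact ⟨C, fun a ha => hC a (hS ha)⟩

variable {γ : Type*} [DecidableEq γ]

theorem inter_pow {f : FreeGroup γ → FreeGroup α} {φ : MulAut (FreeGroup α)} {φ' : MulAut (FreeGroup γ)}
    (h : ∀ y, f (φ' y) = φ (f y)) (k : ℕ) (y : FreeGroup γ) :
    f ((φ' ^ k) y) = (φ ^ k) (f y) ∧ f ((φ' ^ k)⁻¹ y) = (φ ^ k)⁻¹ (f y) := by
  have h1 : ∀ k y, f ((φ' ^ k) y) = (φ ^ k) (f y) := by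
    intro k
    induction k with
    | zero => simp
    | succ k ih => intro y; rw [pow_succ, pow_succ, MulAut.mul_apply, ih, h]; rfl
  refine ⟨h1 k y, ?_⟩
  apply (φ ^ k).injective
  rw [← h1, MulAut.apply_inv_self, MulAut.apply_inv_self]

theorem Flare.pull {f : FreeGroup γ → FreeGroup α} {φ : MulAut (FreeGroup α)}
    {φ' : MulAut (FreeGroup γ)} (hf : Flare φ) (h : ∀ y, f (φ' y) = φ (f y)) {L1 L2 : ℕ}
    (h1 : ∀ y, y.norm ≤ L1 * (f y).norm) (h2 : ∀ y, (f y).norm ≤ L2 * y.norm) : Flare φ' := by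
  intro Λ
  obtain ⟨k0, hk⟩ := hf (L1 * (L2 + 1) * Λ)
  refine ⟨k0, fun k hkk => ?_⟩
  obtain ⟨C, hC⟩ := hk k hkk
  refine ⟨C, fun w => ?_⟩
  have e := hC (f w)
  rw [← (inter_pow h k w).1, ← (inter_pow h k w).2] at e
  have a1 := h1 w
  have a2 := h2 ((φ' ^ k) w)
  have a3 := h2 ((φ' ^ k)⁻¹ w)
  by_contra hcon
  push Not at hcon
  have b1 : (L2 + 1) * (Λ * w.norm) ≤ L1 * (L2 + 1) * Λ * (f w).norm := by
    calc (L2 + 1) * (Λ * w.norm) ≤ (L2 + 1) * (Λ * (L1 * (f w).norm)) := by gcongr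
      _ = _ := by ring
  nlinarith

theorem Good.pull {f : FreeGroup γ → FreeGroup α} {φ : MulAut (FreeGroup α)}
    {φ' : MulAut (FreeGroup γ)} {S : Set (FreeGroup α)} (hf : Good φ S) (S' : Set (FreeGroup γ))
    (hS : ∀ y ∈ S', f y ∈ S) (h : ∀ y, f (φ' y) = φ (f y)) {L1 L2 : ℕ}
    (h1 : ∀ y, y.norm ≤ L1 * (f y).norm) (h2 : ∀ y, (f y).norm ≤ L2 * y.norm) : Good φ' S' := by
  intro Λ
  obtain ⟨k0, hk⟩ := hf (L1 * (L2 + 1) * Λ)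
  refine ⟨k0, fun k hkk => ?_⟩
  obtain ⟨C, hC⟩ := hk k hkk
  refine ⟨C, fun w hw => ?_⟩
  have e := hC (f w) (hS w hw)
  rw [← (inter_pow h k w).1, ← (inter_pow h k w).2] at e
  have a1 := h1 w
  have a2 := h2 ((φ' ^ k) w)
  have a3 := h2 ((φ' ^ k)⁻¹ w)
  have b1 : (L2 + 1) * (Λ * w.norm) ≤ L1 * (L2 + 1) * Λ * (f w).norm := by
    calc (L2 + 1) * (Λ * w.norm) ≤ (L2 + 1) * (Λ * (L1 * (f w).norm)) := by gcongr
      _ = _ := by ring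
  constructor
  · by_contra hcon
    push Not at hcon
    nlinarith [e.1]
  · by_contra hcon
    push Not at hcon
    nlinarith [e.2]

end
end FT

namespace FT
open FreeGroup (of mk mk_toWord norm_one norm_inv_eq norm_of)

theorem exists_pow_stab {n : ℕ} (N : Subgroup (FreeGroup (Fin n))) (hN : N.index ≠ 0)
    (ψ : MulAut (FreeGroup (Fin n))) : ∃ l : ℕ, 0 < l ∧ ∀ g, (ψ ^ l) g ∈ N ↔ g ∈ N := by
  classical
  have : Finite (FreeGroup (Fin n) ⧸ N) := Nat.finite_of_card_ne_zero hN
  have hf : Finite (FreeGroup (Fin n) →* Equiv.Perm (FreeGroup (Fin n) ⧸ N)) :=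
    Finite.of_injective (fun f => FreeGroup.lift.symm f) FreeGroup.lift.symm.injective
  let π : FreeGroup (Fin n) →* Equiv.Perm (FreeGroup (Fin n) ⧸ N) := MulAction.toPermHom _ _
  have hπ : ∀ g, g ∈ N ↔ π g ((1 : FreeGroup (Fin n)) : FreeGroup (Fin n) ⧸ N) = ((1 : FreeGroup (Fin n)) : FreeGroup (Fin n) ⧸ N) := by
    intro g
    have : π g ((1 : FreeGroup (Fin n)) : FreeGroup (Fin n) ⧸ N) = ((g * 1 : FreeGroup (Fin n)) : FreeGroup (Fin n) ⧸ N) := rfl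
    rw [this, mul_one, eq_comm, QuotientGroup.eq]; simp
  obtain ⟨i, j, hij, he⟩ := Finite.exists_ne_map_eq_of_infinite
    (fun j : ℕ => π.comp ((ψ ^ j : MulAut (FreeGroup (Fin n))) : FreeGroup (Fin n) ≃* FreeGroup (Fin n)).toMonoidHom)
  have main : ∀ i j : ℕ, i < j → (∀ g, π ((ψ ^ i) g) = π ((ψ ^ j) g)) →
      ∃ l : ℕ, 0 < l ∧ ∀ g, (ψ ^ l) g ∈ N ↔ g ∈ N := by
    intro i j hij h
    refine ⟨j - i, by omega, fun g => ?_⟩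
    have h2 := h ((ψ ^ i)⁻¹ g)
    rw [MulAut.apply_inv_self, ← MulAut.mul_apply, ← pow_sub ψ hij.le] at h2
    rw [hπ, hπ, h2]
  rcases lt_or_gt_of_ne hij with h1 | h1
  · exact main i j h1 (fun g => DFunLike.congr_fun he g)
  · exact main j i h1 (fun g => (DFunLike.congr_fun he g).symm)

def restr {G : Type*} [Group G] (N : Subgroup G) (ψ : MulAut G) (h : ∀ g, ψ g ∈ N ↔ g ∈ N) : MulAut N where
  toFun g := ⟨ψ g.1, (h _).2 g.2⟩
  invFun g := ⟨ψ⁻¹ g.1, (h _).1 (by rw [MulAut.apply_inv_self]; exact g.2)⟩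
  left_inv g := by ext; simp
  right_inv g := by ext; simp
  map_mul' a b := by ext; simp

theorem nc_aux {Y : Type*} [DecidableEq Y] {a b : Y} (hab : a ≠ b) (u v : FreeGroup Y) (e : Bool)
    (hu : ∀ f : FreeGroup Y →* Equiv.Perm (Fin 3), (∀ y, y ≠ a → y ≠ b → f (of y) = 1) → f u = 1)
    (hv : ∀ f : FreeGroup Y →* Equiv.Perm (Fin 3), (∀ y, y ≠ a → y ≠ b → f (of y) = 1) → f v = 1) :
    (u * ltr (b, e) * v) * of a ≠ of a * (u * ltr (b, e) * v) := by
  intro h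
  let f : FreeGroup Y →* Equiv.Perm (Fin 3) := FreeGroup.lift (fun y => if y = a then Equiv.swap 0 1 else
    if y = b then Equiv.swap 1 2 else 1)
  have hf : ∀ y, y ≠ a → y ≠ b → f (of y) = 1 := by
    intro y h1 h2; simp [f, h1, h2]
  have h2 := congrArg f h
  simp only [_root_.map_mul, hu f hf, hv f hf, one_mul, mul_one, lift_ltr] at h2
  have ha : f (of a) = Equiv.swap 0 1 := by simp [f]
  have hb : f (of b) = Equiv.swap 1 2 := by simp [f, hab.symm]
  rw [ha, hb] at h2
  cases e <;> simp only [sg] at h2 <;> revert h2 <;> simp <;> decide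

section twist
variable {r n : ℕ}

abbrev YY (r n : ℕ) := Option (Fin r) × Fin n

def bY (b : Fin r × Fin n) : YY r n := (some b.1, b.2)

variable (κ : (Fin r × Fin n) × Bool → ℕ) (x z : FreeGroup (YY r n)) (T : ℕ)

def thf (x z : FreeGroup (YY r n)) (T : ℤ) : YY r n → FreeGroup (YY r n)
  | (none, j) => of (none, j)
  | (some i, j) => z ^ κ ((i, j), true) * x ^ T * (z ^ κ ((i, j), true))⁻¹ * of (some i, j) *
      (z ^ κ ((i, j), false) * x ^ T * (z ^ κ ((i, j), false))⁻¹)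

theorem th_inv (i0 i1 : Fin n) (T : ℤ) : ((FreeGroup.lift (thf κ (of (none, i0)) (of (none, i1)) T)).comp
    (FreeGroup.lift (thf κ (of (none, i0)) (of (none, i1)) (-T)))) = MonoidHom.id _ := by
  apply FreeGroup.ext_hom
  rintro ⟨_ | i, j⟩
  · simp [thf]
  · simp [thf]; group

def th (i0 i1 : Fin n) (T : ℤ) : FreeGroup (YY r n) ≃* FreeGroup (YY r n) :=
  MonoidHom.toMulEquiv (FreeGroup.lift (thf κ (of (none, i0)) (of (none, i1)) T))
    (FreeGroup.lift (thf κ (of (none, i0)) (of (none, i1)) (-T)))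
    (by have := th_inv κ i0 i1 (-T); rwa [neg_neg] at this) (th_inv κ i0 i1 T)

theorem th_none (i0 i1 : Fin n) (T : ℤ) (u : FreeGroup (Fin n)) :
    th κ i0 i1 T (FreeGroup.map (fun j => ((none : Option (Fin r)), j)) u) =
      FreeGroup.map (fun j => ((none : Option (Fin r)), j)) u := by
  have : ((th κ i0 i1 T : FreeGroup (YY r n) ≃* FreeGroup (YY r n)) : FreeGroup (YY r n) →* FreeGroup (YY r n)).comp
    (FreeGroup.map (fun j => ((none : Option (Fin r)), j))) = FreeGroup.map (fun j => ((none : Option (Fin r)), j)) := by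
    apply FreeGroup.ext_hom
    intro j; simp [th, thf]
  exact DFunLike.congr_fun this u

theorem th_tw (i0 i1 : Fin n) (T : ℕ) (g : FreeGroup (YY r n) →* FreeGroup (YY r n)) (s : (Fin r × Fin n) × Bool) :
    g (th κ i0 i1 T (FreeGroup.map bY (ltr s))) =
      tw κ (g (of (none, i0))) (g (of (none, i1))) (fun s => g (ltr (bY s.1, s.2))) T s := by
  obtain ⟨⟨i, j⟩, b⟩ := s
  cases b
  · simp only [TG.ltr_false, tw, opp, sg]
    simp [th, thf, bY]
    group
  · simp only [TG.ltr_true, tw, opp, sg]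
    simp [th, thf, bY]

theorem twist (hn : 1 < n) (φ : MulAut (FreeGroup (YY r n))) (hfl : Flare φ)
    (hg : Good φ (FreeGroup.map (fun j : Fin n => ((none : Option (Fin r)), j))).range) :
    ∃ (k2 : ℕ) (θ : FreeGroup (YY r n) ≃* FreeGroup (YY r n)), 0 < k2 ∧
      (∀ u, θ (FreeGroup.map (fun j => ((none : Option (Fin r)), j)) u) =
        FreeGroup.map (fun j => ((none : Option (Fin r)), j)) u) ∧
      Good (φ ^ k2) (θ '' (FreeGroup.map (bY (r := r) (n := n))).range) := by
  obtain ⟨k0, hk0⟩ := hfl 4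
  obtain ⟨k0', hk0'⟩ := hg 4
  let k2 := k0 + k0' + 1
  obtain ⟨C, hC⟩ := hk0 k2 (by omega)
  obtain ⟨C', hC'⟩ := hk0' k2 (by omega)
  obtain ⟨κ, hκ⟩ : ∃ κ : (Fin r × Fin n) × Bool → ℕ, Function.Injective κ :=
    ⟨fun s => (Fintype.equivFin _ s : ℕ), fun a b h => by simpa [Fin.val_inj] using h⟩
  let i0 : Fin n := ⟨0, by omega⟩
  let i1 : Fin n := ⟨1, hn⟩
  have hi : i0 ≠ i1 := by simp [i0, i1]
  let x : FreeGroup (YY r n) := of (none, i0)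
  let z : FreeGroup (YY r n) := of (none, i1)
  have hxz : z * x ≠ x * z := by
    have := nc_aux (a := ((none : Option (Fin r)), i0)) (b := (none, i1)) (by simp [hi]) 1 1 true (by simp) (by simp)
    simpa [TG.ltr_true] using this
  have hB : ∀ s : (Fin r × Fin n) × Bool, ((z ^ κ s)⁻¹ * ltr (bY s.1, s.2) * z ^ κ (opp s)) * x ≠
      x * ((z ^ κ s)⁻¹ * ltr (bY s.1, s.2) * z ^ κ (opp s)) := by
    intro s
    refine nc_aux (by simp [bY]) _ _ _ (fun f hf => ?_) (fun f hf => ?_)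
    all_goals
      have := hf (none, i1) (by simp [hi.symm]) (by simp [bY])
      simp [z, this]
  have tD : ∀ g : MulAut (FreeGroup (YY r n)), _ := fun g => twist_D κ hκ (X := g x) (Z := g z)
    (aut_mul_ne (g := g) hxz) (fun s => g (ltr (bY s.1, s.2))) (fun s => by
      have := aut_mul_ne (g := g) (hB s)
      simpa only [_root_.map_mul, map_inv, map_pow] using this)
  obtain ⟨D0, h0⟩ := tD 1
  obtain ⟨D1, h1⟩ := tD (φ ^ k2)
  obtain ⟨D2, h2⟩ := tD (φ ^ k2)⁻¹
  let T := C' + D0 + D1 + D2 + 1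
  have hxT : (x ^ T).norm = T := by
    obtain ⟨c, τ, -, h⟩ := pow_norm (FreeGroup.of_ne_one ((none : Option (Fin r)), i0))
    have e1 := h 1 le_rfl
    have e2 := h 2 (by norm_num)
    have hof2 : ((of ((none : Option (Fin r)), i0)) ^ 2).norm = 2 := by
      rw [FreeGroup.norm_of_pow]
    rw [pow_one, norm_of] at e1
    rw [hof2] at e2
    have hx : c = 0 ∧ τ = 1 := by omega
    rw [h T (by omega), hx.1, hx.2]; simp
  have hxmem : x ^ T ∈ (FreeGroup.map (fun j : Fin n => ((none : Option (Fin r)), j))).range :=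
    ⟨(of i0) ^ T, by simp [x]⟩
  obtain ⟨e1, e2⟩ := hC' _ hxmem
  rw [hxT, map_pow] at e1 e2
  have tw0 := th_tw κ i0 i1 T (MonoidHom.id _)
  have up : ∀ s, (th κ i0 i1 T (FreeGroup.map bY (ltr s))).norm ≤ 2 * T + D0 := by
    intro s
    have := ((h0 T).1 s).2
    rw [MulAut.one_apply, hxT] at this
    have e := tw0 s
    simp only [MonoidHom.id_apply] at e
    rw [e]
    simpa using this
  have main : ∀ (g : MulAut (FreeGroup (YY r n))) (D : ℕ), D < (g x ^ T).norm → 4 * T + 2 * D0 + 2 * D ≤ 2 * (g x ^ T).norm →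
    (∀ s, 2 * (g x ^ T).norm ≤ (tw κ (g x) (g z) (fun s => g (ltr (bY s.1, s.2))) T s).norm + D) →
    (∀ s t, t ≠ opp s → (tw κ (g x) (g z) (fun s => g (ltr (bY s.1, s.2))) T s).norm + (tw κ (g x) (g z) (fun s => g (ltr (bY s.1, s.2))) T t).norm ≤
      (tw κ (g x) (g z) (fun s => g (ltr (bY s.1, s.2))) T s * tw κ (g x) (g z) (fun s => g (ltr (bY s.1, s.2))) T t).norm + D) →
    ∀ u, 2 * (th κ i0 i1 T (FreeGroup.map bY u)).norm ≤ (g (th κ i0 i1 T (FreeGroup.map bY u))).norm := by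
    intro g D hD hT2 hlo hpair u
    let G : FreeGroup (Fin r × Fin n) →* FreeGroup (YY r n) :=
      ((th κ i0 i1 T : FreeGroup (YY r n) ≃* FreeGroup (YY r n)) : FreeGroup (YY r n) →* FreeGroup (YY r n)).comp (FreeGroup.map bY)
    let Fh : FreeGroup (Fin r × Fin n) →* FreeGroup (YY r n) :=
      ((g : FreeGroup (YY r n) ≃* FreeGroup (YY r n)) : FreeGroup (YY r n) →* FreeGroup (YY r n)).comp G
    have eF : ∀ s, Fh (ltr s) = tw κ (g x) (g z) (fun s => g (ltr (bY s.1, s.2))) T s :=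
      fun s => th_tw κ i0 i1 T ((g : FreeGroup (YY r n) ≃* FreeGroup (YY r n)) : FreeGroup (YY r n) →* FreeGroup (YY r n)) s
    refine L2G_cmp Fh G D 2 (fun s t hst => ?_) (fun s => ?_) (fun s => ?_) u
    · rw [eF, eF]; exact hpair s t hst
    · rw [eF]; have := hlo s; omega
    · rw [eF]; have := hlo s; have : (G (ltr s)).norm ≤ 2 * T + D0 := up s
      omega
  refine ⟨k2, th κ i0 i1 T, by omega, th_none κ i0 i1 T, good_of_two _ _ 0 C ?_ hC⟩
  rintro _ ⟨_, ⟨u, rfl⟩, rfl⟩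
  constructor
  · exact main (φ ^ k2) D1 (by omega) (by omega) (fun s => ((h1 T).1 s).1) ((h1 T).2 (by omega)) u
  · exact main (φ ^ k2)⁻¹ D2 (by omega) (by omega) (fun s => ((h2 T).1 s).1) ((h2 T).2 (by omega)) u
end twist
end FT

namespace FT
open FreeGroup (of mk mk_toWord norm_one norm_inv_eq norm_of)

theorem inter_pow' {G G' : Type*} [Group G] [Group G'] {f : G → G'} {φ : MulAut G'} {φ' : MulAut G}
    (h : ∀ y, f (φ' y) = φ (f y)) (k : ℕ) (y : G) : f ((φ' ^ k) y) = (φ ^ k) (f y) := by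
  induction k generalizing y with
  | zero => simp
  | succ k ih => rw [pow_succ, pow_succ, MulAut.mul_apply, ih, h]; rfl

theorem assemble {n : ℕ} (hn : 1 < n) (φ : MulAut (FreeGroup (Fin n))) (hfl : Flare φ)
    {w w' : FreeGroup (Fin n)} (hww : w' * w ≠ w * w') (m : ℕ) (hm : 0 < m) :
    ∃ (N : Subgroup (FreeGroup (Fin n))) (l r : ℕ) (φ₁ : MulAut N) (e : N ≃* FreeGroup (YY r n))
      (φ3 : MulAut (FreeGroup (YY r n))), N.index ≠ 0 ∧ 0 < l ∧ m ∣ l ∧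
      (∀ k : N, (φ₁ k : FreeGroup (Fin n)) = (φ ^ l) k) ∧ (∀ k, φ3 (e k) = e (φ₁ k)) ∧ Flare φ3 ∧
      (∀ i : Option (Fin r), Good φ3 (FreeGroup.map (fun j : Fin n => (i, j))).range) ∧
      ∀ x ∈ (FreeGroup.map (fun j : Fin n => ((none : Option (Fin r)), j))).range,
        (e.symm x : FreeGroup (Fin n)) ∈ Subgroup.closure {w, w'} := by
  classical
  obtain ⟨k1, a, hk1, ha, hinj, hidx, hgood⟩ := base_A (by omega) (φ ^ m) (hfl.pow hm) hww
  obtain ⟨N, hN, hAN, r, e0, he0, hmem⟩ := marshall n (by omega) a hinj _ rfl hidx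
  obtain ⟨l1, hl1, hst⟩ := exists_pow_stab N hN ((φ ^ m) ^ k1)
  let ρ := restr N _ hst
  have hρ : ∀ k : N, (ρ k : FreeGroup (Fin n)) = (((φ ^ m) ^ k1) ^ l1) k := fun k => rfl
  let φY : MulAut (FreeGroup (YY r n)) := (e0.symm.trans ρ).trans e0
  have hφY : ∀ k, φY (e0 k) = e0 (ρ k) := fun k => by
    change e0 (ρ (e0.symm (e0 k))) = _
    rw [e0.symm_apply_apply]
  let f : FreeGroup (YY r n) → FreeGroup (Fin n) := fun y => (e0.symm y).1
  have hf : ∀ y, f (φY y) = (((φ ^ m) ^ k1) ^ l1) (f y) := fun y => by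
    obtain ⟨k, rfl⟩ := e0.surjective y
    simp only [f]; rw [hφY, e0.symm_apply_apply, e0.symm_apply_apply, hρ]
  have hL1 : ∀ y, y.norm ≤ 1 * (f y).norm := fun y => by
    have := he0 (e0.symm y); rw [e0.apply_symm_apply] at this; simpa [f] using this
  obtain ⟨L2, -, hL2⟩ := exists_lip (N.subtype.comp e0.symm.toMonoidHom)
  have hL2' : ∀ y, (f y).norm ≤ L2 * y.norm := hL2
  have hflY : Flare φY := (((hfl.pow hm).pow hk1).pow hl1).pull hf hL1 hL2'
  have hA : ∀ y ∈ ((FreeGroup.map (fun j : Fin n => ((none : Option (Fin r)), j))).range : Set _),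
      f y ∈ (FreeGroup.lift a).range := fun y hy => by
    rw [hmem, e0.apply_symm_apply]; exact hy
  have hgY : Good φY (FreeGroup.map (fun j : Fin n => ((none : Option (Fin r)), j))).range :=
    (hgood.pow hl1).pull _ hA hf hL1 hL2'
  obtain ⟨k2, θ, hk2, hθ, hB⟩ := twist hn φY hflY hgY
  let φ3 : MulAut (FreeGroup (YY r n)) := (θ.trans (φY ^ k2 : MulAut _)).trans θ.symm
  have h3 : ∀ y, θ (φ3 y) = (φY ^ k2) (θ y) := fun y => by
    change θ (θ.symm _) = _
    rw [θ.apply_symm_apply]; rfl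
  obtain ⟨M1, -, hM1⟩ := exists_lip θ.symm.toMonoidHom
  obtain ⟨M2, -, hM2⟩ := exists_lip θ.toMonoidHom
  have hM1' : ∀ y, y.norm ≤ M1 * (θ y).norm := fun y => by
    have := hM1 (θ y)
    simpa using this
  have hM2' : ∀ y, (θ y).norm ≤ M2 * y.norm := hM2
  have hθs : ∀ u, θ.symm (FreeGroup.map (fun j => ((none : Option (Fin r)), j)) u) =
        FreeGroup.map (fun j => ((none : Option (Fin r)), j)) u := fun u => by
    rw [MulEquiv.symm_apply_eq, hθ]
  refine ⟨N, m * k1 * l1 * k2, r, ρ ^ k2, e0.trans θ.symm, φ3, hN, by positivity,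
    ⟨k1 * l1 * k2, by ring⟩, ?_, ?_, (hflY.pow hk2).pull h3 hM1' hM2', ?_, ?_⟩
  · intro k
    rw [(inter_pow' hρ k2 k), ← pow_mul, ← pow_mul, ← pow_mul]; simp only [mul_assoc]
  · intro k
    apply θ.injective
    rw [h3]
    simp only [MulEquiv.trans_apply, MulEquiv.apply_symm_apply]
    exact (inter_pow' (fun y => (hφY y).symm) k2 k).symm
  · rintro (_ | i)
    · refine (hgY.pow hk2).pull _ ?_ h3 hM1' hM2'
      rintro _ ⟨u, rfl⟩
      exact ⟨u, (hθ u).symm⟩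
    · refine hB.pull _ ?_ h3 hM1' hM2'
      rintro _ ⟨u, rfl⟩
      refine ⟨_, ⟨FreeGroup.map (fun j => (i, j)) u, rfl⟩, ?_⟩
      rw [FreeGroup.map.comp]; rfl
  · rintro _ ⟨u, rfl⟩
    have : f (FreeGroup.map (fun j : Fin n => ((none : Option (Fin r)), j)) u) ∈ (FreeGroup.lift a).range :=
      hA _ ⟨u, rfl⟩
    have h2 : (FreeGroup.lift a).range ≤ Subgroup.closure {w, w'} := by
      apply FreeGroup.range_lift_le
      rintro _ ⟨i, rfl⟩; exact ha i
    have h3 := h2 this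
    change ((e0.symm (θ.symm.symm _) : N) : FreeGroup (Fin n)) ∈ _
    rw [MulEquiv.symm_symm, hθ]
    exact h3
end FT

namespace FT
open FreeGroup (of mk mk_toWord norm_one norm_inv_eq norm_of)

section syl
variable {I J : Type*} [DecidableEq I] [DecidableEq J]

/-- inclusion of a block -/
def bi (i : I) : FreeGroup J →* FreeGroup (I × J) := FreeGroup.map (fun j => (i, j))

/-- product of a syllable list -/
def sP (l : List (I × FreeGroup J)) : FreeGroup (I × J) := (l.map fun p => bi p.1 p.2).prod

/-- reduced syllable lists -/
def sV (l : List (I × FreeGroup J)) : Prop := l.IsChain (fun p q => p.1 ≠ q.1) ∧ ∀ p ∈ l, p.2 ≠ 1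

/-- the word of a syllable list -/
def sW (l : List (I × FreeGroup J)) : List ((I × J) × Bool) :=
  (l.map fun p => p.2.toWord.map fun s => ((p.1, s.1), s.2)).flatten

theorem sP_cons (p : I × FreeGroup J) (l) : sP (p :: l) = bi p.1 p.2 * sP l := by simp [sP]
theorem sP_nil : sP ([] : List (I × FreeGroup J)) = 1 := rfl

theorem sP_eq (l : List (I × FreeGroup J)) : sP l = mk (sW l) := by
  induction l with
  | nil => rfl
  | cons p l ih =>
    rw [sP_cons, ih]
    have : bi p.1 p.2 = mk (p.2.toWord.map fun s => ((p.1, s.1), s.2)) := by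
      conv_lhs => rw [← mk_toWord (x := p.2)]
      exact FreeGroup.map.mk
    rw [this, FreeGroup.mul_mk]
    simp [sW]

theorem sV_tail {p : I × FreeGroup J} {l} (h : sV (p :: l)) : sV l :=
  ⟨h.1.tail, fun q hq => h.2 q (List.mem_cons_of_mem _ hq)⟩

theorem sW_head {l : List (I × FreeGroup J)} (h : sV l) : ∀ a ∈ (sW l).head?, ∃ q ∈ l.head?, q.1 = a.1.1 := by
  cases l with
  | nil => simp [sW]
  | cons p l =>
    intro a ha
    refine ⟨p, by simp, ?_⟩
    have hp : p.2.toWord ≠ [] := by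
      intro h0; exact h.2 p (by simp) (FreeGroup.toWord_eq_nil_iff.1 h0)
    obtain ⟨x, L, hL⟩ := List.exists_cons_of_ne_nil hp
    simp [sW, hL] at ha
    rw [← ha]

theorem sW_red {l : List (I × FreeGroup J)} (h : sV l) : FreeGroup.IsReduced (sW l) := by
  induction l with
  | nil => simp [sW]
  | cons p l ih =>
    have : sW (p :: l) = (p.2.toWord.map fun s => ((p.1, s.1), s.2)) ++ sW l := by simp [sW]
    rw [this, FreeGroup.IsReduced, List.isChain_append]
    refine ⟨?_, ih (sV_tail h), ?_⟩
    · rw [List.isChain_map]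
      refine (FreeGroup.isReduced_toWord (x := p.2)).imp ?_
      intro a b hab hh
      exact hab (by simpa using hh)
    · intro x hx y hy
      obtain ⟨q, hq, hqe⟩ := sW_head (sV_tail h) y hy
      intro hxy
      exfalso
      cases l with
      | nil => simp at hq
      | cons q' l =>
        simp at hq; subst hq
        have := (List.isChain_cons_cons.1 h.1).1
        apply this
        rw [List.getLast?_map] at hx
        rw [Option.mem_map] at hx
        obtain ⟨z, -, rfl⟩ := hx
        rw [hqe, ← hxy]

theorem sP_norm {l : List (I × FreeGroup J)} (h : sV l) : (sP l).norm = (l.map fun p => p.2.norm).sum := by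
  rw [sP_eq, norm_mk_of_red (sW_red h)]
  simp [sW, List.length_flatten, Function.comp_def, FreeGroup.norm]

theorem bi_norm (i : I) (g : FreeGroup J) : (bi i g).norm = g.norm := by
  by_cases hg : g = 1
  · subst hg; simp
  · have := sP_norm (l := [(i, g)]) ⟨by simp, by simpa using hg⟩
    simpa [sP] using this

theorem sP_letter (i : I) (g : FreeGroup J) {l : List (I × FreeGroup J)} (h : sV l) :
    ∃ l', sV l' ∧ sP l' = bi i g * sP l := by
  by_cases hg : g = 1
  · exact ⟨l, h, by simp [hg]⟩
  cases l with
  | nil => exact ⟨[(i, g)], ⟨by simp, by simpa using hg⟩, by simp [sP]⟩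
  | cons p l =>
    by_cases hp : i = p.1
    · by_cases h1 : g * p.2 = 1
      · refine ⟨l, sV_tail h, ?_⟩
        rw [sP_cons, ← mul_assoc, ← hp, ← map_mul, h1]; simp
      · refine ⟨(i, g * p.2) :: l, ⟨?_, ?_⟩, ?_⟩
        · have := h.1
          rw [List.isChain_cons] at this ⊢
          simpa [hp] using this
        · intro q hq
          rcases List.mem_cons.1 hq with rfl | hq
          · exact h1
          · exact h.2 q (List.mem_cons_of_mem _ hq)
        · rw [sP_cons, sP_cons, ← mul_assoc, ← hp, ← map_mul]
    · refine ⟨(i, g) :: p :: l, ⟨?_, ?_⟩, sP_cons _ _⟩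
      · exact List.isChain_cons_cons.2 ⟨hp, h.1⟩
      · intro q hq
        rcases List.mem_cons.1 hq with rfl | hq
        · exact hg
        · exact h.2 q hq

theorem sP_surj (w : FreeGroup (I × J)) : ∃ l : List (I × FreeGroup J), sV l ∧ sP l = w := by
  induction w using ind_letter with
  | h1 => exact ⟨[], ⟨by simp, by simp⟩, rfl⟩
  | hs u v hu huv ih =>
    obtain ⟨l, hl, rfl⟩ := ih
    obtain ⟨⟨⟨i, j⟩, b⟩, rfl⟩ := norm_one_ltr hu
    have : ltr ((i, j), b) = bi i (ltr (j, b)) := by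
      cases b
      · simp [TG.ltr_false, bi]
      · simp [TG.ltr_true, bi]
    rw [this]
    exact sP_letter i _ hl

theorem aut_sP {a : FreeGroup (I × J) →* FreeGroup (I × J)} {b : MulAut (FreeGroup J)}
    (h : ∀ i g, a (bi i g) = bi i (b g)) {l : List (I × FreeGroup J)} (hl : sV l) :
    (a (sP l)).norm = (l.map fun p => (b p.2).norm).sum ∧ l.length ≤ (a (sP l)).norm := by
  have e : a (sP l) = sP (l.map fun p => (p.1, b p.2)) := by
    simp only [sP, map_list_prod, List.map_map]
    congr 1
    apply List.map_congr_left
    intro p _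
    simp [h]
  have v : sV (l.map fun p => (p.1, b p.2)) := by
    refine ⟨?_, ?_⟩
    · rw [List.isChain_map]; exact hl.1
    · intro q hq
      obtain ⟨p, hp, rfl⟩ := List.mem_map.1 hq
      have := hl.2 p hp
      simpa using this
  have e2 : (a (sP l)).norm = (l.map fun p => (b p.2).norm).sum := by
    rw [e, sP_norm v, List.map_map]; rfl
  refine ⟨e2, ?_⟩
  rw [e2]
  have h3 : ∀ x ∈ l.map (fun p => (b p.2).norm), 1 ≤ x := by
    intro x hx
    obtain ⟨p, hp, rfl⟩ := List.mem_map.1 hx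
    have := hl.2 p hp
    have h0 : (b p.2).norm ≠ 0 := by
      rw [Ne, FreeGroup.norm_eq_zero]; simpa using this
    omega
  have := List.length_le_sum_of_one_le _ h3
  simpa using this

/-- blockwise endomorphism -/
def blkH (f : FreeGroup J →* FreeGroup J) : FreeGroup (I × J) →* FreeGroup (I × J) :=
  FreeGroup.lift fun p => bi p.1 (f (of p.2))

theorem blkH_bi (f : FreeGroup J →* FreeGroup J) (i : I) (g : FreeGroup J) :
    blkH f (bi i g) = bi i (f g) := by
  have : (blkH f).comp (bi i) = (bi i).comp f := by
    apply FreeGroup.ext_hom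
    intro j; simp [blkH, bi]
  exact DFunLike.congr_fun this g

theorem blkH_comp (f g : FreeGroup J →* FreeGroup J) (h : f.comp g = MonoidHom.id _) :
    (blkH (I := I) f).comp (blkH g) = MonoidHom.id _ := by
  apply FreeGroup.ext_hom
  rintro ⟨i, j⟩
  have : (of (i, j) : FreeGroup (I × J)) = bi i (of j) := by simp [bi]
  rw [this, MonoidHom.comp_apply, blkH_bi, blkH_bi, show f (g (of j)) = of j from DFunLike.congr_fun h (of j)]; rfl

/-- blockwise automorphism -/
def blk (b : MulAut (FreeGroup J)) : MulAut (FreeGroup (I × J)) :=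
  MonoidHom.toMulEquiv (blkH b.toMonoidHom) (blkH b.symm.toMonoidHom)
    (blkH_comp _ _ (by ext; simp)) (blkH_comp _ _ (by ext; simp))

theorem blk_bi (b : MulAut (FreeGroup J)) (i : I) (g : FreeGroup J) : blk b (bi i g) = bi i (b g) :=
  blkH_bi _ _ _

theorem blk_pow (b : MulAut (FreeGroup J)) (k : ℕ) (i : I) (g : FreeGroup J) :
    ((blk b) ^ k) (bi i g) = bi i ((b ^ k) g) :=
  (inter_pow' (f := fun g => bi i g) (φ := blk b) (φ' := b) (fun g => (blk_bi b i g).symm) k g).symm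

theorem blk_pow_inv (b : MulAut (FreeGroup J)) (k : ℕ) (i : I) (g : FreeGroup J) :
    ((blk b) ^ k)⁻¹ (bi i g) = bi i ((b ^ k)⁻¹ g) := by
  apply ((blk b) ^ k : MulAut (FreeGroup (I × J))).injective
  rw [MulAut.apply_inv_self, blk_pow, MulAut.apply_inv_self]

/-- strict flare -/
def SFlare {X : Type*} [DecidableEq X] (b : MulAut (FreeGroup X)) : Prop :=
  ∀ Λ : ℕ, ∃ j0, ∀ j ≥ j0, ∀ g, Λ * g.norm ≤ ((b ^ j) g).norm + ((b ^ j)⁻¹ g).norm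

theorem SFlare.blk {b : MulAut (FreeGroup J)} (h : SFlare b) :
    SFlare (blk b : MulAut (FreeGroup (I × J))) := by
  intro Λ
  obtain ⟨j0, hj⟩ := h Λ
  refine ⟨j0, fun j hjj w => ?_⟩
  obtain ⟨l, hl, rfl⟩ := sP_surj w
  rw [sP_norm hl]
  have e1 := (aut_sP (a := ((FT.blk b) ^ j : MulAut (FreeGroup (I × J))).toMonoidHom) (b := b ^ j)
    (fun i g => blk_pow b j i g) hl).1
  have e2 := (aut_sP (a := (((FT.blk b) ^ j)⁻¹ : MulAut (FreeGroup (I × J))).toMonoidHom) (b := (b ^ j)⁻¹)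
    (fun i g => blk_pow_inv b j i g) hl).1
  change (((FT.blk b) ^ j) (sP l)).norm = _ at e1
  change (((FT.blk b) ^ j)⁻¹ (sP l)).norm = _ at e2
  rw [e1, e2, ← List.sum_map_mul_left, ← List.sum_map_add]
  exact List.sum_le_sum fun p _ => hj j hjj p.2

theorem good_syl {f : MulAut (FreeGroup (I × J))} {B C Λ : ℕ}
    (hB : ∀ x y, (x * y).norm = x.norm + y.norm → (f x).norm + (f y).norm ≤ (f (x * y)).norm + B)
    (hC : ∀ i g, Λ * (bi i g).norm ≤ (f (bi i g)).norm + C) {l : List (I × FreeGroup J)} (hl : sV l) :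
    Λ * (sP l).norm ≤ (f (sP l)).norm + l.length * (B + C) := by
  induction l with
  | nil => simp [sP_nil]
  | cons p l ih =>
    have h1 := ih (sV_tail hl)
    have e : (sP (p :: l)).norm = (bi p.1 p.2).norm + (sP l).norm := by
      rw [sP_norm hl, sP_norm (sV_tail hl), bi_norm]; simp
    rw [sP_cons] at e
    have h2 := hB _ _ e
    have h3 := hC p.1 p.2
    rw [sP_cons, e, List.length_cons]
    nlinarith
end syl
end FT

namespace FT
open FreeGroup (of mk mk_toWord norm_one norm_inv_eq norm_of)

theorem rec_half (h : ℕ → ℤ) (h0 : 1 ≤ h 0) (h1 : 2 * h 0 ≤ h 1)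
    (hr : ∀ j, 4 * h (j + 1) ≤ h j + h (j + 2)) (j : ℕ) : 2 ^ j * h 0 ≤ h j := by
  have key : ∀ j, 2 ^ j * h 0 ≤ h j ∧ 2 * h j ≤ h (j + 1) := by
    intro j
    induction j with
    | zero => simpa using h1
    | succ j ih =>
      have := hr j
      have p : 0 < 2 ^ j * h 0 := by positivity
      refine ⟨by rw [pow_succ]; linarith, by linarith⟩
  exact (key j).1

theorem rec_two (h : ℤ → ℤ) (h0 : 1 ≤ h 0) (hr : ∀ j, 4 * h j ≤ h (j - 1) + h (j + 1)) :
    (∀ j : ℕ, 2 ^ j * h 0 ≤ h j) ∨ (∀ j : ℕ, 2 ^ j * h 0 ≤ h (-j)) := by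
  have r0 := hr 0
  by_cases c : 2 * h 0 ≤ h 1
  · left
    intro j
    refine rec_half (fun j => h j) (by simpa using h0) (by simpa using c) (fun j => ?_) j
    have := hr (j + 1)
    push_cast
    rw [show ((j : ℤ) + 1 - 1) = j by ring, show ((j : ℤ) + 1 + 1) = j + 2 by ring] at this
    exact this
  · right
    intro j
    simp only [zero_sub, zero_add] at r0
    have := rec_half (fun j => h (-j)) (by simpa using h0) (by simp; omega) (fun j => ?_) j
    · simpa using this
    have := hr (-(j + 1))
    push_cast
    rw [show (-((j : ℤ) + 1) - 1) = -(j + 2) by ring, show (-((j : ℤ) + 1) + 1) = -j by ring] at this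
    linarith

variable {J : Type*} [DecidableEq J]

theorem strict [Finite J] (φ : MulAut (FreeGroup J)) (hf : Flare φ) : ∃ k1, 0 < k1 ∧ SFlare (φ ^ k1) := by
  obtain ⟨k0, hk0⟩ := hf 4
  obtain ⟨C0, hC0⟩ := hk0 (k0 + 1) (by omega)
  obtain ⟨C, hC1, hC0C⟩ : ∃ C : ℕ, 1 ≤ C ∧ C0 ≤ C := ⟨C0 + 1, by omega, by omega⟩
  refine ⟨k0 + 1, by omega, ?_⟩
  obtain ⟨b, hb⟩ : ∃ b, b = φ ^ (k0 + 1) := ⟨_, rfl⟩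
  rw [← hb] at hC0 ⊢
  -- two sided growth
  have grow : ∀ g : FreeGroup J, C ≤ g.norm →
      (∀ j : ℕ, 2 ^ j * g.norm ≤ 2 * ((b ^ (j : ℤ)) g).norm) ∨
      (∀ j : ℕ, 2 ^ j * g.norm ≤ 2 * ((b ^ (-(j : ℤ))) g).norm) := by
    intro g hg
    have := rec_two (fun j => 2 * (((b ^ j) g).norm : ℤ) - C) (by simp; omega) (by
      intro j
      have := hC0 ((b ^ j) g)
      have e1 : b ((b ^ j) g) = (b ^ (j + 1)) g := by
        rw [add_comm, zpow_add, zpow_one]; rfl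
      have e2 : b⁻¹ ((b ^ j) g) = (b ^ (j - 1)) g := by
        rw [sub_eq_add_neg, add_comm, zpow_add, zpow_neg_one]; rfl
      rw [e1, e2] at this
      omega)
    refine this.imp ?_ ?_ <;>
    · intro h j
      have h2 := h j
      simp only [zpow_zero, MulAut.one_apply] at h2
      have p : (0 : ℤ) < 2 ^ j := by positivity
      have : (2 : ℤ) ^ j * g.norm ≤ 2 ^ j * (2 * g.norm - C) :=
        mul_le_mul_of_nonneg_left (by omega) p.le
      zify
      omega
  -- escape
  have esc : ∀ g : FreeGroup J, g ≠ 1 → ∃ t : ℕ, C ≤ ((b ^ t) g).norm := by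
    intro g hg
    by_contra hcon
    push Not at hcon
    have hfin := fball_finite (α := J) C
    obtain ⟨s, t, hst, he⟩ : ∃ s t : ℕ, s < t ∧ (b ^ s) g = (b ^ t) g := by
      obtain ⟨s, -, t, -, hne, he⟩ := Set.infinite_univ.exists_ne_map_eq_of_mapsTo (s := (Set.univ : Set ℕ))
        (f := fun t : ℕ => (b ^ t) g) (t := {x : FreeGroup J | x.norm ≤ C})
        (fun t _ => (hcon t).le) hfin
      rcases lt_or_gt_of_ne hne with h | h
      · exact ⟨s, t, h, he⟩
      · exact ⟨t, s, h, he.symm⟩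
    obtain ⟨p, rfl⟩ : ∃ p, t = s + (p + 1) := ⟨t - s - 1, by omega⟩
    have hfix : (b ^ (p + 1)) g = g := by
      rw [pow_add, MulAut.mul_apply] at he
      exact ((b ^ s).injective he).symm
    obtain ⟨c, τ, hτ, hpn⟩ := pow_norm hg
    have hn := hpn (C + 1) (by omega)
    have hge : C ≤ (g ^ (C + 1)).norm := by rw [hn]; nlinarith
    have hfixz : ∀ q : ℤ, (b ^ (((p : ℤ) + 1) * q)) (g ^ (C + 1)) = g ^ (C + 1) := by
      intro q
      have h1 : (b ^ (p + 1)) ∈ MulAction.stabilizer (MulAut (FreeGroup J)) (g ^ (C + 1)) := by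
        rw [MulAction.mem_stabilizer_iff, MulAut.smul_def, map_pow, hfix]
      have h2 := zpow_mem h1 q
      rw [MulAction.mem_stabilizer_iff, MulAut.smul_def, ← zpow_natCast, ← zpow_mul] at h2
      push_cast at h2; exact h2
    have hpos : 0 < (g ^ (C + 1)).norm := by omega
    have big : 2 ^ 2 ≤ 2 ^ ((p + 1) * 2) := Nat.pow_le_pow_right (by norm_num) (by omega)
    rcases grow _ hge with h | h
    · have h1 := h ((p + 1) * 2)
      have h2 := hfixz 2
      rw [show (((p + 1) * 2 : ℕ) : ℤ) = ((p : ℤ) + 1) * 2 by push_cast; ring, h2] at h1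
      nlinarith
    · have h1 := h ((p + 1) * 2)
      have h2 := hfixz (-2)
      rw [show (-(((p + 1) * 2 : ℕ) : ℤ)) = ((p : ℤ) + 1) * (-2) by push_cast; ring, h2] at h1
      nlinarith
  obtain ⟨J1, hJ1⟩ : ∃ J1, ∀ g : FreeGroup J, g ≠ 1 → ∃ t ≤ J1, C ≤ ((b ^ t) g).norm ∧ g.norm ≤ ((b ^ t) g).norm := by
    have hfin := fball_finite (α := J) C
    have : ∀ g : FreeGroup J, ∃ t : ℕ, g ≠ 1 → C ≤ ((b ^ t) g).norm := fun g => by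
      by_cases hg : g = 1
      · exact ⟨0, fun h => absurd hg h⟩
      · obtain ⟨t, ht⟩ := esc g hg; exact ⟨t, fun _ => ht⟩
    choose T hT using this
    obtain ⟨M, hM⟩ := (hfin.image T).bddAbove
    refine ⟨M, fun g hg => ?_⟩
    by_cases hgn : g.norm ≤ C
    · exact ⟨T g, hM ⟨g, hgn, rfl⟩, hT g hg, hgn.trans (hT g hg)⟩
    · exact ⟨0, by omega, by simp; omega, by simp⟩
  intro Λ
  refine ⟨J1 + 2 * Λ, fun j hj g => ?_⟩
  by_cases hg : g = 1
  · subst hg; simp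
  obtain ⟨t, ht, hc, hgt⟩ := hJ1 g hg
  have e1 : ∀ k : ℤ, (b ^ k) ((b ^ t) g) = (b ^ (k + t)) g := by
    intro k; rw [zpow_add, zpow_natCast]; rfl
  have p1 : ∀ i, Λ * 2 ≤ i → 2 * Λ ≤ 2 ^ i := fun i hi => by
    have := Nat.lt_two_pow_self (n := i); omega
  have ep : (b ^ j) g = (b ^ (j : ℤ)) g := by rw [zpow_natCast]
  have em : (b ^ j)⁻¹ g = (b ^ (-(j : ℤ))) g := by rw [zpow_neg, zpow_natCast]
  rw [ep, em]
  rcases grow _ hc with h | h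
  · have h1 := h (j - t)
    rw [e1, show ((j - t : ℕ) : ℤ) + t = j by omega] at h1
    have h2 := Nat.mul_le_mul (p1 (j - t) (by omega)) hgt
    nlinarith
  · have h1 := h (j + t)
    rw [e1, show -((j + t : ℕ) : ℤ) + t = -j by push_cast; ring] at h1
    have h2 := Nat.mul_le_mul (p1 (j + t) (by omega)) hgt
    nlinarith
end FT

namespace FT
open FreeGroup (of mk mk_toWord norm_one norm_inv_eq norm_of)

section
variable {α σ : Type*} [DecidableEq α] [DecidableEq σ]

/-- flare with constant 20 -/
def FL20 (ρ : FreeGroup σ →* MulAut (FreeGroup α)) : Prop := ∃ C : ℕ, ∀ s s' : σ × Bool, s ≠ s' → ∀ w : FreeGroup α,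
      20 * w.norm ≤ ((ρ (ltr s))⁻¹ w).norm + ((ρ (ltr s'))⁻¹ w).norm + C

theorem FL20.FL {ρ : FreeGroup σ →* MulAut (FreeGroup α)} (h : FL20 ρ) : FL ρ := by
  obtain ⟨C, hC⟩ := h
  exact ⟨C, fun s s' hs w => by have := hC s s' hs w; omega⟩

/-- expansion along a reduced word -/
theorem expand {ρ : FreeGroup σ →* MulAut (FreeGroup α)} {C : ℕ}
    (hC : ∀ s s' : σ × Bool, s ≠ s' → ∀ w : FreeGroup α,
      20 * w.norm ≤ ((ρ (ltr s))⁻¹ w).norm + ((ρ (ltr s'))⁻¹ w).norm + C)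
    (L : List (σ × Bool)) : ∀ (s : σ × Bool) (hL : FreeGroup.IsReduced (s :: L)) (w : FreeGroup α)
    (h0 : C ≤ w.norm) (h1 : 10 * w.norm ≤ ((ρ (ltr s))⁻¹ w).norm + 9 * C),
    10 * w.norm ≤ ((ρ (mk (s :: L)))⁻¹ w).norm + 9 * C := by
  induction L with
  | nil => intro s hL w h0 h1; exact h1
  | cons t L ih =>
    intro s hL w h0 h1
    rw [FreeGroup.isReduced_cons_cons] at hL
    have hts : opp s ≠ t := by
      intro h
      have := hL.1
      rw [← h] at this
      simp [opp] at this
    have e := hC (opp s) t hts ((ρ (ltr s))⁻¹ w)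
    have e1 : (ρ (ltr (opp s)))⁻¹ ((ρ (ltr s))⁻¹ w) = w := by
      rw [ltr_opp, _root_.map_inv, inv_inv, MulAut.apply_inv_self]
    rw [e1] at e
    have i := ih t hL.2 ((ρ (ltr s))⁻¹ w) (by omega) (by omega)
    have e2 : (ρ (mk (s :: t :: L)))⁻¹ w = (ρ (mk (t :: L)))⁻¹ ((ρ (ltr s))⁻¹ w) := by
      have : mk (s :: t :: L) = ltr s * mk (t :: L) := by simp [ltr, FreeGroup.mul_mk]
      rw [this, _root_.map_mul, mul_inv_rev]; rfl
    rw [e2]; omega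

theorem cyc_flare {ρ : FreeGroup σ →* MulAut (FreeGroup α)} (h : FL20 ρ) (c : FreeGroup σ) (hc : c ≠ 1) :
    ∃ (c' v : FreeGroup σ) (C : ℕ), c = v * c' * v⁻¹ ∧
      ∀ w, 10 * w.norm ≤ (ρ c' w).norm + ((ρ c')⁻¹ w).norm + C := by
  obtain ⟨C, hC⟩ := h
  let L := FreeGroup.reduceCyclically c.toWord
  have hcyc : FreeGroup.IsCyclicallyReduced L :=
    FreeGroup.reduceCyclically.isCyclicallyReduced FreeGroup.isReduced_toWord
  have hconj : c = mk (FreeGroup.reduceCyclically.conjugator c.toWord) * mk L *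
      (mk (FreeGroup.reduceCyclically.conjugator c.toWord))⁻¹ := by
    conv_lhs => rw [← mk_toWord (x := c), ← FreeGroup.reduceCyclically.conj_conjugator_reduceCyclically c.toWord]
    rw [FreeGroup.inv_mk, FreeGroup.mul_mk, FreeGroup.mul_mk]
  refine ⟨mk L, _, 10 * C, hconj, ?_⟩
  have hLne : L ≠ [] := by
    intro h0
    rw [h0] at hconj
    apply hc
    rw [hconj, ← FreeGroup.one_eq_mk]; group
  obtain ⟨s, L1, hs⟩ := List.exists_cons_of_ne_nil hLne
  have hLi : FreeGroup.invRev L ≠ [] := by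
    intro h0
    have := congrArg List.length h0
    rw [FreeGroup.invRev_length, hs] at this; simp at this
  obtain ⟨t, L2, ht⟩ := List.exists_cons_of_ne_nil hLi
  have hst : s ≠ t := by
    intro hst
    have hl : opp t ∈ L.getLast? := by
      have h1 : (FreeGroup.invRev L).head? = some t := by rw [ht]; rfl
      rw [FreeGroup.invRev, List.head?_reverse, List.getLast?_map] at h1
      rw [Option.map_eq_some_iff] at h1
      obtain ⟨a, ha, rfl⟩ := h1
      rw [ha]; simp [opp]
    have := hcyc.2 (opp t) hl s (by rw [hs]; simp)
    rw [hst] at this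
    simp [opp] at this
  have r1 : FreeGroup.IsReduced (s :: L1) := hs ▸ hcyc.1
  have r2 : FreeGroup.IsReduced (t :: L2) := by
    have := FreeGroup.isReduced_toWord (x := (mk L)⁻¹)
    rw [FreeGroup.toWord_inv, FreeGroup.toWord_mk, hcyc.1.reduce_eq, ht] at this
    exact this
  intro w
  by_cases h0 : C ≤ w.norm
  · have e := hC s t hst w
    have e2 : ρ (mk L) = (ρ (mk (t :: L2)))⁻¹ := by
      rw [← ht, ← FreeGroup.inv_mk, _root_.map_inv, inv_inv]
    by_cases h1 : 10 * w.norm ≤ ((ρ (ltr s))⁻¹ w).norm + 9 * C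
    · have := expand hC L1 s r1 w h0 h1
      rw [← hs] at this; omega
    · have := expand hC L2 t r2 w h0 (by omega)
      rw [← e2] at this; omega
  · omega

end
end FT

namespace FT
open FreeGroup (of mk mk_toWord norm_one norm_inv_eq norm_of)

theorem hyp_sd {N₁ N₂ G₁ G₂ : Type*} [Group N₁] [Group N₂] [Group G₁] [Group G₂]
    {φ₁ : G₁ →* MulAut N₁} {φ₂ : G₂ →* MulAut N₂} (fn : N₁ ≃* N₂) (fg : G₁ ≃* G₂)
    (h : ∀ g x, fn (φ₁ g x) = φ₂ (fg g) (fn x)) (hyp : IsHypGroup (N₁ ⋊[φ₁] G₁)) :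
    IsHypGroup (N₂ ⋊[φ₂] G₂) :=
  hyp_iso (SemidirectProduct.congr fn fg (fun g => by ext x; simpa using h g x)) hyp

theorem hom_conj {N₁ N₂ G : Type*} [Group N₁] [Group N₂] [Group G]
    {φ₁ : G →* MulAut N₁} {φ₂ : G →* MulAut N₂} (fn : N₁ ≃* N₂) (S : Set G) (hS : Subgroup.closure S = ⊤)
    (h : ∀ g ∈ S, ∀ x, fn (φ₁ g x) = φ₂ g (fn x)) : ∀ g x, fn (φ₁ g x) = φ₂ g (fn x) := by
  intro g
  have hg : g ∈ Subgroup.closure S := by rw [hS]; trivial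
  induction hg using Subgroup.closure_induction with
  | mem x hx => exact h x hx
  | one => intro x; simp
  | mul a b _ _ ha hb => intro x; rw [_root_.map_mul, _root_.map_mul, MulAut.mul_apply, ha, hb]; rfl
  | inv a _ ha =>
    intro x
    apply (φ₂ a).injective
    rw [_root_.map_inv, _root_.map_inv, MulAut.apply_inv_self, ← ha, MulAut.apply_inv_self]

theorem gen_int : Subgroup.closure ({Multiplicative.ofAdd 1} : Set (Multiplicative ℤ)) = ⊤ := by
  rw [← Subgroup.zpowers_eq_closure, eq_top_iff]
  intro x _
  refine ⟨x.toAdd, ?_⟩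
  simp [← ofAdd_zsmul]

theorem ator_conj {N₁ N₂ : Type*} [Group N₁] [Group N₂] {a : MulAut N₁} {b : MulAut N₂} (fn : N₁ ≃* N₂)
    (h : ∀ x, fn (a x) = b (fn x)) (hyp : AtoroidalAut a) : AtoroidalAut b := by
  refine hyp_sd fn (MulEquiv.refl _) ?_ hyp
  refine hom_conj fn _ gen_int ?_
  rintro _ rfl x
  simpa using h x

section
variable {α σ : Type*} [DecidableEq α] [DecidableEq σ]

theorem ator_of_flare [Finite α] {b : MulAut (FreeGroup α)} {C : ℕ}
    (h : ∀ w, 10 * w.norm ≤ (b w).norm + (b⁻¹ w).norm + C) : AtoroidalAut b := by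
  let ρ : FreeGroup Unit →* MulAut (FreeGroup α) := FreeGroup.lift fun _ => b
  have hρ : FL ρ := by
    refine ⟨C, ?_⟩
    have h1 : ρ (ltr ((), true)) = b := by rw [TG.ltr_true]; simp [ρ]
    have h2 : ρ (ltr ((), false)) = b⁻¹ := by rw [TG.ltr_false]; simp [ρ]
    rintro ⟨⟨⟩, _ | _⟩ ⟨⟨⟩, _ | _⟩ hs w
    · exact absurd rfl hs
    · rw [h1, h2, inv_inv]; exact h w
    · rw [h1, h2, inv_inv]; have := h w; omega
    · exact absurd rfl hs
  have := hyp_of_FL ρ hρ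
  refine hyp_sd (MulEquiv.refl _) FreeGroup.mulEquivIntOfUnique ?_ this
  intro g x
  have : ρ = (zpowersHom (MulAut (FreeGroup α)) b).comp FreeGroup.mulEquivIntOfUnique.toMonoidHom := by
    apply FreeGroup.ext_hom
    intro u
    simp [ρ, FreeGroup.mulEquivIntOfUnique, FreeGroup.equivIntOfUnique]
  rw [this]; rfl

theorem ator_of_FL20 [Finite α] {ρ : FreeGroup σ →* MulAut (FreeGroup α)} (h : FL20 ρ)
    (c : FreeGroup σ) (hc : c ≠ 1) : AtoroidalAut (ρ c) := by
  obtain ⟨c', v, C, rfl, hw⟩ := cyc_flare h c hc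
  refine ator_conj (ρ v) ?_ (ator_of_flare hw)
  intro x
  rw [_root_.map_mul, _root_.map_mul, _root_.map_inv, MulAut.mul_apply, MulAut.mul_apply, MulAut.inv_apply_self]

theorem inj_of_FL20 [Nonempty α] {ρ : FreeGroup σ →* MulAut (FreeGroup α)} (h : FL20 ρ) :
    Function.Injective ρ := by
  rw [injective_iff_map_eq_one]
  intro c hc
  by_contra hc1
  obtain ⟨c', v, C, rfl, hw⟩ := cyc_flare h c hc1
  have : ρ c' = 1 := by
    rw [_root_.map_mul, _root_.map_mul, _root_.map_inv] at hc
    exact conj_eq_one_iff.1 hc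
  obtain ⟨a⟩ := ‹Nonempty α›
  have := hw (of a ^ (C + 1))
  rw [‹ρ c' = 1›, FreeGroup.norm_of_pow] at this
  simp at this
  omega

end

section mixed
variable {I J : Type*} [DecidableEq I] [DecidableEq J]

theorem mixed [Finite I] [Finite J] (φ3 : MulAut (FreeGroup (I × J))) (hfl : Flare φ3)
    (hg : ∀ i : I, Good φ3 (bi (J := J) i).range) (b : MulAut (FreeGroup J)) (hb : SFlare b) :
    ∃ k3 M : ℕ, 0 < k3 ∧ 0 < M ∧
      (∀ i, ∃ C : ℕ, ∀ a : FreeGroup J, 10 * (bi i a).norm ≤ ((φ3 ^ k3) (bi i a)).norm + C ∧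
        10 * (bi i a).norm ≤ ((φ3 ^ k3)⁻¹ (bi i a)).norm + C) ∧
      FL20 (FreeGroup.lift ![(blk b) ^ M, φ3 ^ k3] : FreeGroup (Fin 2) →* _) := by
  obtain ⟨k0, hk0⟩ := hfl 20
  choose kg hkg using fun i => hg i 21
  obtain ⟨K, hK⟩ := (Set.finite_range kg).bddAbove
  obtain ⟨k3, h1, h2, h3⟩ : ∃ k3, k0 ≤ k3 ∧ (∀ i, kg i ≤ k3) ∧ 0 < k3 :=
    ⟨k0 + K + 1, by omega, fun i => by have := hK ⟨i, rfl⟩; omega, by omega⟩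
  obtain ⟨C0, hC0⟩ := hk0 k3 h1
  choose Cg hCg using fun i => hkg i k3 (h2 i)
  obtain ⟨C1, hC1⟩ := (Set.finite_range Cg).bddAbove
  have hC1' : ∀ i, Cg i ≤ C1 := fun i => hC1 ⟨i, rfl⟩
  obtain ⟨Bp, hBp⟩ := bcc (φ3 ^ k3)
  obtain ⟨Bm, hBm⟩ := bcc (φ3 ^ k3)⁻¹
  obtain ⟨j0, hj0⟩ := hb.blk (I := I) (Bp + Bm + C1 + 20)
  obtain ⟨M, hM⟩ : ∃ M, M = j0 + 1 := ⟨_, rfl⟩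
  have sf := hj0 M (by omega)
  have sf2 := hj0 (2 * M) (by omega)
  obtain ⟨ψ, hψ⟩ : ∃ ψ : MulAut (FreeGroup (I × J)), ψ = blk b := ⟨_, rfl⟩
  have ex : ∀ f : MulAut (FreeGroup (I × J)), (f = φ3 ^ k3 ∨ f = (φ3 ^ k3)⁻¹) →
      ∀ g : MulAut (FreeGroup (I × J)), (g = ψ ^ (2 * M) ∨ g = (ψ ^ (2 * M))⁻¹) → ∀ w : FreeGroup (I × J),
      20 * w.norm ≤ (f w).norm + (g w).norm := by
    intro f hf g hg' w
    obtain ⟨l, hl, rfl⟩ := sP_surj w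
    have e1 : 21 * (sP l).norm ≤ (f (sP l)).norm + l.length * (Bp + Bm + C1) := by
      refine good_syl ?_ ?_ hl
      · intro x y hxy
        rcases hf with rfl | rfl
        · have := hBp x y hxy; omega
        · have := hBm x y hxy; omega
      · intro i a
        have := hCg i (bi i a) ⟨a, rfl⟩
        have := hC1' i
        rcases hf with rfl | rfl <;> omega
    obtain ⟨g', hg1, hg2, hg3⟩ : ∃ g' : MulAut (FreeGroup (I × J)), (g' = ψ ^ M ∨ g' = (ψ ^ M)⁻¹) ∧
        g' * g' = g ∧ l.length ≤ (g' (sP l)).norm := by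
      subst hψ
      rcases hg' with rfl | rfl
      · refine ⟨_, Or.inl rfl, by rw [← pow_add, two_mul], ?_⟩
        exact (aut_sP (a := ((FT.blk b) ^ M : MulAut (FreeGroup (I × J))).toMonoidHom) (b := b ^ M)
          (fun i g => blk_pow b M i g) hl).2
      · refine ⟨_, Or.inr rfl, by rw [← mul_inv_rev, ← pow_add, two_mul], ?_⟩
        exact (aut_sP (a := (((FT.blk b) ^ M)⁻¹ : MulAut (FreeGroup (I × J))).toMonoidHom) (b := (b ^ M)⁻¹)
          (fun i g => blk_pow_inv b M i g) hl).2
    have e2 : (Bp + Bm + C1 + 20) * (g' (sP l)).norm ≤ (g (sP l)).norm + (sP l).norm := by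
      have := sf (g' (sP l))
      rw [← hψ] at this
      rw [← hg2]
      rcases hg1 with rfl | rfl
      · rw [MulAut.inv_apply_self] at this
        exact this
      · rw [MulAut.apply_inv_self] at this
        exact this.trans (add_comm _ _).le
    have e3 : l.length * (Bp + Bm + C1) ≤ (Bp + Bm + C1 + 20) * (g' (sP l)).norm := by
      rw [mul_comm]; exact Nat.mul_le_mul (by omega) hg3
    omega
  refine ⟨k3, 2 * M, h3, by omega, fun i => ⟨Cg i, fun a => ?_⟩, C0, ?_⟩
  · have := hCg i (bi i a) ⟨a, rfl⟩
    omega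
  · rw [← hψ]
    have t0 : (FreeGroup.lift ![ψ ^ (2 * M), φ3 ^ k3] : FreeGroup (Fin 2) →* _) (ltr (0, true)) = ψ ^ (2 * M) := by
      rw [TG.ltr_true]; simp
    have t1 : (FreeGroup.lift ![ψ ^ (2 * M), φ3 ^ k3] : FreeGroup (Fin 2) →* _) (ltr (1, true)) = φ3 ^ k3 := by
      rw [TG.ltr_true]; simp
    have f0 : (FreeGroup.lift ![ψ ^ (2 * M), φ3 ^ k3] : FreeGroup (Fin 2) →* _) (ltr (0, false)) = (ψ ^ (2 * M))⁻¹ := by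
      rw [TG.ltr_false]; simp
    have f1 : (FreeGroup.lift ![ψ ^ (2 * M), φ3 ^ k3] : FreeGroup (Fin 2) →* _) (ltr (1, false)) = (φ3 ^ k3)⁻¹ := by
      rw [TG.ltr_false]; simp
    have a1 : ∀ w : FreeGroup (I × J), 20 * w.norm ≤ ((ψ ^ (2 * M)) w).norm + ((ψ ^ (2 * M))⁻¹ w).norm := fun w => by
      have h := sf2 w
      rw [← hψ] at h
      have : 20 * w.norm ≤ (Bp + Bm + C1 + 20) * w.norm := Nat.mul_le_mul_right _ (by omega)
      omega
    rintro ⟨s, x⟩ ⟨s', x'⟩ hss w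
    have b1 := hC0 w
    have b2 := a1 w
    have c1 := ex _ (Or.inl rfl) _ (Or.inl rfl) w
    have c2 := ex _ (Or.inl rfl) _ (Or.inr rfl) w
    have c3 := ex _ (Or.inr rfl) _ (Or.inl rfl) w
    have c4 := ex _ (Or.inr rfl) _ (Or.inr rfl) w
    have hs : s = 0 ∨ s = 1 := by omega
    have hs' : s' = 0 ∨ s' = 1 := by omega
    rcases hs with rfl | rfl <;> rcases hs' with rfl | rfl <;> cases x <;> cases x' <;>
      first
      | exact absurd rfl hss
      | (simp only [t0, t1, f0, f1, inv_inv]; omega)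
end mixed
end FT

namespace FT
open FreeGroup (of mk mk_toWord norm_one norm_inv_eq norm_of)
open SemidirectProduct (inl inr)

section
variable {α σ : Type*} [DecidableEq α] [DecidableEq σ]

theorem undist [Finite α] [Finite σ] (ρ : FreeGroup σ →* MulAut (FreeGroup α)) (hFL : FL ρ) (Cg : ℕ) :
    ∃ K : ℕ, ∀ a : FreeGroup α,
      (∀ x y, Ord4 a x y 1 → ∀ s : σ × Bool, 10 * fd x y ≤ ((ρ (ltr s))⁻¹ (x⁻¹ * y)).norm + Cg) →
      a.norm ≤ K * (wordLength (stdS ρ) (inl a : FreeGroup α ⋊[ρ] FreeGroup σ) + 1) := by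
  obtain ⟨C0, hFL⟩ := hFL
  obtain ⟨B, Lp, hB, hLp⟩ := exists_BL ρ
  refine ⟨2 * (2 * B + (C0 + 8 * B + (Cg + 10) + 2)), fun a ha => ?_⟩
  obtain ⟨l, hl1, hl2, hl3⟩ := wl_ex (stdS_closure ρ) (inl a : FreeGroup α ⋊[ρ] FreeGroup σ)
  rw [← hl2]
  obtain ⟨k, hk⟩ : ∃ k, k = l.length := ⟨_, rfl⟩
  obtain ⟨z, hz⟩ : ∃ z : ℕ → FreeGroup α ⋊[ρ] FreeGroup σ, z = fun i => (l.take i).prod := ⟨_, rfl⟩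
  have z0 : z 0 = 1 := by simp [hz]
  have zk : z k = inl a := by simp [hz, hk, hl3]
  have hadj : ∀ i < k, Adj ρ (z i) (z (i + 1)) := by
    intro i hi
    have hi' : i < l.length := hk ▸ hi
    have : z (i + 1) = z i * l[i] := by
      simp only [hz]
      rw [List.prod_take_succ _ _ hi']
    rw [this]
    exact adj_of_letter ρ (hl1 _ (List.getElem_mem hi'))
  rw [← hk]
  classical
  have hnx : ∀ i : Fin (k + 1), (i : ℕ) < k → z (finRotate (k + 1) i : Fin (k + 1)) = z (i + 1) := by
    intro i hi
    rw [finRotate_succ_apply, Fin.val_add_one]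
    split_ifs with h
    · rw [h] at hi; simp at hi
    · rfl
  have hnl : ∀ i : Fin (k + 1), (i : ℕ) = k → z (finRotate (k + 1) i : Fin (k + 1)) = 1 := by
    intro i hi
    have : i = Fin.last k := Fin.ext (by simpa using hi)
    rw [this, finRotate_last]; simp [z0]
  obtain ⟨kd, hkd⟩ : ∃ kd : Fin (k + 1) → Option (σ × Bool), kd = fun i : Fin (k + 1) =>
    if hs : (i : ℕ) < k ∧ ∃ s : σ × Bool, z (i + 1) = z i * inr (ltr s) then some hs.2.choose else none := ⟨_, rfl⟩
  have kd1 : ∀ i s, kd i = some s → (i : ℕ) < k ∧ z (i + 1) = z i * inr (ltr s) := by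
    intro i s hi
    simp only [hkd] at hi
    split_ifs at hi with hs
    have := hs.2.choose_spec
    rw [← Option.some_inj.1 hi]; exact ⟨hs.1, this⟩
  have kd2 : ∀ i, kd i = none → (i : ℕ) < k → ∃ x : FreeGroup α, x.norm ≤ 1 ∧ z (i + 1) = z i * inl x := by
    intro i hi hik
    simp only [hkd] at hi
    split_ifs at hi with hs
    rcases hadj i hik with hh | hh
    · exact hh
    · exact absurd ⟨hik, hh⟩ hs
  have kdl : kd (Fin.last k) = none := by
    simp [hkd]
  have hlast : ∀ i : Fin (k + 1), ¬ (i : ℕ) < k → i = Fin.last k := fun i hi =>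
    Fin.ext (by have := i.2; simp; omega)
  let LS : LoopSys α σ (Fin (k + 1)) :=
    { nxt := finRotate (k + 1)
      q := fun i => (z i).right
      n := fun i => (z i).left
      kind := kd
      hq := by intro i s hi; simp only [hnx i (kd1 i s hi).1]; rw [(kd1 i s hi).2]; simp
      hn := by intro i s hi; simp only [hnx i (kd1 i s hi).1]; rw [(kd1 i s hi).2]; simp
      hnone := by
        intro i hi
        by_cases hik : (i : ℕ) < k
        · simp only [hnx i hik]
          obtain ⟨x, _, hx⟩ := kd2 i hi hik
          rw [hx]; simp
        · rw [hlast i hik]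
          rw [hnl _ (by simp)]; simp [zk] }
  have hvl : ∀ i, LS.kind i = none → (i : ℕ) < k →
      fd ((ρ (LS.q i))⁻¹ (LS.n i)) ((ρ (LS.q i))⁻¹ (LS.n (LS.nxt i))) ≤ 1 := by
    intro i hi hik
    obtain ⟨x, hx1, hx⟩ := kd2 i hi hik
    have : LS.n (LS.nxt i) = (z i).left * ρ (z i).right x := by
      simp only [LS, hnx i hik]; rw [hx]; simp
    rw [this, fd, map_mul]
    simp [LS, hx1]
  have hl1 : (ρ (LS.q (Fin.last k)))⁻¹ (LS.n (Fin.last k)) = a := by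
    simp [LS, zk]
  have hl2 : (ρ (LS.q (Fin.last k)))⁻¹ (LS.n (LS.nxt (Fin.last k))) = 1 := by
    have : LS.n (LS.nxt (Fin.last k)) = 1 := by
      simp only [LS]; rw [hnl _ (by simp)]; rfl
    rw [this, map_one]
  obtain ⟨m, hm, hS⟩ := LS.iso ρ (C0 := C0) (B := B) (Cg := Cg + 10) hFL hB
    (by
      intro i hi x y o s
      by_cases hik : (i : ℕ) < k
      · have := hvl i hi hik
        unfold Ord4 at o
        omega
      · rw [hlast i hik, hl1, hl2] at o
        have := ha x y o s
        omega)
    (by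
      intro i j hij hi hj
      by_cases hik : (i : ℕ) < k
      · left
        have := hvl i hi hik
        simpa [LoopSys.vlen, hi] using this
      · right
        have : (j : ℕ) < k := by
          by_contra hjk
          exact hij ((hlast i hik).trans (hlast j hjk).symm)
        have := hvl j hj this
        simpa [LoopSys.vlen, hj] using this)
  have h1 : LS.vlen ρ (Fin.last k) = a.norm := by
    have : LS.kind (Fin.last k) = none := kdl
    rw [LoopSys.vlen, this, Option.elim_none, hl1, hl2, fd_comm, fd_one]
  have h2 := Finset.single_le_sum (f := fun i => LS.vlen ρ i) (fun i _ => Nat.zero_le _)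
    (Finset.mem_univ (Fin.last k))
  simp only [h1] at h2
  rw [Fintype.card_fin] at hS
  omega

end

section
variable {I J : Type*} [DecidableEq I] [DecidableEq J]

theorem bi_mid (i : I) (a : FreeGroup J) (p : FreeGroup (I × J))
    (h : fd (bi i a) p + fd p 1 = fd (bi i a) 1) : ∃ p', p = bi i p' := by
  obtain ⟨p', h1, h2⟩ := point_at a 1 (fd (bi i a) p) (by
    have : fd (bi i a) 1 = fd a 1 := by rw [fd_comm, fd_one, bi_norm, fd_comm a, fd_one]
    omega)
  have hb : ∀ x y : FreeGroup J, fd (bi i x) (bi i y) = fd x y := by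
    intro x y
    rw [fd, fd, ← _root_.map_inv, ← _root_.map_mul, bi_norm]
  refine ⟨p', point_unique h ?_ ?_⟩
  · have h3 := hb p' 1
    have h4 := hb a 1
    rw [_root_.map_one] at h3 h4
    rw [hb, h3, h4, h2]
  · rw [hb, h1]

theorem nonqi_core [Finite I] [Finite J] (i : I) (j0 : J) (χ φ' : MulAut (FreeGroup (I × J)))
    (hχ : ∀ (k : ℤ) (g : FreeGroup J), ∃ g', (χ ^ k) (bi i g) = bi i g') (C : ℕ)
    (hg : ∀ a : FreeGroup J, 10 * (bi i a).norm ≤ (φ' (bi i a)).norm + C ∧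
        10 * (bi i a).norm ≤ (φ'⁻¹ (bi i a)).norm + C)
    (hf : FL20 (FreeGroup.lift ![χ, φ'] : FreeGroup (Fin 2) →* _)) :
    ∃ a0 : FreeGroup J, ∀ S' : Set (FreeGroup (I × J) ⋊[zpowersHom _ φ'] Multiplicative ℤ),
      GenSet S' → ∀ R : ℝ, ∃ k : ℤ,
        R * (|(k : ℝ)| + 1) < wordLength S' (inl ((χ ^ k) (bi i a0))) := by
  obtain ⟨C2, hf⟩ := hf
  have t0 : (FreeGroup.lift ![χ, φ'] : FreeGroup (Fin 2) →* _) (ltr (0, true)) = χ := by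
    rw [TG.ltr_true]; simp
  have t1 : (FreeGroup.lift ![χ, φ'] : FreeGroup (Fin 2) →* _) (ltr (1, true)) = φ' := by
    rw [TG.ltr_true]; simp
  have f0 : (FreeGroup.lift ![χ, φ'] : FreeGroup (Fin 2) →* _) (ltr (0, false)) = χ⁻¹ := by
    rw [TG.ltr_false]; simp
  have f1 : (FreeGroup.lift ![χ, φ'] : FreeGroup (Fin 2) →* _) (ltr (1, false)) = φ'⁻¹ := by
    rw [TG.ltr_false]; simp
  have h0 := hf (0, true) (0, false) (by simp)
  have h1 := hf (1, true) (1, false) (by simp)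
  simp only [t0, t1, f0, f1, inv_inv] at h0 h1
  -- the rank one extension
  let ρ : FreeGroup Unit →* MulAut (FreeGroup (I × J)) := FreeGroup.lift fun _ => φ'
  have r1 : ρ (ltr ((), true)) = φ' := by rw [TG.ltr_true]; simp [ρ]
  have r2 : ρ (ltr ((), false)) = φ'⁻¹ := by rw [TG.ltr_false]; simp [ρ]
  have hρ : FL ρ := by
    refine ⟨C2, ?_⟩
    rintro ⟨⟨⟩, _ | _⟩ ⟨⟨⟩, _ | _⟩ hs w
    · exact absurd rfl hs
    · rw [r1, r2, inv_inv]; have := h1 w; omega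
    · rw [r1, r2, inv_inv]; have := h1 w; omega
    · exact absurd rfl hs
  obtain ⟨K, hK⟩ := undist ρ hρ C
  have hK' : ∀ a : FreeGroup J, (bi i a).norm ≤
      K * (wordLength (stdS ρ) (inl (bi i a) : FreeGroup (I × J) ⋊[ρ] FreeGroup Unit) + 1) := by
    intro a
    refine hK _ ?_
    intro x y o s
    unfold Ord4 at o
    have t1 := fd_tri (bi i a) x 1
    have t2 := fd_tri x y 1
    have t3 := fd_tri (bi i a) x y
    have t4 := fd_tri (bi i a) y 1
    obtain ⟨x', rfl⟩ := bi_mid i a x (by omega)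
    obtain ⟨y', rfl⟩ := bi_mid i a y (by omega)
    rw [fd, ← _root_.map_inv, ← _root_.map_mul]
    have := hg (x'⁻¹ * y')
    rcases s with ⟨⟨⟩, _ | _⟩
    · rw [r2, inv_inv]; exact this.1
    · rw [r1]; exact this.2
  refine ⟨of j0 ^ (C2 + 1), fun S' hS' R => ?_⟩
  obtain ⟨a0, ha0⟩ : ∃ a0 : FreeGroup J, a0 = of j0 ^ (C2 + 1) := ⟨_, rfl⟩
  have ha0n : (bi i a0).norm = C2 + 1 := by rw [bi_norm, ha0, FreeGroup.norm_of_pow]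
  rw [← ha0]
  have ez : ρ = (zpowersHom (MulAut (FreeGroup (I × J))) φ').comp FreeGroup.mulEquivIntOfUnique.toMonoidHom := by
    apply FreeGroup.ext_hom
    intro u
    simp [ρ, FreeGroup.mulEquivIntOfUnique, FreeGroup.equivIntOfUnique]
  let E : (FreeGroup (I × J) ⋊[ρ] FreeGroup Unit) ≃*
      (FreeGroup (I × J) ⋊[zpowersHom _ φ'] Multiplicative ℤ) :=
    SemidirectProduct.congr (MulEquiv.refl _) FreeGroup.mulEquivIntOfUnique (fun g => by
      ext x
      rw [ez]; rfl)
  have hE : ∀ x, E.symm (inl x) = inl x := by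
    intro x
    rw [MulEquiv.symm_apply_eq]
    ext <;> simp [E]
  obtain ⟨Λ, hΛ0, hΛ⟩ := hom_lip hS' (stdS_closure ρ) E.symm.toMonoidHom
  have low : ∀ k : ℤ, (((χ ^ k) (bi i a0)).norm : ℝ) ≤ K * (Λ * wordLength S' (inl ((χ ^ k) (bi i a0))) + 1) := by
    intro k
    obtain ⟨g', hg'⟩ := hχ k a0
    rw [hg']
    have p1 := hK' g'
    have p2 := hΛ (inl (bi i g'))
    have p3 : E.symm.toMonoidHom (inl (bi i g')) = inl (bi i g') := hE _
    rw [p3] at p2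
    have p1' : ((bi i g').norm : ℝ) ≤
      K * ((wordLength (stdS ρ) (inl (bi i g') : FreeGroup (I × J) ⋊[ρ] FreeGroup Unit) : ℝ) + 1) := by
      exact_mod_cast p1
    refine p1'.trans ?_
    gcongr
  by_contra hcon
  push Not at hcon
  obtain ⟨D, hD0, hD⟩ : ∃ D : ℝ, 0 ≤ D ∧ ∀ k : ℤ, (((χ ^ k) (bi i a0)).norm : ℝ) ≤ D * (|(k : ℝ)| + 1) := by
    refine ⟨K * (Λ * |R| + 1), by positivity, fun k => (low k).trans ?_⟩
    have q := hcon k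
    have q2 : R * (|(k : ℝ)| + 1) ≤ |R| * (|(k : ℝ)| + 1) := by
      gcongr; exact le_abs_self R
    have q3 : (wordLength S' (inl ((χ ^ k) (bi i a0))) : ℝ) ≤ |R| * (|(k : ℝ)| + 1) := q.trans q2
    calc _ ≤ (K : ℝ) * (Λ * (|R| * (|(k : ℝ)| + 1)) + 1) := by gcongr
      _ ≤ (K : ℝ) * (Λ * (|R| * (|(k : ℝ)| + 1)) + 1 * (|(k : ℝ)| + 1)) := by
          gcongr; have := abs_nonneg (k : ℝ); linarith
      _ = _ := by ring
  have rt := rec_two (fun j => (((χ ^ j) (bi i a0)).norm : ℤ) - C2) (by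
    simp [ha0n]) (by
    intro j
    have e1 : (χ ^ (j + 1)) (bi i a0) = χ ((χ ^ j) (bi i a0)) := by
      rw [add_comm, zpow_add, zpow_one]; rfl
    have e2 : (χ ^ (j - 1)) (bi i a0) = χ⁻¹ ((χ ^ j) (bi i a0)) := by
      rw [sub_eq_add_neg, add_comm, zpow_add, zpow_neg_one]; rfl
    have := h0 ((χ ^ j) (bi i a0))
    simp only [e1, e2]
    have h5 : (0 : ℤ) ≤ ((χ ^ j) (bi i a0)).norm := by positivity
    have : (20 : ℤ) * ((χ ^ j) (bi i a0)).norm ≤ (χ⁻¹ ((χ ^ j) (bi i a0))).norm +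
      (χ ((χ ^ j) (bi i a0))).norm + C2 := by exact_mod_cast this
    omega)
  have big : ∀ j : ℕ, (2 : ℝ) ^ j ≤ D * (j + 1) := by
    intro j
    rcases rt with rt | rt
    · have q := rt j
      have q2 := hD j
      simp only [zpow_zero, MulAut.one_apply, ha0n] at q
      push_cast at q q2
      have q3 : (2 : ℤ) ^ j ≤ ((χ ^ (j : ℤ)) (bi i a0)).norm := by
        have : (0:ℤ) ≤ C2 := by positivity
        linarith
      have q4 : (2 : ℝ) ^ j ≤ ((χ ^ (j : ℤ)) (bi i a0)).norm := by exact_mod_cast q3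
      rw [abs_of_nonneg (by positivity)] at q2
      exact q4.trans q2
    · have q := rt j
      have q2 := hD (-j)
      simp only [zpow_zero, MulAut.one_apply, ha0n] at q
      push_cast at q q2
      have q3 : (2 : ℤ) ^ j ≤ ((χ ^ (-(j : ℤ))) (bi i a0)).norm := by
        have : (0:ℤ) ≤ C2 := by positivity
        linarith
      have q4 : (2 : ℝ) ^ j ≤ ((χ ^ (-(j : ℤ))) (bi i a0)).norm := by exact_mod_cast q3
      rw [abs_neg, abs_of_nonneg (by positivity)] at q2
      exact q4.trans q2
  have lim := tendsto_pow_const_div_const_pow_of_one_lt 1 (r := (2 : ℝ)) (by norm_num)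
  obtain ⟨j, hj1, hj2⟩ := ((lim.eventually (gt_mem_nhds (show (0:ℝ) < 1 / (2 * D + 1) by positivity))).and
    (Filter.eventually_ge_atTop 1)).exists
  have hj3 := big j
  rw [pow_one, div_lt_div_iff₀ (by positivity) (by positivity)] at hj1
  have : (1 : ℝ) ≤ j := by exact_mod_cast hj2
  nlinarith

end
end FT

namespace FT
open FreeGroup (of mk mk_toWord norm_one norm_inv_eq norm_of)
open SemidirectProduct (inl inr)

theorem of_comm_eq {α : Type*} (x y : α) (h : of x * of y = of y * of x) : x = y := by
  classical
  by_contra hne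
  have h1 := congrArg FreeGroup.toWord h
  rw [FreeGroup.of, FreeGroup.of, FreeGroup.mul_mk, FreeGroup.mul_mk, FreeGroup.toWord_mk, FreeGroup.toWord_mk] at h1
  simp [FreeGroup.reduce, hne, Ne.symm hne] at h1

theorem comm_cyclic {K : Type*} [Group K] [IsFreeGroup K] (X : Subgroup K)
    (h : ∀ x ∈ X, ∀ y ∈ X, x * y = y * x) : IsCyclic X := by
  have e := IsFreeGroup.toFreeGroup X
  rw [e.isCyclic]
  have hs : Subsingleton (IsFreeGroup.Generators X) := ⟨fun x y => by
    apply of_comm_eq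
    apply e.symm.injective
    rw [_root_.map_mul, _root_.map_mul]
    exact Subtype.ext (h _ (SetLike.coe_mem _) _ (SetLike.coe_mem _))⟩
  rcases isEmpty_or_nonempty (IsFreeGroup.Generators X) with hE | ⟨⟨x⟩⟩
  · infer_instance
  · have : Unique (IsFreeGroup.Generators X) := ⟨⟨x⟩, fun y => Subsingleton.elim _ _⟩
    infer_instance

theorem no_per {α : Type*} [DecidableEq α] {φ : MulAut (FreeGroup α)} (hf : Flare φ)
    (c g : FreeGroup α) (hc : g * φ c * g⁻¹ = c) : c = 1 := by
  by_contra hne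
  obtain ⟨c1, τ, hτ, hp⟩ := pow_norm hne
  obtain ⟨k0, hk0⟩ := hf 3
  obtain ⟨C, hC⟩ := hk0 k0 le_rfl
  have it : ∀ k : ℕ, ∃ g : FreeGroup α, (φ ^ k) c = g⁻¹ * c * g := by
    intro k
    induction k with
    | zero => exact ⟨1, by simp⟩
    | succ k ih =>
      obtain ⟨g', hg'⟩ := ih
      refine ⟨g * φ g', ?_⟩
      have : φ c = g⁻¹ * c * g := by
        calc φ c = g⁻¹ * (g * φ c * g⁻¹) * g := by group
          _ = _ := by rw [hc]
      rw [pow_succ', MulAut.mul_apply, hg', _root_.map_mul, _root_.map_mul, _root_.map_inv, this]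
      group
  obtain ⟨u, hu⟩ := it k0
  have hv : (φ ^ k0)⁻¹ c = ((φ ^ k0)⁻¹ u) * c * ((φ ^ k0)⁻¹ u)⁻¹ := by
    have : c = u * (φ ^ k0) c * u⁻¹ := by rw [hu]; group
    conv_lhs => rw [this]
    rw [_root_.map_mul, _root_.map_mul, _root_.map_inv, MulAut.inv_apply_self]
  obtain ⟨v, hv'⟩ : ∃ v, v = (φ ^ k0)⁻¹ u := ⟨_, rfl⟩
  rw [← hv'] at hv
  have key : ∀ p : ℕ, (c ^ p).norm ≤ 2 * u.norm + 2 * v.norm + C := by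
    intro p
    have h := hC (c ^ p)
    have e1 : (φ ^ k0) (c ^ p) = u⁻¹ * c ^ p * u := by
      rw [_root_.map_pow, hu]
      have := conj_pow (i := p) (a := u⁻¹) (b := c)
      rw [inv_inv] at this; exact this
    have e2 : (φ ^ k0)⁻¹ (c ^ p) = v * c ^ p * v⁻¹ := by
      rw [_root_.map_pow, hv, conj_pow]
    have n1 := FreeGroup.norm_mul_le (u⁻¹ * c ^ p) u
    have n2 := FreeGroup.norm_mul_le u⁻¹ (c ^ p)
    have n3 := FreeGroup.norm_mul_le (v * c ^ p) v⁻¹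
    have n4 := FreeGroup.norm_mul_le v (c ^ p)
    rw [norm_inv_eq] at n2 n3
    rw [e1, e2] at h
    omega
  have q := key (2 * u.norm + 2 * v.norm + C + 1)
  rw [hp _ (by omega)] at q
  nlinarith

theorem pair {K : Type*} [Group K] [IsFreeGroup K] (a : MulAut K)
    (hne : ∀ i : ℕ, 0 < i → ∀ c g : K, g * (a ^ i) c * g⁻¹ = c → c = 1)
    (htf : ∀ (c : K) (i : ℤ), c ≠ 1 → c ^ i = c → i = 1)
    (H : Subgroup (K ⋊[zpowersHom (MulAut K) a] Multiplicative ℤ)) (hH : ¬ VirtCyclic H) :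
    ∃ w w' : K, inl w ∈ H ∧ inl w' ∈ H ∧ w' * w ≠ w * w' := by
  by_contra hcon
  push Not at hcon
  have hcyc := comm_cyclic (H.comap (inl : K →* _)) (fun x hx y hy => hcon y x hy hx)
  have vc : IsCyclic H → False := by
    intro h
    obtain ⟨g, hg⟩ := h.exists_generator
    exact hH ⟨⊤, ⟨g, by symm; rw [eq_top_iff]; exact fun x _ => hg x⟩, by simp⟩
  rw [Subgroup.isCyclic_iff_exists_zpowers_eq_top] at hcyc
  obtain ⟨c, hc⟩ := hcyc
  have hcm : ∀ x, inl x ∈ H → ∃ i : ℤ, c ^ i = x := by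
    intro x hx
    have : x ∈ H.comap (inl : K →* _) := hx
    rw [← hc] at this
    exact Subgroup.mem_zpowers_iff.1 this
  have hcH : (inl c : K ⋊[zpowersHom (MulAut K) a] Multiplicative ℤ) ∈ H := by
    have : c ∈ H.comap (inl : K →* K ⋊[zpowersHom (MulAut K) a] Multiplicative ℤ) := by
      rw [← hc]; exact Subgroup.mem_zpowers c
    exact this
  by_cases hc1 : c = 1
  · apply vc
    refine isCyclic_of_injective (SemidirectProduct.rightHom.comp H.subtype) ?_
    rw [injective_iff_map_eq_one]
    intro h hh
    have hr : (h : K ⋊[zpowersHom (MulAut K) a] Multiplicative ℤ).right = 1 := hh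
    have hl : (h : K ⋊[zpowersHom (MulAut K) a] Multiplicative ℤ) = inl (h : K ⋊[zpowersHom (MulAut K) a] Multiplicative ℤ).left := by
      ext <;> simp [hr]
    obtain ⟨i, hi⟩ := hcm _ (by rw [← hl]; exact h.2)
    rw [hc1, one_zpow] at hi
    apply Subtype.ext
    rw [hl, ← hi]; simp
  by_cases hr : ∀ h ∈ H, h.right = 1
  · apply vc
    rw [Subgroup.isCyclic_iff_exists_zpowers_eq_top]
    refine ⟨inl c, le_antisymm ?_ ?_⟩
    · rw [Subgroup.zpowers_le]; exact hcH
    · intro h hh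
      have hl : h = inl h.left := by ext <;> simp [hr h hh]
      obtain ⟨i, hi⟩ := hcm h.left (by rw [← hl]; exact hh)
      rw [Subgroup.mem_zpowers_iff]
      exact ⟨i, by rw [hl, ← hi, _root_.map_zpow]⟩
  push Not at hr
  obtain ⟨h, hhH, hhr⟩ := hr
  have inv_norm : ∀ h ∈ H, ∀ x, inl x ∈ H → inl (h.left * (zpowersHom (MulAut K) a h.right) x * h.left⁻¹) ∈ H := by
    intro h hh x hx
    have : (inl (h.left * (zpowersHom (MulAut K) a h.right) x * h.left⁻¹) : K ⋊[zpowersHom (MulAut K) a] Multiplicative ℤ) = h * inl x * h⁻¹ := by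
      ext
      · simp
      · simp
    rw [this]
    exact H.mul_mem (H.mul_mem hh hx) (H.inv_mem hh)
  have conj_in : ∀ h ∈ H, ∃ i : ℤ, inl (c ^ i) = h * inl c * h⁻¹ := by
    intro h hh
    obtain ⟨i, hi⟩ := hcm _ (inv_norm h hh c hcH)
    refine ⟨i, ?_⟩
    rw [hi]
    ext <;> simp
  obtain ⟨u, hu⟩ := conj_in h hhH
  obtain ⟨v, hv⟩ := conj_in h⁻¹ (H.inv_mem hhH)
  have huv : c ^ (u * v) = c := by
    apply SemidirectProduct.inl_injective (φ := zpowersHom (MulAut K) a)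
    rw [zpow_mul, _root_.map_zpow, hu, conj_zpow, ← _root_.map_zpow, hv]
    group
  have huv1 := htf c _ hc1 huv
  have huu : u * u = 1 := by
    rcases Int.eq_one_or_neg_one_of_mul_eq_one huv1 with rfl | rfl <;> norm_num
  have h2 : h * h * inl c * (h * h)⁻¹ = inl c := by
    have : h * h * inl c * (h * h)⁻¹ = h * (h * inl c * h⁻¹) * h⁻¹ := by group
    rw [this, ← hu, _root_.map_zpow, ← conj_zpow, ← hu, ← _root_.map_zpow, ← zpow_mul, huu, zpow_one]
  have fin : ∀ g : K ⋊[zpowersHom (MulAut K) a] Multiplicative ℤ, g * inl c * g⁻¹ = inl c →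
      0 < Multiplicative.toAdd g.right → False := by
    intro g hg hpos
    obtain ⟨i, hi⟩ := Int.eq_ofNat_of_zero_le hpos.le
    apply hc1
    refine hne i (by omega) c g.left ?_
    have e : (zpowersHom (MulAut K) a) g.right = a ^ i := by
      rw [zpowersHom_apply, hi]; simp
    apply SemidirectProduct.inl_injective (φ := zpowersHom (MulAut K) a)
    rw [← hg, ← e]
    ext <;> simp
  have hh0 : Multiplicative.toAdd h.right ≠ 0 := fun h0 => hhr (by
    apply Multiplicative.toAdd.injective; simpa using h0)
  rcases lt_or_gt_of_ne hh0 with hlt | hgt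
  · refine fin (h * h)⁻¹ ?_ ?_
    · nth_rewrite 1 [← h2]; group
    · simp; omega
  · refine fin (h * h) h2 ?_
    simp; omega

end FT

namespace FT
open FreeGroup (of mk mk_toWord norm_one norm_inv_eq norm_of)
open SemidirectProduct (inl inr)

theorem inter_zpow {A B : Type*} [Group A] [Group B] {f : A → B} {φ' : MulAut A} {φ : MulAut B}
    (h : ∀ y, f (φ' y) = φ (f y)) (k : ℤ) (y : A) : f ((φ' ^ k) y) = (φ ^ k) (f y) := by
  have hi : ∀ (j : ℕ) y, f ((φ' ^ j)⁻¹ y) = (φ ^ j)⁻¹ (f y) := by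
    intro j y
    have := inter_pow' h j ((φ' ^ j)⁻¹ y)
    rw [MulAut.apply_inv_self] at this
    rw [this, MulAut.inv_apply_self]
  obtain ⟨j, rfl | rfl⟩ := Int.eq_nat_or_neg k
  · rw [zpow_natCast, zpow_natCast]; exact inter_pow' h j y
  · rw [zpow_neg, zpow_neg, zpow_natCast, zpow_natCast]; exact hi j y

theorem congr_app {A B : Type*} [Group A] [Group B] (u : A ≃* B) (f : MulAut A) (x : A) :
    MulAut.congr u f (u x) = u (f x) := by
  change u (f (u.symm (u x))) = _
  rw [u.symm_apply_apply]

theorem data0 {n : ℕ} (hn : 1 < n) (φ : MulAut (FreeGroup (Fin n))) (hfl : Flare φ)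
    {w w' : FreeGroup (Fin n)} (hww : w' * w ≠ w * w') (m : ℕ) (hm : 0 < m) :
    ∃ (N : Subgroup (FreeGroup (Fin n))) (l r : ℕ) (φ₁ : MulAut N) (e : N ≃* FreeGroup (YY r n))
      (χ φ' : MulAut (FreeGroup (YY r n))) (a0 : FreeGroup (YY r n)),
      N.index ≠ 0 ∧ 0 < l ∧ m ∣ l ∧ (∀ k : N, (φ₁ k : FreeGroup (Fin n)) = (φ ^ l) k) ∧
      (∀ k, φ' (e k) = e (φ₁ k)) ∧ FL20 (FreeGroup.lift ![χ, φ'] : FreeGroup (Fin 2) →* _) ∧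
      (∀ k : ℤ, (e.symm ((χ ^ k) a0) : FreeGroup (Fin n)) ∈ Subgroup.closure {w, w'}) ∧
      ∀ S' : Set (FreeGroup (YY r n) ⋊[zpowersHom _ φ'] Multiplicative ℤ),
        GenSet S' → ∀ R : ℝ, ∃ k : ℤ,
        R * (|(k : ℝ)| + 1) < wordLength S' (inl ((χ ^ k) a0)) := by
  obtain ⟨N, l, r, φ₁, e, φ3, hN, hl, hml, hr, he, hf3, hg3, hcl⟩ := assemble hn φ hfl hww m hm
  obtain ⟨k1, hk1, hb⟩ := strict φ hfl
  obtain ⟨k3, M, hk3, hM, hgd, hF⟩ := mixed φ3 hf3 (fun i => hg3 i) (φ ^ k1) hb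
  obtain ⟨C, hC⟩ := hgd none
  have hχ : ∀ (k : ℤ) (g : FreeGroup (Fin n)), ∃ g',
      ((FT.blk (φ ^ k1) ^ M : MulAut (FreeGroup (YY r n))) ^ k) (bi none g) = bi none g' := by
    intro k g
    refine ⟨(((φ ^ k1) ^ M) ^ k) g, ?_⟩
    symm
    exact inter_zpow (f := fun g => (bi none g : FreeGroup (YY r n))) (fun y => (blk_pow (φ ^ k1) M none y).symm) k g
  obtain ⟨a0, ha0⟩ := nonqi_core (none : Option (Fin r)) (⟨0, by omega⟩ : Fin n) _ _ hχ C hC hF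
  refine ⟨N, l * k3, r, φ₁ ^ k3, e, _, φ3 ^ k3, bi none a0, hN, by positivity, hml.mul_right _, ?_, ?_, hF, ?_, ha0⟩
  · intro k
    rw [pow_mul]
    exact inter_pow' (f := fun x : N => (x : FreeGroup (Fin n))) hr k3 k
  · intro k
    exact (inter_pow' (f := e) (fun y => (he y).symm) k3 k).symm
  · intro k
    obtain ⟨g', hg'⟩ := hχ k a0
    rw [hg']
    exact hcl _ ⟨g', rfl⟩

theorem data {K : Type*} [Group K] {n : ℕ} (hn : 1 < n) (e0 : K ≃* FreeGroup (Fin n)) (φ : MulAut K)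
    (hfl : Flare (MulAut.congr e0 φ))
    {w w' : K} (hww : w' * w ≠ w * w') (m : ℕ) (hm : 0 < m) :
    ∃ (N : Subgroup K) (l r : ℕ) (φ₁ : MulAut N) (e : N ≃* FreeGroup (YY r n))
      (χ φ' : MulAut (FreeGroup (YY r n))) (a0 : FreeGroup (YY r n)),
      N.index ≠ 0 ∧ 0 < l ∧ m ∣ l ∧ (∀ k : N, (φ₁ k : K) = (φ ^ l) k) ∧
      (∀ k, φ' (e k) = e (φ₁ k)) ∧ FL20 (FreeGroup.lift ![χ, φ'] : FreeGroup (Fin 2) →* _) ∧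
      (∀ k : ℤ, (e.symm ((χ ^ k) a0) : K) ∈ Subgroup.closure {w, w'}) ∧
      ∀ S' : Set (FreeGroup (YY r n) ⋊[zpowersHom _ φ'] Multiplicative ℤ),
        GenSet S' → ∀ R : ℝ, ∃ k : ℤ,
        R * (|(k : ℝ)| + 1) < wordLength S' (inl ((χ ^ k) a0)) := by
  obtain ⟨N, l, r, φ₁, e, χ, φ', a0, hN, hl, hml, hr, he, hF, hcl, hlast⟩ :=
    data0 hn (MulAut.congr e0 φ) hfl (w := e0 w) (w' := e0 w') (fun h => hww (e0.injective (by
      rw [_root_.map_mul, _root_.map_mul, h]))) m hm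
  obtain ⟨u, hu⟩ : ∃ u : N ≃* (N.map e0.symm.toMonoidHom), ∀ x : N, ((u x : N.map e0.symm.toMonoidHom) : K) = e0.symm x :=
    ⟨e0.symm.subgroupMap N, fun x => rfl⟩
  have hpow : ∀ (x : FreeGroup (Fin n)), e0.symm (((MulAut.congr e0 φ) ^ l) x) = (φ ^ l) (e0.symm x) :=
    fun x => inter_pow' (f := e0.symm) (fun y => by simp [MulAut.congr]) l x
  refine ⟨N.map e0.symm.toMonoidHom, l, r, MulAut.congr u φ₁, u.symm.trans e, χ, φ', a0, ?_, hl, hml, ?_, ?_, hF, ?_, hlast⟩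
  · rwa [Subgroup.index_map_of_bijective]
    exact e0.symm.bijective
  · intro k
    obtain ⟨x, rfl⟩ := u.surjective k
    have : (MulAut.congr u φ₁) (u x) = u (φ₁ x) := congr_app u φ₁ x
    rw [this, hu, hr, hpow, hu]
  · intro k
    obtain ⟨x, rfl⟩ := u.surjective k
    have : (MulAut.congr u φ₁) (u x) = u (φ₁ x) := congr_app u φ₁ x
    rw [this]
    change φ' (e (u.symm (u x))) = e (u.symm (u _))
    rw [u.symm_apply_apply, u.symm_apply_apply]
    exact he x
  · intro k
    have h1 := hcl k
    have h2 : ((u.symm.trans e).symm ((χ ^ k) a0) : K) = e0.symm (e.symm ((χ ^ k) a0) : FreeGroup (Fin n)) := hu _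
    rw [h2]
    have h3 : Subgroup.closure {e0 w, e0 w'} ≤ (Subgroup.closure {w, w'}).comap e0.symm.toMonoidHom := by
      rw [Subgroup.closure_le]
      rintro x (rfl | rfl)
      · exact Subgroup.subset_closure (by simp)
      · exact Subgroup.subset_closure (by simp)
    exact h3 h1

end FT

namespace FT
open FreeGroup (of mk mk_toWord norm_one norm_inv_eq norm_of)
open SemidirectProduct (inl inr)

/-- the power map of the infinite cyclic group -/
def zq (q : ℕ) : Multiplicative ℤ →* Multiplicative ℤ := powMonoidHom q

theorem zq_inj {q : ℕ} (hq : 0 < q) : Function.Injective (zq q) := by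
  rw [injective_iff_map_eq_one]
  intro x hx
  have h : x ^ q = 1 := hx
  have := congrArg Multiplicative.toAdd h
  rw [toAdd_pow, toAdd_one] at this
  apply Multiplicative.toAdd.injective
  rw [toAdd_one]
  simpa [hq.ne'] using this

section incl
variable {K : Type*} [Group K] {a : MulAut K} {N : Subgroup K} {φ₁ : MulAut N} {q : ℕ}

/-- inclusion of the finite index subgroup -/
def incl (h : ∀ k : N, (φ₁ k : K) = (a ^ q) k) :
    N ⋊[zpowersHom (MulAut N) φ₁] Multiplicative ℤ →* K ⋊[zpowersHom (MulAut K) a] Multiplicative ℤ :=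
  SemidirectProduct.map N.subtype (zq q) (fun g => by
    ext x
    have := inter_zpow (f := fun x : N => (x : K)) h (Multiplicative.toAdd g) x
    simp only [MonoidHom.comp_apply]
    change (((φ₁ ^ (Multiplicative.toAdd g)) x : N) : K) = (a ^ (Multiplicative.toAdd (g ^ q))) (x : K)
    rw [this, ← zpow_natCast, ← zpow_mul, toAdd_pow, nsmul_eq_mul])

theorem incl_inj (h : ∀ k : N, (φ₁ k : K) = (a ^ q) k) (hq : 0 < q) : Function.Injective (incl h) := by
  intro x y hxy
  ext
  · have := congrArg SemidirectProduct.left hxy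
    exact this
  · have := congrArg SemidirectProduct.right hxy
    rw [zq_inj hq this]

theorem incl_index (h : ∀ k : N, (φ₁ k : K) = (a ^ q) k) (hq : 0 < q) (hN : N.index ≠ 0) :
    (incl h).range.index ≠ 0 := by
  have hfi : N.FiniteIndex := ⟨hN⟩
  have hfin : Finite (K ⧸ N) := inferInstance
  let f : Fin q × (K ⧸ N) → (K ⋊[zpowersHom (MulAut K) a] Multiplicative ℤ) ⧸ (incl h).range := fun p =>
    QuotientGroup.mk (inr (Multiplicative.ofAdd ((p.1 : ℕ) : ℤ)) * inl p.2.out)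
  have hf : Function.Surjective f := by
    intro g
    obtain ⟨g, rfl⟩ := QuotientGroup.mk_surjective g
    obtain ⟨s, hs⟩ : ∃ s, s = Multiplicative.toAdd g.right := ⟨_, rfl⟩
    have hr0 : 0 ≤ s % (q : ℤ) := Int.emod_nonneg _ (by omega)
    have hr1 : s % (q : ℤ) < q := Int.emod_lt_of_pos _ (by omega)
    obtain ⟨r, hr⟩ := Int.eq_ofNat_of_zero_le hr0
    obtain ⟨y, hy⟩ : ∃ y, y = (a ^ (r : ℤ))⁻¹ g.left := ⟨_, rfl⟩
    obtain ⟨nn, hnn⟩ : ∃ nn : N, y = (QuotientGroup.mk y : K ⧸ N).out * nn := by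
      obtain ⟨nn, hnn⟩ := QuotientGroup.mk_out_eq_mul N y
      exact ⟨nn⁻¹, by rw [hnn]; simp⟩
    refine ⟨(⟨r, by omega⟩, QuotientGroup.mk y), ?_⟩
    rw [QuotientGroup.eq]
    refine ⟨inl nn * inr (Multiplicative.ofAdd (s / (q : ℤ))), ?_⟩
    rw [eq_inv_mul_iff_mul_eq]
    have e1 : incl h (inl nn * inr (Multiplicative.ofAdd (s / (q : ℤ)))) =
        inl (nn : K) * inr (Multiplicative.ofAdd (s / (q : ℤ)) ^ q) := by
      rw [_root_.map_mul]
      unfold incl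
      rw [SemidirectProduct.map_inl, SemidirectProduct.map_inr]; rfl
    rw [e1]
    obtain ⟨d, hd⟩ : ∃ d : Multiplicative ℤ, d = Multiplicative.ofAdd (s / (q : ℤ)) ^ q := ⟨_, rfl⟩
    have hd' : Multiplicative.toAdd d = q * (s / (q : ℤ)) := by
      rw [hd, toAdd_pow, toAdd_ofAdd, nsmul_eq_mul]
    rw [← hd]
    ext
    · have : g.left = (a ^ (r : ℤ)) y := by rw [hy, MulAut.apply_inv_self]
      rw [this]
      conv_rhs => rw [hnn]
      simp
    · apply Multiplicative.toAdd.injective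
      simp only [SemidirectProduct.mul_right, SemidirectProduct.right_inr, SemidirectProduct.right_inl,
        mul_one, one_mul, toAdd_mul, toAdd_ofAdd]
      rw [hd', ← hs]
      have h9 := Int.emod_add_mul_ediv s q
      rw [hr] at h9
      exact h9
  have : Finite ((K ⋊[zpowersHom (MulAut K) a] Multiplicative ℤ) ⧸ (incl h).range) := Finite.of_surjective f hf
  exact Subgroup.index_ne_zero_of_finite
end incl

theorem wl_zpow {G : Type*} [Group G] {S : Set G} (hS : Subgroup.closure S = ⊤) (g : G) (k : ℤ) :
    (wordLength S (g ^ k) : ℝ) ≤ |(k : ℝ)| * wordLength S g := by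
  have h1 : ∀ j : ℕ, wordLength S (g ^ j) ≤ j * wordLength S g := by
    intro j
    induction j with
    | zero => simp [wl_one]
    | succ j ih =>
      rw [pow_succ]
      have := wl_mul hS (g ^ j) g
      rw [add_mul, one_mul]; omega
  obtain ⟨j, rfl | rfl⟩ := Int.eq_nat_or_neg k
  · rw [zpow_natCast]; push_cast
    rw [abs_of_nonneg (by positivity)]
    exact_mod_cast h1 j
  · rw [zpow_neg, zpow_natCast, wl_inv hS]; push_cast
    rw [abs_neg, abs_of_nonneg (by positivity)]
    exact_mod_cast h1 j

/-- abstract distortion criterion -/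
theorem distort {G L : Type*} [Group G] [Group L] (M : Subgroup G) (P : L →* G)
    (hP : Function.Injective P) (hM : M ≤ P.range) {S' : Set L} (hS' : GenSet S')
    (y : ℤ → L) (hy : ∀ k, P (y k) ∈ M) (t : G) (ht : ∀ k : ℤ, P (y k) = t ^ k * P (y 0) * (t ^ k)⁻¹)
    (hbig : ∀ R : ℝ, ∃ k : ℤ, R * (|(k : ℝ)| + 1) < wordLength S' (y k)) : ¬ QIEmbSubgroup M := by
  rintro ⟨S, T, hS, hT, c, hc1, hc⟩
  let f : M →* L := (MonoidHom.ofInjective hP).symm.toMonoidHom.comp (Subgroup.inclusion hM)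
  have hf : ∀ k, f ⟨P (y k), hy k⟩ = y k := by
    intro k
    change (MonoidHom.ofInjective hP).symm _ = _
    rw [MulEquiv.symm_apply_eq]
    rfl
  obtain ⟨Λ, hΛ0, hΛ⟩ := hom_lip hT hS'.2 f
  obtain ⟨A, hA⟩ : ∃ A : ℝ, A = 2 * wordLength S t + wordLength S (P (y 0)) := ⟨_, rfl⟩
  have hA0 : 0 ≤ A := by rw [hA]; positivity
  obtain ⟨k, hk⟩ := hbig (Λ * (c * (A + c)))
  have h1 := (hc 1 ⟨P (y k), hy k⟩).1
  have h2 : wordDist T 1 ⟨P (y k), hy k⟩ = wordLength T ⟨P (y k), hy k⟩ := by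
    rw [wordDist, inv_one, one_mul]
  have h3 : wordDist S ((1 : M) : G) (P (y k)) = wordLength S (P (y k)) := by
    rw [wordDist]; simp
  rw [h2] at h1
  simp only [h3] at h1
  have h4 := hΛ ⟨P (y k), hy k⟩
  rw [hf] at h4
  have h5 : (wordLength S (P (y k)) : ℝ) ≤ A * (|(k : ℝ)| + 1) := by
    rw [ht k]
    have m1 := wl_mul hS.2 (t ^ k * P (y 0)) (t ^ k)⁻¹
    have m2 := wl_mul hS.2 (t ^ k) (P (y 0))
    rw [wl_inv hS.2] at m1
    have m3 := wl_zpow hS.2 t k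
    have m4 : (wordLength S (t ^ k * P (y 0) * (t ^ k)⁻¹) : ℝ) ≤
        wordLength S (t ^ k) + wordLength S (P (y 0)) + wordLength S (t ^ k) := by
      exact_mod_cast m1.trans (by omega)
    have p1 : (0:ℝ) ≤ |(k:ℝ)| := abs_nonneg _
    have p2 : (0:ℝ) ≤ wordLength S t := by positivity
    have p3 : (0:ℝ) ≤ wordLength S (P (y 0)) := by positivity
    rw [hA]
    nlinarith [mul_nonneg p1 p3]
  have h6 : (wordLength T ⟨P (y k), hy k⟩ : ℝ) ≤ c * ((A + c) * (|(k : ℝ)| + 1)) := by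
    have hc0 : 0 < c := by linarith
    have : (wordLength T ⟨P (y k), hy k⟩ : ℝ) / c ≤ A * (|(k : ℝ)| + 1) + c := by linarith
    rw [div_le_iff₀ hc0] at this
    have p1 : (0:ℝ) ≤ |(k:ℝ)| := abs_nonneg _
    nlinarith [mul_nonneg (mul_nonneg hc0.le hc0.le) p1]
  have h7 : Λ * (wordLength T ⟨P (y k), hy k⟩ : ℝ) ≤ Λ * (c * ((A + c) * (|(k : ℝ)| + 1))) := by gcongr
  have h8 : Λ * (c * ((A + c) * (|(k : ℝ)| + 1))) = Λ * (c * (A + c)) * (|(k : ℝ)| + 1) := by ring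
  linarith

end FT

/-- Proposition 4.8. Let `φ ∈ Out(Fₙ)` be fully irreducible and
atoroidal, `Q₁ = ⟨φ^m⟩` (for suitable `m`) with hyperbolic extension
`G₁ = Fₙ ⋊_{φ^m} ℤ`. Let `H < G₁` be an infinite quasiconvex subgroup of infinite
index which is not virtually cyclic. Then there are a finite index subgroup
`F_m = N ≤ Fₙ`, a positive power `φ₁` of a lift of `φ` to `N`, and a finite index
subgroup `G₁' < G₁` with `G₁' ≅ N ⋊_{φ₁} ℤ`; a purely atoroidal `ψ ∈ Aut(N)` such
that `Q = ⟨ψ, φ₁⟩ < Out(F_m)` is free and `G = N ⋊ Q` is hyperbolic; and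
`G₁' ∩ H` has finite index in `H` and is not quasiconvex in `G`. -/
theorem stmt_16 {K : Type*} [Group K] (n : ℕ) (hn : 2 < n)
    (hfreeK : Nonempty (K ≃* FreeGroup (Fin n)))
    (φ : MulAut K) (hφirr : FullyIrreducibleAut φ) (hφat : AtoroidalAut φ)
    (m : ℕ) (hm : 0 < m)
    (hG₁hyp : IsHypGroup (K ⋊[zpowersHom (MulAut K) (φ ^ m)] Multiplicative ℤ))
    (H : Subgroup (K ⋊[zpowersHom (MulAut K) (φ ^ m)] Multiplicative ℤ))
    (hHinfinite : (H : Set (K ⋊[zpowersHom (MulAut K) (φ ^ m)] Multiplicative ℤ)).Infinite)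
    (hHqc : QIEmbSubgroup H)
    (hHii : H.index = 0)
    (hHnvc : ¬ VirtCyclic ↥H) :
    -- (1) a finite index subgroup N = F_m ≤ Fₙ and a positive power φ₁ of a lift of φ:
    ∃ N : Subgroup K, N.index ≠ 0 ∧
    ∃ (φ₁ : MulAut ↥N) (l : ℕ), 0 < l ∧
      (∀ k : ↥N, ((φ₁ k : ↥N) : K) = (φ ^ l : MulAut K) (k : K)) ∧
    ∃ G₁' : Subgroup (K ⋊[zpowersHom (MulAut K) (φ ^ m)] Multiplicative ℤ),
      G₁'.index ≠ 0 ∧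
      -- G₁' = F_m ⋊_{φ₁} ℤ:
      Nonempty (↥G₁' ≃* (↥N ⋊[zpowersHom (MulAut ↥N) φ₁] Multiplicative ℤ)) ∧
    -- (2) a purely atoroidal ψ with Q = ⟨ψ, φ₁⟩ free and G = F_m ⋊ Q hyperbolic:
    ∃ ψ : MulAut ↥N,
      (∀ c ∈ Subgroup.closure ({ψ, φ₁} : Set (MulAut ↥N)), c ≠ 1 → AtoroidalAut c) ∧
      Nonempty (↥(Subgroup.closure ({ψ, φ₁} : Set (MulAut ↥N))) ≃* FreeGroup (Fin 2)) ∧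
      IsHypGroup
        (↥N ⋊[(Subgroup.closure ({ψ, φ₁} : Set (MulAut ↥N))).subtype]
          ↥(Subgroup.closure ({ψ, φ₁} : Set (MulAut ↥N)))) ∧
      -- (3) G₁' ∩ H has finite index in H and is not quasiconvex in G:
      ((G₁' ⊓ H).subgroupOf H).index ≠ 0 ∧
      ∃ Θ : ↥G₁' →*
          (↥N ⋊[(Subgroup.closure ({ψ, φ₁} : Set (MulAut ↥N))).subtype]
            ↥(Subgroup.closure ({ψ, φ₁} : Set (MulAut ↥N)))),
        Function.Injective Θ ∧
        -- Θ is the natural inclusion G₁' ≅ N ⋊ ⟨φ₁⟩ ↪ N ⋊ Q = G on the fiber: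
        (∀ x : ↥G₁',
          (x : K ⋊[zpowersHom (MulAut K) (φ ^ m)] Multiplicative ℤ).right = 1 →
          ∃ kk : ↥N,
            (x : K ⋊[zpowersHom (MulAut K) (φ ^ m)] Multiplicative ℤ).left = (kk : K) ∧
            Θ x = SemidirectProduct.inl kk) ∧
        ¬ QIEmbSubgroup (Subgroup.map Θ ((G₁' ⊓ H).subgroupOf G₁')) := by
  classical
  obtain ⟨e0⟩ := hfreeK
  have hfl : FT.Flare (MulAut.congr e0 φ) :=
    FT.flare_of_hyp _ (FT.ator_conj e0 (fun x => (FT.congr_app e0 φ x).symm) hφat)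
  have hfreeK' : IsFreeGroup K := IsFreeGroup.ofMulEquiv e0.symm
  obtain ⟨w, w', hw, hw', hww⟩ := FT.pair (φ ^ m) (by
    intro i hi c g hc
    have h1 := FT.no_per (hfl.pow (Nat.mul_pos hm hi)) (e0 c) (e0 g) (by
      have : e0 ((φ ^ (m * i)) c) = ((MulAut.congr e0 φ) ^ (m * i)) (e0 c) :=
        FT.inter_pow' (f := e0) (fun y => (FT.congr_app e0 φ y).symm) (m * i) c
      rw [← this, pow_mul, ← _root_.map_mul, ← _root_.map_inv, ← _root_.map_mul, hc])
    exact e0.injective (by rw [h1, _root_.map_one])) (by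
    intro c i hc hi
    by_contra hne
    have h1 : (e0 c) ^ (i - 1) = 1 := by
      rw [← _root_.map_zpow, zpow_sub_one, hi, mul_inv_cancel, _root_.map_one]
    have h2 : e0 c = 1 := by
      exact zpow_left_injective (n := i - 1) (by omega) (by simpa using h1)
    exact hc (e0.injective (by rw [h2, _root_.map_one]))) H hHnvc
  obtain ⟨N, l, r, φ₁, e, χ, φ', a0, hN, hl, ⟨q, hq⟩, hr, he, hF, hcl, hbig⟩ :=
    FT.data (by omega : 1 < n) e0 φ hfl hww m hm
  have hq0 : 0 < q := by
    rcases Nat.eq_zero_or_pos q with h | h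
    · rw [hq, h, mul_zero] at hl; exact absurd hl (lt_irrefl _)
    · exact h
  have hr' : ∀ k : N, (φ₁ k : K) = ((φ ^ m) ^ q) k := fun k => by rw [hr, hq, pow_mul]
  refine ⟨N, hN, φ₁, l, hl, hr, (FT.incl hr').range, FT.incl_index hr' hq0 hN,
    ⟨(MonoidHom.ofInjective (FT.incl_inj hr' hq0)).symm⟩, ?_⟩
  -- the free group of automorphisms
  obtain ⟨ρ, hρ⟩ : ∃ ρ : FreeGroup (Fin 2) →* MulAut (FreeGroup (FT.YY r n)), ρ = FreeGroup.lift ![χ, φ'] := ⟨_, rfl⟩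
  rw [← hρ] at hF
  have hne : Nonempty (FT.YY r n) := ⟨(none, ⟨0, by omega⟩)⟩
  have hρi := FT.inj_of_FL20 hF
  have hρ0 : ρ (FreeGroup.of 0) = χ := by rw [hρ]; simp
  have hρ1 : ρ (FreeGroup.of 1) = φ' := by rw [hρ]; simp
  let R : FreeGroup (Fin 2) →* MulAut N := (MulAut.congr e.symm).toMonoidHom.comp ρ
  have hRi : Function.Injective R := (MulAut.congr e.symm).injective.comp hρi
  have hR : ∀ g x, e.symm (ρ g x) = R g (e.symm x) := fun g x => (FT.congr_app e.symm (ρ g) x).symm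
  obtain ⟨ψ, hψ⟩ : ∃ ψ, ψ = R (FreeGroup.of 0) := ⟨_, rfl⟩
  have hφ₁ : R (FreeGroup.of 1) = φ₁ := by
    ext x
    obtain ⟨y, rfl⟩ := e.symm.surjective x
    rw [← hR, hρ1]
    have := he (e.symm y)
    rw [e.apply_symm_apply] at this
    rw [this, e.symm_apply_apply]
  have hRr : R.range = Subgroup.closure ({ψ, φ₁} : Set (MulAut N)) := by
    rw [MonoidHom.range_eq_map, ← FreeGroup.closure_range_of, MonoidHom.map_closure, ← Set.range_comp]
    congr 1
    ext x
    constructor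
    · rintro ⟨i, rfl⟩
      fin_cases i
      · left; exact hψ.symm
      · right; exact hφ₁
    · rintro (h | h)
      · exact ⟨0, hψ.symm.trans h.symm⟩
      · exact ⟨1, hφ₁.trans h.symm⟩
  refine ⟨ψ, ?_, ?_⟩
  · intro c hc hc1
    rw [← hRr] at hc
    obtain ⟨g, rfl⟩ := hc
    refine FT.ator_conj e.symm (hR g) (FT.ator_of_FL20 hF g ?_)
    rintro rfl
    exact hc1 (_root_.map_one R)
  obtain ⟨Q, hQ⟩ : ∃ Q, Q = Subgroup.closure ({ψ, φ₁} : Set (MulAut N)) := ⟨_, rfl⟩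
  have hψQ : ψ ∈ Q := by rw [hQ]; exact Subgroup.subset_closure (by simp)
  have hφQ : φ₁ ∈ Q := by rw [hQ]; exact Subgroup.subset_closure (by simp)
  rw [← hQ] at hRr ⊢
  obtain ⟨E, hE⟩ : ∃ E : FreeGroup (Fin 2) ≃* Q, ∀ g, (E g : MulAut N) = R g :=
    ⟨(MonoidHom.ofInjective hRi).trans (MulEquiv.subgroupCongr hRr), fun g => rfl⟩
  refine ⟨⟨E.symm⟩, ?_, ?_, ?_⟩
  · refine FT.hyp_sd e.symm E ?_ (FT.hyp_of_FL ρ hF.FL)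
    intro g x
    rw [hR, ← hE]; rfl
  · have hfi : (FT.incl hr').range.FiniteIndex := ⟨FT.incl_index hr' hq0 hN⟩
    have : ((FT.incl hr').range ⊓ H).subgroupOf H = (FT.incl hr').range.subgroupOf H := by
      rw [Subgroup.inf_subgroupOf_right]
    rw [this]
    exact Subgroup.FiniteIndex.index_ne_zero
  -- the embedding
  let z : Multiplicative ℤ →* Q := zpowersHom Q ⟨φ₁, hφQ⟩
  have hz : ∀ t, ((z t : Q) : MulAut N) = zpowersHom (MulAut N) φ₁ t := by
    intro t
    simp [z, zpowersHom_apply]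
  have hzi : Function.Injective z := by
    rw [injective_iff_map_eq_one]
    intro t ht
    have h1 : φ₁ ^ (Multiplicative.toAdd t) = 1 := by
      have := hz t
      rw [ht] at this
      simpa [zpowersHom_apply] using this.symm
    rw [← hφ₁, ← _root_.map_zpow] at h1
    have h2 := hRi (h1.trans (_root_.map_one R).symm)
    have h3 : Multiplicative.toAdd t = 0 := by
      by_contra h0
      exact FreeGroup.of_ne_one 1 (zpow_left_injective h0 (by simpa using h2))
    apply Multiplicative.toAdd.injective
    simpa using h3
  let P : N ⋊[zpowersHom (MulAut N) φ₁] Multiplicative ℤ →* N ⋊[Q.subtype] Q :=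
    SemidirectProduct.map (MonoidHom.id N) z (fun t => by
      ext x
      have := hz t
      simp only [MonoidHom.comp_apply]
      change ((zpowersHom (MulAut N) φ₁ t x : N) : K) = (((z t : Q) : MulAut N) x : N)
      rw [this])
  have hPinl : ∀ x : N, P (SemidirectProduct.inl x) = SemidirectProduct.inl x := fun x => by
    simp [P]
  have hPi : Function.Injective P := by
    intro x y hxy
    ext
    · have := congrArg SemidirectProduct.left hxy
      exact congrArg Subtype.val this
    · have := congrArg SemidirectProduct.right hxy
      rw [hzi this]
  let iso := MonoidHom.ofInjective (FT.incl_inj hr' hq0)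
  have hiso : ∀ x, iso.symm (iso x) = x := fun x => iso.symm_apply_apply x
  refine ⟨P.comp iso.symm.toMonoidHom, ?_, ?_, ?_⟩
  · exact hPi.comp iso.symm.injective
  · intro x hx
    obtain ⟨y, rfl⟩ := iso.surjective x
    have h1 : FT.zq q y.right = 1 := hx
    have h2 : y.right = 1 := FT.zq_inj hq0 (h1.trans (_root_.map_one _).symm)
    refine ⟨y.left, rfl, ?_⟩
    have h3 : y = SemidirectProduct.inl y.left := by
      ext
      · rfl
      · simp [h2]
    change P (iso.symm (iso y)) = _
    rw [hiso]
    conv_lhs => rw [h3]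
    exact hPinl _
  · have hat : AtoroidalAut φ' := by
      rw [← hρ1]
      exact FT.ator_of_FL20 hF _ (FreeGroup.of_ne_one _)
    obtain ⟨S', hS', -⟩ := hat
    let F : N ⋊[zpowersHom (MulAut N) φ₁] Multiplicative ℤ ≃*
        FreeGroup (FT.YY r n) ⋊[zpowersHom _ φ'] Multiplicative ℤ :=
      SemidirectProduct.congr e (MulEquiv.refl _) (fun t => by
        ext x
        have := FT.inter_zpow (f := e) (fun y => (he y).symm) (Multiplicative.toAdd t) x
        exact this)
    have hFi : ∀ x, F.symm (SemidirectProduct.inl x) = SemidirectProduct.inl (e.symm x) := by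
      intro x
      rw [MulEquiv.symm_apply_eq]
      ext <;> simp [F]
    let P' := P.comp F.symm.toMonoidHom
    have hP' : ∀ x, P' (SemidirectProduct.inl x) = SemidirectProduct.inl (e.symm x) := by
      intro x
      change P (F.symm _) = _
      rw [hFi, hPinl]
    have hψk : ∀ k : ℤ, e.symm ((χ ^ k) a0) = (ψ ^ k) (e.symm a0) := by
      intro k
      exact FT.inter_zpow (f := e.symm) (fun y => by rw [hψ, ← hR, hρ0]) k a0
    refine FT.distort _ P' (hPi.comp F.symm.injective) ?_ hS'
      (fun k => SemidirectProduct.inl ((χ ^ k) a0)) ?_ (SemidirectProduct.inr ⟨ψ, hψQ⟩) ?_ (hbig S' hS')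
    · rintro x ⟨y, -, rfl⟩
      refine ⟨F (iso.symm y), ?_⟩
      change P (F.symm (F _)) = P _
      rw [F.symm_apply_apply]
      rfl
    · intro k
      rw [hP']
      refine ⟨iso (SemidirectProduct.inl (e.symm ((χ ^ k) a0))), ?_, ?_⟩
      · rw [SetLike.mem_coe, Subgroup.mem_subgroupOf]
        refine ⟨SetLike.coe_mem _, ?_⟩
        have h1 : ((iso (SemidirectProduct.inl (e.symm ((χ ^ k) a0))) : (FT.incl hr').range) :
            K ⋊[zpowersHom (MulAut K) (φ ^ m)] Multiplicative ℤ) =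
            SemidirectProduct.inl ((e.symm ((χ ^ k) a0) : N) : K) := by
          change FT.incl hr' _ = _
          unfold FT.incl
          rw [SemidirectProduct.map_inl]; rfl
        rw [SetLike.mem_coe, h1]
        have h2 : Subgroup.closure {w, w'} ≤ H.comap (SemidirectProduct.inl : K →* _) := by
          rw [Subgroup.closure_le]
          rintro x (rfl | rfl)
          · exact hw
          · exact hw'
        exact h2 (hcl k)
      · change P (iso.symm (iso _)) = _
        rw [hiso, hPinl]
    · intro k
      simp only [zpow_zero, MulAut.one_apply]
      rw [hP', hP', hψk]
      have : (⟨ψ, hψQ⟩ : Q) ^ k = ⟨ψ ^ k, Q.zpow_mem hψQ k⟩ := rfl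
      rw [← _root_.map_zpow, this, ← _root_.map_inv, ← SemidirectProduct.inl_aut]
      rfl
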